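/- Let m > 7, and let G be a finite group with a normal subgroup V such that V is an elementary abelian 2-group of rank n, V is of maximal rank in G, and W = G/V is an elementary abelian 2-group with rank(W) ≥ 2n + 1. If G acts freely and continuously on X = (S^m)^n, then the orbit space X/V (with the quotient topology) is NOT homotopy equivalent to (ℝP^m)^n. -/

import Mathlib

noncomputable section

/-- The unit sphere `S^m` in `ℝ^{m+1}`. -/
abbrev Sph (m : ℕ) : Type := Metric.sphere (0 : EuclideanSpace ℝ (Fin (m + 1))) 1

/-- The antipodal relation on the sphere `S^m`. -/
def antipodal (m : ℕ) (x y : Sph m) : Prop :=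
  (y : EuclideanSpace ℝ (Fin (m + 1))) = (x : EuclideanSpace ℝ (Fin (m + 1))) ∨
    (y : EuclideanSpace ℝ (Fin (m + 1))) = -(x : EuclideanSpace ℝ (Fin (m + 1)))

/-- Real projective `m`-space: the quotient of `S^m` by the antipodal map,
with the quotient topology. -/
abbrev RP (m : ℕ) : Type := Quot (antipodal m)

/-- A subgroup is an elementary abelian 2-group: every element squares to the
identity (such a subgroup is automatically abelian). -/
def IsElemAbelian2 {G : Type*} [Group G] (A : Subgroup G) : Prop :=
  (∀ a ∈ A, a * a = 1) ∧ ∀ a ∈ A, ∀ b ∈ A, a * b = b * a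

/-- A subgroup `V` of `G` has maximal rank if every elementary abelian
2-subgroup `A` of `G` satisfies `|A| ≤ |V|`. -/
def IsMaximalRank2 {G : Type*} [Group G] (V : Subgroup G) : Prop :=
  ∀ A : Subgroup G, IsElemAbelian2 A → Nat.card A ≤ Nat.card V

set_option linter.unusedSectionVars false
set_option linter.unusedDecidableInType false
set_option linter.unusedFintypeInType false

section

open Matrix

/-- Block diagonal sum of two matrices. -/
def dsum {κ κ' ι ι' : Type*} (A : Matrix κ ι ℂ) (D : Matrix κ' ι' ℂ) :
    Matrix (κ ⊕ κ') (ι ⊕ ι') ℂ := fromBlocks A 0 0 D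

section dsum
variable {κ κ' ι ι' μ μ' : Type*} [Fintype ι] [Fintype ι'] [Fintype κ] [Fintype κ']

theorem dsum_mul (A : Matrix κ ι ℂ) (D : Matrix κ' ι' ℂ) (A' : Matrix ι μ ℂ)
    (D' : Matrix ι' μ' ℂ) : dsum A D * dsum A' D' = dsum (A * A') (D * D') := by
  simp [dsum, fromBlocks_multiply]

theorem dsum_one [DecidableEq ι] [DecidableEq ι'] :
    dsum (1 : Matrix ι ι ℂ) (1 : Matrix ι' ι' ℂ) = 1 := by simp [dsum]

theorem dsum_pow [DecidableEq ι] [DecidableEq ι'] (A : Matrix ι ι ℂ) (D : Matrix ι' ι' ℂ)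
    (n : ℕ) : dsum A D ^ n = dsum (A ^ n) (D ^ n) := by
  induction n with
  | zero => simp [dsum_one]
  | succ n ih => rw [pow_succ, ih, dsum_mul, ← pow_succ, ← pow_succ]

theorem trace_dsum (A : Matrix ι ι ℂ) (D : Matrix ι' ι' ℂ) :
    (dsum A D).trace = A.trace + D.trace := by simp [dsum, Matrix.trace, Fintype.sum_sum_type]

end dsum

/-- Continuous families of matrices, equivariant with respect to a self map `τ` of the base and
matrices `a`, `b` acting on the target and on the source. -/
structure EMap {Y : Type*} [TopologicalSpace Y] (τ : Y → Y) {κ ι : Type*} [Fintype κ] [Fintype ι]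
    (a : Matrix κ κ ℂ) (b : Matrix ι ι ℂ) (F : Y → Matrix κ ι ℂ) : Prop where
  cont : Continuous F
  eqv : ∀ y, F (τ y) * b = a * F y

section EMap
variable {Y : Type*} [TopologicalSpace Y] {τ : Y → Y} {κ ι μ κ' ι' : Type*}
  [Fintype κ] [Fintype ι] [Fintype μ] [Fintype κ'] [Fintype ι']
  {a : Matrix κ κ ℂ} {b : Matrix ι ι ℂ} {c : Matrix μ μ ℂ}
  {a' : Matrix κ' κ' ℂ} {b' : Matrix ι' ι' ℂ}

theorem continuous_dsum {F : Y → Matrix κ ι ℂ} {G : Y → Matrix κ' ι' ℂ} (hF : Continuous F)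
    (hG : Continuous G) : Continuous fun y => dsum (F y) (G y) :=
  hF.matrix_fromBlocks continuous_const continuous_const hG

theorem EMap.const {F : Matrix κ ι ℂ} (h : F * b = a * F) : EMap τ a b fun _ => F :=
  ⟨continuous_const, fun _ => h⟩

theorem EMap.one [DecidableEq ι] : EMap τ b b fun _ => 1 := EMap.const (by simp)

theorem EMap.zero : EMap τ a b fun _ => 0 := EMap.const (by simp)

theorem EMap.mul {F : Y → Matrix κ ι ℂ} {G : Y → Matrix ι μ ℂ} (hF : EMap τ a b F)
    (hG : EMap τ b c G) : EMap τ a c fun y => F y * G y :=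
  ⟨hF.1.matrix_mul hG.1, fun y => by
    rw [Matrix.mul_assoc, hG.2, ← Matrix.mul_assoc, hF.2, Matrix.mul_assoc]⟩

theorem EMap.add {F G : Y → Matrix κ ι ℂ} (hF : EMap τ a b F) (hG : EMap τ a b G) :
    EMap τ a b fun y => F y + G y :=
  ⟨hF.1.add hG.1, fun y => by rw [Matrix.add_mul, hF.2, hG.2, Matrix.mul_add]⟩

theorem EMap.sub {F G : Y → Matrix κ ι ℂ} (hF : EMap τ a b F) (hG : EMap τ a b G) :
    EMap τ a b fun y => F y - G y :=
  ⟨hF.1.sub hG.1, fun y => by rw [Matrix.sub_mul, hF.2, hG.2, Matrix.mul_sub]⟩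

theorem EMap.smul {F : Y → Matrix κ ι ℂ} {f : Y → ℂ} (hF : EMap τ a b F) (hf : Continuous f)
    (hfτ : ∀ y, f (τ y) = f y) : EMap τ a b fun y => f y • F y :=
  ⟨hf.smul hF.1, fun y => by rw [Matrix.smul_mul, hF.2, hfτ, Matrix.mul_smul]⟩

theorem EMap.dsum {F : Y → Matrix κ ι ℂ} {G : Y → Matrix κ' ι' ℂ} (hF : EMap τ a b F)
    (hG : EMap τ a' b' G) : EMap τ (dsum a a') (dsum b b') fun y => dsum (F y) (G y) :=
  ⟨continuous_dsum hF.1 hG.1, fun y => by rw [dsum_mul, dsum_mul, hF.2, hG.2]⟩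

theorem EMap.fromBlocks {A : Y → Matrix κ ι ℂ} {B : Y → Matrix κ ι' ℂ} {C : Y → Matrix κ' ι ℂ}
    {D : Y → Matrix κ' ι' ℂ} (hA : EMap τ a b A) (hB : EMap τ a b' B) (hC : EMap τ a' b C)
    (hD : EMap τ a' b' D) :
    EMap τ (_root_.dsum a a') (_root_.dsum b b') fun y => fromBlocks (A y) (B y) (C y) (D y) :=
  ⟨hA.1.matrix_fromBlocks hB.1 hC.1 hD.1, fun y => by
    simp only [_root_.dsum, fromBlocks_multiply, Matrix.mul_zero, Matrix.zero_mul, add_zero,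
      zero_add, hA.2, hB.2, hC.2, hD.2]⟩

theorem EMap.comp {Y' : Type*} [TopologicalSpace Y'] {τ' : Y' → Y'} {h : Y' → Y}
    {F : Y → Matrix κ ι ℂ} (hF : EMap τ a b F)
    (hc : Continuous h) (hτ : ∀ y, h (τ' y) = τ (h y)) : EMap τ' a b fun y => F (h y) :=
  ⟨hF.1.comp hc, fun y => by rw [hτ, hF.2]⟩

theorem continuous_matrix_inv [DecidableEq ι] {F : Y → Matrix ι ι ℂ} (hF : Continuous F)
    (hu : ∀ y, IsUnit (F y)) : Continuous fun y => (F y)⁻¹ := by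
  simp only [Matrix.inv_def, Ring.inverse_eq_inv']
  exact (hF.matrix_det.inv₀ fun y => ((Matrix.isUnit_iff_isUnit_det _).1 (hu y)).ne_zero).smul
    hF.matrix_adjugate

theorem Matrix.inv_mul_of_isUnit [DecidableEq ι] {A : Matrix ι ι ℂ} (h : IsUnit A) :
    A⁻¹ * A = 1 := Matrix.nonsing_inv_mul _ ((Matrix.isUnit_iff_isUnit_det _).1 h)

theorem Matrix.mul_inv_of_isUnit [DecidableEq ι] {A : Matrix ι ι ℂ} (h : IsUnit A) :
    A * A⁻¹ = 1 := Matrix.mul_nonsing_inv _ ((Matrix.isUnit_iff_isUnit_det _).1 h)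

theorem EMap.inv [DecidableEq ι] {F : Y → Matrix ι ι ℂ} {a b : Matrix ι ι ℂ} (hF : EMap τ a b F)
    (hu : ∀ y, IsUnit (F y)) : EMap τ b a fun y => (F y)⁻¹ :=
  ⟨continuous_matrix_inv hF.1 hu, fun y => by
    have h := congrArg (fun M => (F (τ y))⁻¹ * M * (F y)⁻¹) (hF.2 y)
    simp only [← Matrix.mul_assoc, Matrix.inv_mul_of_isUnit (hu _), Matrix.one_mul] at h
    rw [Matrix.mul_assoc _ (F y), Matrix.mul_inv_of_isUnit (hu y), Matrix.mul_one] at h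
    exact h.symm⟩

end EMap

/-- An idempotent family: an equivariant vector bundle over `Y`. -/
structure IsBun {Y : Type*} [TopologicalSpace Y] (τ : Y → Y) {ι : Type*} [Fintype ι]
    [DecidableEq ι] (ρ : Matrix ι ι ℂ) (P : Y → Matrix ι ι ℂ) : Prop where
  emap : EMap τ ρ ρ P
  idem : ∀ y, P y * P y = P y
  ord : ρ ^ 6 = 1

/-- A constant idempotent commuting with the action. -/
structure IsCon {ι : Type*} [Fintype ι] [DecidableEq ι] (ρ p : Matrix ι ι ℂ) : Prop where
  comm : p * ρ = ρ * p
  idem : p * p = p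
  ord : ρ ^ 6 = 1

/-- Isomorphism of equivariant vector bundles. -/
def BIso {Y : Type*} [TopologicalSpace Y] (τ : Y → Y) {κ ι : Type*} [Fintype κ] [Fintype ι]
    (ρ : Matrix ι ι ℂ) (σ : Matrix κ κ ℂ) (P : Y → Matrix ι ι ℂ) (Q : Y → Matrix κ κ ℂ) : Prop :=
  ∃ (A : Y → Matrix κ ι ℂ) (B : Y → Matrix ι κ ℂ), EMap τ σ ρ A ∧ EMap τ ρ σ B ∧
    (∀ y, B y * A y = P y) ∧ ∀ y, A y * B y = Q y

section BIso
variable {Y : Type*} [TopologicalSpace Y] {τ : Y → Y} {κ ι μ κ' ι' : Type*}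
  [Fintype κ] [Fintype ι] [Fintype μ] [Fintype κ'] [Fintype ι'] [DecidableEq ι] [DecidableEq κ]
  [DecidableEq ι'] [DecidableEq κ'] [DecidableEq μ]
  {ρ : Matrix ι ι ℂ} {σ : Matrix κ κ ℂ} {υ : Matrix μ μ ℂ}
  {ρ' : Matrix ι' ι' ℂ} {σ' : Matrix κ' κ' ℂ}
  {P : Y → Matrix ι ι ℂ} {Q : Y → Matrix κ κ ℂ} {R : Y → Matrix μ μ ℂ}
  {P' : Y → Matrix ι' ι' ℂ} {Q' : Y → Matrix κ' κ' ℂ}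

theorem IsCon.isBun {p : Matrix ι ι ℂ} (h : IsCon ρ p) : IsBun τ ρ fun _ => p :=
  ⟨EMap.const h.comm, fun _ => h.idem, h.ord⟩

theorem IsCon.dsum {p : Matrix ι ι ℂ} {p' : Matrix ι' ι' ℂ} (h : IsCon ρ p) (h' : IsCon ρ' p') :
    IsCon (dsum ρ ρ') (dsum p p') :=
  ⟨by rw [dsum_mul, dsum_mul, h.comm, h'.comm], by rw [dsum_mul, h.idem, h'.idem],
    by rw [dsum_pow, h.ord, h'.ord, dsum_one]⟩

theorem IsBun.dsum (h : IsBun τ ρ P) (h' : IsBun τ ρ' P') :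
    IsBun τ (dsum ρ ρ') fun y => dsum (P y) (P' y) :=
  ⟨h.emap.dsum h'.emap, fun y => by rw [dsum_mul, h.idem, h'.idem],
    by rw [dsum_pow, h.ord, h'.ord, dsum_one]⟩

theorem IsBun.compl (h : IsBun τ ρ P) : IsBun τ ρ fun y => 1 - P y :=
  ⟨EMap.one.sub h.emap, fun y => IsIdempotentElem.one_sub (h.idem y), h.ord⟩

theorem BIso.refl (h : IsBun τ ρ P) : BIso τ ρ ρ P P :=
  ⟨P, P, h.emap, h.emap, h.idem, h.idem⟩

theorem BIso.symm (h : BIso τ ρ σ P Q) : BIso τ σ ρ Q P := by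
  obtain ⟨A, B, hA, hB, h1, h2⟩ := h
  exact ⟨B, A, hB, hA, h2, h1⟩

theorem BIso.trans (hP : ∀ y, P y * P y = P y) (hR : ∀ y, R y * R y = R y)
    (h : BIso τ ρ σ P Q) (h' : BIso τ σ υ Q R) : BIso τ ρ υ P R := by
  obtain ⟨A, B, hA, hB, h1, h2⟩ := h
  obtain ⟨A', B', hA', hB', h1', h2'⟩ := h'
  refine ⟨_, _, hA'.mul hA, hB.mul hB', fun y => ?_, fun y => ?_⟩
  · calc B y * B' y * (A' y * A y) = B y * (B' y * A' y) * A y := by simp only [Matrix.mul_assoc]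
      _ = (B y * A y) * (B y * A y) := by rw [h1', ← h2]; simp only [Matrix.mul_assoc]
      _ = P y := by rw [h1, hP]
  · calc A' y * A y * (B y * B' y) = A' y * (A y * B y) * B' y := by simp only [Matrix.mul_assoc]
      _ = (A' y * B' y) * (A' y * B' y) := by rw [h2, ← h1']; simp only [Matrix.mul_assoc]
      _ = R y := by rw [h2', hR]

theorem BIso.dsum (h : BIso τ ρ σ P Q) (h' : BIso τ ρ' σ' P' Q') :
    BIso τ (dsum ρ ρ') (dsum σ σ') (fun y => dsum (P y) (P' y)) fun y => dsum (Q y) (Q' y) := by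
  obtain ⟨A, B, hA, hB, h1, h2⟩ := h
  obtain ⟨A', B', hA', hB', h1', h2'⟩ := h'
  exact ⟨_, _, hA.dsum hA', hB.dsum hB', fun y => by rw [dsum_mul, h1, h1'],
    fun y => by rw [dsum_mul, h2, h2']⟩

theorem BIso.comp {Y' : Type*} [TopologicalSpace Y'] {τ' : Y' → Y'} {h : Y' → Y}
    (H : BIso τ ρ σ P Q) (hc : Continuous h) (hτ : ∀ y, h (τ' y) = τ (h y)) :
    BIso τ' ρ σ (fun y => P (h y)) fun y => Q (h y) := by
  obtain ⟨A, B, hA, hB, h1, h2⟩ := H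
  exact ⟨_, _, hA.comp hc hτ, hB.comp hc hτ, fun y => h1 _, fun y => h2 _⟩

theorem IsBun.comp {Y' : Type*} [TopologicalSpace Y'] {τ' : Y' → Y'} {h : Y' → Y}
    (H : IsBun τ ρ P) (hc : Continuous h) (hτ : ∀ y, h (τ' y) = τ (h y)) :
    IsBun τ' ρ (fun y => P (h y)) :=
  ⟨H.emap.comp hc hτ, fun _ => H.idem _, H.ord⟩

/-- Permuting the basis gives an isomorphic bundle. -/
theorem BIso.reindex (e : ι ≃ κ) (h : IsBun τ ρ P) :
    BIso τ ρ (reindex e e ρ) P fun y => reindex e e (P y) := by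
  refine ⟨fun y => (P y).submatrix e.symm id, fun y => (P y).submatrix id e.symm,
    ⟨h.emap.1.matrix_submatrix _ _, fun y => ?_⟩, ⟨h.emap.1.matrix_submatrix _ _, fun y => ?_⟩,
    fun y => ?_, fun y => ?_⟩
  · ext i j; simpa [Matrix.mul_apply, e.symm.sum_comp fun x => ρ (e.symm i) x * P y x j]
      using congrFun (congrFun (h.emap.2 y) (e.symm i)) j
  · ext i j; simpa [Matrix.mul_apply, e.symm.sum_comp fun x => P (τ y) i x * ρ x (e.symm j)]
      using congrFun (congrFun (h.emap.2 y) i) (e.symm j)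
  · ext i j
    rw [← congrFun (congrFun (h.idem y) i) j]
    simp [Matrix.mul_apply, e.symm.sum_comp fun x => P y i x * P y x j]
  · ext i j
    simp only [reindex_apply, submatrix_apply]
    rw [← congrFun (congrFun (h.idem y) (e.symm i)) (e.symm j)]
    simp [Matrix.mul_apply]

theorem BIso.of_conj {σ : Matrix ι ι ℂ} {Q : Y → Matrix ι ι ℂ} {g : Y → Matrix ι ι ℂ}
    (h : IsBun τ ρ P) (hg : EMap τ σ ρ g) (hu : ∀ y, IsUnit (g y))
    (hc : ∀ y, g y * P y = Q y * g y) : BIso τ ρ σ P Q := by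
  have hQ : ∀ y, g y * P y * (g y)⁻¹ = Q y := fun y => by
    rw [hc, Matrix.mul_assoc, Matrix.mul_inv_of_isUnit (hu y), Matrix.mul_one]
  refine ⟨_, _, hg.mul h.emap, h.emap.mul (hg.inv hu), fun y => ?_, fun y => ?_⟩
  · calc P y * (g y)⁻¹ * (g y * P y) = P y * ((g y)⁻¹ * g y) * P y := by
          simp only [Matrix.mul_assoc]
      _ = P y := by rw [Matrix.inv_mul_of_isUnit (hu y), Matrix.mul_one, h.idem]
  · rw [← hQ, Matrix.mul_assoc, ← Matrix.mul_assoc (P y), h.idem, Matrix.mul_assoc]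

/-- The standard involution attached to an isomorphism between the images of two idempotents. -/
theorem BIso.exists_conj (hP : IsBun τ ρ P) (hQ : IsBun τ σ Q) (h : BIso τ ρ σ P Q) :
    ∃ u : Y → Matrix (ι ⊕ κ) (ι ⊕ κ) ℂ, EMap τ (_root_.dsum ρ σ) (_root_.dsum ρ σ) u ∧
      (∀ y, u y * u y = 1) ∧
      ∀ y, u y * _root_.dsum (P y) 0 = _root_.dsum 0 (Q y) * u y := by
  obtain ⟨A, B, hA, hB, h1, h2⟩ := h
  refine ⟨_, EMap.fromBlocks (EMap.one.sub hP.emap) (hB.mul hQ.emap)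
    (hQ.emap.mul hA) (EMap.one.sub hQ.emap), fun y => ?_, fun y => ?_⟩
  · have e1 : (1 - P y) * (1 - P y) = 1 - P y := IsIdempotentElem.one_sub (hP.idem y)
    have e2 : (1 - Q y) * (1 - Q y) = 1 - Q y := IsIdempotentElem.one_sub (hQ.idem y)
    have e3 : B y * Q y * (Q y * A y) = P y := by
      calc B y * Q y * (Q y * A y) = B y * (Q y * Q y) * A y := by simp only [Matrix.mul_assoc]
        _ = (B y * A y) * (B y * A y) := by rw [hQ.idem, ← h2]; simp only [Matrix.mul_assoc]
        _ = P y := by rw [h1, hP.idem]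
    have e4 : Q y * A y * (B y * Q y) = Q y := by
      calc Q y * A y * (B y * Q y) = Q y * (A y * B y) * Q y := by simp only [Matrix.mul_assoc]
        _ = Q y := by rw [h2, hQ.idem, hQ.idem]
    have e5 : P y * (B y * Q y) = B y * Q y := by
      calc P y * (B y * Q y) = B y * (A y * B y) * Q y := by
            rw [← h1]; simp only [Matrix.mul_assoc]
        _ = _ := by rw [h2, Matrix.mul_assoc, hQ.idem]
    have e6 : Q y * A y * P y = Q y * A y := by
      calc Q y * A y * P y = Q y * (A y * B y) * A y := by
            rw [← h1]; simp only [Matrix.mul_assoc]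
        _ = _ := by rw [h2, hQ.idem]
    simp only [fromBlocks_multiply, e1, e2, e3, e4]
    rw [Matrix.sub_mul, Matrix.mul_sub, Matrix.mul_sub, Matrix.sub_mul, e5, e6,
      Matrix.mul_assoc (B y) (Q y) (Q y), hQ.idem, ← Matrix.mul_assoc (Q y) (Q y), hQ.idem]
    simp [fromBlocks_one]
  · have e6 : Q y * A y * P y = Q y * A y := by
      calc Q y * A y * P y = Q y * (A y * B y) * A y := by
            rw [← h1]; simp only [Matrix.mul_assoc]
        _ = _ := by rw [h2, hQ.idem]
    have e7 : (1 - P y) * P y = 0 := by rw [Matrix.sub_mul, hP.idem, Matrix.one_mul, sub_self]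
    have e8 : Q y * (1 - Q y) = 0 := by rw [Matrix.mul_sub, hQ.idem, Matrix.mul_one, sub_self]
    simp only [_root_.dsum, fromBlocks_multiply, e6, e7, e8, Matrix.mul_zero, Matrix.zero_mul,
      add_zero, zero_add, ← Matrix.mul_assoc, hQ.idem]

end BIso

/-- A stably constant bundle, together with the difference of the traces of the action on the
constant bundles involved. -/
def HasVal {Y : Type*} [TopologicalSpace Y] (τ : Y → Y) {ι : Type} [Fintype ι] [DecidableEq ι]
    (ρ : Matrix ι ι ℂ) (P : Y → Matrix ι ι ℂ) (x : ℂ) : Prop :=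
  ∃ (κ : Type) (_ : Fintype κ) (_ : DecidableEq κ) (μ : Type) (_ : Fintype μ) (_ : DecidableEq μ)
    (δ d : Matrix κ κ ℂ) (σ q : Matrix μ μ ℂ), IsCon δ d ∧ IsCon σ q ∧
    BIso τ (dsum ρ δ) σ (fun y => dsum (P y) d) (fun _ => q) ∧
    x = (σ * q).trace - (δ * d).trace

/-- Every bundle over `Y` is stably constant. -/
def AllVal {Y : Type*} [TopologicalSpace Y] (τ : Y → Y) : Prop :=
  ∀ (ι : Type) [Fintype ι] [DecidableEq ι] (ρ : Matrix ι ι ℂ) (P : Y → Matrix ι ι ℂ),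
    IsBun τ ρ P → ∃ x, HasVal τ ρ P x

/-- Isomorphic constant bundles over `Y` have traces congruent modulo `2 ^ N`. -/
def TrDiv {Y : Type*} [TopologicalSpace Y] (τ : Y → Y) (N : ℕ) : Prop :=
  ∀ (ι κ : Type) [Fintype ι] [DecidableEq ι] [Fintype κ] [DecidableEq κ]
    (ρ p : Matrix ι ι ℂ) (σ q : Matrix κ κ ℂ), IsCon ρ p → IsCon σ q →
    BIso τ ρ σ (fun _ => p) (fun _ => q) →
    ∃ a : ℂ, IsIntegral ℤ a ∧ (σ * q).trace - (ρ * p).trace = 2 ^ N * a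

section HasVal
variable {Y : Type*} [TopologicalSpace Y] {τ : Y → Y} {κ ι : Type}
  [Fintype κ] [Fintype ι] [DecidableEq ι] [DecidableEq κ]
  {ρ : Matrix ι ι ℂ} {σ : Matrix κ κ ℂ}
  {P : Y → Matrix ι ι ℂ} {Q : Y → Matrix κ κ ℂ} {x x' : ℂ}

theorem HasVal.con {p : Matrix ι ι ℂ} (h : IsCon ρ p) : HasVal τ ρ (fun _ => p) (ρ * p).trace := by
  refine ⟨Empty, inferInstance, inferInstance, _, inferInstance, inferInstance, 1, 1, _, _,
    ⟨rfl, by simp, by simp⟩, IsCon.dsum h (⟨rfl, by simp, by simp⟩ : IsCon (1 : Matrix Empty Empty ℂ) 1),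
    BIso.refl (IsCon.isBun (h.dsum ⟨rfl, by simp, by simp⟩)), ?_⟩
  rw [dsum_mul, trace_dsum]; simp

theorem HasVal.biso (hQ : IsBun τ σ Q) (h : HasVal τ ρ P x)
    (e : BIso τ ρ σ P Q) : HasVal τ σ Q x := by
  obtain ⟨α, _, _, β, _, _, δ, d, m, q, hd, hq, hi, hx⟩ := h
  refine ⟨α, _, _, β, _, _, δ, d, m, q, hd, hq, ?_, hx⟩
  exact (e.symm.dsum (BIso.refl hd.isBun)).trans (hQ.dsum hd.isBun).idem (hq.isBun (τ := τ)).idem hi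

theorem HasVal.dsum (hP : IsBun τ ρ P) (hQ : IsBun τ σ Q) (h : HasVal τ ρ P x)
    (h' : HasVal τ σ Q x') : HasVal τ (dsum ρ σ) (fun y => dsum (P y) (Q y)) (x + x') := by
  obtain ⟨α, _, _, β, _, _, δ, d, m, q, hd, hq, hi, rfl⟩ := h
  obtain ⟨α', _, _, β', _, _, δ', d', m', q', hd', hq', hi', rfl⟩ := h'
  refine ⟨_, _, inferInstance, _, _, inferInstance, _, _, _, _, hd.dsum hd', hq.dsum hq', ?_, ?_⟩
  · have h1 := BIso.reindex (Equiv.sumSumSumComm ι κ α α') ((hP.dsum hQ).dsum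
      (hd.isBun (τ := τ) |>.dsum hd'.isBun))
    have h2 := hi.dsum hi'
    have e1 : ∀ (A : Matrix ι ι ℂ) (B : Matrix κ κ ℂ) (C : Matrix α α ℂ) (D : Matrix α' α' ℂ),
        Matrix.reindex (Equiv.sumSumSumComm ι κ α α') (Equiv.sumSumSumComm ι κ α α')
          (_root_.dsum (_root_.dsum A B) (_root_.dsum C D)) =
          _root_.dsum (_root_.dsum A C) (_root_.dsum B D) := by
      intro A B C D
      ext i j
      rcases i with (i | i) | (i | i) <;> rcases j with (j | j) | (j | j) <;> rfl
    simp only [e1] at h1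
    exact h1.trans ((hP.dsum hQ).dsum (hd.isBun (τ := τ) |>.dsum hd'.isBun)).idem
      (fun _ => (hq.dsum hq').idem) h2
  · simp only [dsum_mul, trace_dsum]; ring

theorem HasVal.unique {N : ℕ} (hT : TrDiv τ N) (hP : IsBun τ ρ P) (h : HasVal τ ρ P x)
    (h' : HasVal τ ρ P x') : ∃ a : ℂ, IsIntegral ℤ a ∧ x - x' = 2 ^ N * a := by
  obtain ⟨α, _, _, β, _, _, δ, d, m, q, hd, hq, hi, rfl⟩ := h
  obtain ⟨α', _, _, β', _, _, δ', d', m', q', hd', hq', hi', rfl⟩ := h'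
  let e : (ι ⊕ α') ⊕ α ≃ (ι ⊕ α) ⊕ α' :=
    (Equiv.sumAssoc _ _ _).trans (((Equiv.refl _).sumCongr (Equiv.sumComm _ _)).trans
      (Equiv.sumAssoc _ _ _).symm)
  have h1 := BIso.reindex e ((hP.dsum hd'.isBun).dsum (hd.isBun (τ := τ)))
  have e1 : ∀ (A : Matrix ι ι ℂ) (B : Matrix α' α' ℂ) (C : Matrix α α ℂ),
      Matrix.reindex e e (_root_.dsum (_root_.dsum A B) C) =
        _root_.dsum (_root_.dsum A C) B := by
    intro A B C
    ext i j
    rcases i with (i | i) | i <;> rcases j with (j | j) | j <;> rfl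
  simp only [e1] at h1
  have h2 := (((hi'.dsum (BIso.refl hd.isBun)).symm.trans (fun _ => (hq'.dsum hd).idem)
    ((hP.dsum hd.isBun).dsum hd'.isBun).idem h1).trans (fun _ => (hq'.dsum hd).idem)
      (fun _ => (hq.dsum hd').idem) (hi.dsum (BIso.refl hd'.isBun)))
  obtain ⟨a, ha, h3⟩ := hT _ _ _ _ _ _ (hq'.dsum hd) (hq.dsum hd') h2
  refine ⟨a, ha, ?_⟩
  simp only [dsum_mul, trace_dsum] at h3
  rw [← h3]; ring

theorem HasVal.comp {Y' : Type*} [TopologicalSpace Y'] {τ' : Y' → Y'} {f : Y' → Y}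
    (h : HasVal τ ρ P x) (hc : Continuous f) (hτ : ∀ y, f (τ' y) = τ (f y)) :
    HasVal τ' ρ (fun y => P (f y)) x := by
  obtain ⟨α, _, _, β, _, _, δ, d, m, q, hd, hq, hi, hx⟩ := h
  exact ⟨α, _, _, β, _, _, δ, d, m, q, hd, hq, hi.comp hc hτ, hx⟩

theorem AllVal.of_homeomorph {Y' : Type*} [TopologicalSpace Y'] {τ' : Y' → Y'} (f : Y' ≃ₜ Y)
    (h : AllVal τ) (hτ : ∀ y, f (τ' y) = τ (f y)) : AllVal τ' := by
  intro ι _ _ ρ P hP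
  have hs : ∀ y, f.symm (τ y) = τ' (f.symm y) := fun y => f.injective (by simp [hτ])
  obtain ⟨x, hx⟩ := h ι ρ _ (hP.comp f.symm.continuous hs)
  have := hx.comp f.continuous hτ
  simp only [Homeomorph.symm_apply_apply] at this
  exact ⟨x, this⟩

theorem TrDiv.of_map {Y' : Type*} [TopologicalSpace Y'] {τ' : Y' → Y'} {f : Y → Y'} {N : ℕ}
    (h : TrDiv τ N) (hc : Continuous f) (hτ : ∀ y, f (τ y) = τ' (f y)) : TrDiv τ' N :=
  fun ι κ _ _ _ _ ρ p σ q hp hq hi => h ι κ ρ p σ q hp hq (hi.comp hc hτ)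

end HasVal

/-- The unit sphere of a normed space. -/
abbrev US (V : Type) [NormedAddCommGroup V] : Type := Metric.sphere (0 : V) 1

theorem US.norm_eq {V : Type} [NormedAddCommGroup V] (v : US V) : ‖(v : V)‖ = 1 := by
  simp

theorem US.ne_zero {V : Type} [NormedAddCommGroup V] (v : US V) : (v : V) ≠ 0 := by
  intro h; have := v.norm_eq; simp [h] at this

section Normalize
variable {V W : Type} [NormedAddCommGroup V] [NormedSpace ℝ V] [NormedAddCommGroup W]
  [NormedSpace ℝ W]

/-- Radial projection to the unit sphere. -/
noncomputable def US.normalize (v : V) (h : v ≠ 0) : US V :=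
  ⟨‖v‖⁻¹ • v, by simp [norm_smul, h]⟩

/-- The homeomorphism of unit spheres induced by a linear isomorphism. -/
noncomputable def US.congr (L : V ≃L[ℝ] W) : US V ≃ₜ US W where
  toFun v := US.normalize (L v) (by simpa using v.ne_zero)
  invFun w := US.normalize (L.symm w) (by simpa using w.ne_zero)
  left_inv v := by
    apply Subtype.ext
    have h : ‖L v‖ ≠ 0 := by simpa using v.ne_zero
    simp [US.normalize, norm_smul, smul_smul, v.norm_eq, h]
  right_inv v := by
    apply Subtype.ext
    have h : ‖L.symm v‖ ≠ 0 := by simpa using v.ne_zero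
    simp [US.normalize, norm_smul, smul_smul, v.norm_eq, h]
  continuous_toFun := by
    refine Continuous.subtype_mk (Continuous.smul (Continuous.inv₀ (by fun_prop) ?_) (by fun_prop)) _
    intro v; simpa using v.ne_zero
  continuous_invFun := by
    refine Continuous.subtype_mk (Continuous.smul (Continuous.inv₀ (by fun_prop) ?_) (by fun_prop)) _
    intro v; simpa using v.ne_zero

theorem US.congr_neg (L : V ≃L[ℝ] W) (v : US V) : US.congr L (-v) = -US.congr L v := by
  apply Subtype.ext; simp [US.congr, US.normalize]

end Normalize

section Join
variable {V W : Type} [NormedAddCommGroup V] [NormedSpace ℝ V] [NormedAddCommGroup W]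
  [NormedSpace ℝ W]

open unitInterval

/-- The join parametrisation of the unit sphere of a product. -/
noncomputable def US.join (x : US V × US W × I) : US (V × W) :=
  ⟨((min 1 (2 - 2 * (x.2.2 : ℝ))) • (x.1 : V), (min 1 (2 * (x.2.2 : ℝ))) • (x.2.1 : W)), by
    have h0 := x.2.2.2.1
    have h1 := x.2.2.2.2
    have ha : 0 ≤ min 1 (2 - 2 * (x.2.2 : ℝ)) := le_min (by norm_num) (by linarith)
    have hb : 0 ≤ min 1 (2 * (x.2.2 : ℝ)) := le_min (by norm_num) (by linarith)
    simp only [mem_sphere_iff_norm, sub_zero, Prod.norm_mk, norm_smul, US.norm_eq, mul_one,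
      Real.norm_eq_abs, abs_of_nonneg ha, abs_of_nonneg hb]
    rcases le_total (x.2.2 : ℝ) (1 / 2) with h | h
    · rw [min_eq_left (by linarith : (1 : ℝ) ≤ 2 - 2 * x.2.2)]
      exact max_eq_left (min_le_left _ _)
    · rw [min_eq_left (by linarith : (1 : ℝ) ≤ 2 * x.2.2)]
      exact max_eq_right (min_le_left _ _)⟩

theorem US.continuous_join : Continuous (US.join : US V × US W × I → US (V × W)) := by
  unfold US.join; fun_prop

theorem US.join_neg (x : US V × US W × I) : US.join (-x.1, -x.2.1, x.2.2) = -US.join x := by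
  apply Subtype.ext; simp [US.join]

theorem US.join_surjective [Nontrivial V] [Nontrivial W] :
    Function.Surjective (US.join : US V × US W × I → US (V × W)) := by
  rintro ⟨⟨v, w⟩, h⟩
  simp only [mem_sphere_iff_norm, sub_zero, Prod.norm_mk] at h
  obtain ⟨v', hv'⟩ : ∃ v' : US V, ‖v‖ • (v' : V) = v := by
    by_cases hv : v = 0
    · obtain ⟨u, hu⟩ := exists_ne (0 : V)
      exact ⟨US.normalize u hu, by simp [hv]⟩
    · exact ⟨US.normalize v hv, by simp [US.normalize, smul_smul, hv]⟩
  obtain ⟨w', hw'⟩ : ∃ w' : US W, ‖w‖ • (w' : W) = w := by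
    by_cases hv : w = 0
    · obtain ⟨u, hu⟩ := exists_ne (0 : W)
      exact ⟨US.normalize u hu, by simp [hv]⟩
    · exact ⟨US.normalize w hv, by simp [US.normalize, smul_smul, hv]⟩
  have hv0 := norm_nonneg v
  have hw0 := norm_nonneg w
  have hv1 : ‖v‖ ≤ 1 := h ▸ le_max_left _ _
  have hw1 : ‖w‖ ≤ 1 := h ▸ le_max_right _ _
  rcases max_choice ‖v‖ ‖w‖ with hc | hc
  · rw [hc] at h
    refine ⟨(v', w', ⟨‖w‖ / 2, by linarith, by linarith⟩), Subtype.ext (Prod.ext ?_ ?_)⟩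
    · simp only [US.join]; rw [min_eq_left (by linarith), one_smul, ← hv', h, one_smul]
    · simp only [US.join]; rw [min_eq_right (by linarith), mul_div_cancel₀ _ two_ne_zero, hw']
  · rw [hc] at h
    refine ⟨(v', w', ⟨1 - ‖v‖ / 2, by linarith, by linarith⟩), Subtype.ext (Prod.ext ?_ ?_)⟩
    · simp only [US.join]; rw [min_eq_right (by linarith)]
      ring_nf; rw [hv']
    · simp only [US.join]; rw [min_eq_left (by linarith), one_smul, ← hw', h, one_smul]

theorem US.join_eq_iff {v v' : US V} {w w' : US W} {t t' : I}
    (h : US.join (v, w, t) = US.join (v', w', t')) :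
    t = t' ∧ (t ≠ 1 → v = v') ∧ (t ≠ 0 → w = w') := by
  have h1 := congrArg (fun x : US (V × W) => (x : V × W).1) h
  have h2 := congrArg (fun x : US (V × W) => (x : V × W).2) h
  simp only [US.join] at h1 h2
  have n1 := congrArg norm h1
  have n2 := congrArg norm h2
  have a0 := t.2.1; have a1 := t.2.2; have b0 := t'.2.1; have b1 := t'.2.2
  have ha : 0 ≤ min 1 (2 - 2 * (t : ℝ)) := le_min (by norm_num) (by linarith)
  have hb : 0 ≤ min 1 (2 * (t : ℝ)) := le_min (by norm_num) (by linarith)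
  have ha' : 0 ≤ min 1 (2 - 2 * (t' : ℝ)) := le_min (by norm_num) (by linarith)
  have hb' : 0 ≤ min 1 (2 * (t' : ℝ)) := le_min (by norm_num) (by linarith)
  simp only [norm_smul, US.norm_eq, mul_one, Real.norm_eq_abs, abs_of_nonneg ha, abs_of_nonneg hb,
    abs_of_nonneg ha', abs_of_nonneg hb'] at n1 n2
  have ht : (t : ℝ) = t' := by
    simp only [min_def] at n1 n2
    split_ifs at n1 n2 <;> linarith
  have htt : t = t' := Subtype.ext ht
  subst htt
  refine ⟨rfl, fun hne => Subtype.ext ?_, fun hne => Subtype.ext ?_⟩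
  · have : (t : ℝ) < 1 := lt_of_le_of_ne a1 fun e => hne (Subtype.ext e)
    exact smul_right_injective _ (ne_of_gt (lt_min one_pos (by linarith))) h1
  · have : 0 < (t : ℝ) := lt_of_le_of_ne a0 fun e => hne (Subtype.ext e.symm)
    exact smul_right_injective _ (ne_of_gt (lt_min one_pos (by linarith))) h2

/-- Functions on a join. -/
theorem US.exists_descend [FiniteDimensional ℝ V] [FiniteDimensional ℝ W] [Nontrivial V]
    [Nontrivial W] {α : Type*} [TopologicalSpace α] {G : US V × US W × I → α} (hG : Continuous G)
    (h0 : ∀ v w w', G (v, w, 0) = G (v, w', 0)) (h1 : ∀ v v' w, G (v, w, 1) = G (v', w, 1)) :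
    ∃ g : US (V × W) → α, Continuous g ∧ ∀ x, g (US.join x) = G x := by
  have : CompactSpace (US V) := isCompact_iff_compactSpace.1 (isCompact_sphere _ _)
  have : CompactSpace (US W) := isCompact_iff_compactSpace.1 (isCompact_sphere _ _)
  have hq : Topology.IsQuotientMap (US.join : US V × US W × I → US (V × W)) :=
    US.continuous_join.isClosedMap.isQuotientMap US.continuous_join US.join_surjective
  have key : ∀ x y, US.join x = US.join y → G x = G y := by
    rintro ⟨v, w, t⟩ ⟨v', w', t'⟩ h
    obtain ⟨rfl, hv, hw⟩ := US.join_eq_iff h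
    by_cases ht0 : t = 0
    · subst ht0; rw [hv (by simp), h0]
    · by_cases ht1 : t = 1
      · subst ht1; rw [hw (by simp), h1]
      · rw [hv ht1, hw ht0]
  refine ⟨G ∘ Function.surjInv US.join_surjective, ?_, fun x => ?_⟩
  · rw [hq.continuous_iff]
    convert hG using 1
    funext x
    exact key _ _ (Function.surjInv_eq _ _)
  · exact key _ _ (Function.surjInv_eq _ _)

theorem US.exists_descend_EMap [FiniteDimensional ℝ V] [FiniteDimensional ℝ W] [Nontrivial V]
    [Nontrivial W] {κ ι : Type*} [Fintype κ] [Fintype ι] {a : Matrix κ κ ℂ} {b : Matrix ι ι ℂ}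
    {G : US V × US W × I → Matrix κ ι ℂ} (hG : EMap (fun x => (-x.1, -x.2.1, x.2.2)) a b G)
    (h0 : ∀ v w w', G (v, w, 0) = G (v, w', 0)) (h1 : ∀ v v' w, G (v, w, 1) = G (v', w, 1)) :
    ∃ g : US (V × W) → Matrix κ ι ℂ, EMap Neg.neg a b g ∧ ∀ x, g (US.join x) = G x := by
  obtain ⟨g, hg, h⟩ := US.exists_descend hG.1 h0 h1
  refine ⟨g, ⟨hg, fun y => ?_⟩, h⟩
  obtain ⟨x, rfl⟩ := US.join_surjective y
  rw [← US.join_neg, h, h, hG.2]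

end Join

section Congr
variable {V W : Type} [NormedAddCommGroup V] [NormedSpace ℝ V] [NormedAddCommGroup W]
  [NormedSpace ℝ W] [FiniteDimensional ℝ V] [FiniteDimensional ℝ W]

theorem AllVal.of_finrank_eq (h : AllVal (Neg.neg : US V → US V))
    (e : Module.finrank ℝ W = Module.finrank ℝ V) : AllVal (Neg.neg : US W → US W) :=
  h.of_homeomorph (US.congr (ContinuousLinearEquiv.ofFinrankEq e)) fun _ => US.congr_neg _ _

theorem TrDiv.of_finrank_eq {N : ℕ} (h : TrDiv (Neg.neg : US V → US V) N)
    (e : Module.finrank ℝ V = Module.finrank ℝ W) : TrDiv (Neg.neg : US W → US W) N :=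
  h.of_map (US.congr (ContinuousLinearEquiv.ofFinrankEq e)).continuous fun _ => US.congr_neg _ _

end Congr

theorem isIntegral_trace_of_pow_seven {ι : Type*} [Fintype ι] [DecidableEq ι] {X : Matrix ι ι ℂ}
    (h : X ^ 7 = X) : IsIntegral ℤ X.trace := by
  rw [Matrix.trace_eq_sum_roots_charpoly]
  refine IsIntegral.multiset_sum fun μ hμ => ?_
  rw [Polynomial.mem_roots X.charpoly_monic.ne_zero, Polynomial.IsRoot.def,
    Matrix.eval_charpoly] at hμ
  obtain ⟨v, hv, hv0⟩ := Matrix.exists_mulVec_eq_zero_iff.2 hμ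
  have h1 : X *ᵥ v = μ • v := by
    rw [Matrix.sub_mulVec, sub_eq_zero, Matrix.scalar_apply] at hv0
    rw [← hv0]; ext i; simp [Matrix.mulVec_diagonal]
  have h2 : ∀ k : ℕ, X ^ k *ᵥ v = μ ^ k • v := by
    intro k
    induction k with
    | zero => simp
    | succ k ih => rw [pow_succ, ← Matrix.mulVec_mulVec, h1, Matrix.mulVec_smul, ih, smul_smul,
        pow_succ, mul_comm]
  have h3 : μ ^ 7 = μ := by
    have := h2 7
    rw [h, h1] at this
    exact (smul_left_injective ℂ hv this).symm
  refine ⟨Polynomial.X ^ 7 - Polynomial.X, ?_, by simp [h3]⟩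
  exact Polynomial.monic_X_pow_sub (by simp)

theorem US_real_cases (y : US ℝ) : (y : ℝ) = 1 ∨ (y : ℝ) = -1 := by
  have := y.norm_eq
  rwa [Real.norm_eq_abs, abs_eq one_pos.le] at this

theorem US_real_eq (y : US ℝ) (u : US ℝ) : y = u ∨ y = -u := by
  rcases US_real_cases y with h | h <;> rcases US_real_cases u with h' | h'
  · left; exact Subtype.ext (h.trans h'.symm)
  · right; apply Subtype.ext; simp [h, h']
  · right; apply Subtype.ext; simp [h, h']
  · left; exact Subtype.ext (h.trans h'.symm)

instance : DiscreteTopology (US ℝ) := by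
  have : Finite (US ℝ) := by
    refine Set.Finite.subset (Set.toFinite {1, -1}) fun y hy => ?_
    simpa using US_real_cases ⟨y, hy⟩
  infer_instance

theorem allVal_US_real : AllVal (Neg.neg : US ℝ → US ℝ) := by
  classical
  intro ι _ _ ρ P hP
  let u : US ℝ := ⟨1, by simp⟩
  have hu : -u ≠ u := fun h => by
    have := congrArg Subtype.val h; simp [u] at this; norm_num at this
  have e1 := hP.emap.2 u
  have e2 := hP.emap.2 (-u)
  rw [neg_neg] at e2
  have h6 := hP.ord
  have h2 : P u * (ρ * ρ) = (ρ * ρ) * P u := by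
    rw [← Matrix.mul_assoc, e2, Matrix.mul_assoc, e1, Matrix.mul_assoc]
  have h2' : Commute (P u) (ρ ^ 2) := by rw [pow_two]; exact h2
  have h4 : Commute (P u) (ρ ^ 4) := by
    rw [show (4 : ℕ) = 2 * 2 from rfl, pow_mul]; exact h2'.pow_right 2
  have hcon : IsCon (ρ ^ 4) (P u) := ⟨h4, hP.idem u, by
    rw [← pow_mul, mul_comm, pow_mul, h6, one_pow]⟩
  refine ⟨_, (HasVal.con hcon).biso hP (BIso.of_conj (g := fun y => if y = u then 1 else ρ ^ 3)
    hcon.isBun ⟨continuous_of_discreteTopology, fun y => ?_⟩ (fun y => ?_) fun y => ?_)⟩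
  · rcases US_real_eq y u with rfl | rfl
    · simp only [hu, if_true, if_false, mul_one]
      rw [← pow_add, pow_succ, h6, one_mul]
    · simp only [neg_neg, hu, if_true, if_false, one_mul]
      rw [← pow_succ']
  · have : IsUnit (ρ ^ 3) := by
      refine IsUnit.of_mul_eq_one (ρ ^ 3) ?_
      rw [← pow_add, h6]
    split_ifs
    · exact isUnit_one
    · exact this
  · rcases US_real_eq y u with rfl | rfl
    · simp
    · simp only [hu, if_false]
      have e3 : P (-u) * ρ ^ 2 = ρ ^ 2 * P (-u) := by
        rw [pow_two, ← Matrix.mul_assoc, e1, Matrix.mul_assoc, e2, Matrix.mul_assoc]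
      rw [pow_succ, Matrix.mul_assoc, ← e1, ← Matrix.mul_assoc, ← e3, Matrix.mul_assoc]

theorem trDiv_US_real : TrDiv (Neg.neg : US ℝ → US ℝ) 1 := by
  intro ι κ _ _ _ _ ρ p σ q hp hq ⟨A, B, hA, hB, h1, h2⟩
  let u : US ℝ := ⟨1, by simp⟩
  have e1 := hA.2 u
  have e2 := hA.2 (-u)
  rw [neg_neg] at e2
  have e3 : A u * ρ ^ 2 = σ ^ 2 * A u := by
    rw [pow_two, pow_two, ← Matrix.mul_assoc, e2, Matrix.mul_assoc, e1, Matrix.mul_assoc]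
  have e4 : A u * ρ ^ 4 = σ ^ 4 * A u := by
    rw [show (4 : ℕ) = 2 + 2 from rfl, pow_add, pow_add, ← Matrix.mul_assoc, e3, Matrix.mul_assoc,
      e3, Matrix.mul_assoc]
  have e5 : (ρ ^ 4 * p).trace = (σ ^ 4 * q).trace := by
    have h1u : B u * A u = p := h1 u
    have h2u : A u * B u = q := h2 u
    rw [← h1u, ← h2u, ← Matrix.mul_assoc, ← Matrix.mul_assoc, ← e4, Matrix.trace_mul_comm,
      ← Matrix.mul_assoc]
  have key : ∀ {α : Type} [Fintype α] [DecidableEq α] {s r : Matrix α α ℂ}, IsCon s r →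
      ∃ a : ℂ, IsIntegral ℤ a ∧ (s * r).trace = (s ^ 4 * r).trace - 2 * a := by
    intro α _ _ s r h
    refine ⟨(s ^ 4 * r * ((1 / 2 : ℂ) • (1 - s ^ 3))).trace, isIntegral_trace_of_pow_seven ?_, ?_⟩
    · have c1 : Commute r s := h.comm
      have c3 : Commute (s ^ 4 * r) ((1 / 2 : ℂ) • (1 - s ^ 3)) := by
        refine Commute.smul_right (Commute.sub_right (Commute.one_right _) ?_) _
        exact Commute.mul_left ((Commute.refl s).pow_pow _ _) (c1.pow_right _)
      have i1 : IsIdempotentElem ((1 / 2 : ℂ) • (1 - s ^ 3)) := by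
        have : s ^ 3 * s ^ 3 = 1 := by rw [← pow_add, h.ord]
        rw [IsIdempotentElem, smul_mul_smul_comm, sub_mul, mul_sub, mul_sub, this]
        simp only [one_mul, mul_one]
        rw [show (1 - s ^ 3 - (s ^ 3 - 1) : Matrix α α ℂ) = (2 : ℂ) • (1 - s ^ 3) by
          rw [two_smul]; abel, smul_smul]
        norm_num
      rw [c3.mul_pow, (c1.symm.pow_left 4).mul_pow, i1.pow_eq (by norm_num : (7 : ℕ) ≠ 0),
        IsIdempotentElem.pow_eq h.idem (by norm_num : (7 : ℕ) ≠ 0), ← pow_mul,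
        show 4 * 7 = 6 * 4 + 4 from rfl, pow_add, pow_mul, h.ord, one_pow, one_mul]
    · have : s ^ 4 * r * s ^ 3 = s * r := by
        rw [Matrix.mul_assoc, (Commute.pow_right (show Commute r s from h.comm) 3).eq,
          ← Matrix.mul_assoc, ← pow_add, pow_succ, h.ord, one_mul]
      rw [mul_smul_comm, Matrix.trace_smul, Matrix.mul_sub, this, Matrix.mul_one,
        Matrix.trace_sub, smul_eq_mul]
      ring
  obtain ⟨a, ha, ha'⟩ := key hp
  obtain ⟨b, hb, hb'⟩ := key hq
  refine ⟨a - b, ha.sub hb, ?_⟩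
  rw [ha', hb', e5]; ring

open unitInterval

/-- The elementary intertwiner between two idempotents. -/
def itw {ι : Type*} [Fintype ι] [DecidableEq ι] (P Q : Matrix ι ι ℂ) : Matrix ι ι ℂ :=
  P * Q + (1 - P) * (1 - Q)

section Transport
variable {ι : Type*} [Fintype ι] [DecidableEq ι]

theorem itw_self {P : Matrix ι ι ℂ} (h : P * P = P) : itw P P = 1 := by
  have : (1 - P) * (1 - P) = 1 - P := IsIdempotentElem.one_sub h
  rw [itw, h, this]; abel

theorem itw_mul {P Q : Matrix ι ι ℂ} (hP : P * P = P) (hQ : Q * Q = Q) :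
    itw P Q * Q = P * itw P Q := by
  have h1 : (1 - Q) * Q = 0 := by rw [sub_mul, hQ, one_mul, sub_self]
  have h2 : P * (1 - P) = 0 := by rw [mul_sub, hP, mul_one, sub_self]
  rw [itw, add_mul, mul_add, mul_assoc, hQ, mul_assoc, h1, ← mul_assoc, hP, ← mul_assoc, h2]
  simp

variable {Y : Type*} [PseudoMetricSpace Y] [CompactSpace Y] {τ : Y → Y} {ρ : Matrix ι ι ℂ}

theorem exists_transport {P : Y × I → Matrix ι ι ℂ} (hP : EMap (Prod.map τ id) ρ ρ P)
    (hi : ∀ x, P x * P x = P x) :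
    ∃ T : Y × I → Matrix ι ι ℂ, EMap (Prod.map τ id) ρ ρ T ∧ (∀ x, IsUnit (T x)) ∧
      (∀ y, T (y, 0) = 1) ∧ ∀ y t, T (y, t) * P (y, 0) = P (y, t) * T (y, t) := by
  have hPc := hP.1
  have hdet : Continuous fun x : Y × I × I => (itw (P (x.1, x.2.2)) (P (x.1, x.2.1))).det := by
    unfold itw; fun_prop
  obtain ⟨δ, hδ, hδ'⟩ := Metric.uniformContinuous_iff.1
    (CompactSpace.uniformContinuous_of_continuous hdet) 1 one_pos
  have hunit : ∀ y (s t : I), |(t : ℝ) - s| < δ → IsUnit (itw (P (y, t)) (P (y, s))) := by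
    intro y s t h
    have := @hδ' (y, s, t) (y, s, s) (by
      rw [Prod.dist_eq, Prod.dist_eq]; simpa [Subtype.dist_eq, Real.dist_eq] using h)
    simp only [itw_self (hi _), det_one] at this
    rw [Matrix.isUnit_iff_isUnit_det, isUnit_iff_ne_zero]
    intro h0
    rw [h0, Complex.dist_eq] at this
    norm_num at this
  let c : ℕ → I → I := fun k t => ⟨min t (k * (δ / 2)), le_min t.2.1 (by positivity),
    (min_le_left _ _).trans t.2.2⟩
  have hc : ∀ k, Continuous (c k) := fun k => by unfold c; fun_prop
  have hc0 : ∀ k, c k 0 = 0 := fun k => Subtype.ext (min_eq_left (by positivity))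
  have ind : ∀ k : ℕ, ∃ T : Y × I → Matrix ι ι ℂ, EMap (Prod.map τ id) ρ ρ T ∧
      (∀ x, IsUnit (T x)) ∧ (∀ y, T (y, 0) = 1) ∧
      ∀ y t, T (y, t) * P (y, 0) = P (y, c k t) * T (y, t) := by
    intro k
    induction k with
    | zero =>
      refine ⟨fun _ => 1, EMap.one, fun _ => isUnit_one, fun _ => rfl, fun y t => ?_⟩
      have : c 0 t = 0 := Subtype.ext (by simp [c, t.2.1])
      rw [this]; simp
    | succ k ih =>
      obtain ⟨T, h1, h2, h3, h4⟩ := ih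
      have e : ∀ k, EMap (Prod.map τ id) ρ ρ fun x : Y × I => P (x.1, c k x.2) := fun k =>
        hP.comp (by have := hc k; fun_prop) fun _ => rfl
      refine ⟨_, (((e (k + 1)).mul (e k)).add ((EMap.one.sub (e (k + 1))).mul
        (EMap.one.sub (e k)))).mul h1, fun x => ?_, fun y => ?_, fun y t => ?_⟩
      · refine (hunit x.1 (c k x.2) (c (k + 1) x.2) ?_).mul (h2 x)
        simp only [c, Nat.cast_add, Nat.cast_one, abs_lt, min_def]
        split_ifs <;> constructor <;> linarith
      · have := itw_self (hi (y, 0))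
        rw [itw] at this
        simp only [hc0, this, h3, mul_one]
      · have := itw_mul (hi (y, c (k + 1) t)) (hi (y, c k t))
        rw [itw] at this
        dsimp only
        rw [mul_assoc, h4, ← mul_assoc, this, mul_assoc]
  obtain ⟨k, hk⟩ := exists_nat_ge (1 / (δ / 2))
  obtain ⟨T, h1, h2, h3, h4⟩ := ind k
  refine ⟨T, h1, h2, h3, fun y t => ?_⟩
  have : c k t = t := Subtype.ext (min_eq_left (t.2.2.trans (by
    rwa [div_le_iff₀ (by positivity)] at hk)))
  rw [h4, this]

/-- Homotopic bundles are isomorphic. -/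
theorem BIso.of_homotopy {P : Y × I → Matrix ι ι ℂ} (hP : EMap (Prod.map τ id) ρ ρ P)
    (hi : ∀ x, P x * P x = P x) (ho : ρ ^ 6 = 1) :
    BIso τ ρ ρ (fun y => P (y, 0)) fun y => P (y, 1) := by
  obtain ⟨T, h1, h2, h3, h4⟩ := exists_transport hP hi
  exact BIso.of_conj (g := fun y => T (y, 1)) ⟨hP.comp (h := fun y => (y, 0)) (by fun_prop)
    fun _ => rfl, fun _ => hi _, ho⟩ (h1.comp (h := fun y => (y, 1)) (by fun_prop) fun _ => rfl)
    (fun _ => h2 _) fun y => h4 y 1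

end Transport

end

section

open Matrix MeasureTheory

section Mean

noncomputable local instance : MeasurableSpace Circle := borel Circle
local instance : BorelSpace Circle := ⟨rfl⟩

/-- The mean of a function on the circle. -/
noncomputable def cmean (f : Circle → ℂ) : ℂ :=
  ∫ z, f z ∂(Measure.haarMeasure (⊤ : TopologicalSpace.PositiveCompacts Circle))

local instance : IsProbabilityMeasure
    (Measure.haarMeasure (⊤ : TopologicalSpace.PositiveCompacts Circle)) :=
  ⟨Measure.haarMeasure_self⟩

theorem integrable_circle {f : Circle → ℂ} (hf : Continuous f) :
    Integrable f (Measure.haarMeasure (⊤ : TopologicalSpace.PositiveCompacts Circle)) :=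
  hf.integrable_of_hasCompactSupport (HasCompactSupport.of_compactSpace _)

theorem cmean_rotate (f : Circle → ℂ) (c : Circle) : cmean (fun z => f (z * c)) = cmean f := by
  unfold cmean
  simp_rw [mul_comm _ c]
  exact integral_mul_left_eq_self (μ := Measure.haarMeasure (⊤ : TopologicalSpace.PositiveCompacts Circle)) f c

theorem cmean_const (c : ℂ) : cmean (fun _ => c) = c := by simp [cmean]

theorem cmean_sub {f g : Circle → ℂ} (hf : Continuous f) (hg : Continuous g) :
    cmean (fun z => f z - g z) = cmean f - cmean g :=
  integral_sub (integrable_circle hf) (integrable_circle hg)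

theorem cmean_sum {ι : Type*} (s : Finset ι) {f : ι → Circle → ℂ} (hf : ∀ i, Continuous (f i)) :
    cmean (fun z => ∑ i ∈ s, f i z) = ∑ i ∈ s, cmean (f i) :=
  integral_finsetSum s fun i _ => integrable_circle (hf i)

theorem cmean_const_mul (c : ℂ) (f : Circle → ℂ) : cmean (fun z => c * f z) = c * cmean f :=
  integral_const_mul c f

theorem norm_cmean_le {f : Circle → ℂ} {C : ℝ} (h : ∀ z, ‖f z‖ ≤ C) : ‖cmean f‖ ≤ C := by
  have := norm_integral_le_of_norm_le_const (f := f) (C := C)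
    (μ := Measure.haarMeasure (⊤ : TopologicalSpace.PositiveCompacts Circle)) (.of_forall h)
  simpa [cmean] using this

theorem cmean_swap {f : Circle → Circle → ℂ} (hf : Continuous f.uncurry) :
    cmean (fun z => cmean (f z)) = cmean fun w => cmean fun z => f z w :=
  integral_integral_swap (hf.integrable_of_hasCompactSupport (HasCompactSupport.of_compactSpace _))

theorem continuous_cmean {Y : Type*} [PseudoMetricSpace Y] [CompactSpace Y] {f : Y → Circle → ℂ}
    (hf : Continuous f.uncurry) : Continuous fun y => cmean (f y) := by
  have := continuous_parametric_integral_of_continuous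
    (μ := Measure.haarMeasure (⊤ : TopologicalSpace.PositiveCompacts Circle)) hf isCompact_univ
  simpa [cmean] using this

theorem cmean_zpow {j : ℤ} (hj : j ≠ 0) : cmean (fun z => (z : ℂ) ^ j) = 0 := by
  have h := cmean_rotate (fun z => (z : ℂ) ^ j) (Circle.exp (Real.pi / j))
  have h1 : ((Circle.exp (Real.pi / j) : Circle) : ℂ) ^ j = -1 := by
    rw [← Circle.coe_zpow, ← Circle.exp_zsmul]
    simp only [zsmul_eq_mul, Circle.coe_exp]
    rw [show ((j : ℝ) * (Real.pi / j) : ℝ) = Real.pi by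
      have : (j : ℝ) ≠ 0 := by exact_mod_cast hj
      field_simp]
    exact Complex.exp_pi_mul_I
  simp only [Circle.coe_mul, mul_zpow, h1] at h
  simp_rw [mul_comm _ (-1 : ℂ)] at h
  rw [cmean_const_mul] at h
  linear_combination (-1 / 2 : ℂ) * h

theorem cmean_geom {e : ℤ} (he : e ≠ 0) {w : ℂ} (hw : ‖w‖ < 1) :
    cmean (fun z => (1 - w * (z : ℂ) ^ e)⁻¹) = 1 := by
  have hn : ∀ z : Circle, ‖w * (z : ℂ) ^ e‖ = ‖w‖ := fun z => by
    rw [norm_mul, norm_zpow, Circle.norm_coe, _root_.one_zpow, mul_one]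
  have hne : ∀ z : Circle, 1 - w * (z : ℂ) ^ e ≠ 0 := fun z h => by
    have := hn z
    rw [← sub_eq_zero.1 h, norm_one] at this
    linarith
  have hcz : Continuous fun z : Circle => (z : ℂ) ^ e := by
    refine Continuous.zpow₀ (by fun_prop) _ fun z => Or.inl (by simp)
  have hc : Continuous fun z : Circle => (1 - w * (z : ℂ) ^ e)⁻¹ :=
    Continuous.inv₀ (by fun_prop) hne
  have hs : ∀ N : ℕ, cmean (fun z => ∑ j ∈ Finset.range (N + 1), (w * (z : ℂ) ^ e) ^ j) = 1 := by
    intro N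
    rw [cmean_sum _ fun i => by fun_prop, Finset.sum_range_succ']
    simp only [pow_zero, cmean_const]
    rw [Finset.sum_eq_zero, zero_add]
    intro j _
    simp only [mul_pow]
    rw [cmean_const_mul]
    have : (e * ((j + 1 : ℕ) : ℤ)) ≠ 0 := mul_ne_zero he (by positivity)
    have h := cmean_zpow this
    have h' : (fun z : Circle => ((z : ℂ) ^ e) ^ (j + 1)) =
        fun z : Circle => (z : ℂ) ^ (e * ((j + 1 : ℕ) : ℤ)) := by
      funext z; rw [_root_.zpow_mul, zpow_natCast]
    rw [h', h, mul_zero]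
  have hb : ∀ N : ℕ, ‖cmean (fun z => (1 - w * (z : ℂ) ^ e)⁻¹) - 1‖ ≤ ‖w‖ ^ (N + 1) * (1 - ‖w‖)⁻¹ := by
    intro N
    have h0 := cmean_sub hc (g := fun z : Circle => ∑ j ∈ Finset.range (N + 1), (w * (z : ℂ) ^ e) ^ j)
      (by fun_prop)
    rw [hs N] at h0
    rw [← h0]
    refine norm_cmean_le fun z => ?_
    have h1 : (1 - w * (z : ℂ) ^ e)⁻¹ - ∑ j ∈ Finset.range (N + 1), (w * (z : ℂ) ^ e) ^ j =
        (w * (z : ℂ) ^ e) ^ (N + 1) * (1 - w * (z : ℂ) ^ e)⁻¹ := by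
      have := mul_neg_geom_sum (w * (z : ℂ) ^ e) (N + 1)
      have h2 := hne z
      field_simp
      rw [this]; ring
    rw [h1, norm_mul, norm_pow, hn, norm_inv]
    have := norm_sub_norm_le (1 : ℂ) (w * (z : ℂ) ^ e)
    rw [hn, norm_one] at this
    exact mul_le_mul_of_nonneg_left (inv_anti₀ (by linarith) this) (by positivity)
  have hlim : Filter.Tendsto (fun N : ℕ => ‖w‖ ^ (N + 1) * (1 - ‖w‖)⁻¹) Filter.atTop (nhds 0) := by
    have := ((tendsto_pow_atTop_nhds_zero_of_lt_one (norm_nonneg w) hw).comp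
      (Filter.tendsto_add_atTop_nat 1)).mul_const ((1 - ‖w‖)⁻¹)
    simpa using this
  have := ge_of_tendsto' hlim hb
  exact sub_eq_zero.1 (norm_le_zero_iff.1 this)

theorem cmean_div_sub_of_lt {ζ : ℂ} (h : ‖ζ‖ < 1) : cmean (fun z => (z : ℂ) * (z - ζ)⁻¹) = 1 := by
  rw [← cmean_geom (e := -1) (by norm_num) h]
  congr 1; funext z
  have hz : (z : ℂ) ≠ 0 := by simp
  rw [_root_.zpow_neg_one, show (1 - ζ * (z : ℂ)⁻¹) = (z - ζ) * (z : ℂ)⁻¹ by field_simp, mul_inv, inv_inv,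
    mul_comm]

theorem cmean_div_sub_of_gt {ζ : ℂ} (h : 1 < ‖ζ‖) : cmean (fun z => (z : ℂ) * (z - ζ)⁻¹) = 0 := by
  have h0 : ζ ≠ 0 := fun h' => by simp [h'] at h; linarith
  have hw : ‖ζ⁻¹‖ < 1 := by rw [norm_inv]; exact inv_lt_one_of_one_lt₀ h
  have hne : ∀ z : Circle, (z : ℂ) - ζ ≠ 0 := fun z hz => by
    have := Circle.norm_coe z
    rw [sub_eq_zero.1 hz] at this; linarith
  have hne' : ∀ z : Circle, 1 - ζ⁻¹ * (z : ℂ) ^ (1 : ℤ) ≠ 0 := fun z hz => hne z (by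
    rw [_root_.zpow_one] at hz; field_simp at hz; linear_combination -hz)
  have h1 := cmean_geom (e := 1) (by norm_num) hw
  have h2 := cmean_sub (f := fun _ => 1) (g := fun z : Circle => (1 - ζ⁻¹ * (z : ℂ) ^ (1 : ℤ))⁻¹)
    continuous_const (Continuous.inv₀ (by simp only [_root_.zpow_one]; fun_prop) hne')
  rw [h1, cmean_const, sub_self] at h2
  rw [← h2]
  congr 1; funext z
  have a := hne z
  have b := hne' z
  rw [_root_.zpow_one] at b ⊢
  have c : ζ - z ≠ 0 := fun hh => a (by linear_combination -hh)
  field_simp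
  ring

end Mean

section MatrixMean
variable {κ ι μ : Type*} [Fintype κ] [Fintype ι] [Fintype μ]

/-- The entrywise mean of a matrix valued function on the circle. -/
noncomputable def mmean (F : Circle → Matrix κ ι ℂ) : Matrix κ ι ℂ :=
  Matrix.of fun i j => cmean fun z => F z i j

theorem mmean_mul_left (C : Matrix μ κ ℂ) {F : Circle → Matrix κ ι ℂ} (hF : Continuous F) :
    mmean (fun z => C * F z) = C * mmean F := by
  ext i j
  simp only [mmean, Matrix.mul_apply, Matrix.of_apply]
  rw [cmean_sum _ fun k => by fun_prop]
  simp_rw [cmean_const_mul]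

theorem mmean_mul_right (C : Matrix ι μ ℂ) {F : Circle → Matrix κ ι ℂ} (hF : Continuous F) :
    mmean (fun z => F z * C) = mmean F * C := by
  ext i j
  simp only [mmean, Matrix.mul_apply, Matrix.of_apply]
  rw [cmean_sum _ fun k => by fun_prop]
  simp_rw [mul_comm _ (C _ j), cmean_const_mul]

theorem mmean_sub {F G : Circle → Matrix κ ι ℂ} (hF : Continuous F) (hG : Continuous G) :
    mmean (fun z => F z - G z) = mmean F - mmean G := by
  ext i j
  exact cmean_sub (by fun_prop) (by fun_prop)

theorem mmean_smul (c : ℂ) (F : Circle → Matrix κ ι ℂ) :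
    mmean (fun z => c • F z) = c • mmean F := by
  ext i j
  exact cmean_const_mul c _

theorem mmean_const (C : Matrix κ ι ℂ) : mmean (fun _ => C) = C := by
  ext i j
  exact cmean_const _

theorem mmean_rotate (F : Circle → Matrix κ ι ℂ) (c : Circle) :
    mmean (fun z => F (z * c)) = mmean F := by
  ext i j
  exact cmean_rotate (fun z => F z i j) c

theorem mmean_swap {F : Circle → Circle → Matrix κ ι ℂ} (hF : Continuous F.uncurry) :
    mmean (fun z => mmean (F z)) = mmean fun w => mmean fun z => F z w := by
  ext i j
  exact cmean_swap (f := fun z w => F z w i j) (hF.matrix_elem i j)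

theorem continuous_mmean {Y : Type*} [PseudoMetricSpace Y] [CompactSpace Y]
    {F : Y → Circle → Matrix κ ι ℂ} (hF : Continuous F.uncurry) :
    Continuous fun y => mmean (F y) := by
  refine continuous_matrix fun i j => ?_
  exact continuous_cmean (f := fun y z => F y z i j) (hF.matrix_elem i j)

end MatrixMean

end

section

open Matrix

section Pencil
variable {ι : Type*} [Fintype ι] [DecidableEq ι]

theorem Matrix.isUnit_of_forall_mul_eq_zero {M : Matrix ι ι ℂ}
    (h : ∀ N : Matrix ι Unit ℂ, M * N = 0 → N = 0) : IsUnit M := by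
  rw [← Matrix.mulVec_injective_iff_isUnit]
  refine (injective_iff_map_eq_zero M.mulVecLin).2 fun v hv => ?_
  have := h (replicateCol Unit v) (by
    rw [← replicateCol_mulVec]; rw [Matrix.mulVecLin_apply] at hv; rw [hv]; simp)
  funext i
  exact congrFun (congrFun this i) ()

/-- The spectral projection of the pencil `B + z A` given by a contour integral over the circle. -/
noncomputable def pencilProj (A B : Matrix ι ι ℂ) : Matrix ι ι ℂ :=
  mmean fun z => (z : ℂ) • ((B + (z : ℂ) • A)⁻¹ * A)

theorem continuous_pencil_inv {Y : Type*} [TopologicalSpace Y] {A B : Y → Matrix ι ι ℂ}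
    (hA : Continuous A) (hB : Continuous B) (h : ∀ y (z : Circle), IsUnit (B y + (z : ℂ) • A y)) :
    Continuous fun x : Y × Circle => (B x.1 + (x.2 : ℂ) • A x.1)⁻¹ :=
  continuous_matrix_inv (by fun_prop) fun x => h x.1 x.2

theorem continuous_pencilProj {Y : Type*} [PseudoMetricSpace Y] [CompactSpace Y]
    {A B : Y → Matrix ι ι ℂ} (hA : Continuous A) (hB : Continuous B)
    (h : ∀ y (z : Circle), IsUnit (B y + (z : ℂ) • A y)) :
    Continuous fun y => pencilProj (A y) (B y) := by
  refine continuous_mmean (F := fun y z => (z : ℂ) • ((B y + (z : ℂ) • A y)⁻¹ * A y)) ?_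
  have := continuous_pencil_inv hA hB h
  simp only [Function.uncurry_def]
  fun_prop

theorem pencilProj_mul_left {C A B : Matrix ι ι ℂ} (hC : IsUnit C) :
    pencilProj (C * A) (C * B) = pencilProj A B := by
  refine congrArg mmean (funext fun z => ?_)
  have e : C * B + (z : ℂ) • (C * A) = C * (B + (z : ℂ) • A) := by
    rw [Matrix.mul_add, Matrix.mul_smul]
  rw [e, Matrix.mul_inv_rev, Matrix.mul_assoc,
    ← Matrix.mul_assoc C⁻¹, Matrix.inv_mul_of_isUnit hC, Matrix.one_mul]

theorem continuous_pencil_inv_const {A B : Matrix ι ι ℂ}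
    (h : ∀ z : Circle, IsUnit (B + (z : ℂ) • A)) :
    Continuous fun z : Circle => (B + (z : ℂ) • A)⁻¹ :=
  continuous_matrix_inv (by fun_prop) h

theorem pencilProj_equivariant {A B A' B' r s : Matrix ι ι ℂ} (hr : IsUnit r) (hs : IsUnit s)
    (h : ∀ z : Circle, IsUnit (B + (z : ℂ) • A)) (hA : A' * r = -(s * A)) (hB : B' * r = s * B) :
    pencilProj A' B' * r = r * pencilProj A B := by
  have h' : ∀ z : Circle, IsUnit (B' + (z : ℂ) • A') := fun z => by
    have e : B' + (z : ℂ) • A' = s * (B + ((-z : Circle) : ℂ) • A) * r⁻¹ := by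
      have e0 : (B' + (z : ℂ) • A') * r = s * (B + ((-z : Circle) : ℂ) • A) := by
        rw [Matrix.add_mul, hB, Matrix.smul_mul, hA, Matrix.mul_add, Circle.coe_neg]
        simp
      rw [← e0, Matrix.mul_assoc, Matrix.mul_inv_of_isUnit hr, Matrix.mul_one]
    rw [e]
    exact (hs.mul (h _)).mul (Matrix.isUnit_nonsing_inv_iff.2 hr)
  have hc := continuous_pencil_inv_const h
  have hc' := continuous_pencil_inv_const h'
  have e : ∀ z : Circle, (z : ℂ) • ((B' + (z : ℂ) • A')⁻¹ * A') * r =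
      r * (((z * (-1) : Circle) : ℂ) • ((B + ((z * (-1) : Circle) : ℂ) • A)⁻¹ * A)) := by
    intro z
    have e1 : (B' + (z : ℂ) • A') * r = s * (B + ((z * (-1) : Circle) : ℂ) • A) := by
      rw [Matrix.add_mul, hB, Matrix.smul_mul, hA, Matrix.mul_add]
      simp
    have e2 : (B' + (z : ℂ) • A')⁻¹ * s = r * (B + ((z * (-1) : Circle) : ℂ) • A)⁻¹ := by
      rw [← Matrix.mul_one s, ← Matrix.mul_inv_of_isUnit (h (z * (-1))), ← Matrix.mul_assoc s, ← e1,
        ← Matrix.mul_assoc, ← Matrix.mul_assoc, Matrix.inv_mul_of_isUnit (h' z), Matrix.one_mul]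
    rw [Matrix.smul_mul, Matrix.mul_assoc, hA, Matrix.mul_neg, ← Matrix.mul_assoc, e2]
    simp [Matrix.mul_assoc]
  rw [pencilProj, ← mmean_mul_right _ (by fun_prop)]
  simp_rw [e]
  rw [mmean_rotate (fun z => r * ((z : ℂ) • ((B + (z : ℂ) • A)⁻¹ * A))) (-1),
    mmean_mul_left _ (by fun_prop), pencilProj]

theorem pencilProj_mul_self {A B : Matrix ι ι ℂ}
    (h : ∀ z : Circle, IsUnit (B + (z : ℂ) • A)) :
    pencilProj A B * pencilProj A B = pencilProj A B := by
  set R : Circle → Matrix ι ι ℂ := fun z => (z : ℂ) • ((B + (z : ℂ) • A)⁻¹ * A) with hR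
  have hRc : Continuous R := by
    have := continuous_pencil_inv_const h
    fun_prop
  have hQ : pencilProj A B = mmean R := rfl
  have key : ∀ ζ θ : Circle, ((θ : ℂ) - 1) • (R ζ * R (ζ * θ)) = (θ : ℂ) • R ζ - R (ζ * θ) := by
    intro ζ θ
    have hz : (ζ : ℂ) ≠ 0 := by simp
    have hL : ∀ z : Circle, (B + (z : ℂ) • A)⁻¹ * (B + (z : ℂ) • A) = 1 := fun z =>
      Matrix.inv_mul_of_isUnit (h z)
    have hL' : (B + (ζ : ℂ) • A)⁻¹ * (((ζ * θ : Circle) - ζ : ℂ) • A) *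
        (B + ((ζ * θ : Circle) : ℂ) • A)⁻¹ =
        (B + (ζ : ℂ) • A)⁻¹ - (B + ((ζ * θ : Circle) : ℂ) • A)⁻¹ := by
      have : ((ζ * θ : Circle) - ζ : ℂ) • A =
          (B + ((ζ * θ : Circle) : ℂ) • A) - (B + (ζ : ℂ) • A) := by
        rw [sub_smul]; abel
      rw [this, Matrix.mul_sub, hL, Matrix.sub_mul, Matrix.mul_assoc,
        Matrix.mul_inv_of_isUnit (h (ζ * θ)), Matrix.mul_one, Matrix.one_mul]
    have h1 : ((θ : ℂ) - 1) • (R ζ * R (ζ * θ)) = ((ζ * θ : Circle) : ℂ) •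
        ((B + (ζ : ℂ) • A)⁻¹ * (((ζ * θ : Circle) - ζ : ℂ) • A) *
        (B + ((ζ * θ : Circle) : ℂ) • A)⁻¹ * A) := by
      simp only [hR, Matrix.smul_mul, Matrix.mul_smul, smul_smul, Matrix.mul_assoc]
      congr 1
      rw [Circle.coe_mul]; ring
    rw [h1, hL', Matrix.sub_mul, smul_sub]
    simp only [hR, smul_smul]
    congr 2
    rw [Circle.coe_mul]; ring
  have hG : ∀ θ : Circle, θ ≠ 1 → mmean (fun ζ => R ζ * R (ζ * θ)) = mmean R := by
    intro θ hθ
    have h1 : (θ : ℂ) - 1 ≠ 0 := fun h' => hθ (by ext; simpa using sub_eq_zero.1 h')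
    have h2 := congrArg mmean (funext fun ζ => key ζ θ)
    rw [mmean_smul, mmean_sub (by fun_prop) (by fun_prop), mmean_smul, mmean_rotate] at h2
    have h3 : (θ : ℂ) • mmean R - mmean R = ((θ : ℂ) - 1) • mmean R := by rw [sub_smul, one_smul]
    rw [h3] at h2
    exact smul_right_injective _ h1 h2
  have hGc : Continuous fun θ : Circle => mmean (fun ζ => R ζ * R (ζ * θ)) := by
    refine continuous_mmean (F := fun θ ζ => R ζ * R (ζ * θ)) ?_
    simp only [Function.uncurry_def]
    fun_prop
  have hG1 : ∀ θ : Circle, mmean (fun ζ => R ζ * R (ζ * θ)) = mmean R := by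
    have hcl : IsClosed {θ : Circle | mmean (fun ζ => R ζ * R (ζ * θ)) = mmean R} :=
      isClosed_eq hGc continuous_const
    intro θ
    by_cases hθ : θ = 1
    · subst hθ
      have ht : Filter.Tendsto (fun n : ℕ => Circle.exp (1 / ((n : ℝ) + 1))) Filter.atTop (nhds 1) := by
        rw [← Circle.exp_zero]
        exact (Circle.exp.continuous.tendsto 0).comp tendsto_one_div_add_atTop_nhds_zero_nat
      refine hcl.mem_of_tendsto ht (.of_forall fun n => hG _ fun h1 => ?_)
      rw [← Circle.exp_zero] at h1
      have hn : (0 : ℝ) < 1 / ((n : ℝ) + 1) := by positivity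
      have hn1 : 1 / ((n : ℝ) + 1) ≤ 1 := by
        rw [div_le_one (by positivity)]; linarith [n.cast_nonneg (α := ℝ)]
      have := Circle.exp_injOn_Icc (a := 0) (b := 1) (by linarith [Real.pi_gt_three])
        ⟨hn.le, hn1⟩ ⟨le_rfl, zero_le_one⟩ h1
      linarith
    · exact hG θ hθ
  calc pencilProj A B * pencilProj A B = mmean (fun ζ => R ζ * mmean R) := by
        rw [mmean_mul_right _ hRc, hQ]
    _ = mmean (fun ζ => mmean fun θ => R ζ * R (ζ * θ)) := by
        congr 1; funext ζ
        rw [mmean_mul_left _ (by fun_prop)]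
        congr 1
        rw [← mmean_rotate R ζ]
        simp_rw [mul_comm]
    _ = mmean (fun θ => mmean fun ζ => R ζ * R (ζ * θ)) := by
        refine mmean_swap (F := fun ζ θ => R ζ * R (ζ * θ)) ?_
        simp only [Function.uncurry_def]
        fun_prop
    _ = pencilProj A B := by
        simp_rw [hG1]; rw [mmean_const, hQ]

/-- The spectral projection of the pencil acting on the target. -/
theorem exists_pencilProj_intertwine {A B : Matrix ι ι ℂ}
    (h : ∀ z : Circle, IsUnit (B + (z : ℂ) • A)) :
    ∃ Q', A * pencilProj A B = Q' * A ∧ B * pencilProj A B = Q' * B := by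
  have hc := continuous_pencil_inv_const h
  refine ⟨mmean fun z => (z : ℂ) • (A * (B + (z : ℂ) • A)⁻¹), ?_, ?_⟩
  · rw [pencilProj, ← mmean_mul_left _ (by fun_prop), ← mmean_mul_right _ (by fun_prop)]
    congr 1; funext z
    simp [Matrix.mul_assoc]
  · rw [pencilProj, ← mmean_mul_left _ (by fun_prop), ← mmean_mul_right _ (by fun_prop)]
    congr 1; funext z
    rw [Matrix.mul_smul, Matrix.smul_mul]
    congr 1
    set L := B + (z : ℂ) • A with hL
    have hB : B = L - (z : ℂ) • A := by rw [hL]; abel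
    have e1 : B * (L⁻¹ * A) = A - (z : ℂ) • (A * L⁻¹ * A) := by
      rw [hB, Matrix.sub_mul, ← Matrix.mul_assoc, Matrix.mul_inv_of_isUnit (h z), Matrix.one_mul,
        Matrix.smul_mul, Matrix.mul_assoc]
    have e2 : A * L⁻¹ * B = A - (z : ℂ) • (A * L⁻¹ * A) := by
      rw [hB, Matrix.mul_sub, Matrix.mul_assoc A, Matrix.inv_mul_of_isUnit (h z), Matrix.mul_one,
        Matrix.mul_smul]
    rw [e1, e2]

theorem pencil_resolvent {A B : Matrix ι ι ℂ}
    (h : ∀ z : Circle, IsUnit (B + (z : ℂ) • A))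
    {κ : Type*} [Fintype κ] {N : Matrix ι κ ℂ} {ζ : ℂ} (hN : B * N = -(ζ • (A * N)))
    (hζ : ∀ z : Circle, (z : ℂ) ≠ ζ) :
    pencilProj A B * N = cmean (fun z => (z : ℂ) * (z - ζ)⁻¹) • N := by
  have hc := continuous_pencil_inv_const h
  have e : ∀ z : Circle, (z : ℂ) • ((B + (z : ℂ) • A)⁻¹ * A) * N = ((z : ℂ) * (z - ζ)⁻¹) • N := by
    intro z
    have hz : (z : ℂ) - ζ ≠ 0 := sub_ne_zero.2 (hζ z)
    have h1 : (B + (z : ℂ) • A) * N = ((z : ℂ) - ζ) • (A * N) := by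
      rw [Matrix.add_mul, hN, Matrix.smul_mul, sub_smul]; abel
    have h2 : A * N = ((z : ℂ) - ζ)⁻¹ • ((B + (z : ℂ) • A) * N) := by
      rw [h1, smul_smul, inv_mul_cancel₀ hz, one_smul]
    rw [Matrix.smul_mul, Matrix.mul_assoc, h2, Matrix.mul_smul, ← Matrix.mul_assoc,
      Matrix.inv_mul_of_isUnit (h z), Matrix.one_mul, smul_smul]
  rw [pencilProj, ← mmean_mul_right _ (by fun_prop)]
  simp_rw [e]
  ext i j
  simp only [mmean, Matrix.of_apply, Matrix.smul_apply, smul_eq_mul]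
  simp_rw [mul_comm _ (N i j)]
  rw [cmean_const_mul]

theorem isUnit_pencil_deform {A B : Matrix ι ι ℂ}
    (h : ∀ z : Circle, IsUnit (B + (z : ℂ) • A))
    (z : Circle) {t : ℝ} (ht0 : 0 ≤ t) (ht1 : t ≤ 1) :
    IsUnit (((z : ℂ) • A + (t : ℂ) • B) * pencilProj A B +
      (((t : ℂ) * z) • A + B) * (1 - pencilProj A B)) := by
  obtain ⟨Q', hA, hB⟩ := exists_pencilProj_intertwine h
  have hQ := pencilProj_mul_self h
  have hres := fun N ζ => pencil_resolvent (κ := Unit) h (N := N) (ζ := ζ)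
  obtain ⟨Q, hQd⟩ : ∃ Q, Q = pencilProj A B := ⟨_, rfl⟩
  rw [← hQd] at hA hB hQ hres ⊢
  refine Matrix.isUnit_of_forall_mul_eq_zero fun N hN => ?_
  have hz0 : (z : ℂ) ≠ 0 := by simp
  have hcomm : ∀ a b : ℂ, Q' * (a • A + b • B) = (a • A + b • B) * Q := by
    intro a b
    rw [Matrix.mul_add, Matrix.add_mul, Matrix.mul_smul, Matrix.mul_smul, Matrix.smul_mul,
      Matrix.smul_mul, hA, hB]
  have hc2 : Q' * (((t : ℂ) * z) • A + B) = (((t : ℂ) * z) • A + B) * Q := by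
    simpa using hcomm ((t : ℂ) * z) 1
  have hQ0 : Q * (1 - Q) = 0 := by rw [mul_sub, hQ, mul_one, sub_self]
  have ha : ((z : ℂ) • A + (t : ℂ) • B) * (Q * N) = 0 := by
    have := congrArg (Q' * ·) hN
    simp only [Matrix.mul_zero] at this
    rw [← Matrix.mul_assoc, Matrix.mul_add, ← Matrix.mul_assoc, ← Matrix.mul_assoc, hcomm, hc2,
      Matrix.mul_assoc _ Q, Matrix.mul_assoc _ Q, hQ, hQ0, Matrix.mul_zero, add_zero,
      Matrix.mul_assoc] at this
    exact this
  have hb : (((t : ℂ) * z) • A + B) * ((1 - Q) * N) = 0 := by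
    rw [Matrix.add_mul, Matrix.mul_assoc, ha, zero_add, Matrix.mul_assoc] at hN
    exact hN
  have hinj : ∀ M : Matrix ι Unit ℂ, (B + (z : ℂ) • A) * M = 0 → M = 0 := fun M hM => by
    have := congrArg ((B + (z : ℂ) • A)⁻¹ * ·) hM
    simpa only [← Matrix.mul_assoc, Matrix.inv_mul_of_isUnit (h z), Matrix.one_mul, Matrix.mul_zero]
      using this
  have a0 : Q * N = 0 := by
    rcases ht1.eq_or_lt with rfl | ht1
    · refine hinj _ ?_
      rw [add_comm]; simpa using ha
    have hQQ : Q * (Q * N) = Q * N := by rw [← Matrix.mul_assoc, hQ]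
    rcases ht0.eq_or_lt with rfl | ht0
    · have : A * (Q * N) = 0 := by simpa [hz0] using ha
      rw [← hQQ]
      have hc := continuous_pencil_inv_const h
      have e : ∀ z : Circle, (z : ℂ) • ((B + (z : ℂ) • A)⁻¹ * A) * (Q * N) = 0 := fun z => by
        rw [Matrix.smul_mul, Matrix.mul_assoc, this, Matrix.mul_zero, smul_zero]
      have e' : pencilProj A B * (Q * N) = 0 := by
        rw [pencilProj, ← mmean_mul_right _ (by fun_prop)]
        simp_rw [e]
        exact mmean_const 0
      rwa [← hQd] at e'
    · have htc : (t : ℂ) ≠ 0 := by exact_mod_cast ht0.ne'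
      have hn : 1 < ‖(z : ℂ) / t‖ := by
        rw [norm_div, Circle.norm_coe, Complex.norm_real, Real.norm_of_nonneg ht0.le]
        exact (one_lt_div ht0).2 ht1
      rw [← hQQ, hres (Q * N) (z / t) ?_ ?_, cmean_div_sub_of_gt hn, zero_smul]
      · rw [Matrix.add_mul, Matrix.smul_mul, Matrix.smul_mul] at ha
        have := congrArg ((t : ℂ)⁻¹ • ·) ha
        simp only [smul_add, smul_smul, inv_mul_cancel₀ htc, one_smul, smul_zero] at this
        rw [div_eq_inv_mul]
        exact eq_neg_of_add_eq_zero_right this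
      · intro w hw
        rw [← hw, Circle.norm_coe] at hn
        exact lt_irrefl _ hn
  have b0 : (1 - Q) * N = 0 := by
    rcases ht1.eq_or_lt with rfl | ht1
    · refine hinj _ ?_
      rw [add_comm]; simpa using hb
    have hn : ‖(t : ℂ) * z‖ < 1 := by
      rw [norm_mul, Circle.norm_coe, Complex.norm_real, Real.norm_of_nonneg ht0, mul_one]
      exact ht1
    have := hres ((1 - Q) * N) (t * z) ?_ ?_
    · rw [cmean_div_sub_of_lt hn, one_smul, ← Matrix.mul_assoc, hQ0, Matrix.zero_mul] at this
      exact this.symm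
    · rw [Matrix.add_mul, Matrix.smul_mul] at hb
      exact eq_neg_of_add_eq_zero_right hb
    · intro w hw
      rw [← hw, Circle.norm_coe] at hn
      exact lt_irrefl _ hn
  calc N = Q * N + (1 - Q) * N := by rw [Matrix.sub_mul, Matrix.one_mul]; abel
    _ = 0 := by rw [a0, b0, add_zero]

end Pencil

end

section

open Matrix unitInterval

/-! ### Companion linearization of matrix polynomials -/

section Companion
variable {ι : Type*} [Fintype ι] [DecidableEq ι] {K : ℕ}

/-- The companion pencil of the polynomial `∑ j ≤ K, z ^ j p j`, with an additional deformation
parameter: `t = 1` is the linear pencil, and `t = 0` is the polynomial itself plus an identity. -/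
def companion (K : ℕ) (p : ℕ → Matrix ι ι ℂ) (t z : ℂ) :
    Matrix (ι ⊕ ι × Fin K) (ι ⊕ ι × Fin K) ℂ :=
  fromBlocks (p 0 + ∑ j : Fin K, (z ^ (j + 1 : ℕ) * (1 - t ^ (j + 2 : ℕ))) • p (j + 1))
    (Matrix.of fun i k => t * p (k.2 + 1) i k.1)
    (Matrix.of fun k i => if k.1 = i ∧ (k.2 : ℕ) = 0 then -(t * z) else 0)
    (1 - Matrix.of fun k l => if k.1 = l.1 ∧ (k.2 : ℕ) = l.2 + 1 then t * z else 0)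

theorem companion_zero (p : ℕ → Matrix ι ι ℂ) (z : ℂ) :
    companion K p 0 z = dsum (∑ j ∈ Finset.range (K + 1), z ^ j • p j) 1 := by
  rw [companion, dsum, Finset.sum_range_succ', add_comm, Finset.sum_range]
  congr 1
  · simp
  · ext; simp
  · ext; simp
  · ext; simp

/-- The constant term of the companion pencil. -/
def companionB (K : ℕ) (p : ℕ → Matrix ι ι ℂ) : Matrix (ι ⊕ ι × Fin K) (ι ⊕ ι × Fin K) ℂ :=
  fromBlocks (p 0) (Matrix.of fun i k => p (k.2 + 1) i k.1) 0 1

/-- The linear term of the companion pencil. -/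
def companionA (ι : Type*) [DecidableEq ι] (K : ℕ) : Matrix (ι ⊕ ι × Fin K) (ι ⊕ ι × Fin K) ℂ :=
  fromBlocks 0 0 (Matrix.of fun k i => if k.1 = i ∧ (k.2 : ℕ) = 0 then -1 else 0)
    (-Matrix.of fun k l => if k.1 = l.1 ∧ (k.2 : ℕ) = l.2 + 1 then 1 else 0)

theorem companion_one (p : ℕ → Matrix ι ι ℂ) (z : ℂ) :
    companion K p 1 z = companionB K p + z • companionA ι K := by
  rw [companion, companionB, companionA, fromBlocks_smul, fromBlocks_add]
  congr 1
  · simp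
  · ext; simp
  · ext; simp
  · ext; simp [sub_eq_add_neg]

theorem companionB_mul_left (C : Matrix ι ι ℂ) (p : ℕ → Matrix ι ι ℂ) :
    companionB K (fun j => C * p j) = dsum C 1 * companionB K p := by
  rw [companionB, companionB, dsum, fromBlocks_multiply]
  congr 1
  · simp
  · ext; simp [Matrix.mul_apply]
  · simp
  · simp

theorem companionA_mul_left (C : Matrix ι ι ℂ) :
    dsum C 1 * companionA ι K = companionA ι K := by
  rw [companionA, dsum, fromBlocks_multiply]
  simp

theorem isUnit_companion {p : ℕ → Matrix ι ι ℂ} {z : ℂ}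
    (h : IsUnit (∑ j ∈ Finset.range (K + 1), z ^ j • p j)) (t : ℂ) :
    IsUnit (companion K p t z) := by
  refine Matrix.isUnit_of_forall_mul_eq_zero fun N hN => ?_
  set x : Matrix ι Unit ℂ := N.submatrix Sum.inl id with hx
  have e2 : ∀ k : ι × Fin K, N (Sum.inr k) () = (t * z) ^ (k.2 + 1 : ℕ) * x k.1 () := by
    rintro ⟨i, j, hj⟩
    induction j with
    | zero =>
      have := congrFun (congrFun hN (Sum.inr (i, ⟨0, hj⟩))) ()
      simp [companion, Matrix.mul_apply, Fintype.sum_sum_type, ite_and, Matrix.one_apply] at this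
      simp [hx]
      linear_combination this
    | succ j ih =>
      have := congrFun (congrFun hN (Sum.inr (i, ⟨j + 1, hj⟩))) ()
      have ih := ih (by omega)
      have h1 : ∑ l : ι × Fin K, (1 - Matrix.of fun k l : ι × Fin K =>
          if k.1 = l.1 ∧ (k.2 : ℕ) = l.2 + 1 then t * z else 0 : Matrix _ _ ℂ) (i, ⟨j + 1, hj⟩) l *
          N (Sum.inr l) () = N (Sum.inr (i, ⟨j + 1, hj⟩)) () -
            t * z * N (Sum.inr (i, ⟨j, by omega⟩)) () := by
        simp only [Matrix.sub_apply, sub_mul, Finset.sum_sub_distrib, Matrix.of_apply]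
        congr 1
        · simp [Matrix.one_apply]
        · rw [Finset.sum_eq_single (i, ⟨j, by omega⟩)]
          · simp
          · rintro ⟨a, b, hb⟩ _ hne
            rw [if_neg, zero_mul]
            rintro ⟨h1, h2⟩
            simp at h1 h2
            exact hne (by simp [h1, h2])
          · simp
      simp only [companion, Matrix.mul_apply, Fintype.sum_sum_type, fromBlocks_apply₂₁,
        fromBlocks_apply₂₂, h1, ih] at this
      simp at this
      simp only
      rw [pow_succ (t * z) (j + 1)]
      linear_combination this
  have e0 : (∑ j ∈ Finset.range (K + 1), z ^ j • p j) * x = 0 := by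
    ext i u
    have := congrFun (congrFun hN (Sum.inl i)) ()
    simp only [companion, Matrix.mul_apply, Fintype.sum_sum_type, fromBlocks_apply₁₁,
        fromBlocks_apply₁₂, e2, Fintype.sum_prod_type] at this
    rw [← Finset.sum_add_distrib] at this
    rw [Finset.sum_range_succ', Finset.sum_range, Matrix.mul_apply]
    simp only [Matrix.zero_apply, Matrix.add_apply, Matrix.sum_apply, Matrix.smul_apply,
      smul_eq_mul, Matrix.of_apply] at this ⊢
    rw [← this]
    refine Finset.sum_congr rfl fun k _ => ?_
    have hu : N (Sum.inl k) () = x k u := rfl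
    rw [hu, add_mul, add_mul, Finset.sum_mul, Finset.sum_mul]
    rw [add_comm, add_assoc, ← Finset.sum_add_distrib]
    congr 1
    · simp
    · refine Finset.sum_congr rfl fun j _ => ?_
      simp only [mul_pow]
      ring
  have x0 : x = 0 := by
    have := congrArg ((∑ j ∈ Finset.range (K + 1), z ^ j • p j)⁻¹ * ·) e0
    simpa only [← Matrix.mul_assoc, Matrix.inv_mul_of_isUnit h, Matrix.one_mul, Matrix.mul_zero]
      using this
  ext (i | k) u
  · exact congrFun (congrFun x0 i) ()
  · exact (e2 k).trans (by rw [x0]; simp)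

/-- The action on the additional coordinates of the companion pencil. -/
def companionRep (K : ℕ) (ρ : Matrix ι ι ℂ) : Matrix (ι × Fin K) (ι × Fin K) ℂ :=
  Matrix.of fun k l => if k.2 = l.2 then (-1) ^ (k.2 + 1 : ℕ) * ρ k.1 l.1 else 0

theorem companionRep_eq (ρ : Matrix ι ι ℂ) : companionRep K ρ =
    kroneckerMap (· * ·) ρ (diagonal fun j : Fin K => (-1 : ℂ) ^ (j + 1 : ℕ)) := by
  ext k l
  by_cases h : k.2 = l.2 <;> simp [companionRep, h, mul_comm]

theorem companionRep_pow_six {ρ : Matrix ι ι ℂ} (h : ρ ^ 6 = 1) : companionRep K ρ ^ 6 = 1 := by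
  have hp : ∀ n, companionRep K ρ ^ n = kroneckerMap (· * ·) (ρ ^ n)
      ((diagonal fun j : Fin K => (-1 : ℂ) ^ (j + 1 : ℕ)) ^ n) := by
    intro n
    induction n with
    | zero => simp
    | succ n ih => rw [pow_succ, ih, companionRep_eq, ← Matrix.mul_kronecker_mul, pow_succ, pow_succ]
  rw [hp, h, diagonal_pow]
  have : ((fun j : Fin K => (-1 : ℂ) ^ (j + 1 : ℕ)) ^ 6) = fun _ => 1 := by
    funext j
    rw [Pi.pow_apply, ← pow_mul, mul_comm, pow_mul]; norm_num
  rw [this]; simp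

theorem companion_equivariant {p p' : ℕ → Matrix ι ι ℂ} {r s : Matrix ι ι ℂ}
    (h : ∀ j, p' j * r = (-1 : ℂ) ^ j • (s * p j)) (t z : ℂ) :
    companion K p' t (-z) * dsum r (companionRep K r) =
      dsum s (companionRep K r) * companion K p t z := by
  rw [companion, companion, dsum, dsum, fromBlocks_multiply, fromBlocks_multiply]
  simp only [Matrix.mul_zero, Matrix.zero_mul, add_zero, zero_add]
  congr 1
  · rw [Matrix.add_mul, Matrix.mul_add, h 0, Matrix.sum_mul, Matrix.mul_sum]
    simp only [pow_zero, one_smul]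
    congr 1
    refine Finset.sum_congr rfl fun j _ => ?_
    rw [Matrix.smul_mul, h, Matrix.mul_smul, smul_smul]
    congr 1
    rw [neg_pow, mul_assoc, mul_comm, mul_assoc]
    have : (-1 : ℂ) ^ (j + 1 : ℕ) * (-1) ^ (j + 1 : ℕ) = 1 := by rw [← mul_pow]; norm_num
    linear_combination (z ^ (j + 1 : ℕ) * (1 - t ^ (j + 2 : ℕ))) * this
  · ext i ⟨k, j⟩
    have := congrFun (congrFun (h (j + 1)) i) k
    simp only [Matrix.mul_apply, Matrix.smul_apply, smul_eq_mul] at this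
    simp only [Matrix.mul_apply, companionRep, Matrix.of_apply, Fintype.sum_prod_type, mul_ite,
      mul_zero, Finset.sum_ite_eq', Finset.mem_univ, if_true]
    have h1 : (-1 : ℂ) ^ (j + 1 : ℕ) * (-1) ^ (j + 1 : ℕ) = 1 := by rw [← mul_pow]; norm_num
    have e1 : ∑ x, t * p' (j + 1) i x * ((-1) ^ (j + 1 : ℕ) * r x k) =
        t * (-1) ^ (j + 1 : ℕ) * ∑ x, p' (j + 1) i x * r x k := by
      rw [Finset.mul_sum]; refine Finset.sum_congr rfl fun x _ => ?_; ring
    have e2 : ∑ x, s i x * (t * p (j + 1) x k) = t * ∑ x, s i x * p (j + 1) x k := by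
      rw [Finset.mul_sum]; refine Finset.sum_congr rfl fun x _ => ?_; ring
    rw [e1, e2, this]
    linear_combination (t * ∑ x, s i x * p (j + 1) x k) * h1
  · ext ⟨k, j⟩ i
    simp only [Matrix.mul_apply, companionRep, Matrix.of_apply, Fintype.sum_prod_type, ite_mul,
      mul_ite, zero_mul, mul_zero, ite_and]
    rw [Finset.sum_comm]
    simp
    rcases j with ⟨j, hj⟩
    rcases j with _ | j
    · rw [Finset.sum_eq_single ⟨0, hj⟩] <;> simp +contextual [eq_comm, mul_comm]
    · rw [eq_comm]
      refine Finset.sum_eq_zero fun x _ => ?_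
      split_ifs with h1 h2
      · simp [← h2] at h1
      · rfl
      · rfl
  · have hN : ∀ w : ℂ, (Matrix.of fun k l : ι × Fin K =>
        if k.1 = l.1 ∧ (k.2 : ℕ) = l.2 + 1 then w else 0) = w • kroneckerMap (· * ·) (1 : Matrix ι ι ℂ)
          (Matrix.of fun a b : Fin K => if (a : ℕ) = b + 1 then (1 : ℂ) else 0) := by
      intro w
      ext k l
      simp only [Matrix.of_apply, Matrix.smul_apply, kroneckerMap_apply, Matrix.one_apply, smul_eq_mul]
      split_ifs <;> simp_all
    have hS : (Matrix.of fun a b : Fin K => if (a : ℕ) = b + 1 then (1 : ℂ) else 0) *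
        (diagonal fun j : Fin K => (-1 : ℂ) ^ (j + 1 : ℕ)) =
        -((diagonal fun j : Fin K => (-1 : ℂ) ^ (j + 1 : ℕ)) *
          (Matrix.of fun a b : Fin K => if (a : ℕ) = b + 1 then (1 : ℂ) else 0)) := by
      ext a b
      rw [mul_diagonal, Matrix.neg_apply, diagonal_mul]
      by_cases hab : (a : ℕ) = b + 1
      · simp [hab, pow_succ]
      · simp [hab]
    rw [hN, hN, companionRep_eq, Matrix.sub_mul, Matrix.mul_sub, Matrix.one_mul, Matrix.mul_one,
      Matrix.smul_mul, Matrix.mul_smul, ← Matrix.mul_kronecker_mul, ← Matrix.mul_kronecker_mul, hS,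
      Matrix.one_mul, Matrix.mul_one]
    congr 1
    ext k l
    simp
    split_ifs <;> simp

theorem companion_equivariant_pencil {p p' : ℕ → Matrix ι ι ℂ} {r s : Matrix ι ι ℂ}
    (h : ∀ j, p' j * r = (-1 : ℂ) ^ j • (s * p j)) :
    companionA ι K * dsum r (companionRep K r) = -(dsum s (companionRep K r) * companionA ι K) ∧
    companionB K p' * dsum r (companionRep K r) = dsum s (companionRep K r) * companionB K p := by
  have h0 := companion_equivariant (K := K) h 1 0
  have h1 := companion_equivariant (K := K) h 1 1
  rw [companion_one, companion_one] at h0 h1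
  simp only [neg_zero, zero_smul, add_zero, neg_smul, one_smul, Matrix.add_mul, Matrix.mul_add,
    Matrix.neg_mul] at h0 h1
  refine ⟨?_, h0⟩
  rw [h0] at h1
  rw [← add_left_cancel h1, neg_neg]

end Companion

/-! ### Approximation by equivariant Laurent polynomials -/

section Laurent
variable {X : Type*} [MetricSpace X] [CompactSpace X]

theorem exists_scalar_laurent_approx (f : C(X × Circle, ℂ)) {ε : ℝ} (hε : 0 < ε) :
    ∃ (k : ℕ) (q : Polynomial C(X, ℂ)), ∀ x (z : Circle),
      ‖(z : ℂ) ^ k * f (x, z) - ∑ l ∈ Finset.range (q.natDegree + 1), (z : ℂ) ^ l * q.coeff l x‖ < ε := by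
  let ι : C(X, ℂ) →ₐ[ℂ] C(X × Circle, ℂ) := ContinuousMap.compRightAlgHom ℂ ℂ ⟨Prod.fst, continuous_fst⟩
  let Z : C(X × Circle, ℂ) := ⟨fun x => (x.2 : ℂ), by fun_prop⟩
  let s : Set C(X × Circle, ℂ) := Set.range ι ∪ {Z}
  have hZ : star Z * Z = 1 := by
    ext x
    change (starRingEnd ℂ) (x.2 : ℂ) * (x.2 : ℂ) = 1
    rw [mul_comm, Complex.mul_conj, Circle.normSq_coe]; simp
  have hL : ∀ g ∈ Algebra.adjoin ℂ (s ∪ star s),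
      ∃ (k : ℕ) (q : Polynomial C(X, ℂ)), Z ^ k * g = q.eval₂ (ι : C(X, ℂ) →+* C(X × Circle, ℂ)) Z := by
    intro g hg
    induction hg using Algebra.adjoin_induction with
    | mem g hg =>
      rcases hg with (⟨a, rfl⟩ | rfl) | hg
      · exact ⟨0, Polynomial.C a, by simp⟩
      · exact ⟨0, Polynomial.X, by simp⟩
      · rcases hg with ⟨a, ha⟩ | hg
        · refine ⟨0, Polynomial.C (star a), ?_⟩
          rw [pow_zero, one_mul, Polynomial.eval₂_C, ← star_star g, ← ha]
          rfl
        · refine ⟨1, 1, ?_⟩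
          rw [pow_one, Polynomial.eval₂_one, ← star_star g, hg, mul_comm, hZ]
    | algebraMap r => exact ⟨0, Polynomial.C (algebraMap ℂ _ r), by
        rw [pow_zero, one_mul, Polynomial.eval₂_C]; exact (ι.commutes r).symm⟩
    | add a b _ _ ha hb =>
      obtain ⟨k, q, h⟩ := ha
      obtain ⟨k', q', h'⟩ := hb
      refine ⟨k + k', q * Polynomial.X ^ k' + q' * Polynomial.X ^ k, ?_⟩
      rw [Polynomial.eval₂_add, Polynomial.eval₂_mul, Polynomial.eval₂_mul, ← h, ← h']
      simp only [Polynomial.eval₂_pow, Polynomial.eval₂_X]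
      ring
    | mul a b _ _ ha hb =>
      obtain ⟨k, q, h⟩ := ha
      obtain ⟨k', q', h'⟩ := hb
      refine ⟨k + k', q * q', ?_⟩
      rw [Polynomial.eval₂_mul, ← h, ← h']
      ring
  have hsep : (StarAlgebra.adjoin ℂ s).toSubalgebra.SeparatesPoints := by
    rintro ⟨x, z⟩ ⟨x', z'⟩ hne
    by_cases hx : x = x'
    · refine ⟨Z, ⟨Z, StarAlgebra.subset_adjoin ℂ s (Or.inr rfl), rfl⟩, ?_⟩
      intro h
      exact hne (Prod.ext hx (Circle.ext h))
    · let d : C(X, ℂ) := ⟨fun y => (dist y x : ℂ), by fun_prop⟩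
      refine ⟨ι d, ⟨ι d, StarAlgebra.subset_adjoin ℂ s (Or.inl ⟨d, rfl⟩), rfl⟩, ?_⟩
      change ((dist x x : ℝ) : ℂ) ≠ ((dist x' x : ℝ) : ℂ)
      rw [dist_self]
      intro h
      exact hx (dist_eq_zero.1 (Complex.ofReal_injective h).symm).symm
  have hd := ContinuousMap.starSubalgebra_topologicalClosure_eq_top_of_separatesPoints _ hsep
  have hf : f ∈ (StarAlgebra.adjoin ℂ s).topologicalClosure := by rw [hd]; trivial
  obtain ⟨g, hg, hfg⟩ := Metric.mem_closure_iff.1 hf ε hε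
  have hg' : g ∈ Algebra.adjoin ℂ (s ∪ star s) := by
    rw [← StarAlgebra.adjoin_toSubalgebra]; exact hg
  obtain ⟨k, q, hq⟩ := hL g hg'
  refine ⟨k, q, fun x z => ?_⟩
  have h1 : (z : ℂ) ^ k * g (x, z) =
      ∑ l ∈ Finset.range (q.natDegree + 1), (z : ℂ) ^ l * q.coeff l x := by
    have := congrArg (fun F : C(X × Circle, ℂ) => F (x, z)) hq
    simp only [Polynomial.eval₂_eq_sum_range] at this
    rw [ContinuousMap.sum_apply] at this
    rw [show (z : ℂ) ^ k * g (x, z) = (Z ^ k * g) (x, z) from rfl, this]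
    refine Finset.sum_congr rfl fun l _ => ?_
    rw [mul_comm]; rfl
  rw [← h1, ← mul_sub, norm_mul, norm_pow, Circle.norm_coe, one_pow, one_mul]
  exact (ContinuousMap.norm_coe_le_norm (f - g) (x, z)).trans_lt (by rwa [← dist_eq_norm])

variable {ι : Type*} [Fintype ι] [DecidableEq ι]

theorem exists_matrix_laurent_approx {φ : X × Circle → Matrix ι ι ℂ} (hφ : Continuous φ) {ε : ℝ}
    (hε : 0 < ε) : ∃ (k K : ℕ) (p : ℕ → X → Matrix ι ι ℂ), (∀ l, Continuous (p l)) ∧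
      ∀ x (z : Circle) i j, ‖((z : ℂ) ^ (2 * k) • φ (x, z) -
        ∑ l ∈ Finset.range (K + 1), (z : ℂ) ^ l • p l x) i j‖ < ε := by
  choose k q h using fun ij : ι × ι =>
    exists_scalar_laurent_approx ⟨fun x => φ x ij.1 ij.2, hφ.matrix_elem _ _⟩ hε
  let k' := ∑ ij, k ij
  have hk : ∀ ij, k ij ≤ 2 * k' := fun ij =>
    (Finset.single_le_sum (fun _ _ => Nat.zero_le _) (Finset.mem_univ ij)).trans (by omega)
  let Q : ι × ι → Polynomial C(X, ℂ) := fun ij => q ij * Polynomial.X ^ (2 * k' - k ij)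
  let K := ∑ ij, (Q ij).natDegree
  refine ⟨k', K, fun l x => Matrix.of fun i j => (Q (i, j)).coeff l x, fun l => ?_, fun x z i j => ?_⟩
  · exact continuous_matrix fun i j => map_continuous ((Q (i, j)).coeff l)
  · have hev : ∀ (P : Polynomial C(X, ℂ)) (N : ℕ), P.natDegree < N →
        ∑ l ∈ Finset.range N, (z : ℂ) ^ l * P.coeff l x =
        (P.map (ContinuousMap.evalAlgHom ℂ ℂ x : C(X, ℂ) →+* ℂ)).eval (z : ℂ) := by
      intro P N hN
      rw [Polynomial.eval_map, Polynomial.eval₂_eq_sum_range' _ hN]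
      refine Finset.sum_congr rfl fun l _ => ?_
      rw [mul_comm]; rfl
    have h1 := h (i, j) x z
    rw [hev _ _ (Nat.lt_succ_self _)] at h1
    simp only [Matrix.sub_apply, Matrix.smul_apply, Matrix.sum_apply, Matrix.of_apply, smul_eq_mul]
    rw [hev (Q (i, j)) (K + 1) (Nat.lt_succ_of_le (Finset.single_le_sum
      (f := fun ij => (Q ij).natDegree) (fun _ _ => Nat.zero_le _) (Finset.mem_univ (i, j))))]
    simp only [Q, Polynomial.map_mul, Polynomial.map_pow, Polynomial.map_X, Polynomial.eval_mul,
      Polynomial.eval_pow, Polynomial.eval_X]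
    have h2 : (z : ℂ) ^ (2 * k') = z ^ (2 * k' - k (i, j)) * z ^ k (i, j) := by
      rw [← pow_add, Nat.sub_add_cancel (hk _)]
    rw [h2, mul_comm (Polynomial.eval _ _), mul_assoc, ← mul_sub, norm_mul, norm_pow,
      Circle.norm_coe, one_pow, one_mul]
    exact h1

theorem exists_equivariant_laurent_approx {τ : X → X} (hτ : Continuous τ) (hττ : ∀ x, τ (τ x) = x)
    {a b : Matrix ι ι ℂ} (ha : a ^ 6 = 1) (hb : b ^ 6 = 1) {φ : X × Circle → Matrix ι ι ℂ}
    (hφ : EMap (Prod.map τ Neg.neg) a b φ) {ε : ℝ} (hε : 0 < ε) :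
    ∃ (k K : ℕ) (p : ℕ → X → Matrix ι ι ℂ), (∀ l, Continuous (p l)) ∧
      (∀ l x, p l (τ x) * b = (-1 : ℂ) ^ l • (a * p l x)) ∧
      ∀ x (z : Circle) i j, ‖((z : ℂ) ^ (2 * k) • φ (x, z) -
        ∑ l ∈ Finset.range (K + 1), (z : ℂ) ^ l • p l x) i j‖ < ε := by
  let S : (Fin 6 → ι → ι → ℂ) → (ι → ι → ℂ) := fun M =>
    (6 : ℂ)⁻¹ • ∑ g : Fin 6, a ^ (6 - g : ℕ) * Matrix.of (M g) * b ^ (g : ℕ)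
  have hS : Continuous S := by
    have : ∀ g : Fin 6, Continuous fun M : Fin 6 → ι → ι → ℂ => Matrix.of (M g) := fun g =>
      continuous_apply g
    have h : Continuous fun M : Fin 6 → ι → ι → ℂ =>
        (6 : ℂ)⁻¹ • ∑ g : Fin 6, a ^ (6 - g : ℕ) * Matrix.of (M g) * b ^ (g : ℕ) := by fun_prop
    exact h
  have hS0 : S 0 = 0 := by
    have : ∀ g : Fin 6, Matrix.of ((0 : Fin 6 → ι → ι → ℂ) g) = 0 := fun g => rfl
    simp only [S, this, Matrix.mul_zero, Matrix.zero_mul, Finset.sum_const_zero, smul_zero]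
    rfl
  obtain ⟨δ, hδ, hδ'⟩ := Metric.continuous_iff.1 hS 0 ε hε
  obtain ⟨k, K, p, hp, happ⟩ := exists_matrix_laurent_approx hφ.1 (half_pos hδ)
  have hσ : ∀ g x, (τ^[g]) (τ x) = τ^[g + 1] x := fun g x => rfl
  have hτ6 : ∀ x, τ^[6] x = x := fun x => by simp [hττ]
  have hφg : ∀ (g : ℕ) (x : X) (z : Circle), φ (τ^[g] x, (-1) ^ g * z) * b ^ g = a ^ g * φ (x, z) := by
    intro g x z
    induction g with
    | zero => simp
    | succ g ih =>
      have := hφ.2 (τ^[g] x, (-1) ^ g * z)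
      simp only [Prod.map_apply] at this
      rw [Function.iterate_succ_apply', pow_succ' (-1 : Circle), mul_assoc, neg_one_mul, pow_succ' b,
        ← Matrix.mul_assoc, this, Matrix.mul_assoc, ih, pow_succ', Matrix.mul_assoc]
  refine ⟨k, K, fun l x => (6 : ℂ)⁻¹ • ∑ g ∈ Finset.range 6, (-1 : ℂ) ^ (l * g) •
    (a ^ (6 - g) * p l (τ^[g] x) * b ^ g), fun l => ?_, fun l x => ?_, fun x z i j => ?_⟩
  · have : ∀ g, Continuous fun x => p l (τ^[g] x) := fun g => (hp l).comp (hτ.iterate g)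
    fun_prop
  · rw [Matrix.smul_mul, Matrix.mul_smul, smul_comm]
    congr 1
    have key : ∀ g, ((-1 : ℂ) ^ (l * g) • (a ^ (6 - g) * p l (τ^[g + 1] x) * b ^ (g + 1))) =
        (-1 : ℂ) ^ l • ((-1 : ℂ) ^ (l * (g + 1)) • (a ^ (6 - g) * p l (τ^[g + 1] x) * b ^ (g + 1))) := by
      intro g
      rw [smul_smul, mul_add, pow_add, mul_one]
      congr 1
      have : (-1 : ℂ) ^ l * (-1) ^ l = 1 := by rw [← mul_pow]; norm_num
      linear_combination (-(-1 : ℂ) ^ (l * g)) * this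
    have hl : (∑ g ∈ Finset.range 6, (-1 : ℂ) ^ (l * g) • (a ^ (6 - g) * p l (τ^[g] (τ x)) * b ^ g)) * b =
        (-1 : ℂ) ^ l • ∑ g ∈ Finset.range 6,
          ((-1 : ℂ) ^ (l * (g + 1)) • (a ^ (7 - (g + 1)) * p l (τ^[g + 1] x) * b ^ (g + 1))) := by
      rw [Finset.sum_mul, Finset.smul_sum]
      refine Finset.sum_congr rfl fun g _ => ?_
      rw [hσ, Matrix.smul_mul, Matrix.mul_assoc _ _ b, ← pow_succ, key, Nat.add_sub_add_right 6 1 g]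
    rw [hl]
    congr 1
    have hr : a * ∑ g ∈ Finset.range 6, (-1 : ℂ) ^ (l * g) • (a ^ (6 - g) * p l (τ^[g] x) * b ^ g) =
        ∑ g ∈ Finset.range 6, (-1 : ℂ) ^ (l * g) • (a ^ (7 - g) * p l (τ^[g] x) * b ^ g) := by
      rw [Finset.mul_sum]
      refine Finset.sum_congr rfl fun g hg => ?_
      rw [Matrix.mul_smul, ← Matrix.mul_assoc, ← Matrix.mul_assoc, ← pow_succ']
      congr 4
      have := Finset.mem_range.1 hg
      omega
    rw [hr]
    have e := Finset.sum_range_succ' (fun g =>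
      (-1 : ℂ) ^ (l * g) • (a ^ (7 - g) * p l (τ^[g] x) * b ^ g)) 6
    rw [Finset.sum_range_succ] at e
    have e6 : (-1 : ℂ) ^ (l * 6) • (a ^ (7 - 6) * p l (τ^[6] x) * b ^ 6) =
        (-1 : ℂ) ^ (l * 0) • (a ^ (7 - 0) * p l (τ^[0] x) * b ^ 0) := by
      rw [hτ6, hb, pow_succ a 6, ha, mul_comm l 6, pow_mul,
        show (-1 : ℂ) ^ 6 = 1 by norm_num, one_pow]
      simp
    rw [e6] at e
    exact (add_right_cancel e).symm
  · set E : X → Circle → Matrix ι ι ℂ := fun x z => (z : ℂ) ^ (2 * k) • φ (x, z) -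
        ∑ l ∈ Finset.range (K + 1), (z : ℂ) ^ l • p l x with hE
    have e : (z : ℂ) ^ (2 * k) • φ (x, z) - ∑ l ∈ Finset.range (K + 1), (z : ℂ) ^ l •
        ((6 : ℂ)⁻¹ • ∑ g ∈ Finset.range 6, (-1 : ℂ) ^ (l * g) •
          (a ^ (6 - g) * p l (τ^[g] x) * b ^ g)) =
        (6 : ℂ)⁻¹ • ∑ g ∈ Finset.range 6, a ^ (6 - g) * E (τ^[g] x) ((-1) ^ g * z) * b ^ g := by
      have h1 : ∀ g ∈ Finset.range 6, a ^ (6 - g) * E (τ^[g] x) ((-1) ^ g * z) * b ^ g =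
          (z : ℂ) ^ (2 * k) • φ (x, z) - ∑ l ∈ Finset.range (K + 1), (z : ℂ) ^ l •
            (-1 : ℂ) ^ (l * g) • (a ^ (6 - g) * p l (τ^[g] x) * b ^ g) := by
        intro g hg
        have hs : (((-1) ^ g * z : Circle) : ℂ) = (-1) ^ g * z := by simp
        simp only [hE]
        rw [Matrix.mul_sub, Matrix.sub_mul]
        congr 1
        · rw [Matrix.mul_smul, Matrix.smul_mul, Matrix.mul_assoc, hφg, ← Matrix.mul_assoc, ← pow_add,
            Nat.sub_add_cancel (Finset.mem_range.1 hg).le, ha, Matrix.one_mul, hs, mul_pow, ← pow_mul,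
            mul_comm g, mul_assoc 2, pow_mul]
          simp
        · rw [Matrix.mul_sum, Matrix.sum_mul]
          refine Finset.sum_congr rfl fun l _ => ?_
          rw [Matrix.mul_smul, Matrix.smul_mul, smul_smul, hs, mul_pow, ← pow_mul, mul_comm g l,
            mul_comm (_ ^ (l * g))]
      rw [Finset.sum_congr rfl h1, Finset.sum_sub_distrib, smul_sub]
      congr 1
      · rw [Finset.sum_const, Finset.card_range, ← Nat.cast_smul_eq_nsmul ℂ, smul_smul]; norm_num
      · rw [Finset.sum_comm, Finset.smul_sum]
        refine Finset.sum_congr rfl fun l _ => ?_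
        rw [smul_comm, ← Finset.smul_sum]
    rw [e]
    have h2 := hδ' (fun g => E (τ^[(g : ℕ)] x) ((-1) ^ (g : ℕ) * z)) (by
      refine (dist_pi_le_iff (half_pos hδ).le).2 (fun g => (dist_pi_le_iff (half_pos hδ).le).2 fun i =>
        (dist_pi_le_iff (half_pos hδ).le).2 fun j => ?_) |>.trans_lt (half_lt_self hδ)
      rw [Pi.zero_apply, Pi.zero_apply, Pi.zero_apply, dist_zero_right]
      exact (happ _ _ _ _).le)
    rw [hS0] at h2
    have h3 := (dist_le_pi_dist _ _ i).trans_lt h2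
    have h4 := (dist_le_pi_dist _ _ j).trans_lt h3
    rw [Pi.zero_apply, Pi.zero_apply, dist_zero_right] at h4
    rw [Finset.sum_range]
    exact h4

end Laurent

/-! ### Homotopies of invertible equivariant families -/

/-- Homotopy through invertible equivariant families of matrices. -/
def Htpy {Y : Type*} [TopologicalSpace Y] (τ : Y → Y) {ι : Type*} [Fintype ι] [DecidableEq ι]
    (a b : Matrix ι ι ℂ) (F G : Y → Matrix ι ι ℂ) : Prop :=
  ∃ H : Y × I → Matrix ι ι ℂ, EMap (Prod.map τ id) a b H ∧ (∀ x, IsUnit (H x)) ∧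
    (∀ y, H (y, 0) = F y) ∧ ∀ y, H (y, 1) = G y

theorem Matrix.isUnit_of_isUnit_thickening {X : Type*} [TopologicalSpace X] [CompactSpace X]
    {ι : Type*} [Fintype ι] [DecidableEq ι] {φ : X → Matrix ι ι ℂ} (hφ : Continuous φ)
    (hu : ∀ x, IsUnit (φ x)) :
    ∃ ε > 0, ∀ x M, (∀ i j, ‖(M - φ x) i j‖ < ε) → IsUnit M := by
  let f : X → ι → ι → ℂ := φ
  have hf : Continuous f := hφ
  let U : Set (ι → ι → ℂ) := {M | (Matrix.of M).det ≠ 0}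
  have hU : IsOpen U := by
    have h1 : Continuous fun M : ι → ι → ℂ => (Matrix.of M).det :=
      Continuous.matrix_det (A := fun M : ι → ι → ℂ => Matrix.of M) continuous_id
    exact isOpen_ne.preimage h1
  obtain ⟨ε, hε, h⟩ := (isCompact_range hf).exists_thickening_subset_open hU (by
    rintro _ ⟨x, rfl⟩
    exact ((Matrix.isUnit_iff_isUnit_det _).1 (hu x)).ne_zero)
  have key : ∀ (x : X) (M : ι → ι → ℂ), (∀ i j, ‖((Matrix.of M : Matrix ι ι ℂ) - φ x) i j‖ < ε / 2) →
      dist M (f x) ≤ ε / 2 := by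
    intro x M hM
    refine (dist_pi_le_iff (half_pos hε).le).2 fun i => (dist_pi_le_iff (half_pos hε).le).2 fun j => ?_
    rw [dist_eq_norm]
    exact (hM i j).le
  refine ⟨ε / 2, half_pos hε, fun x M hM => ?_⟩
  let M' : ι → ι → ℂ := fun i j => M i j
  have hM' : M' ∈ Metric.thickening ε (Set.range f) :=
    Metric.mem_thickening_iff.2 ⟨f x, ⟨x, rfl⟩, (key x M' hM).trans_lt (half_lt_self hε)⟩
  have hM2 : M' ∈ U := h hM'
  have hM3 : M.det ≠ 0 := hM2
  exact (Matrix.isUnit_iff_isUnit_det _).2 (isUnit_iff_ne_zero.2 hM3)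

section Htpy
variable {Y : Type*} [TopologicalSpace Y] {τ : Y → Y} {ι κ : Type*} [Fintype ι] [DecidableEq ι]
  [Fintype κ] [DecidableEq κ]
  {a b c : Matrix ι ι ℂ} {a' b' : Matrix κ κ ℂ} {F G K F' G' : Y → Matrix ι ι ℂ}

theorem Htpy.isUnit_right (h : Htpy τ a b F G) (y : Y) : IsUnit (G y) := by
  obtain ⟨H, -, h1, -, h2⟩ := h
  exact h2 y ▸ h1 _

theorem Htpy.emap_right (h : Htpy τ a b F G) : EMap τ a b G := by
  obtain ⟨H, h0, h1, -, h2⟩ := h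
  have := h0.comp (h := fun y => (y, (1 : I))) (τ' := τ) (by fun_prop) (fun y => rfl)
  exact (funext h2 : (fun y => H (y, 1)) = G) ▸ this

theorem Htpy.refl (h : EMap τ a b F) (hu : ∀ y, IsUnit (F y)) : Htpy τ a b F F :=
  ⟨fun x => F x.1, h.comp continuous_fst fun _ => rfl, fun x => hu x.1, fun _ => rfl, fun _ => rfl⟩

theorem Htpy.mul (h : Htpy τ a b F G) (h' : Htpy τ b c F' G') :
    Htpy τ a c (fun y => F y * F' y) (fun y => G y * G' y) := by
  obtain ⟨H, h0, h1, h2, h3⟩ := h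
  obtain ⟨H', h0', h1', h2', h3'⟩ := h'
  exact ⟨_, h0.mul h0', fun x => (h1 x).mul (h1' x), fun y => by rw [h2, h2'], fun y => by rw [h3, h3']⟩

theorem Htpy.trans (h : Htpy τ a b F G) (h' : Htpy τ a b G K) : Htpy τ a b F K := by
  have hG := h.emap_right
  have hGu := h.isUnit_right
  obtain ⟨H, h0, h1, h2, h3⟩ := h
  obtain ⟨H', h0', h1', h2', h3'⟩ := h'
  let f : I → I := fun t => Set.projIcc 0 1 zero_le_one (2 * (t : ℝ))
  let g : I → I := fun t => Set.projIcc 0 1 zero_le_one (2 * (t : ℝ) - 1)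
  have hf : Continuous f := by fun_prop
  have hg : Continuous g := by fun_prop
  refine ⟨fun x => H (x.1, f x.2) * (G x.1)⁻¹ * H' (x.1, g x.2),
    ((h0.comp (h := fun x : Y × I => (x.1, f x.2)) (by fun_prop) fun _ => rfl).mul
    ((hG.inv hGu).comp (h := fun x : Y × I => x.1) (by fun_prop) fun _ => rfl)).mul
    (h0'.comp (h := fun x : Y × I => (x.1, g x.2)) (by fun_prop) fun _ => rfl),
    fun x => ((h1 _).mul ?_).mul (h1' _), fun y => ?_, fun y => ?_⟩
  · rw [Matrix.isUnit_nonsing_inv_iff]; exact hGu _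
  · have e0 : f 0 = 0 := by simp [f]
    have e1 : g 0 = 0 := by simp only [g]; exact Set.projIcc_of_le_left _ (by norm_num)
    change H (y, f 0) * (G y)⁻¹ * H' (y, g 0) = _
    rw [e0, e1, h2, h2', Matrix.mul_assoc, Matrix.inv_mul_of_isUnit (hGu y), Matrix.mul_one]
  · have e0 : f 1 = 1 := by simp only [f]; exact Set.projIcc_of_right_le _ (by norm_num)
    have e1 : g 1 = 1 := by simp only [g]; exact Set.projIcc_of_right_le _ (by norm_num)
    change H (y, f 1) * (G y)⁻¹ * H' (y, g 1) = _
    rw [e0, e1, h3, h3', Matrix.mul_inv_of_isUnit (hGu y), Matrix.one_mul]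

theorem isUnit_dsum {A : Matrix ι ι ℂ} {D : Matrix κ κ ℂ} (hA : IsUnit A) (hD : IsUnit D) :
    IsUnit (dsum A D) := by
  rw [Matrix.isUnit_iff_isUnit_det, dsum, det_fromBlocks_zero₂₁]
  exact ((Matrix.isUnit_iff_isUnit_det _).1 hA).mul ((Matrix.isUnit_iff_isUnit_det _).1 hD)

theorem Htpy.dsum_one (h : Htpy τ a b F G) (d : Matrix κ κ ℂ) :
    Htpy τ (dsum a d) (dsum b d) (fun y => dsum (F y) 1) (fun y => dsum (G y) 1) := by
  obtain ⟨H, h0, h1, h2, h3⟩ := h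
  exact ⟨_, h0.dsum (EMap.one (b := d)), fun x => isUnit_dsum (h1 x) isUnit_one,
    fun y => by rw [h2], fun y => by rw [h3]⟩

theorem isUnit_reindex {ι κ : Type*} [Fintype ι] [DecidableEq ι] [Fintype κ] [DecidableEq κ]
    (e : ι ≃ κ) {A : Matrix ι ι ℂ} (h : IsUnit A) : IsUnit (reindex e e A) := by
  rw [Matrix.isUnit_iff_isUnit_det] at h ⊢
  rwa [Matrix.det_reindex_self]

theorem EMap.reindex {ι κ : Type*} [Fintype ι] [DecidableEq ι] [Fintype κ] [DecidableEq κ]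
    (e : ι ≃ κ) {a b : Matrix ι ι ℂ} {F : Y → Matrix ι ι ℂ} (h : EMap τ a b F) :
    EMap τ (Matrix.reindex e e a) (Matrix.reindex e e b) fun y => Matrix.reindex e e (F y) :=
  ⟨h.1.matrix_reindex e e, fun y => by
    simp only [Matrix.reindex_apply, Matrix.submatrix_mul_equiv, h.2]⟩

theorem Htpy.reindex {ι κ : Type*} [Fintype ι] [DecidableEq ι] [Fintype κ] [DecidableEq κ]
    (e : ι ≃ κ) {a b : Matrix ι ι ℂ} {F G : Y → Matrix ι ι ℂ} (h : Htpy τ a b F G) :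
    Htpy τ (Matrix.reindex e e a) (Matrix.reindex e e b) (fun y => Matrix.reindex e e (F y))
      fun y => Matrix.reindex e e (G y) := by
  obtain ⟨H, h0, h1, h2, h3⟩ := h
  exact ⟨_, h0.reindex e, fun x => isUnit_reindex e (h1 x), fun y => by rw [h2], fun y => by rw [h3]⟩

theorem reindex_sumAssoc_dsum {ι κ μ : Type*} (A : Matrix ι ι ℂ)
    (D : Matrix κ κ ℂ) (E : Matrix μ μ ℂ) :
    Matrix.reindex (Equiv.sumAssoc ι κ μ) (Equiv.sumAssoc ι κ μ) (dsum (dsum A D) E) =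
      dsum A (dsum D E) := by
  ext (i | i | i) (j | j | j) <;> rfl

end Htpy

/-! ### Splitting families over a product with the circle -/

/-- A family over `X × Circle` which stably is homotopic to a product of a family over `Circle` and
a family over `X`. -/
def Splits {X : Type*} [TopologicalSpace X] (τ : X → X) {ι : Type} [Fintype ι] [DecidableEq ι]
    (a b : Matrix ι ι ℂ) (φ : X × Circle → Matrix ι ι ℂ) : Prop :=
  ∃ (κ : Type) (_ : Fintype κ) (_ : DecidableEq κ) (δ : Matrix κ κ ℂ) (c : Matrix (ι ⊕ κ) (ι ⊕ κ) ℂ)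
    (α : Circle → Matrix (ι ⊕ κ) (ι ⊕ κ) ℂ) (β : X → Matrix (ι ⊕ κ) (ι ⊕ κ) ℂ),
    δ ^ 6 = 1 ∧ c ^ 6 = 1 ∧ EMap Neg.neg (dsum a δ) c α ∧ (∀ z, IsUnit (α z)) ∧
    EMap τ c (dsum b δ) β ∧ (∀ x, IsUnit (β x)) ∧
    Htpy (Prod.map τ Neg.neg) (dsum a δ) (dsum b δ) (fun y => dsum (φ y) 1) fun y => α y.2 * β y.1

section Splits
variable {X : Type*} [TopologicalSpace X] {τ : X → X} {ι κ : Type} [Fintype ι] [DecidableEq ι]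
  [Fintype κ] [DecidableEq κ] {a b : Matrix ι ι ℂ} {φ ψ : X × Circle → Matrix ι ι ℂ}

theorem Splits.of_htpy (h : Htpy (Prod.map τ Neg.neg) a b φ ψ) (hs : Splits τ a b ψ) :
    Splits τ a b φ := by
  obtain ⟨κ, i1, i2, δ, c, α, β, h1, h2, h3, h4, h5, h6, h7⟩ := hs
  exact ⟨κ, i1, i2, δ, c, α, β, h1, h2, h3, h4, h5, h6, (h.dsum_one δ).trans h7⟩

theorem Splits.mul_left {a' : Matrix ι ι ℂ} {α₀ : Circle → Matrix ι ι ℂ}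
    (hα : EMap Neg.neg a' a α₀) (hu : ∀ z, IsUnit (α₀ z)) (hs : Splits τ a b φ) :
    Splits τ a' b fun y => α₀ y.2 * φ y := by
  obtain ⟨κ, i1, i2, δ, c, α, β, h1, h2, h3, h4, h5, h6, h7⟩ := hs
  have e : EMap Neg.neg (dsum a' δ) (dsum a δ) fun z => dsum (α₀ z) 1 := hα.dsum EMap.one
  have eu : ∀ z, IsUnit (dsum (α₀ z) (1 : Matrix κ κ ℂ)) := fun z => isUnit_dsum (hu z) isUnit_one
  refine ⟨κ, i1, i2, δ, c, fun z => dsum (α₀ z) 1 * α z, β, h1, h2, e.mul h3,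
    fun z => (eu z).mul (h4 z), h5, h6, ?_⟩
  have := (Htpy.refl (e.comp (h := fun y : X × Circle => y.2) (τ' := Prod.map τ Neg.neg)
    continuous_snd fun _ => rfl) fun y => eu y.2).mul h7
  simpa only [dsum_mul, Matrix.one_mul, Matrix.mul_assoc] using this

theorem reindex_pow {ι κ : Type*} [Fintype ι] [DecidableEq ι] [Fintype κ] [DecidableEq κ]
    (e : ι ≃ κ) (A : Matrix ι ι ℂ) (n : ℕ) :
    Matrix.reindex e e A ^ n = Matrix.reindex e e (A ^ n) :=
  (map_pow (Matrix.reindexAlgEquiv ℂ ℂ e) A n).symm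

theorem Splits.of_dsum_one {d : Matrix κ κ ℂ} (hd : d ^ 6 = 1)
    (hs : Splits τ (dsum a d) (dsum b d) fun y => dsum (φ y) 1) : Splits τ a b φ := by
  obtain ⟨μ, i1, i2, δ, c, α, β, h1, h2, h3, h4, h5, h6, h7⟩ := hs
  let e := Equiv.sumAssoc ι κ μ
  refine ⟨κ ⊕ μ, inferInstance, inferInstance, dsum d δ, Matrix.reindex e e c,
    fun z => Matrix.reindex e e (α z), fun x => Matrix.reindex e e (β x), ?_, ?_, ?_,
    fun z => isUnit_reindex e (h4 z), ?_, fun x => isUnit_reindex e (h6 x), ?_⟩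
  · rw [dsum_pow, hd, h1, dsum_one]
  · rw [reindex_pow, h2]; simp
  · simpa only [e, reindex_sumAssoc_dsum] using h3.reindex e
  · simpa only [e, reindex_sumAssoc_dsum] using h5.reindex e
  · have h8 := h7.reindex e
    simp only [e, reindex_sumAssoc_dsum] at h8
    simp only [dsum_one] at h8
    convert h8 using 2 with y
    exact (map_mul (Matrix.reindexAlgEquiv ℂ ℂ e) _ _).symm

theorem Splits.of_mul {S R c₀ : Matrix ι ι ℂ} (hS : S ^ 6 = 1) (hR : R ^ 6 = 1) (hc : c₀ ^ 6 = 1)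
    {N g : X → Matrix ι ι ℂ} {α₀ : Circle → Matrix ι ι ℂ} (hN : EMap τ S c₀ N)
    (hα : EMap Neg.neg c₀ R α₀) (hg : EMap τ R b g) (uN : ∀ x, IsUnit (N x))
    (uα : ∀ z, IsUnit (α₀ z)) (ug : ∀ x, IsUnit (g x)) :
    Splits τ S b fun y => N y.1 * α₀ y.2 * g y.1 := by
  let Rot : I → Matrix (ι ⊕ ι) (ι ⊕ ι) ℂ := fun t =>
    fromBlocks ((Real.cos (Real.pi / 2 * t) : ℂ) • 1) ((-Real.sin (Real.pi / 2 * t) : ℂ) • 1)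
      ((Real.sin (Real.pi / 2 * t) : ℂ) • 1) ((Real.cos (Real.pi / 2 * t) : ℂ) • 1)
  have cR : Continuous Rot := Continuous.matrix_fromBlocks (by fun_prop) (by fun_prop) (by fun_prop)
    (by fun_prop)
  have uR : ∀ t, IsUnit (Rot t) := fun t => by
    refine IsUnit.of_mul_eq_one (b := fromBlocks ((Real.cos (Real.pi / 2 * t) : ℂ) • 1)
      ((Real.sin (Real.pi / 2 * t) : ℂ) • 1) ((-Real.sin (Real.pi / 2 * t) : ℂ) • 1)
      ((Real.cos (Real.pi / 2 * t) : ℂ) • 1)) ?_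
    have h := Complex.sin_sq_add_cos_sq (Real.pi / 2 * t)
    simp only [Rot, fromBlocks_multiply, Matrix.smul_mul, Matrix.mul_smul, Matrix.one_mul, smul_smul,
      ← add_smul]
    rw [← fromBlocks_one]
    push_cast
    congr 1
    · rw [← one_smul ℂ (1 : Matrix ι ι ℂ), smul_smul]; congr 1; linear_combination h
    · rw [← zero_smul ℂ (1 : Matrix ι ι ℂ)]; congr 1; ring
    · rw [← zero_smul ℂ (1 : Matrix ι ι ℂ)]; congr 1; ring
    · rw [← one_smul ℂ (1 : Matrix ι ι ℂ), smul_smul]; congr 1; linear_combination h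
  have eR : ∀ t, Rot t * dsum c₀ c₀ = dsum c₀ c₀ * Rot t := fun t => by
    simp [Rot, dsum, fromBlocks_multiply]
  refine ⟨ι, inferInstance, inferInstance, c₀, dsum S R, fun z => dsum 1 (α₀ z),
    fun x => fromBlocks 0 (-N x) (g x) 0, hc, by rw [dsum_pow, hS, hR, dsum_one],
    EMap.one.dsum hα, fun z => isUnit_dsum isUnit_one (uα z), ?_, fun x => ?_, ?_⟩
  · refine EMap.fromBlocks EMap.zero ?_ hg EMap.zero
    simpa using EMap.zero.sub hN
  · refine IsUnit.of_mul_eq_one (b := fromBlocks 0 (g x)⁻¹ (-(N x)⁻¹) 0) ?_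
    simp [fromBlocks_multiply, Matrix.mul_inv_of_isUnit (ug x), Matrix.mul_inv_of_isUnit (uN x)]
  · refine ⟨fun y => dsum (N y.1.1) 1 * Rot y.2 * dsum (α₀ y.1.2 * g y.1.1) 1, EMap.mul (b := dsum c₀ c₀)
      (EMap.mul (b := dsum c₀ c₀) ?_ ?_) ?_, fun y => ((isUnit_dsum (uN _) isUnit_one).mul (uR _)).mul
      (isUnit_dsum ((uα _).mul (ug _)) isUnit_one), fun y => ?_, fun y => ?_⟩
    · exact (hN.comp (h := fun y : (X × Circle) × I => y.1.1) (by fun_prop) fun _ => rfl).dsum EMap.one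
    · exact ⟨by fun_prop, fun y => eR _⟩
    · exact ((hα.comp (h := fun y : (X × Circle) × I => y.1.2) (by fun_prop) fun _ => rfl).mul
        (hg.comp (h := fun y : (X × Circle) × I => y.1.1) (by fun_prop) fun _ => rfl)).dsum EMap.one
    · have : Rot 0 = 1 := by simp [Rot]
      simp only [this, Matrix.mul_one, dsum_mul, Matrix.mul_assoc]
    · have : Rot 1 = fromBlocks 0 (-1) 1 0 := by simp [Rot]
      simp only [this, dsum, fromBlocks_multiply]
      simp

end Splits

section
variable {ι κ : Type*} [Fintype ι] [DecidableEq ι] [Fintype κ] [DecidableEq κ]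

theorem smul_idem_mul {q : Matrix ι ι ℂ} (hq : q * q = q) (z w : ℂ) :
    (z • q + (1 - q)) * (w • q + (1 - q)) = (z * w) • q + (1 - q) := by
  simp only [add_mul, mul_add, sub_mul, mul_sub, Matrix.smul_mul, Matrix.mul_smul, hq, one_mul, mul_one,
    sub_self, smul_smul]
  rw [mul_comm w z]
  abel

theorem isUnit_smul_idem {q : Matrix ι ι ℂ} (hq : q * q = q) {z : ℂ} (hz : z ≠ 0) :
    IsUnit (z • q + (1 - q)) :=
  IsUnit.of_mul_eq_one (b := z⁻¹ • q + (1 - q)) (by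
    rw [smul_idem_mul hq, mul_inv_cancel₀ hz, one_smul, add_sub_cancel])

theorem one_sub_two_idem {q : Matrix ι ι ℂ} (hq : q * q = q) : (1 - 2 • q) * (1 - 2 • q) = 1 := by
  simp only [two_smul, sub_mul, mul_sub, add_mul, mul_add, hq, one_mul, mul_one]
  abel

theorem IsCon.twist {ρ p : Matrix ι ι ℂ} (h : IsCon ρ p) : (ρ * (1 - 2 • p)) ^ 6 = 1 := by
  have hc : Commute ρ (1 - 2 • p) := by
    have : Commute ρ p := h.comm.symm
    exact (Commute.one_right _).sub_right (this.smul_right 2)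
  have h2 : (1 - 2 • p) ^ 6 = 1 := by
    rw [show 6 = 2 * 3 from rfl, pow_mul, sq, one_sub_two_idem h.idem, one_pow]
  rw [hc.mul_pow, h.ord, h2, mul_one]

theorem IsCon.smul_idem_twist {ρ p : Matrix ι ι ℂ} (h : IsCon ρ p) (z : ℂ) :
    (-z • p + (1 - p)) * ρ = ρ * (1 - 2 • p) * (z • p + (1 - p)) := by
  have e : (1 - 2 • p) * (z • p + (1 - p)) = -z • p + (1 - p) := by
    simp only [two_smul, sub_mul, mul_sub, add_mul, mul_add, h.idem, one_mul, mul_one, Matrix.mul_smul,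
      neg_smul]
    abel
  rw [Matrix.mul_assoc, e]
  simp only [add_mul, sub_mul, mul_add, mul_sub, one_mul, mul_one, Matrix.smul_mul, Matrix.mul_smul, h.comm]

theorem IsCon.smul_idem_twist' {ρ p : Matrix ι ι ℂ} (h : IsCon ρ p) (z : ℂ) :
    (-z • p + (1 - p)) * (ρ * (1 - 2 • p)) = ρ * (z • p + (1 - p)) := by
  have hc : (1 - 2 • p) * (z • p + (1 - p)) = (z • p + (1 - p)) * (1 - 2 • p) := by
    simp only [two_smul, sub_mul, mul_sub, add_mul, mul_add, h.idem, one_mul, mul_one, Matrix.mul_smul,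
      Matrix.smul_mul]
    abel
  rw [← Matrix.mul_assoc, h.smul_idem_twist, Matrix.mul_assoc ρ, hc, Matrix.mul_assoc,
    Matrix.mul_assoc, one_sub_two_idem h.idem, mul_one]

theorem pow_six_isUnit {r : Matrix ι ι ℂ} (h : r ^ 6 = 1) : IsUnit r :=
  IsUnit.of_pow_eq_one h (by norm_num)

end

section Splits
variable {X : Type*} [PseudoMetricSpace X] [CompactSpace X] {τ : X → X} {ι : Type} [Fintype ι]
  [DecidableEq ι]

theorem pencil_bun {A R S : Matrix ι ι ℂ} {B : X → Matrix ι ι ℂ} (hB : Continuous B) (hR : R ^ 6 = 1)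
    (hS : S ^ 6 = 1) (h : ∀ x (z : Circle), IsUnit (B x + (z : ℂ) • A)) (hAR : A * R = -(S * A))
    (hBR : ∀ x, B (τ x) * R = S * B x) : IsBun τ R fun x => pencilProj A (B x) :=
  ⟨⟨continuous_pencilProj continuous_const hB h, fun x =>
    pencilProj_equivariant (pow_six_isUnit hR) (pow_six_isUnit hS) (h x) hAR (hBR x)⟩,
    fun x => pencilProj_mul_self (h x), hR⟩

theorem pencil_htpy {A R S : Matrix ι ι ℂ} {B : X → Matrix ι ι ℂ} (hB : Continuous B) (hR : R ^ 6 = 1)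
    (hS : S ^ 6 = 1) (h : ∀ x (z : Circle), IsUnit (B x + (z : ℂ) • A)) (hAR : A * R = -(S * A))
    (hBR : ∀ x, B (τ x) * R = S * B x) :
    Htpy (Prod.map τ Neg.neg) S R (fun y : X × Circle => B y.1 + (y.2 : ℂ) • A) fun y =>
      (A * pencilProj A (B y.1) + B y.1 * (1 - pencilProj A (B y.1))) *
        ((y.2 : ℂ) • pencilProj A (B y.1) + (1 - pencilProj A (B y.1))) := by
  have hQ := pencil_bun (τ := τ) hB hR hS h hAR hBR
  have hQc := hQ.emap.cont
  refine ⟨fun y : (X × Circle) × I => ((y.1.2 : ℂ) • A + ((1 - y.2 : ℝ) : ℂ) • B y.1.1) * pencilProj A (B y.1.1) +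
      ((((1 - y.2 : ℝ) : ℂ) * y.1.2) • A + B y.1.1) * (1 - pencilProj A (B y.1.1)), ⟨?_, ?_⟩, fun y =>
    isUnit_pencil_deform (h y.1.1) y.1.2 (t := 1 - (y.2 : ℝ)) (sub_nonneg.2 y.2.2.2)
      (by linarith [y.2.2.1]), fun y => ?_, fun y => ?_⟩
  · have h1 : Continuous fun y : (X × Circle) × I => pencilProj A (B y.1.1) :=
      hQc.comp (by fun_prop : Continuous fun y : (X × Circle) × I => y.1.1)
    fun_prop
  · rintro ⟨⟨x, z⟩, t⟩
    simp only [Prod.map_apply, id_eq, Circle.coe_neg]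
    have e := hQ.emap.eqv x
    have e' := hQ.compl.emap.eqv x
    rw [Matrix.add_mul, Matrix.mul_assoc, Matrix.mul_assoc, e, e', ← Matrix.mul_assoc, ← Matrix.mul_assoc,
      Matrix.add_mul _ _ R, Matrix.add_mul _ _ R, Matrix.smul_mul, Matrix.smul_mul, Matrix.smul_mul, hAR, hBR,
      Matrix.mul_add, ← Matrix.mul_assoc, ← Matrix.mul_assoc, Matrix.mul_add, Matrix.mul_add]
    simp only [Matrix.mul_smul, smul_neg, neg_smul, neg_neg, mul_neg]
  · simp only [Set.Icc.coe_zero, sub_zero, Complex.ofReal_one, one_smul, one_mul]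
    rw [add_comm (B _), ← Matrix.mul_add, add_sub_cancel, Matrix.mul_one]
  · have e := hQ.idem y.1
    simp only [Set.Icc.coe_one, sub_self, Complex.ofReal_zero, zero_smul, zero_mul, add_zero, zero_add]
    simp only [Matrix.mul_add, Matrix.add_mul, Matrix.mul_sub, Matrix.sub_mul, Matrix.mul_smul,
      Matrix.smul_mul, Matrix.mul_one, Matrix.mul_assoc, e]
    abel_nf

theorem pencil_center {A R S B B' Q Q' : Matrix ι ι ℂ} (hQ : Q * Q = Q) (hQQ : Q' * R = R * Q)
    (hAR : A * R = -(S * A)) (hBR : B' * R = S * B) :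
    (A * Q' + B' * (1 - Q')) * R = S * (A * Q + B * (1 - Q)) * (1 - 2 • Q) := by
  have e' : (1 - Q') * R = R * (1 - Q) := by rw [sub_mul, mul_sub, hQQ, one_mul, mul_one]
  rw [add_mul, Matrix.mul_assoc, Matrix.mul_assoc, hQQ, e', ← Matrix.mul_assoc, ← Matrix.mul_assoc, hAR, hBR]
  simp only [two_smul, Matrix.mul_add, Matrix.add_mul, Matrix.mul_sub, Matrix.sub_mul, Matrix.mul_one,
    Matrix.mul_assoc, hQ, Matrix.neg_mul]
  abel

theorem Splits.of_pencil (hall : AllVal τ) {A R S : Matrix ι ι ℂ} {B : X → Matrix ι ι ℂ}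
    (hB : Continuous B) (hR : R ^ 6 = 1)
    (hS : S ^ 6 = 1) (h : ∀ x (z : Circle), IsUnit (B x + (z : ℂ) • A)) (hAR : A * R = -(S * A))
    (hBR : ∀ x, B (τ x) * R = S * B x) : Splits τ S R fun y => B y.1 + (y.2 : ℂ) • A := by
  refine Splits.of_htpy (pencil_htpy hB hR hS h hAR hBR) ?_
  have hQ := pencil_bun (τ := τ) hB hR hS h hAR hBR
  set Q : X → Matrix ι ι ℂ := fun x => pencilProj A (B x) with hQd
  change Splits τ S R fun y => (A * Q y.1 + B y.1 * (1 - Q y.1)) * ((y.2 : ℂ) • Q y.1 + (1 - Q y.1))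
  set C : X → Matrix ι ι ℂ := fun x => A * Q x + B x * (1 - Q x) with hC
  have uC : ∀ x, IsUnit (C x) := fun x => by
    have := isUnit_pencil_deform (h x) 1 (t := 0) le_rfl zero_le_one
    simpa using this
  obtain ⟨-, κ, i1, i2, μ, i3, i4, δ, d, ς, q, hd, hq, hb, -⟩ := hall ι R Q hQ
  obtain ⟨u, hu, huu, hc⟩ := BIso.exists_conj (hQ.dsum hd.isBun) hq.isBun hb
  set R₁ := dsum (dsum R δ) ς with hR1
  set q₁ : Matrix ((ι ⊕ κ) ⊕ μ) ((ι ⊕ κ) ⊕ μ) ℂ := dsum 0 q with hq1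
  have hcon : IsCon R₁ q₁ := IsCon.dsum ⟨by simp, by simp, by rw [dsum_pow, hR, hd.ord, dsum_one]⟩ hq
  set S₁ := dsum (dsum S (δ * (1 - 2 • d))) ς with hS1
  have hS₁ : S₁ ^ 6 = 1 := by rw [hS1, dsum_pow, dsum_pow, hS, hd.twist, hq.ord, dsum_one, dsum_one]
  set N : X → Matrix ((ι ⊕ κ) ⊕ μ) ((ι ⊕ κ) ⊕ μ) ℂ := fun x => dsum (dsum (C x) 1) 1 * u x with hN
  have uu : ∀ x, IsUnit (u x) := fun x => IsUnit.of_mul_eq_one (b := u x) (huu x)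
  have eN : EMap τ S₁ (R₁ * (1 - 2 • q₁)) N := by
    refine ⟨?_, fun x => ?_⟩
    · have := hQ.emap.cont
      exact (continuous_dsum (continuous_dsum (by fun_prop) continuous_const) continuous_const).matrix_mul hu.cont
    · have e1 : u (τ x) * (R₁ * (1 - 2 • q₁)) = R₁ * (1 - 2 • dsum (dsum (Q x) d) 0) * u x := by
        rw [← Matrix.mul_assoc, hu.eqv, Matrix.mul_assoc, Matrix.mul_assoc]
        congr 1
        have e2 : u x * q₁ = dsum (dsum (Q x) d) 0 * u x := by
          calc u x * q₁ = u x * (q₁ * u x) * u x := by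
                rw [Matrix.mul_assoc, Matrix.mul_assoc, huu, Matrix.mul_one]
            _ = _ := by rw [← hc x, ← Matrix.mul_assoc, huu, Matrix.one_mul]
        rw [mul_sub, sub_mul, mul_one, one_mul, Matrix.mul_smul, Matrix.smul_mul, e2]
      have e3 : dsum (dsum (C (τ x)) 1) 1 * R₁ =
          S₁ * dsum (dsum (C x) 1) 1 * (1 - 2 • dsum (dsum (Q x) d) 0) := by
        have e4 : (1 - 2 • dsum (dsum (Q x) d) (0 : Matrix μ μ ℂ)) = dsum (dsum (1 - 2 • Q x) (1 - 2 • d)) 1 := by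
          rw [← dsum_one, ← dsum_one]
          simp only [dsum, sub_eq_add_neg, fromBlocks_smul, fromBlocks_neg, fromBlocks_add]
          simp
        rw [e4, hR1, hS1, dsum_mul, dsum_mul, dsum_mul, dsum_mul, dsum_mul, dsum_mul]
        rw [pencil_center (hQ.idem x) (hQ.emap.eqv x) hAR (hBR x)]
        simp only [Matrix.mul_one, Matrix.one_mul]
        rw [Matrix.mul_assoc δ, one_sub_two_idem hd.idem, Matrix.mul_one]
      have e5 : dsum (dsum (Q x) d) (0 : Matrix μ μ ℂ) * dsum (dsum (Q x) d) 0 = dsum (dsum (Q x) d) 0 := by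
        simp only [dsum_mul, hQ.idem, hd.idem, Matrix.mul_zero]
      rw [hN]
      simp only
      rw [Matrix.mul_assoc, e1, ← Matrix.mul_assoc, ← Matrix.mul_assoc, e3, Matrix.mul_assoc (S₁ * _),
        one_sub_two_idem e5, Matrix.mul_one, Matrix.mul_assoc]
  have uN : ∀ x, IsUnit (N x) := fun x => (isUnit_dsum (isUnit_dsum (uC x) isUnit_one) isUnit_one).mul (uu x)
  have s1 : Splits τ S₁ R₁ fun y => N y.1 * ((y.2 : ℂ) • q₁ + (1 - q₁)) * u y.1 := by
    refine Splits.of_mul (α₀ := fun z : Circle => (z : ℂ) • q₁ + (1 - q₁)) hS₁ hcon.ord hcon.twist eN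
      ⟨by fun_prop, fun z => ?_⟩ hu uN
      (fun z => isUnit_smul_idem hcon.idem (Circle.coe_ne_zero z)) uu
    rw [Circle.coe_neg]; exact hcon.smul_idem_twist z
  have s2 : Splits τ (dsum (dsum S δ) ς) R₁ fun y =>
      dsum (dsum 1 ((y.2 : ℂ)⁻¹ • d + (1 - d))) 1 * (N y.1 * ((y.2 : ℂ) • q₁ + (1 - q₁)) * u y.1) := by
    refine Splits.mul_left (α₀ := fun z : Circle => dsum (dsum 1 ((z : ℂ)⁻¹ • d + (1 - d))) 1) ?_ ?_ s1
    · refine EMap.dsum (EMap.dsum EMap.one ⟨?_, fun z => ?_⟩) EMap.one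
      · have : Continuous fun z : Circle => (z : ℂ)⁻¹ :=
          Continuous.inv₀ (by fun_prop) fun z => Circle.coe_ne_zero z
        fun_prop
      · rw [Circle.coe_neg, inv_neg]; exact hd.smul_idem_twist' _
    · exact fun z => isUnit_dsum (isUnit_dsum isUnit_one (isUnit_smul_idem hd.idem
        (inv_ne_zero (Circle.coe_ne_zero z)))) isUnit_one
  refine Splits.of_dsum_one hd.ord (Splits.of_dsum_one hq.ord ?_)
  convert s2 using 2 with y
  have e6 : ((y.2 : ℂ) • q₁ + (1 - q₁)) * u y.1 =
      u y.1 * ((y.2 : ℂ) • dsum (dsum (Q y.1) d) 0 + (1 - dsum (dsum (Q y.1) d) 0)) := by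
    rw [mul_add, add_mul, mul_sub, sub_mul, Matrix.mul_smul, Matrix.smul_mul, hc, one_mul, mul_one]
  have e7 : ((y.2 : ℂ) • dsum (dsum (Q y.1) d) (0 : Matrix μ μ ℂ) + (1 - dsum (dsum (Q y.1) d) 0)) =
      dsum (dsum ((y.2 : ℂ) • Q y.1 + (1 - Q y.1)) ((y.2 : ℂ) • d + (1 - d))) 1 := by
    rw [← dsum_one, ← dsum_one]
    simp only [dsum, sub_eq_add_neg, fromBlocks_smul, fromBlocks_neg, fromBlocks_add]
    simp
  rw [Matrix.mul_assoc, e6, hN]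
  simp only
  rw [Matrix.mul_assoc (dsum _ _), ← Matrix.mul_assoc (u _), huu, Matrix.one_mul, e7, dsum_mul, dsum_mul,
    dsum_mul, dsum_mul]
  simp only [Matrix.mul_one, Matrix.one_mul]
  rw [smul_idem_mul hd.idem, inv_mul_cancel₀ (Circle.coe_ne_zero _), one_smul, add_sub_cancel]

end Splits

theorem continuous_companion {Y : Type*} [TopologicalSpace Y] {ι : Type*} [Fintype ι] [DecidableEq ι]
    {K : ℕ} {p : ℕ → Y → Matrix ι ι ℂ} {t z : Y → ℂ} (hp : ∀ j, Continuous (p j)) (ht : Continuous t)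
    (hz : Continuous z) : Continuous fun y => companion K (fun j => p j y) (t y) (z y) := by
  refine Continuous.matrix_fromBlocks ?_ ?_ ?_ ?_
  · fun_prop
  · refine continuous_matrix fun i k => ?_
    simp only [Matrix.of_apply]
    exact ht.mul ((hp _).matrix_elem _ _)
  · refine continuous_matrix fun i k => ?_
    simp only [Matrix.of_apply]
    split_ifs <;> fun_prop
  · refine continuous_const.sub (continuous_matrix fun i k => ?_)
    simp only [Matrix.of_apply]
    split_ifs <;> fun_prop

theorem continuous_companionB {Y : Type*} [TopologicalSpace Y] {ι : Type*} [Fintype ι] [DecidableEq ι]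
    {K : ℕ} {p : ℕ → Y → Matrix ι ι ℂ} (hp : ∀ j, Continuous (p j)) :
    Continuous fun y => companionB K (fun j => p j y) := by
  refine Continuous.matrix_fromBlocks (hp 0) (continuous_matrix fun i k => ?_) continuous_const continuous_const
  exact (hp _).matrix_elem _ _

section
variable {X : Type*} [MetricSpace X] [CompactSpace X] [Nonempty X] {τ : X → X} {ι : Type} [Fintype ι]
  [DecidableEq ι]

/-- Two invertible families, one of which is a small perturbation of the other, are homotopic. -/
theorem Htpy.of_segment {Y : Type*} [TopologicalSpace Y] {τ : Y → Y} {ι : Type*} [Fintype ι]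
    [DecidableEq ι] {a b : Matrix ι ι ℂ} {F G : Y → Matrix ι ι ℂ} (hF : EMap τ a b F) (hG : EMap τ a b G)
    (h : ∀ y (t : I), IsUnit (F y + (t : ℂ) • (G y - F y))) : Htpy τ a b F G :=
  ⟨fun y => F y.1 + ((y.2 : ℝ) : ℂ) • (G y.1 - F y.1),
    (hF.comp (h := fun y : Y × I => y.1) (by fun_prop) fun _ => rfl).add
    (EMap.smul ((hG.sub hF).comp (h := fun y : Y × I => y.1) (by fun_prop) fun _ => rfl)
      (by fun_prop) fun _ => rfl), fun y => h y.1 y.2, fun y => by simp, fun y => by simp⟩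

theorem Splits.of_laurent (hall : AllVal τ) {K : ℕ} {a b : Matrix ι ι ℂ} (ha : a ^ 6 = 1)
    (hb : b ^ 6 = 1) {p : ℕ → X → Matrix ι ι ℂ} (hp : ∀ j, Continuous (p j))
    (hpe : ∀ l x, p l (τ x) * b = (-1 : ℂ) ^ l • (a * p l x))
    (hu : ∀ x (z : Circle), IsUnit (∑ l ∈ Finset.range (K + 1), (z : ℂ) ^ l • p l x)) :
    Splits τ a b fun y => ∑ l ∈ Finset.range (K + 1), (y.2 : ℂ) ^ l • p l y.1 := by
  refine Splits.of_dsum_one (companionRep_pow_six (K := K) hb) ?_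
  have uc := fun x (z : Circle) => isUnit_companion (hu x z)
  have hpe' := fun x => companion_equivariant_pencil (K := K) (p := fun j => p j x)
    (p' := fun j => p j (τ x)) (fun j => hpe j x)
  refine Splits.of_htpy (ψ := fun y => companionB K (fun j => p j y.1) + (y.2 : ℂ) • companionA ι K)
    ⟨fun y : (X × Circle) × I => companion K (fun j => p j y.1.1) (y.2 : ℝ) y.1.2, ⟨?_, fun y => ?_⟩, fun y => uc _ _ _,
      fun y => ?_, fun y => ?_⟩ (Splits.of_pencil hall (continuous_companionB hp) ?_ ?_ ?_ ?_ ?_)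
  · exact continuous_companion (p := fun j (y : (X × Circle) × I) => p j y.1.1)
      (fun j => (hp j).comp (by fun_prop : Continuous fun y : (X × Circle) × I => y.1.1))
      (by fun_prop) (by fun_prop)
  · exact companion_equivariant (fun j => hpe j y.1.1) _ _
  · simp only [Set.Icc.coe_zero, Complex.ofReal_zero, companion_zero]
  · simp only [Set.Icc.coe_one, Complex.ofReal_one, companion_one]
  · rw [dsum_pow, hb, companionRep_pow_six hb, dsum_one]
  · rw [dsum_pow, ha, companionRep_pow_six hb, dsum_one]
  · exact fun x z => companion_one (K := K) (fun j => p j x) z ▸ uc x z 1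
  · exact (hpe' (Classical.arbitrary X)).1
  · exact fun x => (hpe' x).2

theorem Splits.of_allVal (hall : AllVal τ) (hτ : Continuous τ) (hττ : ∀ x, τ (τ x) = x)
    {a b : Matrix ι ι ℂ} (ha : a ^ 6 = 1) (hb : b ^ 6 = 1) {φ : X × Circle → Matrix ι ι ℂ}
    (hφ : EMap (Prod.map τ Neg.neg) a b φ) (hu : ∀ y, IsUnit (φ y)) : Splits τ a b φ := by
  obtain ⟨ε, hε, hopen⟩ := Matrix.isUnit_of_isUnit_thickening hφ.cont hu
  obtain ⟨k, K, p, hp, hpe, happ⟩ := exists_equivariant_laurent_approx hτ hττ ha hb hφ hε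
  set L : X × Circle → Matrix ι ι ℂ := fun y => ∑ l ∈ Finset.range (K + 1), (y.2 : ℂ) ^ l • p l y.1 with hL
  have hLe : EMap (Prod.map τ Neg.neg) a b L := by
    refine ⟨?_, fun y => ?_⟩
    · have : ∀ l, Continuous fun y : X × Circle => p l y.1 := fun l => (hp l).comp continuous_fst
      fun_prop
    · simp only [hL, Finset.sum_mul, Finset.mul_sum]
      refine Finset.sum_congr rfl fun l _ => ?_
      change ((-y.2 : Circle) : ℂ) ^ l • p l (τ y.1) * b = _
      rw [Matrix.smul_mul, hpe, smul_smul, Matrix.mul_smul, ← mul_pow, Circle.coe_neg, mul_neg_one, neg_neg]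
  have cz : Continuous fun z : Circle => ((z : ℂ) ^ (2 * k))⁻¹ :=
    Continuous.inv₀ (by fun_prop) fun z => pow_ne_zero _ (Circle.coe_ne_zero z)
  have key : ∀ (y : X × Circle) (t : I),
      IsUnit (φ y + (t : ℂ) • (((y.2 : ℂ) ^ (2 * k))⁻¹ • L y - φ y)) := by
    intro y t
    refine hopen y _ fun i j => ?_
    have hz : (y.2 : ℂ) ^ (2 * k) ≠ 0 := pow_ne_zero _ (Circle.coe_ne_zero _)
    have h1 := happ y.1 y.2 i j
    have e : ((φ y + (t : ℂ) • (((y.2 : ℂ) ^ (2 * k))⁻¹ • L y - φ y) - φ y) i j) =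
        -((t : ℂ) * ((y.2 : ℂ) ^ (2 * k))⁻¹ * (((y.2 : ℂ) ^ (2 * k) • φ y - L y) i j)) := by
      simp only [Matrix.sub_apply, Matrix.add_apply, Matrix.smul_apply, smul_eq_mul]
      field_simp
      ring
    rw [e, norm_neg, norm_mul, norm_mul, norm_inv, norm_pow, Circle.norm_coe, one_pow, inv_one, mul_one,
      Complex.norm_real, Real.norm_of_nonneg t.2.1]
    calc (t : ℝ) * _ ≤ 1 * ‖((y.2 : ℂ) ^ (2 * k) • φ y - L y) i j‖ :=
          mul_le_mul_of_nonneg_right t.2.2 (norm_nonneg _)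
      _ < ε := by rw [one_mul]; exact h1
  have uL : ∀ y, IsUnit (L y) := fun y => by
    have h1 := key y 1
    have hz : (y.2 : ℂ) ^ (2 * k) ≠ 0 := pow_ne_zero _ (Circle.coe_ne_zero _)
    simp only [Set.Icc.coe_one, Complex.ofReal_one, one_smul, add_sub_cancel] at h1
    rw [Matrix.isUnit_iff_isUnit_det, Matrix.det_smul] at h1
    exact (Matrix.isUnit_iff_isUnit_det _).2 (isUnit_of_mul_isUnit_right h1)
  have sL : Splits τ a b L := Splits.of_laurent hall ha hb hp hpe fun x z => uL (x, z)
  have eα : EMap Neg.neg a a fun z : Circle => ((z : ℂ) ^ (2 * k))⁻¹ • (1 : Matrix ι ι ℂ) := by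
    refine EMap.one.smul cz fun z => ?_
    rw [Circle.coe_neg, (even_two_mul k).neg_pow]
  have sL' := sL.mul_left eα fun z => by
    refine IsUnit.of_mul_eq_one (b := (z : ℂ) ^ (2 * k) • (1 : Matrix ι ι ℂ)) ?_
    rw [Matrix.smul_mul, Matrix.one_mul, smul_smul,
      inv_mul_cancel₀ (pow_ne_zero _ (Circle.coe_ne_zero _)), one_smul]
  refine Splits.of_htpy (Htpy.of_segment hφ (EMap.mul
    (eα.comp (h := fun y : X × Circle => y.2) (by fun_prop) fun _ => rfl) hLe) fun y t => ?_) sL'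
  simpa only [Matrix.smul_mul, Matrix.one_mul] using key y t

end

/-! ### Bundles over the circle -/

section Circle
variable {ι : Type*} [Fintype ι] [DecidableEq ι]

theorem Matrix.exists_unit_path {M : Matrix ι ι ℂ} (hM : IsUnit M) :
    ∃ c : I → ℂ, Continuous c ∧ c 0 = 0 ∧ c 1 = 1 ∧ ∀ t, IsUnit ((1 - c t) • (1 : Matrix ι ι ℂ) + c t • M) := by
  let p : Polynomial ℂ := ((1 - Polynomial.X : Polynomial ℂ) • (1 : Matrix ι ι (Polynomial ℂ)) +
    (Polynomial.X : Polynomial ℂ) • M.map (Polynomial.C : ℂ → Polynomial ℂ)).det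
  have hp : ∀ c, p.eval c = ((1 - c) • (1 : Matrix ι ι ℂ) + c • M).det := by
    intro c
    rw [← Polynomial.coe_evalRingHom, RingHom.map_det]
    congr 1
    ext i j
    by_cases h : i = j <;> simp [h] <;> exact mul_comm _ _
  have h0 : p.eval 0 = 1 := by rw [hp]; simp
  have h1 : p.eval 1 ≠ 0 := by
    rw [hp]; simpa using ((Matrix.isUnit_iff_isUnit_det _).1 hM).ne_zero
  have hp0 : p ≠ 0 := by rintro h; rw [h] at h0; simp at h0
  have hc : IsPathConnected ({c | p.IsRoot c}ᶜ : Set ℂ) := by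
    refine Set.Countable.isPathConnected_compl_of_one_lt_rank ?_
      (Polynomial.finite_setOfPred_isRoot hp0).countable
    rw [Complex.rank_real_complex]; norm_num
  obtain ⟨γ, hγ⟩ := hc.joinedIn 0 (by simp [Polynomial.IsRoot, h0]) 1 h1
  refine ⟨γ, γ.continuous, γ.source, γ.target, fun t => ?_⟩
  rw [Matrix.isUnit_iff_isUnit_det, ← hp]
  exact isUnit_iff_ne_zero.2 (hγ t)

/-- The upper half circle, parametrised by the real part. -/
noncomputable def halfCircle (t : I) : Circle :=
  ⟨((1 - 2 * (t : ℝ) : ℝ) : ℂ) + (Real.sqrt (1 - (1 - 2 * (t : ℝ)) ^ 2) : ℝ) * Complex.I, by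
    refine mem_sphere_zero_iff_norm.2 ?_
    rw [Complex.norm_add_mul_I, Real.sq_sqrt (by nlinarith [t.2.1, t.2.2])]
    simp⟩

theorem continuous_halfCircle : Continuous halfCircle :=
  Continuous.subtype_mk (by fun_prop) _

/-- The position of a point of the circle along the half circle. -/
noncomputable def circleParam (z : Circle) : I :=
  ⟨(1 - (z : ℂ).re) / 2, by
    have := Complex.abs_re_le_norm (z : ℂ)
    rw [Circle.norm_coe, abs_le] at this
    constructor <;> linarith⟩

theorem continuous_circleParam : Continuous circleParam :=
  Continuous.subtype_mk (by fun_prop) _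

theorem halfCircle_circleParam {z : Circle} (hz : 0 ≤ (z : ℂ).im) :
    halfCircle (circleParam z) = z := by
  have h : (z : ℂ).re ^ 2 + (z : ℂ).im ^ 2 = 1 := by
    have := Circle.normSq_coe z
    rw [Complex.normSq_apply] at this; linarith
  have e : 1 - 2 * ((circleParam z : I) : ℝ) = (z : ℂ).re := by simp [circleParam]; ring
  apply Subtype.ext
  simp only [halfCircle, e]
  rw [show 1 - (z : ℂ).re ^ 2 = (z : ℂ).im ^ 2 by linarith, Real.sqrt_sq hz]
  exact Complex.re_add_im _

theorem exists_circle_trivialization {ρ : Matrix ι ι ℂ} {P : Circle → Matrix ι ι ℂ}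
    (hP : IsBun Neg.neg ρ P) : ∃ g : Circle → Matrix ι ι ℂ, EMap Neg.neg (ρ ^ 4) ρ g ∧
      (∀ z, IsUnit (g z)) ∧ (∀ z, g z * P z = P 1 * g z) ∧ IsCon (ρ ^ 4) (P 1) := by
  have h6 := hP.ord
  have hρu : IsUnit ρ := pow_six_isUnit h6
  have hc : ∀ z, P (-z) * ρ = ρ * P z := hP.emap.2
  have hc2 : ∀ z, P z * ρ ^ 2 = ρ ^ 2 * P z := fun z => by
    rw [pow_two, ← Matrix.mul_assoc]
    have := hc (-z)
    rw [neg_neg] at this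
    rw [this, Matrix.mul_assoc, hc, Matrix.mul_assoc]
  have p0 : halfCircle 0 = 1 := by
    have := halfCircle_circleParam (z := 1) (by simp)
    rwa [show circleParam 1 = 0 from Subtype.ext (by simp [circleParam])] at this
  have p1 : halfCircle 1 = -1 := by
    have := halfCircle_circleParam (z := -1) (by simp)
    rwa [show circleParam (-1) = 1 from Subtype.ext (by simp [circleParam])] at this
  obtain ⟨T, hT, hTu, hT0, hTP⟩ := exists_transport (Y := Unit) (τ := id) (ρ := ρ ^ 2)
    (P := fun y => P (halfCircle y.2))
    ⟨hP.emap.1.comp (continuous_halfCircle.comp continuous_snd), fun y => hc2 _⟩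
    (fun y => hP.idem _)
  simp only [p0] at hTP
  have hT2 : ∀ t, T ((), t) * ρ ^ 2 = ρ ^ 2 * T ((), t) := fun t => hT.2 ((), t)
  set T1 := T ((), 1) with hT1
  have hi2 : T1⁻¹ * ρ ^ 2 = ρ ^ 2 * T1⁻¹ := by
    calc T1⁻¹ * ρ ^ 2 = T1⁻¹ * (ρ ^ 2 * T1) * T1⁻¹ := by
          rw [Matrix.mul_assoc, Matrix.mul_assoc, Matrix.mul_inv_of_isUnit (hTu _), Matrix.mul_one]
      _ = _ := by rw [← hT2, ← Matrix.mul_assoc, Matrix.inv_mul_of_isUnit (hTu _), Matrix.one_mul]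
  set M := T1⁻¹ * ρ ^ 3 with hM
  have hρ3 : ρ ^ 3 * P 1 = P (-1) * ρ ^ 3 := by
    rw [pow_succ, Matrix.mul_assoc, ← neg_neg (1 : Circle), ← hc, neg_neg, ← Matrix.mul_assoc,
      ← hc2, Matrix.mul_assoc]
  have hMP : M * P 1 = P 1 * M := by
    have h1 : T1 * P 1 = P (-1) * T1 := by rw [hTP, p1]
    have h2 : T1⁻¹ * P (-1) = P 1 * T1⁻¹ := by
      calc T1⁻¹ * P (-1) = T1⁻¹ * (P (-1) * T1) * T1⁻¹ := by
            rw [Matrix.mul_assoc, Matrix.mul_assoc, Matrix.mul_inv_of_isUnit (hTu _),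
              Matrix.mul_one]
        _ = _ := by
            rw [← h1, ← Matrix.mul_assoc, Matrix.inv_mul_of_isUnit (hTu _), Matrix.one_mul]
    rw [hM, Matrix.mul_assoc, hρ3, ← Matrix.mul_assoc, h2, Matrix.mul_assoc]
  have hM2 : M * ρ ^ 2 = ρ ^ 2 * M := by
    rw [hM, Matrix.mul_assoc, ← pow_add, add_comm, pow_add, ← Matrix.mul_assoc, hi2,
      Matrix.mul_assoc]
  have hMu : IsUnit M := ((Matrix.isUnit_nonsing_inv_iff).2 (hTu _)).mul (hρu.pow 3)
  obtain ⟨c, hcc, c0, c1, hcu⟩ := Matrix.exists_unit_path hMu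
  let K : I → Matrix ι ι ℂ := fun t => T ((), t) * ((1 - c t) • (1 : Matrix ι ι ℂ) + c t • M)
  have hKc : Continuous K := by
    have := hT.1
    fun_prop
  have K0 : K 0 = 1 := by simp [K, hT0, c0]
  have K1 : K 1 = ρ ^ 3 := by
    simp only [K, c1, hM]
    rw [← hT1, sub_self, zero_smul, zero_add, one_smul, ← Matrix.mul_assoc,
      Matrix.mul_inv_of_isUnit (hTu _), Matrix.one_mul]
  have hKu : ∀ t, IsUnit (K t) := fun t => (hTu _).mul (hcu t)
  have hN : ∀ t (X : Matrix ι ι ℂ), M * X = X * M →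
      ((1 - c t) • (1 : Matrix ι ι ℂ) + c t • M) * X =
        X * ((1 - c t) • (1 : Matrix ι ι ℂ) + c t • M) := fun t X h => by
    simp only [Matrix.add_mul, Matrix.mul_add, Matrix.smul_mul, Matrix.mul_smul, Matrix.one_mul,
      Matrix.mul_one, h]
  have hK2 : ∀ t, K t * ρ ^ 2 = ρ ^ 2 * K t := fun t => by
    simp only [K]
    rw [Matrix.mul_assoc, hN t _ hM2, ← Matrix.mul_assoc, hT2, Matrix.mul_assoc]
  have hKP : ∀ t, K t * P 1 = P (halfCircle t) * K t := fun t => by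
    simp only [K]
    rw [Matrix.mul_assoc, hN t _ hMP, ← Matrix.mul_assoc, hTP, Matrix.mul_assoc]
  let G : Circle → Matrix ι ι ℂ := fun z =>
    if 0 ≤ (z : ℂ).im then K (circleParam z) else ρ * K (circleParam (-z)) * ρ ^ 2
  have hG0 : ∀ z : Circle, 0 ≤ (z : ℂ).im → G z = K (circleParam z) := fun z h => if_pos h
  have hre : ∀ z : Circle, (z : ℂ).im = 0 → z = 1 ∨ z = -1 := fun z hz => by
    have h : (z : ℂ).re ^ 2 + (z : ℂ).im ^ 2 = 1 := by
      have := Circle.normSq_coe z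
      rw [Complex.normSq_apply] at this; linarith
    rw [hz] at h
    rcases sq_eq_one_iff.1 (by linarith : (z : ℂ).re ^ 2 = 1) with h1 | h1
    · left; apply Circle.ext; apply Complex.ext <;> simp [h1, hz]
    · right; apply Circle.ext; apply Complex.ext <;> simp [h1, hz]
  have q1 : circleParam 1 = 0 := Subtype.ext (by simp [circleParam])
  have q2 : circleParam (-1) = 1 := Subtype.ext (by simp [circleParam])
  have hagree : ∀ z : Circle, (z : ℂ).im = 0 →
      K (circleParam z) = ρ * K (circleParam (-z)) * ρ ^ 2 := fun z hz => by
    rcases hre z hz with rfl | rfl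
    · rw [q1, q2, K0, K1, ← pow_succ', ← pow_add, h6]
    · rw [neg_neg, q1, q2, K0, K1, Matrix.mul_one, ← pow_succ']
  have hG1 : ∀ z : Circle, (z : ℂ).im ≤ 0 → G z = ρ * K (circleParam (-z)) * ρ ^ 2 := fun z h => by
    by_cases h0 : 0 ≤ (z : ℂ).im
    · rw [hG0 z h0, hagree z (le_antisymm h h0)]
    · exact if_neg h0
  have hGc : Continuous G := by
    refine Continuous.if_le (hKc.comp continuous_circleParam) ?_ continuous_const
      (Complex.continuous_im.comp continuous_subtype_val) fun z hz => hagree z hz.symm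
    exact ((continuous_const.mul (hKc.comp (continuous_circleParam.comp continuous_neg))).mul
      continuous_const)
  have hGu : ∀ z, IsUnit (G z) := fun z => by
    rcases le_total 0 (z : ℂ).im with h | h
    · rw [hG0 z h]; exact hKu _
    · rw [hG1 z h]; exact (hρu.mul (hKu _)).mul (hρu.pow 2)
  have hGe : EMap Neg.neg ρ (ρ ^ 4) G := ⟨hGc, fun z => by
    rcases le_total 0 (z : ℂ).im with h | h
    · rw [hG0 z h, hG1 (-z) (by rw [Circle.coe_neg]; simpa using h), neg_neg, Matrix.mul_assoc,
        ← pow_add, h6, Matrix.mul_one]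
    · rw [hG1 z h, hG0 (-z) (by rw [Circle.coe_neg]; simpa using h), Matrix.mul_assoc ρ, hK2,
        ← Matrix.mul_assoc, ← Matrix.mul_assoc, show ρ * ρ = ρ ^ 2 from (pow_two ρ).symm,
        show ρ ^ 4 = ρ ^ 2 * ρ ^ 2 by rw [← pow_add], ← Matrix.mul_assoc, hK2, Matrix.mul_assoc,
        hK2, ← Matrix.mul_assoc]⟩
  have hGP : ∀ z, G z * P 1 = P z * G z := fun z => by
    rcases le_total 0 (z : ℂ).im with h | h
    · rw [hG0 z h, hKP, halfCircle_circleParam h]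
    · rw [hG1 z h, Matrix.mul_assoc, ← hc2, ← Matrix.mul_assoc, Matrix.mul_assoc ρ, hKP,
        halfCircle_circleParam (by rw [Circle.coe_neg]; simpa using h), ← Matrix.mul_assoc, ← hc, neg_neg]
      simp only [Matrix.mul_assoc]
  refine ⟨fun z => (G z)⁻¹, hGe.inv hGu, fun z => Matrix.isUnit_nonsing_inv_iff.2 (hGu z),
    fun z => ?_, ?_, hP.idem _, ?_⟩
  · calc (G z)⁻¹ * P z = (G z)⁻¹ * (P z * G z) * (G z)⁻¹ := by
          rw [Matrix.mul_assoc, Matrix.mul_assoc, Matrix.mul_inv_of_isUnit (hGu _), Matrix.mul_one]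
      _ = _ := by rw [← hGP, ← Matrix.mul_assoc, Matrix.inv_mul_of_isUnit (hGu _), Matrix.one_mul]
  · rw [show ρ ^ 4 = ρ ^ 2 * ρ ^ 2 by rw [← pow_add], ← Matrix.mul_assoc, hc2, Matrix.mul_assoc,
      hc2, Matrix.mul_assoc]
  · rw [← pow_mul, show 4 * 6 = 6 * 4 from rfl, pow_mul, h6, one_pow]
end Circle

/-! ### Every bundle over a sphere is stably constant -/

section HasVal
variable {Y : Type*} [TopologicalSpace Y] {τ : Y → Y} {κ ι : Type}
  [Fintype κ] [Fintype ι] [DecidableEq ι] [DecidableEq κ]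
  {ρ : Matrix ι ι ℂ} {P : Y → Matrix ι ι ℂ} {x : ℂ}

theorem HasVal.of_dsum {δ d : Matrix κ κ ℂ} (hP : IsBun τ ρ P) (hd : IsCon δ d)
    (h : HasVal τ (_root_.dsum ρ δ) (fun y => _root_.dsum (P y) d) x) :
    HasVal τ ρ P (x - (δ * d).trace) := by
  obtain ⟨α, _, _, β, _, _, δ', d', m, q, hd', hq, hi, rfl⟩ := h
  refine ⟨_, inferInstance, inferInstance, β, _, _, _, _, m, q, hd.dsum hd', hq, ?_, ?_⟩
  · have h1 := BIso.reindex (Equiv.sumAssoc ι κ α)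
      ((hP.dsum (hd.isBun (τ := τ))).dsum (hd'.isBun (τ := τ)))
    simp only [reindex_sumAssoc_dsum] at h1
    exact h1.symm.trans (hP.dsum ((hd.dsum hd').isBun (τ := τ))).idem (fun _ => hq.idem) hi
  · simp only [dsum_mul, trace_dsum]; ring

end HasVal

section Rows
variable {Y : Type*} [TopologicalSpace Y] {τ : Y → Y} {κ κ' ι ι' : Type*}
  [Fintype κ] [Fintype κ'] [Fintype ι] [Fintype ι']
  {a : Matrix κ κ ℂ} {a' : Matrix κ' κ' ℂ} {b : Matrix ι ι ℂ} {b' : Matrix ι' ι' ℂ}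

theorem EMap.fromRows {A : Y → Matrix κ ι ℂ} {C : Y → Matrix κ' ι ℂ} (hA : EMap τ a b A)
    (hC : EMap τ a' b C) :
    EMap τ (_root_.dsum a a') b fun y => fromRows (A y) (C y) :=
  ⟨continuous_matrix fun i j => by
      rcases i with i | i
      · exact hA.1.matrix_elem i j
      · exact hC.1.matrix_elem i j, fun y => by
    simp only [_root_.dsum, fromBlocks_mul_fromRows, Matrix.zero_mul, add_zero, zero_add,
      fromRows_mul, hA.2, hC.2]⟩

theorem EMap.fromCols {A : Y → Matrix κ ι ℂ} {B : Y → Matrix κ ι' ℂ} (hA : EMap τ a b A)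
    (hB : EMap τ a b' B) :
    EMap τ a (_root_.dsum b b') fun y => fromCols (A y) (B y) :=
  ⟨continuous_matrix fun i j => by
      rcases j with j | j
      · exact hA.1.matrix_elem i j
      · exact hB.1.matrix_elem i j, fun y => by
    simp only [_root_.dsum, fromCols_mul_fromBlocks, Matrix.mul_zero, add_zero, zero_add,
      mul_fromCols, hA.2, hB.2]⟩

end Rows

/-- The unit sphere of the complex plane. -/
def US.toCircle (z : US ℂ) : Circle := ⟨z.1, z.2⟩

/-- The unit sphere of the complex plane. -/
def US.ofCircle (z : Circle) : US ℂ := ⟨z.1, z.2⟩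

theorem US.continuous_toCircle : Continuous US.toCircle :=
  Continuous.subtype_mk continuous_subtype_val _

theorem US.continuous_ofCircle : Continuous US.ofCircle :=
  Continuous.subtype_mk continuous_subtype_val _

section Conj
variable {ι : Type*} [Fintype ι] [DecidableEq ι]

theorem Matrix.mul_inv_eq_of_mul_eq {g A B : Matrix ι ι ℂ} (hg : IsUnit g) (h : g * A = B * g) :
    A * g⁻¹ = g⁻¹ * B := by
  calc A * g⁻¹ = g⁻¹ * (g * A) * g⁻¹ := by
        rw [← Matrix.mul_assoc, Matrix.inv_mul_of_isUnit hg, Matrix.one_mul]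
    _ = _ := by rw [h, Matrix.mul_assoc, Matrix.mul_assoc, Matrix.mul_inv_of_isUnit hg,
        Matrix.mul_one]

theorem Matrix.conj_pow {g A B : Matrix ι ι ℂ} (h : g * A = B * g) (n : ℕ) :
    g * A ^ n = B ^ n * g := by
  induction n with
  | zero => simp
  | succ n ih => rw [pow_succ, ← Matrix.mul_assoc, ih, Matrix.mul_assoc, h, pow_succ,
      Matrix.mul_assoc]

theorem cut_mul_cut {q A B : Matrix ι ι ℂ} (hq : q * q = q) (hB : q * B = B * q) :
    (A * q + (1 - q)) * (B * q + (1 - q)) = A * B * q + (1 - q) := by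
  have hq1 : q * (1 - q) = 0 := by rw [Matrix.mul_sub, hq, Matrix.mul_one, sub_self]
  have hq2 : (1 - q) * q = 0 := by rw [Matrix.sub_mul, hq, Matrix.one_mul, sub_self]
  have hq3 : (1 - q) * (1 - q) = 1 - q := IsIdempotentElem.one_sub hq
  calc (A * q + (1 - q)) * (B * q + (1 - q))
      = A * (q * B) * q + A * (q * (1 - q)) + ((1 - q) * (B * q) + (1 - q) * (1 - q)) := by
        rw [Matrix.mul_add, Matrix.add_mul, Matrix.add_mul]; simp only [Matrix.mul_assoc]; abel
    _ = _ := by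
        rw [hB, hq1, ← hB, ← Matrix.mul_assoc (1 - q), hq2, hq3, Matrix.mul_zero, Matrix.zero_mul,
          add_zero, zero_add, hB, Matrix.mul_assoc A, Matrix.mul_assoc B, hq, Matrix.mul_assoc]

theorem IsCon.cut_ord {ς q : Matrix ι ι ℂ} (h : IsCon ς q) : (ς * q + (1 - q)) ^ 6 = 1 := by
  have h1 : ∀ n : ℕ, (ς * q + (1 - q)) ^ n = ς ^ n * q + (1 - q) := fun n => by
    induction n with
    | zero => simp
    | succ n ih => rw [pow_succ, ih, cut_mul_cut h.idem h.comm, pow_succ]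
  rw [h1, h.ord, Matrix.one_mul, add_sub_cancel]

end Conj

section Join
variable {V : Type} [NormedAddCommGroup V] [NormedSpace ℝ V] [FiniteDimensional ℝ V] [Nontrivial V]
  {ι κ : Type} [Fintype ι] [DecidableEq ι] [Fintype κ] [DecidableEq κ]

/-- The clutching construction: a bundle over the join of a sphere with the circle, trivialised on
both ends, is stably constant when the clutching function splits. -/
theorem exists_hasVal_of_clutching {ρ ρ₀ ρ₁ q : Matrix ι ι ℂ} {P : US (V × ℂ) → Matrix ι ι ℂ}
    (hP : IsBun Neg.neg ρ P) {g₀ : US V → Matrix ι ι ℂ} {g₁ : Circle → Matrix ι ι ℂ}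
    (hq₀ : IsCon ρ₀ q) (hg₀ : EMap Neg.neg ρ₀ ρ g₀) (hu₀ : ∀ v, IsUnit (g₀ v))
    (hc₀ : ∀ v z, g₀ v * P (US.join (v, z, 0)) = q * g₀ v)
    (hq₁ : IsCon ρ₁ q) (hg₁ : EMap Neg.neg ρ₁ ρ g₁) (hu₁ : ∀ z, IsUnit (g₁ z))
    (hc₁ : ∀ v z, g₁ z * P (US.join (v, US.ofCircle z, 1)) = q * g₁ z)
    (hs : ∀ (a b : Matrix ι ι ℂ), a ^ 6 = 1 → b ^ 6 = 1 → ∀ φ : US V × Circle → Matrix ι ι ℂ,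
      EMap (Prod.map Neg.neg Neg.neg) a b φ → (∀ y, IsUnit (φ y)) → Splits Neg.neg a b φ) :
    ∃ x, HasVal Neg.neg ρ P x := by
  have hqi : q * q = q := hq₀.idem
  have hq1 : q * (1 - q) = 0 := by rw [Matrix.mul_sub, hqi, Matrix.mul_one, sub_self]
  have hq2 : (1 - q) * q = 0 := by rw [Matrix.sub_mul, hqi, Matrix.one_mul, sub_self]
  have hq3 : (1 - q) * (1 - q) = 1 - q := IsIdempotentElem.one_sub hqi
  have : CompactSpace (US V) := isCompact_iff_compactSpace.1 (isCompact_sphere _ _)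
  obtain ⟨T, hT, hTu, hT0, hTP⟩ := exists_transport (Y := US V × Circle)
    (τ := Prod.map Neg.neg Neg.neg) (ρ := ρ)
    (P := fun y => P (US.join (y.1.1, US.ofCircle y.1.2, y.2)))
    (hP.emap.comp (h := fun y : (US V × Circle) × I => US.join (y.1.1, US.ofCircle y.1.2, y.2))
      (US.continuous_join.comp ((continuous_fst.comp continuous_fst).prodMk
        ((US.continuous_ofCircle.comp (continuous_snd.comp continuous_fst)).prodMk continuous_snd)))
      fun y => US.join_neg (y.1.1, US.ofCircle y.1.2, y.2)) fun y => hP.idem _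
  have hg₀i : EMap (Prod.map (Prod.map Neg.neg Neg.neg) id) ρ ρ₀
      fun y : (US V × Circle) × I => (g₀ y.1.1)⁻¹ :=
    (hg₀.inv hu₀).comp (h := fun y : (US V × Circle) × I => y.1.1) (by fun_prop) fun _ => rfl
  let Z : (US V × Circle) × I → Matrix ι ι ℂ := fun y => T y * (g₀ y.1.1)⁻¹
  have hZ : EMap (Prod.map (Prod.map Neg.neg Neg.neg) id) ρ ρ₀ Z := hT.mul hg₀i
  have hZu : ∀ y, IsUnit (Z y) := fun y => (hTu y).mul (Matrix.isUnit_nonsing_inv_iff.2 (hu₀ _))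
  have hZq : ∀ y, Z y * q = P (US.join (y.1.1, US.ofCircle y.1.2, y.2)) * Z y := fun y => by
    simp only [Z]
    rw [Matrix.mul_assoc, ← Matrix.mul_inv_eq_of_mul_eq (hu₀ _) (hc₀ _ (US.ofCircle y.1.2)),
      ← Matrix.mul_assoc, hTP y.1 y.2, Matrix.mul_assoc]
  let φ : US V × Circle → Matrix ι ι ℂ := fun y => g₁ y.2 * Z (y, 1)
  have hφ : EMap (Prod.map Neg.neg Neg.neg) ρ₁ ρ₀ φ :=
    (hg₁.comp (h := fun y : US V × Circle => y.2) continuous_snd fun _ => rfl).mul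
      (hZ.comp (h := fun y : US V × Circle => (y, 1)) (by fun_prop) fun _ => rfl)
  have hφu : ∀ y, IsUnit (φ y) := fun y => (hu₁ _).mul (hZu _)
  have hφq : ∀ y, φ y * q = q * φ y := fun y => by
    simp only [φ]
    rw [Matrix.mul_assoc, hZq, ← Matrix.mul_assoc, hc₁, Matrix.mul_assoc]
  let φ₁ : US V × Circle → Matrix ι ι ℂ := fun y => φ y * q + (1 - q)
  have hq1φ : ∀ y, q * φ₁ y = q * φ y := fun y => by
    simp only [φ₁]
    rw [Matrix.mul_add, hq1, add_zero, hφq, ← Matrix.mul_assoc, hqi]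
  have hq1φ' : ∀ y, φ₁ y * q = φ y * q := fun y => by
    simp only [φ₁]
    rw [Matrix.add_mul, hq2, add_zero, Matrix.mul_assoc, hqi]
  have hq2φ : ∀ y, (1 - q) * φ₁ y = 1 - q := fun y => by
    simp only [φ₁]
    rw [Matrix.mul_add, hq3, hφq, ← Matrix.mul_assoc, hq2, Matrix.zero_mul, zero_add]
  have hq2φ' : ∀ y, φ₁ y * (1 - q) = 1 - q := fun y => by
    simp only [φ₁]
    rw [Matrix.add_mul, hq3, Matrix.mul_assoc, hq1, Matrix.mul_zero, zero_add]
  have hφ₁u : ∀ y, IsUnit (φ₁ y) := fun y => by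
    refine IsUnit.of_mul_eq_one (b := (φ y)⁻¹ * q + (1 - q)) ?_
    have h1 : q * (φ y)⁻¹ = (φ y)⁻¹ * q := Matrix.mul_inv_eq_of_mul_eq (hφu y) (hφq y)
    rw [Matrix.mul_add, hq2φ', ← h1, ← Matrix.mul_assoc, hq1φ', Matrix.mul_assoc, h1,
      ← Matrix.mul_assoc, Matrix.mul_inv_of_isUnit (hφu y), Matrix.one_mul, add_sub_cancel]
  have hφ₁ : EMap (Prod.map Neg.neg Neg.neg) (ρ₁ * q + (1 - q)) (ρ₀ * q + (1 - q)) φ₁ :=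
    ⟨(hφ.1.mul continuous_const).add continuous_const, fun y => by
      simp only [φ₁]
      rw [cut_mul_cut hqi hq₀.comm, cut_mul_cut hqi (hφq y).symm, hφ.2]⟩
  obtain ⟨κ, _, _, δ, c, α, β, hδ, hc, hα, hαu, hβ, hβu, H, hH, hHu, hH0, hH1⟩ :=
    hs _ _ hq₁.cut_ord hq₀.cut_ord φ₁ hφ₁ hφ₁u
  have hZb : ∀ y, Z (Prod.map (Prod.map Neg.neg Neg.neg) id y) * q * (ρ₀ * q + (1 - q)) =
      ρ * (Z y * q) := fun y => by
    rw [Matrix.mul_assoc, Matrix.mul_add, hq1, add_zero, ← Matrix.mul_assoc q, hq₀.comm,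
      Matrix.mul_assoc ρ₀, hqi, ← Matrix.mul_assoc, hZ.2, Matrix.mul_assoc]
  have hZi := hZ.inv hZu
  have hZb' : ∀ y, q * (Z (Prod.map (Prod.map Neg.neg Neg.neg) id y))⁻¹ * ρ =
      (ρ₀ * q + (1 - q)) * (q * (Z y)⁻¹) := fun y => by
    rw [Matrix.add_mul, ← Matrix.mul_assoc (1 - q), hq2, Matrix.zero_mul, add_zero,
      Matrix.mul_assoc ρ₀, ← Matrix.mul_assoc q q, hqi, Matrix.mul_assoc, hZi.2,
      ← Matrix.mul_assoc, hq₀.comm, Matrix.mul_assoc]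
  have hqb : (1 - q) * (ρ₀ * q + (1 - q)) = 1 * (1 - q) := by
    rw [Matrix.mul_add, hq3, ← Matrix.mul_assoc, show (1 - q) * ρ₀ = ρ₀ * (1 - q) by
      rw [Matrix.sub_mul, hq₀.comm, Matrix.mul_sub, Matrix.mul_one, Matrix.one_mul],
      Matrix.mul_assoc, hq2, Matrix.mul_zero, zero_add, Matrix.one_mul]
  have hqb' : (1 - q) * 1 = (ρ₀ * q + (1 - q)) * (1 - q) := by
    rw [Matrix.add_mul, hq3, Matrix.mul_assoc, hq1, Matrix.mul_zero, zero_add, Matrix.mul_one]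
  let E : (US V × Circle) × I → Matrix ((ι ⊕ ι) ⊕ κ) (ι ⊕ κ) ℂ := fun y =>
    dsum (fromRows (Z y * q) (1 - q)) 1
  let E' : (US V × Circle) × I → Matrix (ι ⊕ κ) ((ι ⊕ ι) ⊕ κ) ℂ := fun y =>
    dsum (fromCols (q * (Z y)⁻¹) (1 - q)) 1
  have hE : EMap (Prod.map (Prod.map Neg.neg Neg.neg) id) (dsum (dsum ρ 1) δ)
      (dsum (ρ₀ * q + (1 - q)) δ) E :=
    (EMap.fromRows ⟨hZ.1.mul continuous_const, hZb⟩ (EMap.const hqb)).dsum EMap.one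
  have hE' : EMap (Prod.map (Prod.map Neg.neg Neg.neg) id) (dsum (ρ₀ * q + (1 - q)) δ)
      (dsum (dsum ρ 1) δ) E' :=
    (EMap.fromCols ⟨continuous_const.mul hZi.1, hZb'⟩ (EMap.const hqb')).dsum EMap.one
  have hE'E : ∀ y, E' y * E y = 1 := fun y => by
    simp only [E, E']
    rw [dsum_mul, fromCols_mul_fromRows, hq3, Matrix.mul_assoc, ← Matrix.mul_assoc _ (Z y),
      Matrix.inv_mul_of_isUnit (hZu y), Matrix.one_mul, hqi, add_sub_cancel, Matrix.one_mul,
      dsum_one]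
  have hEE' : ∀ y, E y * E' y =
      dsum (dsum (P (US.join (y.1.1, US.ofCircle y.1.2, y.2))) (1 - q)) 1 := fun y => by
    simp only [E, E']
    have e1 : Z y * q * (q * (Z y)⁻¹) = P (US.join (y.1.1, US.ofCircle y.1.2, y.2)) := by
      rw [← Matrix.mul_assoc, Matrix.mul_assoc (Z y), hqi, hZq, Matrix.mul_assoc,
        Matrix.mul_inv_of_isUnit (hZu y), Matrix.mul_one]
    have e2 : Z y * q * (1 - q) = 0 := by rw [Matrix.mul_assoc, hq1, Matrix.mul_zero]
    have e3 : (1 - q) * (q * (Z y)⁻¹) = 0 := by rw [← Matrix.mul_assoc, hq2, Matrix.zero_mul]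
    rw [dsum_mul, fromRows_mul_fromCols, hq3, e1, e2, e3, Matrix.one_mul]
    rfl
  have hβ' : EMap (Prod.map (Prod.map Neg.neg Neg.neg) id) c (dsum (ρ₀ * q + (1 - q)) δ)
      fun y : (US V × Circle) × I => β y.1.1 :=
    hβ.comp (h := fun y : (US V × Circle) × I => y.1.1) (by fun_prop) fun _ => rfl
  have hHz : EMap (Prod.map (Prod.map Neg.neg Neg.neg) id) (dsum (ρ₁ * q + (1 - q)) δ)
      (dsum (ρ₀ * q + (1 - q)) δ) fun y : (US V × Circle) × I => H (y.1, 0) :=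
    hH.comp (h := fun y : (US V × Circle) × I => (y.1, 0)) (by fun_prop) fun _ => rfl
  let R : (US V × Circle) × I → Matrix (ι ⊕ κ) (ι ⊕ κ) ℂ := fun y =>
    (H (y.1, 0))⁻¹ * H y * (β y.1.1)⁻¹
  let R' : (US V × Circle) × I → Matrix (ι ⊕ κ) (ι ⊕ κ) ℂ := fun y =>
    β y.1.1 * (H y)⁻¹ * H (y.1, 0)
  have hR : EMap (Prod.map (Prod.map Neg.neg Neg.neg) id) (dsum (ρ₀ * q + (1 - q)) δ) c R :=
    ((hHz.inv fun _ => hHu _).mul hH).mul (hβ'.inv fun _ => hβu _)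
  have hR' : EMap (Prod.map (Prod.map Neg.neg Neg.neg) id) c (dsum (ρ₀ * q + (1 - q)) δ) R' :=
    (hβ'.mul (hH.inv hHu)).mul hHz
  have hRR' : ∀ y, R y * R' y = 1 := fun y => by
    calc R y * R' y = (H (y.1, 0))⁻¹ * (H y * ((β y.1.1)⁻¹ * β y.1.1) * (H y)⁻¹) * H (y.1, 0) := by
          simp only [R, R', Matrix.mul_assoc]
      _ = 1 := by
          rw [Matrix.inv_mul_of_isUnit (hβu _), Matrix.mul_one,
            Matrix.mul_inv_of_isUnit (hHu _), Matrix.mul_one, Matrix.inv_mul_of_isUnit (hHu _)]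
  have hR'R : ∀ y, R' y * R y = 1 := fun y => mul_eq_one_comm.1 (hRR' y)
  let f : US V × US ℂ × I → (US V × Circle) × I := fun x => ((x.1, US.toCircle x.2.1), x.2.2)
  have hf : Continuous f := (continuous_fst.prodMk
    (US.continuous_toCircle.comp (continuous_fst.comp continuous_snd))).prodMk
    (continuous_snd.comp continuous_snd)
  let E₁ : Circle → Matrix ((ι ⊕ ι) ⊕ κ) (ι ⊕ κ) ℂ := fun z =>
    dsum (fromRows ((g₁ z)⁻¹ * q) (1 - q)) 1
  let E₁' : Circle → Matrix (ι ⊕ κ) ((ι ⊕ ι) ⊕ κ) ℂ := fun z =>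
    dsum (fromCols (q * g₁ z) (1 - q)) 1
  have hE₁ : ∀ y, E (y, 1) = E₁ y.2 * H (y, 0) := fun y => by
    have h1 : Z (y, 1) = (g₁ y.2)⁻¹ * φ y := by
      simp only [φ]
      rw [← Matrix.mul_assoc, Matrix.inv_mul_of_isUnit (hu₁ _), Matrix.one_mul]
    have h2 : Z (y, 1) * q = (g₁ y.2)⁻¹ * q * φ₁ y := by
      rw [Matrix.mul_assoc _ q, hq1φ, h1, Matrix.mul_assoc, hφq]
    simp only [E, E₁]
    rw [hH0, dsum_mul, fromRows_mul, hq2φ, h2, Matrix.one_mul]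
  have hE₁' : ∀ y, H (y, 0) * E' (y, 1) = E₁' y.2 := fun y => by
    have h1 : φ y * (Z (y, 1))⁻¹ = g₁ y.2 := by
      simp only [φ]
      rw [Matrix.mul_assoc, Matrix.mul_inv_of_isUnit (hZu _), Matrix.mul_one]
    have h2 : φ₁ y * (q * (Z (y, 1))⁻¹) = q * g₁ y.2 := by
      rw [← Matrix.mul_assoc, hq1φ', hφq, Matrix.mul_assoc, h1]
    simp only [E', E₁']
    rw [hH0, dsum_mul, mul_fromCols, hq2φ', h2, Matrix.one_mul]
  obtain ⟨A, hA, hAJ⟩ := US.exists_descend_EMap (V := V) (W := ℂ)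
    ((hE.mul hR).comp (τ' := fun x : US V × US ℂ × I => (-x.1, -x.2.1, x.2.2)) hf fun _ => rfl)
    (fun v w w' => by
      simp only [f, E, R, Z, hT0]
      rw [Matrix.inv_mul_of_isUnit (hHu _), Matrix.inv_mul_of_isUnit (hHu _)])
    (fun v v' w => by
      simp only [f, hE₁, R]
      have : ∀ v : US V, E₁ (US.toCircle w) * H ((v, US.toCircle w), 0) *
          ((H ((v, US.toCircle w), 0))⁻¹ * H ((v, US.toCircle w), 1) * (β v)⁻¹) =
          E₁ (US.toCircle w) * α (US.toCircle w) := fun v => by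
        rw [hH1, Matrix.mul_assoc (E₁ _), ← Matrix.mul_assoc (H _), ← Matrix.mul_assoc (H _),
          Matrix.mul_inv_of_isUnit (hHu _), Matrix.one_mul, Matrix.mul_assoc (α _),
          Matrix.mul_inv_of_isUnit (hβu _), Matrix.mul_one]
      rw [this, this])
  obtain ⟨B, hB, hBJ⟩ := US.exists_descend_EMap (V := V) (W := ℂ)
    ((hR'.mul hE').comp (τ' := fun x : US V × US ℂ × I => (-x.1, -x.2.1, x.2.2)) hf fun _ => rfl)
    (fun v w w' => by
      simp only [f, E', R', Z, hT0]
      have : ∀ y, β v * (H y)⁻¹ * H y = β v := fun y => by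
        rw [Matrix.mul_assoc, Matrix.inv_mul_of_isUnit (hHu _), Matrix.mul_one]
      rw [this, this])
    (fun v v' w => by
      simp only [f, R']
      have : ∀ v : US V, β v * (H ((v, US.toCircle w), 1))⁻¹ * H ((v, US.toCircle w), 0) *
          E' ((v, US.toCircle w), 1) = (α (US.toCircle w))⁻¹ * E₁' (US.toCircle w) := fun v => by
        rw [Matrix.mul_assoc, hE₁', hH1, Matrix.mul_inv_rev, ← Matrix.mul_assoc (β _),
          Matrix.mul_inv_of_isUnit (hβu _), Matrix.one_mul]
      rw [this, this])
  have hbun : IsBun Neg.neg (dsum (dsum ρ 1) δ) fun y => dsum (dsum (P y) (1 - q)) 1 :=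
    (hP.dsum (IsCon.isBun ⟨by simp, hq3, by simp⟩)).dsum (IsCon.isBun ⟨by simp, by simp, hδ⟩)
  have hiso : BIso Neg.neg c (dsum (dsum ρ 1) δ) (fun _ => 1)
      (fun y => dsum (dsum (P y) (1 - q)) 1) := by
    refine ⟨A, B, hA, hB, fun y => ?_, fun y => ?_⟩ <;> obtain ⟨x, rfl⟩ := US.join_surjective y
    · rw [hAJ, hBJ]
      simp only []
      rw [Matrix.mul_assoc, ← Matrix.mul_assoc (E' _), hE'E, Matrix.one_mul, hR'R]
    · rw [hAJ, hBJ]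
      simp only []
      rw [Matrix.mul_assoc, ← Matrix.mul_assoc (R _), hRR', Matrix.one_mul, hEE']
      rfl
  have h1 := (HasVal.con (τ := (Neg.neg : US (V × ℂ) → US (V × ℂ)))
    (⟨by simp, by simp, hc⟩ : IsCon c 1)).biso hbun hiso
  have h2 := HasVal.of_dsum (hP.dsum (IsCon.isBun ⟨by simp, hq3, by simp⟩))
    ⟨by simp, by simp, hδ⟩ h1
  exact ⟨_, HasVal.of_dsum hP ⟨by simp, hq3, by simp⟩ h2⟩

theorem US.join_zero (v : US V) (z z' : US ℂ) : US.join (v, z, 0) = US.join (v, z', 0) := by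
  simp [US.join]

theorem US.join_one (v v' : US V) (z : US ℂ) : US.join (v, z, 1) = US.join (v', z, 1) := by
  simp [US.join]

theorem AllVal.prod_complex (h : AllVal (Neg.neg : US V → US V)) :
    AllVal (Neg.neg : US (V × ℂ) → US (V × ℂ)) := by
  intro ι _ _ ρ P hP
  have : CompactSpace (US V) := isCompact_iff_compactSpace.1 (isCompact_sphere _ _)
  obtain ⟨w, hw⟩ := exists_ne (0 : V)
  let v₀ : US V := US.normalize w hw
  have : Nonempty (US V) := ⟨v₀⟩
  let z₀ : US ℂ := US.ofCircle 1
  have hP₀ : IsBun Neg.neg ρ fun v : US V => P (US.join (v, z₀, 0)) :=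
    hP.comp (h := fun v : US V => US.join (v, z₀, 0))
      (US.continuous_join.comp (by fun_prop)) fun v => by
        rw [US.join_zero _ z₀ (-z₀)]; exact US.join_neg (v, z₀, 0)
  obtain ⟨x, κ, _, _, μ, _, _, δ, d, ς, q, hd, hq, hi, -⟩ := h ι ρ _ hP₀
  obtain ⟨u, hu, huu, huc⟩ :=
    BIso.exists_conj (hP₀.dsum (hd.isBun (τ := Neg.neg))) hq.isBun hi
  let R := _root_.dsum (_root_.dsum ρ δ) ς
  let PP : US (V × ℂ) → Matrix ((ι ⊕ κ) ⊕ μ) ((ι ⊕ κ) ⊕ μ) ℂ :=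
    fun y => _root_.dsum (_root_.dsum (P y) d) 0
  have h0 : IsCon ς 0 := ⟨by simp, by simp, hq.ord⟩
  have h0' : IsCon (_root_.dsum ρ δ) 0 := ⟨by simp, by simp, (hP.dsum hd.isBun).ord⟩
  have hPP : IsBun Neg.neg R PP := (hP.dsum hd.isBun).dsum h0.isBun
  let Q : Matrix ((ι ⊕ κ) ⊕ μ) ((ι ⊕ κ) ⊕ μ) ℂ := _root_.dsum 0 q
  have hQ : IsCon R Q := h0'.dsum hq
  have huU : ∀ v, IsUnit (u v) := fun v => IsUnit.of_mul_eq_one (b := u v) (huu v)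
  have hP₁ : IsBun Neg.neg R fun z : Circle => PP (US.join (v₀, US.ofCircle z, 1)) :=
    hPP.comp (h := fun z : Circle => US.join (v₀, US.ofCircle z, 1))
      (US.continuous_join.comp (continuous_const.prodMk
        (US.continuous_ofCircle.prodMk continuous_const))) fun z => by
        rw [US.join_one v₀ (-v₀)]; exact US.join_neg (v₀, US.ofCircle z, 1)
  obtain ⟨g, hg, hgu, hgP, hgc⟩ := exists_circle_trivialization hP₁
  obtain ⟨T, -, hTu, -, hTP⟩ := exists_transport (Y := Unit) (τ := id) (ρ := 1)
    (P := fun y => PP (US.join (v₀, z₀, y.2)))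
    ⟨hPP.emap.cont.comp (US.continuous_join.comp (by fun_prop)), fun y => by simp⟩
    fun y => hPP.idem _
  set T₁ := T ((), 1)
  have hT₁ : T₁ * PP (US.join (v₀, z₀, 0)) = PP (US.join (v₀, z₀, 1)) * T₁ := hTP () 1
  have hT₁u : IsUnit T₁ := hTu _
  let M := u v₀ * T₁⁻¹
  have hM : IsUnit M := (huU _).mul (Matrix.isUnit_nonsing_inv_iff.2 hT₁u)
  have hMQ : M * PP (US.join (v₀, z₀, 1)) = Q * M := by
    simp only [M]
    rw [Matrix.mul_assoc, ← Matrix.mul_inv_eq_of_mul_eq hT₁u hT₁, ← Matrix.mul_assoc, huc v₀,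
      Matrix.mul_assoc]
  have hMQ' : PP (US.join (v₀, z₀, 1)) * M⁻¹ = M⁻¹ * Q := Matrix.mul_inv_eq_of_mul_eq hM hMQ
  have hρ₁ : IsCon (M * R ^ 4 * M⁻¹) Q := by
    refine ⟨?_, hQ.idem, ?_⟩
    · rw [← Matrix.mul_assoc, ← Matrix.mul_assoc, ← hMQ, Matrix.mul_assoc M, hgc.comm,
        ← Matrix.mul_assoc, Matrix.mul_assoc (M * R ^ 4), hMQ', ← Matrix.mul_assoc]
    · have h6 := Matrix.conj_pow (g := M) (A := R ^ 4) (B := M * R ^ 4 * M⁻¹)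
        (by rw [Matrix.mul_assoc _ M⁻¹, Matrix.inv_mul_of_isUnit hM, Matrix.mul_one]) 6
      rw [hgc.ord, Matrix.mul_one] at h6
      exact hM.mul_right_cancel (by rw [Matrix.one_mul, ← h6])
  have hg₁ : EMap Neg.neg (M * R ^ 4 * M⁻¹) R fun z => M * g z :=
    (EMap.const (by rw [Matrix.mul_assoc _ M⁻¹, Matrix.inv_mul_of_isUnit hM,
      Matrix.mul_one])).mul hg
  obtain ⟨y, hy⟩ := exists_hasVal_of_clutching hPP hQ hu huU
    (fun v z => by rw [US.join_zero v z z₀]; exact huc v) hρ₁ hg₁ (fun z => hM.mul (hgu z))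
    (fun v z => by
      rw [US.join_one v v₀, Matrix.mul_assoc, hgP z, ← Matrix.mul_assoc]
      exact (congrArg (· * g z) hMQ).trans (Matrix.mul_assoc _ _ _))
    fun a b ha hb φ hφ hφu => Splits.of_allVal h continuous_neg neg_neg ha hb hφ hφu
  exact ⟨_, HasVal.of_dsum hP hd (HasVal.of_dsum (hP.dsum hd.isBun) h0 hy)⟩

end Join

/-! ### Constant bundles which are isomorphic over a sphere -/

/-- Every bundle over the unit sphere of an odd-dimensional space has a value. -/
theorem allVal_US (n : ℕ) {V : Type} [NormedAddCommGroup V] [NormedSpace ℝ V]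
    (hV : Module.finrank ℝ V = 2 * n + 1) : AllVal (Neg.neg : US V → US V) := by
  induction n generalizing V with
  | zero =>
    have : FiniteDimensional ℝ V := Module.finite_of_finrank_eq_succ hV
    exact allVal_US_real.of_finrank_eq (by simp [hV])
  | succ n ih =>
    have : FiniteDimensional ℝ V := Module.finite_of_finrank_eq_succ hV
    have h := ih (V := EuclideanSpace ℝ (Fin (2 * n + 1))) (by simp)
    exact h.prod_complex.of_finrank_eq (by simp [hV]; ring)

section Disc
variable {ι : Type} [Fintype ι] [DecidableEq ι]

theorem trace_sub_of_companion {K : ℕ} {p : ℕ → Matrix ι ι ℂ} {r s : Matrix ι ι ℂ} (hr : r ^ 6 = 1)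
    (hs : s ^ 6 = 1) (hp : ∀ j, p j * r = (-1 : ℂ) ^ j • (s * p j))
    (hu : ∀ z : Circle, IsUnit (∑ j ∈ Finset.range (K + 1), (z : ℂ) ^ j • p j)) :
    s.trace - r.trace = -2 * (dsum r (companionRep K r) *
      pencilProj (companionA ι K) (companionB K p)).trace := by
  obtain ⟨hA, hB⟩ := companion_equivariant_pencil (K := K) hp
  have h : ∀ z : Circle, IsUnit (companionB K p + (z : ℂ) • companionA ι K) := fun z => by
    rw [← companion_one]; exact isUnit_companion (hu z) 1
  have hR : dsum r (companionRep K r) ^ 6 = 1 := by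
    rw [dsum_pow, hr, companionRep_pow_six hr, dsum_one]
  have hS : dsum s (companionRep K r) ^ 6 = 1 := by
    rw [dsum_pow, hs, companionRep_pow_six hr, dsum_one]
  set Q := pencilProj (companionA ι K) (companionB K p)
  set C := companionA ι K * Q + companionB K p * (1 - Q)
  have uC : IsUnit C := by
    have := isUnit_pencil_deform h 1 (t := 0) le_rfl zero_le_one
    simpa using this
  have e := pencil_center (pencilProj_mul_self h)
    (pencilProj_equivariant (pow_six_isUnit hR) (pow_six_isUnit hS) h hA hB) hA hB
  change C * _ = _ * C * _ at e
  have e2 : C * (dsum r (companionRep K r) * (1 - 2 • Q)) * C⁻¹ = dsum s (companionRep K r) := by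
    rw [← Matrix.mul_assoc, e, Matrix.mul_assoc (_ * C),
      one_sub_two_idem (pencilProj_mul_self h), Matrix.mul_one, Matrix.mul_assoc,
      Matrix.mul_inv_of_isUnit uC, Matrix.mul_one]
  have e3 := congrArg Matrix.trace e2
  rw [Matrix.mul_assoc, Matrix.trace_mul_comm, Matrix.mul_assoc, Matrix.inv_mul_of_isUnit uC,
    Matrix.mul_one, Matrix.mul_sub, Matrix.mul_one, Matrix.trace_sub, trace_dsum, trace_dsum,
    two_smul, Matrix.mul_add, Matrix.trace_add] at e3
  linear_combination -e3

variable {V : Type} [NormedAddCommGroup V] [NormedSpace ℝ V]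

/-- The map `D × S¹ → S(V × ℂ)` which covers the join; it does not depend on the second
coordinate near the boundary of `D`. -/
noncomputable def US.ofDisc (y : Metric.closedBall (0 : V) 3 × Circle) : US (V × ℂ) :=
  ⟨((max 1 ‖(y.1 : V)‖)⁻¹ • (y.1 : V), ((max 0 (min 1 (2 - ‖(y.1 : V)‖)) : ℝ) : ℂ) * y.2), by
    rw [mem_sphere_zero_iff_norm, Prod.norm_mk, norm_smul, norm_mul, Circle.norm_coe, mul_one,
      Complex.norm_real, Real.norm_of_nonneg (le_max_left _ _), norm_inv,
      Real.norm_of_nonneg (zero_le_one.trans (le_max_left _ _))]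
    rcases le_total ‖(y.1 : V)‖ 1 with h | h
    · rw [max_eq_left h, min_eq_left (by linarith), max_eq_right zero_le_one, inv_one, one_mul,
        max_eq_right h]
    · rw [max_eq_right (a := 1) h, inv_mul_cancel₀ (by linarith), max_eq_left]
      exact max_le zero_le_one (min_le_left _ _)⟩

theorem US.continuous_ofDisc : Continuous (US.ofDisc (V := V)) := by
  have h : ∀ y : Metric.closedBall (0 : V) 3 × Circle, max 1 ‖(y.1 : V)‖ ≠ 0 := fun y =>
    (zero_lt_one.trans_le (le_max_left _ _)).ne'
  refine Continuous.subtype_mk (Continuous.prodMk (Continuous.smul ?_ (by fun_prop)) ?_) _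
  · exact Continuous.inv₀ (by fun_prop) h
  · exact (Complex.continuous_ofReal.comp (by fun_prop)).mul
      (continuous_subtype_val.comp continuous_snd)

theorem US.ofDisc_neg (y : Metric.closedBall (0 : V) 3 × Circle) :
    US.ofDisc (Prod.map Neg.neg Neg.neg y) = -US.ofDisc y := by
  apply Subtype.ext
  change ((max 1 ‖-(y.1 : V)‖)⁻¹ • -(y.1 : V),
    ((max 0 (min 1 (2 - ‖-(y.1 : V)‖)) : ℝ) : ℂ) * ((-y.2 : Circle) : ℂ)) = -(_, _)
  rw [norm_neg, Circle.coe_neg, smul_neg, mul_neg]; rfl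

theorem US.ofDisc_eq {y : Metric.closedBall (0 : V) 3} (h : 2 ≤ ‖(y : V)‖) (z z' : Circle) :
    US.ofDisc (y, z) = US.ofDisc (y, z') := by
  apply Subtype.ext
  simp only [US.ofDisc]
  rw [max_eq_left (a := (0 : ℝ)) ((min_le_right _ _).trans (by linarith))]
  simp


theorem exists_trace_sub_eq [FiniteDimensional ℝ V] [Nontrivial V] {N : ℕ}
    (hT : TrDiv (Neg.neg : US V → US V) N)
    {a b : Matrix ι ι ℂ} (ha : a ^ 6 = 1) (hb : b ^ 6 = 1) {F : US (V × ℂ) → Matrix ι ι ℂ}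
    (hF : EMap Neg.neg a b F) (hu : ∀ y, IsUnit (F y)) :
    ∃ x : ℂ, IsIntegral ℤ x ∧ a.trace - b.trace = 2 ^ (N + 1) * x := by
  let D := Metric.closedBall (0 : V) 3
  have : CompactSpace D := isCompact_iff_compactSpace.1 (isCompact_closedBall _ _)
  have : CompactSpace (US V) := isCompact_iff_compactSpace.1 (isCompact_sphere _ _)
  let o : D := ⟨0, Metric.mem_closedBall_self (by norm_num)⟩
  let Φ : D × Circle → Matrix ι ι ℂ := fun y => F (US.ofDisc y)
  have hΦ : EMap (Prod.map Neg.neg Neg.neg) a b Φ :=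
    hF.comp (h := US.ofDisc) US.continuous_ofDisc US.ofDisc_neg
  have hΦu : ∀ y, IsUnit (Φ y) := fun y => hu _
  have hΦe : ∀ (w : D) (z z' : Circle), 2 ≤ ‖(w : V)‖ → Φ (w, z) = Φ (w, z') := fun w z z' h => by
    simp only [Φ]; rw [US.ofDisc_eq h z z']
  obtain ⟨ε, hε, hopen⟩ := Matrix.isUnit_of_isUnit_thickening hΦ.cont hΦu
  obtain ⟨k, K, p, hp, hpe, happ⟩ := exists_equivariant_laurent_approx (τ := (Neg.neg : D → D))
    continuous_neg neg_neg ha hb hΦ hε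
  let c : D → ℝ := fun w => max 0 (min 1 (‖(w : V)‖ - 2))
  have hcc : Continuous c := by fun_prop
  have hc0 : ∀ w, 0 ≤ c w := fun w => le_max_left _ _
  have hc1 : ∀ w, c w ≤ 1 := fun w => max_le zero_le_one (min_le_left _ _)
  have hcn : ∀ w, c (-w) = c w := fun w => by
    change max 0 (min 1 (‖-(w : V)‖ - 2)) = _; rw [norm_neg]
  have hcz : ∀ (w : D) (z : Circle), (c w : ℂ) • Φ (w, z) = (c w : ℂ) • Φ (w, 1) := fun w z => by
    rcases le_total 2 ‖(w : V)‖ with h | h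
    · rw [hΦe w z 1 h]
    · have : c w = 0 := max_eq_left ((min_le_right _ _).trans (by linarith))
      simp [this]
  let M := K + 2 * k
  let P : ℕ → D → Matrix ι ι ℂ := fun l w =>
    (if l < K + 1 then ((1 - c w : ℝ) : ℂ) • p l w else 0) +
      if l = 2 * k then (c w : ℂ) • Φ (w, 1) else 0
  have hPc : ∀ l, Continuous (P l) := fun l => by
    have h1 := hp l
    have h2 := hΦ.cont
    refine Continuous.add ?_ ?_
    · split_ifs <;> fun_prop
    · split_ifs <;> fun_prop
  have hPe : ∀ l w, P l (-w) * b = (-1 : ℂ) ^ l • (a * P l w) := fun l w => by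
    simp only [P]
    rw [Matrix.add_mul, Matrix.mul_add, smul_add]
    congr 1
    · split_ifs
      · rw [hcn, Matrix.smul_mul, hpe, Matrix.mul_smul, smul_comm]
      · simp
    · split_ifs with h
      · have e : Φ (-w, -1) * b = a * Φ (w, 1) := hΦ.eqv (w, 1)
        rw [h, (even_two_mul k).neg_one_pow, one_smul, Matrix.mul_smul, ← e, ← hcz (-w) (-1), hcn,
          Matrix.smul_mul]
      · simp
  have hPs : ∀ w (z : Circle), ∑ l ∈ Finset.range (M + 1), (z : ℂ) ^ l • P l w =
      ((1 - c w : ℝ) : ℂ) • (∑ l ∈ Finset.range (K + 1), (z : ℂ) ^ l • p l w) +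
        ((z : ℂ) ^ (2 * k) * c w) • Φ (w, z) := fun w z => by
    simp only [P, smul_add, Finset.sum_add_distrib, smul_ite, smul_zero]
    congr 1
    · rw [← Finset.sum_filter, Finset.smul_sum]
      refine Finset.sum_congr ?_ fun l _ => smul_comm _ _ _
      ext l; simp only [Finset.mem_filter, Finset.mem_range, M]; omega
    · rw [Finset.sum_ite_eq' _ (2 * k), if_pos (by simp only [Finset.mem_range, M]; omega),
        ← hcz w z, smul_smul]
  have hPu : ∀ w (z : Circle), IsUnit (∑ l ∈ Finset.range (M + 1), (z : ℂ) ^ l • P l w) := by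
    intro w z
    have hz : (z : ℂ) ^ (2 * k) ≠ 0 := pow_ne_zero _ (Circle.coe_ne_zero _)
    have h1 : IsUnit (((z : ℂ) ^ (2 * k))⁻¹ •
        ∑ l ∈ Finset.range (M + 1), (z : ℂ) ^ l • P l w) := by
      refine hopen (w, z) _ fun i j => ?_
      have e : ((((z : ℂ) ^ (2 * k))⁻¹ • ∑ l ∈ Finset.range (M + 1), (z : ℂ) ^ l • P l w -
          Φ (w, z)) i j) = -(((1 - c w : ℝ) : ℂ) * ((z : ℂ) ^ (2 * k))⁻¹ *
            (((z : ℂ) ^ (2 * k) • Φ (w, z) -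
              ∑ l ∈ Finset.range (K + 1), (z : ℂ) ^ l • p l w) i j)) := by
        rw [hPs]
        simp only [Matrix.sub_apply, Matrix.add_apply, Matrix.smul_apply, smul_eq_mul]
        push_cast
        field_simp
        ring
      rw [e, norm_neg, norm_mul, norm_mul, norm_inv, norm_pow, Circle.norm_coe, one_pow, inv_one,
        mul_one, Complex.norm_real, Real.norm_of_nonneg (sub_nonneg.2 (hc1 w))]
      exact (mul_le_of_le_one_left (norm_nonneg _) (by linarith [hc0 w])).trans_lt (happ w z i j)
    rw [Matrix.isUnit_iff_isUnit_det, Matrix.det_smul] at h1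
    exact (Matrix.isUnit_iff_isUnit_det _).2 (isUnit_of_mul_isUnit_right h1)
  let R := dsum b (companionRep M b)
  have hR : R ^ 6 = 1 := by rw [dsum_pow, hb, companionRep_pow_six hb, dsum_one]
  have hS : dsum a (companionRep M b) ^ 6 = 1 := by
    rw [dsum_pow, ha, companionRep_pow_six hb, dsum_one]
  have hLu : ∀ w (z : Circle),
      IsUnit (companionB M (fun l => P l w) + (z : ℂ) • companionA ι M) := fun w z => by
    rw [← companion_one]; exact isUnit_companion (hPu w z) 1
  let Q : D → Matrix (ι ⊕ ι × Fin M) (ι ⊕ ι × Fin M) ℂ :=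
    fun w => pencilProj (companionA ι M) (companionB M fun l => P l w)
  have hQ : IsBun Neg.neg R Q := pencil_bun (continuous_companionB hPc) hR hS hLu
    (companion_equivariant_pencil (K := M) (hPe · o)).1
    fun w => (companion_equivariant_pencil (hPe · w)).2
  let pc : ℕ → Matrix ι ι ℂ := fun l => if l = 2 * k then 1 else 0
  let Q₁ := pencilProj (companionA ι M) (companionB M pc)
  have hQ₁ : ∀ w : D, ‖(w : V)‖ = 3 → Q w = Q₁ := fun w hw => by
    have hcw : c w = 1 := by simp only [c, hw]; norm_num
    have e : (fun l => P l w) = fun l => Φ (w, 1) * pc l := by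
      funext l
      simp only [P, pc, hcw]
      simp
    simp only [Q]
    rw [e, companionB_mul_left, ← companionA_mul_left (Φ (w, 1)),
      pencilProj_mul_left (isUnit_dsum (hΦu _) isUnit_one)]
  have ho : -o = o := Subtype.ext neg_zero
  have t₀ := trace_sub_of_companion hb ha (K := M) (p := fun l => P l o)
    (fun l => by have := hPe l o; rwa [ho] at this) (hPu o)
  have t₁ := trace_sub_of_companion hb hb (K := M) (p := pc)
    (fun l => by
      simp only [pc]
      split_ifs with h
      · rw [h, (even_two_mul k).neg_one_pow]; simp
      · simp) fun z => by
      simp only [pc, smul_ite, smul_zero]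
      rw [Finset.sum_ite_eq' _ (2 * k), if_pos (by simp only [Finset.mem_range, M]; omega)]
      exact (Matrix.isUnit_iff_isUnit_det _).2 (by rw [Matrix.det_smul]; simp)
  let j : US V × I → D := fun y => ⟨(3 * (y.2 : ℝ)) • (y.1 : V), by
    rw [mem_closedBall_zero_iff, norm_smul, y.1.norm_eq, mul_one,
      Real.norm_of_nonneg (by linarith [y.2.2.1])]
    linarith [y.2.2.2]⟩
  have hj : Continuous j := by fun_prop
  have hQj : IsBun (Prod.map Neg.neg id) R fun y => Q (j y) := hQ.comp hj fun y => by
    apply Subtype.ext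
    change (3 * (y.2 : ℝ)) • (-(y.1 : V)) = -((3 * (y.2 : ℝ)) • (y.1 : V))
    rw [smul_neg]
  have hi := BIso.of_homotopy hQj.emap hQj.idem hR
  have e0 : ∀ y, Q (j (y, 0)) = Q o := fun y => congrArg Q (Subtype.ext (by simp [j, o]))
  have e1 : ∀ y, Q (j (y, 1)) = Q₁ := fun y => hQ₁ _ (by
    simp only [j, Set.Icc.coe_one]
    rw [norm_smul, y.norm_eq]; norm_num)
  simp only [e0, e1] at hi
  obtain ⟨v, hv⟩ := exists_ne (0 : V)
  have hc₀ : IsCon R (Q o) := ⟨by simpa only [ho] using hQ.emap.eqv o, hQ.idem o, hR⟩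
  have hc₁ : IsCon R Q₁ := by
    let y := US.normalize v hv
    have h := hQj.emap.eqv (y, 1)
    have h' := hQj.idem (y, 1)
    simp only [Prod.map_apply, id_eq, e1] at h h'
    exact ⟨h, h', hR⟩
  obtain ⟨x, hx, hxe⟩ := hT _ _ R (Q o) R Q₁ hc₀ hc₁ hi
  refine ⟨x, hx, ?_⟩
  rw [pow_succ]
  change _ = -2 * (R * Q o).trace at t₀
  change _ = -2 * (R * Q₁).trace at t₁
  linear_combination t₀ - t₁ + 2 * hxe

theorem TrDiv.prod_complex [FiniteDimensional ℝ V] [Nontrivial V] {N : ℕ}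
    (hT : TrDiv (Neg.neg : US V → US V) N) :
    TrDiv (Neg.neg : US (V × ℂ) → US (V × ℂ)) (N + 1) := by
  intro ι κ _ _ _ _ ρ p ς q hp hq hi
  obtain ⟨u, hu, huu, huc⟩ := BIso.exists_conj hp.isBun hq.isBun hi
  set R := dsum ρ ς
  set e : Matrix (ι ⊕ κ) (ι ⊕ κ) ℂ := dsum p 0
  set f : Matrix (ι ⊕ κ) (ι ⊕ κ) ℂ := dsum 0 q
  have he : IsCon R e := hp.dsum ⟨by simp, by simp, hq.ord⟩
  have hf : IsCon R f := (⟨by simp, by simp, hp.ord⟩ : IsCon ρ 0).dsum hq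
  obtain ⟨w, hw⟩ := exists_ne (0 : V × ℂ)
  let x₀ := US.normalize w hw
  have huc' : ∀ y, u y * (1 - e) = (1 - f) * u y := fun y => by
    rw [Matrix.mul_sub, huc, Matrix.sub_mul, Matrix.mul_one, Matrix.one_mul]
  have he0 : e * (1 - e) = 0 := by rw [Matrix.mul_sub, he.idem, Matrix.mul_one, sub_self]
  have he1 : (1 - e) * e = 0 := by rw [Matrix.sub_mul, he.idem, Matrix.one_mul, sub_self]
  have he2 : (1 - e) * (1 - e) = 1 - e := IsIdempotentElem.one_sub he.idem
  have hf0 : f * (1 - f) = 0 := by rw [Matrix.mul_sub, hf.idem, Matrix.mul_one, sub_self]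
  have hf1 : (1 - f) * f = 0 := by rw [Matrix.sub_mul, hf.idem, Matrix.one_mul, sub_self]
  have hf2 : (1 - f) * (1 - f) = 1 - f := IsIdempotentElem.one_sub hf.idem
  have hFu : ∀ y, IsUnit (u y * e + u x₀ * (1 - e)) := fun y => by
    refine IsUnit.of_mul_eq_one (b := e * u y + (1 - e) * u x₀) ?_
    have e1 : u y * e * (e * u y) = f := by
      rw [Matrix.mul_assoc, ← Matrix.mul_assoc e, he.idem, ← Matrix.mul_assoc, huc,
        Matrix.mul_assoc, huu, Matrix.mul_one]
    have e2 : u x₀ * (1 - e) * ((1 - e) * u x₀) = 1 - f := by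
      rw [Matrix.mul_assoc, ← Matrix.mul_assoc (1 - e), he2, ← Matrix.mul_assoc, huc',
        Matrix.mul_assoc, huu, Matrix.mul_one]
    have e3 : u y * e * ((1 - e) * u x₀) = 0 := by
      rw [Matrix.mul_assoc, ← Matrix.mul_assoc e, he0, Matrix.zero_mul, Matrix.mul_zero]
    have e4 : u x₀ * (1 - e) * (e * u y) = 0 := by
      rw [Matrix.mul_assoc, ← Matrix.mul_assoc (1 - e), he1, Matrix.zero_mul, Matrix.mul_zero]
    rw [Matrix.add_mul, Matrix.mul_add, Matrix.mul_add, e1, e2, e3, e4]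
    abel
  have hF : EMap Neg.neg (R * f + (1 - f)) (R * e + (1 - e))
      fun y => u y * e + u x₀ * (1 - e) := by
    refine ⟨by have := hu.cont; fun_prop, fun y => ?_⟩
    have h1 : (u (-y) * e + u x₀ * (1 - e)) * (R * e + (1 - e)) =
        R * u y * e + u x₀ * (1 - e) := by
      have a1 : u (-y) * e * (R * e) = R * u y * e := by
        rw [Matrix.mul_assoc, ← Matrix.mul_assoc e, he.comm, Matrix.mul_assoc, he.idem,
          ← Matrix.mul_assoc, hu.eqv]
      have a2 : u x₀ * (1 - e) * (R * e) = 0 := by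
        rw [← he.comm, Matrix.mul_assoc, ← Matrix.mul_assoc (1 - e), he1, Matrix.zero_mul,
          Matrix.mul_zero]
      rw [Matrix.add_mul, Matrix.mul_add, Matrix.mul_add, a1, a2, Matrix.mul_assoc (u _) e,
        he0, Matrix.mul_assoc (u x₀), he2, Matrix.mul_zero]
      abel
    have h2 : (R * f + (1 - f)) * (u y * e + u x₀ * (1 - e)) =
        R * u y * e + u x₀ * (1 - e) := by
      rw [huc, huc', Matrix.add_mul, Matrix.mul_add, Matrix.mul_add, Matrix.mul_assoc R,
        Matrix.mul_assoc R, ← Matrix.mul_assoc f, ← Matrix.mul_assoc f, hf.idem, hf0,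
        ← Matrix.mul_assoc (1 - f), ← Matrix.mul_assoc (1 - f), hf1, hf2, Matrix.mul_assoc R,
        huc]
      simp
    exact h1.trans h2.symm
  obtain ⟨x, hx, hxe⟩ := exists_trace_sub_eq hT hf.cut_ord he.cut_ord hF hFu
  refine ⟨x, hx, ?_⟩
  have htr : e.trace = f.trace := by
    have h := congrArg (fun m => (m * u x₀).trace) (huc x₀)
    rwa [Matrix.trace_mul_comm, ← Matrix.mul_assoc, huu, Matrix.one_mul, Matrix.mul_assoc, huu,
      Matrix.mul_one] at h
  have h1 : (R * e).trace = (ρ * p).trace := by simp [R, e, dsum_mul, trace_dsum]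
  have h2 : (R * f).trace = (ς * q).trace := by simp [R, f, dsum_mul, trace_dsum]
  rw [Matrix.trace_add, Matrix.trace_add, Matrix.trace_sub, Matrix.trace_sub, h1, h2] at hxe
  linear_combination hxe - htr

end Disc

/-- Isomorphic constant bundles over the unit sphere of a space of dimension `2 * n + 1` have
traces congruent modulo `2 ^ (n + 1)`. -/
theorem trDiv_US (n : ℕ) {V : Type} [NormedAddCommGroup V] [NormedSpace ℝ V]
    (hV : Module.finrank ℝ V = 2 * n + 1) : TrDiv (Neg.neg : US V → US V) (n + 1) := by
  induction n generalizing V with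
  | zero =>
    have : FiniteDimensional ℝ V := Module.finite_of_finrank_eq_succ hV
    exact trDiv_US_real.of_finrank_eq (by simp [hV])
  | succ n ih =>
    have : FiniteDimensional ℝ V := Module.finite_of_finrank_eq_succ hV
    have h := ih (V := EuclideanSpace ℝ (Fin (2 * n + 1))) (by simp)
    exact h.prod_complex.of_finrank_eq (by simp [hV]; ring)

end

section

open Matrix unitInterval
open scoped Kronecker

/-! ### Operations on values -/

section Ops
variable {Y : Type*} [TopologicalSpace Y] {τ : Y → Y} {κ ι : Type}
  [Fintype κ] [Fintype ι] [DecidableEq ι] [DecidableEq κ]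
  {ρ : Matrix ι ι ℂ} {P Q : Y → Matrix ι ι ℂ} {x y : ℂ}

theorem EMap.smul_rep {a : Matrix κ κ ℂ} {b : Matrix ι ι ℂ} {F : Y → Matrix κ ι ℂ}
    (h : EMap τ a b F) (ω : ℂ) : EMap τ (ω • a) (ω • b) F :=
  ⟨h.cont, fun y => by rw [Matrix.mul_smul, h.eqv, Matrix.smul_mul]⟩

theorem BIso.smul_rep {ς : Matrix κ κ ℂ} {Q : Y → Matrix κ κ ℂ} (h : BIso τ ρ ς P Q) (ω : ℂ) :
    BIso τ (ω • ρ) (ω • ς) P Q := by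
  obtain ⟨A, B, hA, hB, h1, h2⟩ := h
  exact ⟨A, B, hA.smul_rep ω, hB.smul_rep ω, h1, h2⟩

theorem IsCon.smul_rep {p : Matrix ι ι ℂ} (h : IsCon ρ p) {ω : ℂ} (hω : ω ^ 6 = 1) :
    IsCon (ω • ρ) p :=
  ⟨by rw [Matrix.mul_smul, h.comm, Matrix.smul_mul], h.idem, by rw [smul_pow, hω, h.ord, one_smul]⟩

theorem HasVal.smul_rep (h : HasVal τ ρ P x) {ω : ℂ} (hω : ω ^ 6 = 1) :
    HasVal τ (ω • ρ) P (ω * x) := by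
  obtain ⟨κ, _, _, μ, _, _, δ, d, ς, q, hd, hq, hi, rfl⟩ := h
  refine ⟨κ, _, _, μ, _, _, ω • δ, d, ω • ς, q, hd.smul_rep hω, hq.smul_rep hω, ?_, ?_⟩
  · have := hi.smul_rep ω
    simpa only [_root_.dsum, fromBlocks_smul, smul_zero] using this
  · rw [Matrix.smul_mul, Matrix.smul_mul, Matrix.trace_smul, Matrix.trace_smul, smul_eq_mul,
      smul_eq_mul, mul_sub]

theorem IsBun.add (hP : IsBun τ ρ P) (hQ : IsBun τ ρ Q) (h : ∀ y, P y * Q y = 0)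
    (h' : ∀ y, Q y * P y = 0) : IsBun τ ρ fun y => P y + Q y :=
  ⟨hP.emap.add hQ.emap, fun y => by
    rw [Matrix.add_mul, Matrix.mul_add, Matrix.mul_add, h, h', hP.idem, hQ.idem]; simp, hP.ord⟩

theorem HasVal.add (hP : IsBun τ ρ P) (hQ : IsBun τ ρ Q) (h : ∀ y, P y * Q y = 0)
    (h' : ∀ y, Q y * P y = 0) (hx : HasVal τ ρ P x) (hy : HasVal τ ρ Q y) :
    HasVal τ ρ (fun y => P y + Q y) (x + y) := by
  refine HasVal.biso (hP.add hQ h h') (hx.dsum hP hQ hy)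
    ⟨fun y => fromCols (P y) (Q y), fun y => fromRows (P y) (Q y), hP.emap.fromCols hQ.emap,
      hP.emap.fromRows hQ.emap, fun y => ?_, fun y => ?_⟩
  · rw [fromRows_mul_fromCols, hP.idem, hQ.idem, h, h']
    rfl
  · rw [fromCols_mul_fromRows, hP.idem, hQ.idem]

/-- A bundle which is a sum of three bundles permuted cyclically by the representation has value
zero, up to multiplication by three. -/
theorem HasVal.three_mul_of_cyclic {N : ℕ} (hT : TrDiv τ N) {S : ZMod 3 → Y → Matrix ι ι ℂ}
    (hS : ∀ i, Continuous (S i)) (hSi : ∀ i y, S i y * S i y = S i y)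
    (hSo : ∀ i j, i ≠ j → ∀ y, S i y * S j y = 0)
    (hSe : ∀ i y, S (i + 1) (τ y) * ρ = ρ * S i y) (hρ : ρ ^ 6 = 1)
    (h : HasVal τ ρ (fun y => S 0 y + S 1 y + S 2 y) x) :
    ∃ a : ℂ, IsIntegral ℤ a ∧ 3 * x = 2 ^ N * a := by
  have o01 := hSo 0 1 (by decide)
  have o02 := hSo 0 2 (by decide)
  have o10 := hSo 1 0 (by decide)
  have o12 := hSo 1 2 (by decide)
  have o20 := hSo 2 0 (by decide)
  have o21 := hSo 2 1 (by decide)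
  have e1 : ∀ y, S 1 (τ y) * ρ = ρ * S 0 y := hSe 0
  have e2 : ∀ y, S 2 (τ y) * ρ = ρ * S 1 y := hSe 1
  have e0 : ∀ y, S 0 (τ y) * ρ = ρ * S 2 y := hSe 2
  have c0 := hS 0
  have c1 := hS 1
  have c2 := hS 2
  obtain ⟨ω, hω⟩ : ∃ ω : ℂ, IsPrimitiveRoot ω 3 := ⟨_, Complex.isPrimitiveRoot_exp 3 (by norm_num)⟩
  have hω3 : ω ^ 3 = 1 := hω.pow_eq_one
  have hω6 : ω ^ 6 = 1 := by rw [show 6 = 3 * 2 from rfl, pow_mul, hω3, one_pow]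
  have hωs : 1 + ω + ω ^ 2 = 0 := by
    have := hω.geom_sum_eq_zero (by norm_num)
    simpa [Finset.sum_range_succ] using this
  have hB : IsBun τ ρ fun y => S 0 y + S 1 y + S 2 y :=
    ⟨⟨by fun_prop, fun y => by
      simp only [Matrix.add_mul, Matrix.mul_add, e0, e1, e2]; abel⟩, fun y => by
      simp only [Matrix.add_mul, Matrix.mul_add, hSi, o01, o02, o10, o12, o20, o21]; simp, hρ⟩
  have hi : BIso τ ρ (ω • ρ) (fun y => S 0 y + S 1 y + S 2 y) fun y => S 0 y + S 1 y + S 2 y := by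
    refine ⟨fun y => S 0 y + ω • S 1 y + ω ^ 2 • S 2 y, fun y => S 0 y + ω ^ 2 • S 1 y + ω • S 2 y,
      ⟨by fun_prop, fun y => ?_⟩, ⟨by fun_prop, fun y => ?_⟩, fun y => ?_, fun y => ?_⟩
    · simp only [Matrix.add_mul, Matrix.mul_add, Matrix.smul_mul, Matrix.mul_smul, e0, e1, e2,
        smul_smul]
      simp only [show ω ^ 2 * ω = 1 by rw [← hω3]; ring,
        one_smul, show ω * ω = ω ^ 2 by ring]
      abel
    · simp only [Matrix.add_mul, Matrix.mul_add, Matrix.smul_mul, Matrix.mul_smul, e0, e1, e2,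
        smul_add, smul_smul]
      simp only [show ω * ω ^ 2 = 1 by rw [← hω3]; ring,
        one_smul, show ω * ω = ω ^ 2 by ring]
      abel
    · simp only [Matrix.add_mul, Matrix.mul_add, Matrix.smul_mul, Matrix.mul_smul, hSi, o01, o02,
        o10, o12, o20, o21, smul_zero, add_zero, zero_add, smul_smul]
      rw [show ω * ω ^ 2 = 1 by rw [← hω3]; ring, show ω ^ 2 * ω = 1 by rw [← hω3]; ring]
      simp
    · simp only [Matrix.add_mul, Matrix.mul_add, Matrix.smul_mul, Matrix.mul_smul, hSi, o01, o02,
        o10, o12, o20, o21, smul_zero, add_zero, zero_add, smul_smul]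
      rw [show ω * ω ^ 2 = 1 by rw [← hω3]; ring, show ω ^ 2 * ω = 1 by rw [← hω3]; ring]
      simp
  have hB' : IsBun τ (ω • ρ) fun y => S 0 y + S 1 y + S 2 y :=
    ⟨hB.emap.smul_rep ω, hB.idem, by rw [smul_pow, hω6, hρ, one_smul]⟩
  obtain ⟨a, ha, hae⟩ := HasVal.unique hT hB' (HasVal.biso hB' h hi) (h.smul_rep hω6)
  have hωi : IsIntegral ℤ ω := ⟨Polynomial.X ^ 3 - 1, Polynomial.monic_X_pow_sub_C 1 (by norm_num),
    by simp [hω3]⟩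
  refine ⟨(1 - ω ^ 2) * a, (isIntegral_one.sub (hωi.pow 2)).mul ha, ?_⟩
  linear_combination (1 - ω ^ 2) * hae - x * hω3 + x * hωs

theorem BIso.kron {ς : Matrix κ κ ℂ} {Q : Y → Matrix κ κ ℂ} {μ : Type} [Fintype μ] [DecidableEq μ]
    {υ r : Matrix μ μ ℂ} (hr : IsCon υ r) (h : BIso τ ρ ς P Q) :
    BIso τ (ρ ⊗ₖ υ) (ς ⊗ₖ υ) (fun y => P y ⊗ₖ r) fun y => Q y ⊗ₖ r := by
  obtain ⟨A, B, hA, hB, h1, h2⟩ := h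
  refine ⟨fun y => A y ⊗ₖ r, fun y => B y ⊗ₖ r, ⟨?_, fun y => ?_⟩, ⟨?_, fun y => ?_⟩,
    fun y => ?_, fun y => ?_⟩
  · refine continuous_matrix fun i j => ?_
    exact (hA.cont.matrix_elem _ _).mul continuous_const
  · rw [← mul_kronecker_mul, ← mul_kronecker_mul, hA.eqv, hr.comm]
  · refine continuous_matrix fun i j => ?_
    exact (hB.cont.matrix_elem _ _).mul continuous_const
  · rw [← mul_kronecker_mul, ← mul_kronecker_mul, hB.eqv, hr.comm]
  · rw [← mul_kronecker_mul, h1, hr.idem]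
  · rw [← mul_kronecker_mul, h2, hr.idem]

theorem kronecker_pow' {μ : Type} [Fintype μ] [DecidableEq μ] (A : Matrix ι ι ℂ) (B : Matrix μ μ ℂ)
    (n : ℕ) : (A ⊗ₖ B) ^ n = (A ^ n) ⊗ₖ (B ^ n) := by
  induction n with
  | zero => simp
  | succ n ih => rw [pow_succ, ih, ← mul_kronecker_mul, pow_succ, pow_succ]

theorem IsBun.kron {μ : Type} [Fintype μ] [DecidableEq μ]
    {υ r : Matrix μ μ ℂ} (hP : IsBun τ ρ P) (hr : IsCon υ r) :
    IsBun τ (ρ ⊗ₖ υ) fun y => P y ⊗ₖ r := by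
  refine ⟨⟨?_, fun y => ?_⟩, fun y => ?_, ?_⟩
  · refine continuous_matrix fun i j => ?_
    exact (hP.emap.cont.matrix_elem _ _).mul continuous_const
  · rw [← mul_kronecker_mul, ← mul_kronecker_mul, hP.emap.eqv, hr.comm]
  · rw [← mul_kronecker_mul, hP.idem, hr.idem]
  · rw [kronecker_pow', hP.ord, hr.ord, one_kronecker_one]

theorem IsCon.kron {μ : Type} [Fintype μ] [DecidableEq μ] {p : Matrix ι ι ℂ}
    {υ r : Matrix μ μ ℂ} (hP : IsCon ρ p) (hr : IsCon υ r) : IsCon (ρ ⊗ₖ υ) (p ⊗ₖ r) :=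
  ⟨by rw [← mul_kronecker_mul, ← mul_kronecker_mul, hP.comm, hr.comm],
    by rw [← mul_kronecker_mul, hP.idem, hr.idem],
    by rw [kronecker_pow', hP.ord, hr.ord, one_kronecker_one]⟩

theorem HasVal.kron {μ : Type} [Fintype μ] [DecidableEq μ] {υ r : Matrix μ μ ℂ}
    (hP : IsBun τ ρ P) (hr : IsCon υ r) (h : HasVal τ ρ P x) :
    HasVal τ (ρ ⊗ₖ υ) (fun y => P y ⊗ₖ r) (x * (υ * r).trace) := by
  obtain ⟨α, _, _, β, _, _, δ, d, ς, q, hd, hq, hi, rfl⟩ := h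
  refine ⟨_, inferInstance, inferInstance, _, inferInstance, inferInstance, δ ⊗ₖ υ, d ⊗ₖ r,
    ς ⊗ₖ υ, q ⊗ₖ r, hd.kron hr, hq.kron hr, ?_, ?_⟩
  · have e : ∀ (A : Matrix ι ι ℂ) (D : Matrix α α ℂ) (C : Matrix μ μ ℂ),
        reindex (Equiv.sumProdDistrib ι α μ) (Equiv.sumProdDistrib ι α μ) (_root_.dsum A D ⊗ₖ C) =
          _root_.dsum (A ⊗ₖ C) (D ⊗ₖ C) := fun A D C => by
      ext (i | i) (j | j) <;> simp [_root_.dsum]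
    have h1 := BIso.reindex (Equiv.sumProdDistrib ι α μ)
      ((hP.dsum (hd.isBun (τ := τ))).kron hr)
    simp only [e] at h1
    exact h1.symm.trans ((hP.kron hr).dsum ((hd.kron hr).isBun (τ := τ))).idem
      (fun _ => (hq.kron hr).idem) (hi.kron hr)
  · rw [← mul_kronecker_mul, ← mul_kronecker_mul, trace_kronecker, trace_kronecker, sub_mul]

end Ops

/-! ### Cubes -/

section Ten
variable {κ ι μ : Type*} [Fintype κ] [Fintype ι] [Fintype μ] [DecidableEq ι] [DecidableEq κ]

/-- The tensor product of three matrices. -/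
def ten (A B C : Matrix κ ι ℂ) : Matrix (κ × κ × κ) (ι × ι × ι) ℂ := A ⊗ₖ (B ⊗ₖ C)

theorem ten_mul (A B C : Matrix κ ι ℂ) (A' B' C' : Matrix ι μ ℂ) :
    ten A B C * ten A' B' C' = ten (A * A') (B * B') (C * C') := by
  simp only [ten, ← mul_kronecker_mul]

theorem ten_one : ten (1 : Matrix ι ι ℂ) 1 1 = 1 := by simp only [ten, one_kronecker_one]

theorem ten_pow (A B C : Matrix ι ι ℂ) (n : ℕ) : ten A B C ^ n = ten (A ^ n) (B ^ n) (C ^ n) := by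
  induction n with
  | zero => simp [ten_one]
  | succ n ih => simp only [pow_succ, ih, ten_mul]

theorem ten_add_left (A A' B C : Matrix κ ι ℂ) : ten (A + A') B C = ten A B C + ten A' B C := by
  simp only [ten, add_kronecker]

theorem ten_add_mid (A B B' C : Matrix κ ι ℂ) : ten A (B + B') C = ten A B C + ten A B' C := by
  simp only [ten, add_kronecker, kronecker_add]

theorem ten_add_right (A B C C' : Matrix κ ι ℂ) : ten A B (C + C') = ten A B C + ten A B C' := by
  simp only [ten, kronecker_add]

theorem ten_smul_left (c : ℂ) (A B C : Matrix κ ι ℂ) : ten (c • A) B C = c • ten A B C := by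
  simp only [ten, smul_kronecker]

theorem ten_smul_mid (c : ℂ) (A B C : Matrix κ ι ℂ) : ten A (c • B) C = c • ten A B C := by
  simp only [ten, smul_kronecker, kronecker_smul]

theorem ten_smul_right (c : ℂ) (A B C : Matrix κ ι ℂ) : ten A B (c • C) = c • ten A B C := by
  simp only [ten, kronecker_smul]

theorem ten_zero_left (B C : Matrix κ ι ℂ) : ten 0 B C = 0 := by simp [ten]

theorem ten_zero_mid (A C : Matrix κ ι ℂ) : ten A 0 C = 0 := by simp [ten]

theorem ten_zero_right (A B : Matrix κ ι ℂ) : ten A B 0 = 0 := by simp [ten]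

theorem continuous_ten {Y : Type*} [TopologicalSpace Y] {A B C : Y → Matrix κ ι ℂ}
    (hA : Continuous A) (hB : Continuous B) (hC : Continuous C) :
    Continuous fun y => ten (A y) (B y) (C y) := by
  refine continuous_matrix fun i j => ?_
  simp only [ten, kroneckerMap_apply]
  exact (hA.matrix_elem _ _).mul ((hB.matrix_elem _ _).mul (hC.matrix_elem _ _))

variable (ι) in
/-- The cyclic permutation of the factors of a triple product. -/
def cycPerm : ι × ι × ι ≃ ι × ι × ι where
  toFun x := (x.2.1, x.2.2, x.1)
  invFun x := (x.2.2, x.1, x.2.1)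
  left_inv _ := rfl
  right_inv _ := rfl

variable (ι) in
/-- The matrix permuting the factors of a triple tensor product cyclically. -/
def cycMat : Matrix (ι × ι × ι) (ι × ι × ι) ℂ := (1 : Matrix _ _ ℂ).submatrix (cycPerm ι) id

theorem cycMat_mul (M : Matrix (ι × ι × ι) μ ℂ) :
    cycMat ι * M = M.submatrix (cycPerm ι) id := by
  ext i j
  simp [cycMat, Matrix.mul_apply, Matrix.one_apply]

theorem mul_cycMat (M : Matrix μ (ι × ι × ι) ℂ) :
    M * cycMat ι = M.submatrix id (cycPerm ι).symm := by
  ext i j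
  simp [cycMat, Matrix.mul_apply, Matrix.one_apply, ← Equiv.eq_symm_apply]

theorem cycMat_mul_ten (A B C : Matrix κ ι ℂ) :
    cycMat κ * ten A B C = ten C A B * cycMat ι := by
  rw [cycMat_mul, mul_cycMat]
  ext i j
  simp only [ten, submatrix_apply, kroneckerMap_apply, cycPerm, Equiv.coe_fn_mk, id,
    Equiv.coe_fn_symm_mk]
  ring

theorem cycMat_pow_three : cycMat ι ^ 3 = 1 := by
  rw [pow_succ, pow_two, cycMat_mul, mul_cycMat]
  ext i j
  obtain ⟨a, b, c⟩ := i
  obtain ⟨a', b', c'⟩ := j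
  simp only [cycMat, submatrix_apply, cycPerm, Equiv.coe_fn_mk, id, Equiv.coe_fn_symm_mk,
    Matrix.one_apply, Prod.mk.injEq]
  congr 1
  simp only [eq_iff_iff]
  tauto

theorem trace_ten_mul_cycMat (A B C : Matrix ι ι ℂ) :
    (ten A B C * cycMat ι).trace = (A * C * B).trace := by
  rw [mul_cycMat]
  simp only [Matrix.trace, Matrix.diag, submatrix_apply, Matrix.mul_apply, Fintype.sum_prod_type,
    ten, kroneckerMap_apply, cycPerm, id, Equiv.coe_fn_symm_mk, Finset.sum_mul]
  refine Finset.sum_congr rfl fun a _ => Finset.sum_congr rfl fun b _ =>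
    Finset.sum_congr rfl fun c _ => ?_
  ring

theorem commute_ten_cycMat (A : Matrix ι ι ℂ) : Commute (ten A A A) (cycMat ι) :=
  (cycMat_mul_ten A A A).symm

theorem ten_mul_cycMat_pow_six {ρ : Matrix ι ι ℂ} (h : ρ ^ 6 = 1) :
    (ten ρ ρ ρ * cycMat ι) ^ 6 = 1 := by
  rw [(commute_ten_cycMat ρ).mul_pow, ten_pow, h, ten_one, show 6 = 3 * 2 from rfl, pow_mul,
    cycMat_pow_three]
  simp

end Ten

section Cube
variable {Y : Type*} [TopologicalSpace Y] {τ : Y → Y} {κ ι : Type}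
  [Fintype κ] [Fintype ι] [DecidableEq ι] [DecidableEq κ]
  {ρ : Matrix ι ι ℂ} {ς : Matrix κ κ ℂ} {P : Y → Matrix ι ι ℂ} {Q : Y → Matrix κ κ ℂ}
  {x y z : ℂ}

theorem EMap.ten {A : Y → Matrix κ ι ℂ} (h : EMap τ ς ρ A) :
    EMap τ (ten ς ς ς * cycMat κ) (ten ρ ρ ρ * cycMat ι) fun y => ten (A y) (A y) (A y) :=
  ⟨continuous_ten h.cont h.cont h.cont, fun y => by
    rw [← Matrix.mul_assoc, ten_mul, h.eqv, ← ten_mul, Matrix.mul_assoc, Matrix.mul_assoc,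
      cycMat_mul_ten]⟩

theorem IsBun.ten (h : IsBun τ ρ P) :
    IsBun τ (ten ρ ρ ρ * cycMat ι) fun y => ten (P y) (P y) (P y) :=
  ⟨h.emap.ten, fun y => by rw [ten_mul, h.idem], ten_mul_cycMat_pow_six h.ord⟩

theorem IsCon.ten {p : Matrix ι ι ℂ} (h : IsCon ρ p) :
    IsCon (ten ρ ρ ρ * cycMat ι) (ten p p p) :=
  ⟨by rw [← Matrix.mul_assoc, ten_mul, h.comm, ← ten_mul, Matrix.mul_assoc, Matrix.mul_assoc,
    cycMat_mul_ten], by rw [ten_mul, h.idem], ten_mul_cycMat_pow_six h.ord⟩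

theorem IsCon.trace_ten {p : Matrix ι ι ℂ} (h : IsCon ρ p) :
    (_root_.ten ρ ρ ρ * cycMat ι * _root_.ten p p p).trace = (ρ ^ 3 * p).trace := by
  have hc : Commute ρ p := h.comm.symm
  rw [Matrix.mul_assoc, cycMat_mul_ten, ← Matrix.mul_assoc, ten_mul, trace_ten_mul_cycMat,
    show ρ * p * (ρ * p) * (ρ * p) = (ρ * p) ^ 3 by simp only [pow_succ, pow_zero, one_mul],
    hc.mul_pow, show p ^ 3 = p by simp only [pow_succ, pow_zero, one_mul, h.idem]]

theorem BIso.ten (h : BIso τ ρ ς P Q) :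
    BIso τ (ten ρ ρ ρ * cycMat ι) (ten ς ς ς * cycMat κ) (fun y => ten (P y) (P y) (P y))
      fun y => ten (Q y) (Q y) (Q y) := by
  obtain ⟨A, B, hA, hB, h1, h2⟩ := h
  exact ⟨_, _, hA.ten, hB.ten, fun y => by rw [ten_mul, h1], fun y => by rw [ten_mul, h2]⟩

/-- The mixed terms in the cube of a sum. -/
theorem HasVal.mixed {N : ℕ} (hτ : AllVal τ) (hT : TrDiv τ N) (hP : IsBun τ ρ P)
    {Q : Y → Matrix ι ι ℂ} (hQ : IsBun τ ρ Q) (h : ∀ y, P y * Q y = 0)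
    (h' : ∀ y, Q y * P y = 0) :
    IsBun τ (_root_.ten ρ ρ ρ * cycMat ι) (fun y => _root_.ten (P y) (P y) (Q y) +
      _root_.ten (Q y) (P y) (P y) + _root_.ten (P y) (Q y) (P y)) ∧
    ∃ x a : ℂ, IsIntegral ℤ a ∧ 3 * x = 2 ^ N * a ∧
    HasVal τ (_root_.ten ρ ρ ρ * cycMat ι) (fun y => _root_.ten (P y) (P y) (Q y) +
      _root_.ten (Q y) (P y) (P y) + _root_.ten (P y) (Q y) (P y)) x := by
  have e : ∀ (A B C : Y → Matrix ι ι ℂ), IsBun τ ρ A → IsBun τ ρ B → IsBun τ ρ C → ∀ y,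
      _root_.ten (A (τ y)) (B (τ y)) (C (τ y)) * (_root_.ten ρ ρ ρ * cycMat ι) =
        _root_.ten ρ ρ ρ * cycMat ι * _root_.ten (B y) (C y) (A y) := fun A B C hA hB hC y => by
    rw [← Matrix.mul_assoc, ten_mul, hA.emap.eqv, hB.emap.eqv, hC.emap.eqv, Matrix.mul_assoc,
      cycMat_mul_ten, ← Matrix.mul_assoc, ten_mul]
  have e1 := e _ _ _ hP hP hQ
  have e2 := e _ _ _ hQ hP hP
  have e3 := e _ _ _ hP hQ hP
  have c1 := continuous_ten hP.emap.cont hP.emap.cont hQ.emap.cont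
  have c2 := continuous_ten hQ.emap.cont hP.emap.cont hP.emap.cont
  have c3 := continuous_ten hP.emap.cont hQ.emap.cont hP.emap.cont
  have hB : IsBun τ (_root_.ten ρ ρ ρ * cycMat ι) (fun y => _root_.ten (P y) (P y) (Q y) +
      _root_.ten (Q y) (P y) (P y) + _root_.ten (P y) (Q y) (P y)) := by
    refine ⟨⟨(c1.add c2).add c3, fun y => ?_⟩, fun y => ?_, ten_mul_cycMat_pow_six hP.ord⟩
    · simp only [Matrix.add_mul, Matrix.mul_add, e1, e2, e3]
      abel
    · simp only [Matrix.add_mul, Matrix.mul_add, ten_mul, h, h', hP.idem, hQ.idem,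
        ten_zero_mid, ten_zero_right, add_zero, zero_add]
  refine ⟨hB, ?_⟩
  obtain ⟨x, hx⟩ := hτ _ _ _ hB
  obtain ⟨a, ha, hxa⟩ := HasVal.three_mul_of_cyclic (S := ![fun y => _root_.ten (P y) (P y) (Q y),
    fun y => _root_.ten (Q y) (P y) (P y), fun y => _root_.ten (P y) (Q y) (P y)]) hT
    (fun i => by fin_cases i; exacts [c1, c2, c3])
    (fun i y => by fin_cases i <;> simp [ten_mul, hP.idem, hQ.idem])
    (fun i j hij y => by
      fin_cases i <;> fin_cases j <;> first | exact absurd rfl hij | skip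
      all_goals simp [ten_mul, hP.idem, h, h', ten_zero_mid,
        ten_zero_right])
    (fun i y => by fin_cases i; exacts [e2 y, e3 y, e1 y]) (ten_mul_cycMat_pow_six hP.ord) hx
  exact ⟨x, a, ha, hxa, hx⟩

theorem HasVal.ten_add {N : ℕ} (hτ : AllVal τ) (hT : TrDiv τ N) (hP : IsBun τ ρ P)
    {Q : Y → Matrix ι ι ℂ} (hQ : IsBun τ ρ Q) (h : ∀ y, P y * Q y = 0)
    (h' : ∀ y, Q y * P y = 0)
    (hx : HasVal τ (_root_.ten ρ ρ ρ * cycMat ι) (fun y => _root_.ten (P y) (P y) (P y)) x)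
    (hy : HasVal τ (_root_.ten ρ ρ ρ * cycMat ι) (fun y => _root_.ten (Q y) (Q y) (Q y)) y)
    (hz : HasVal τ (_root_.ten ρ ρ ρ * cycMat ι)
      (fun y => _root_.ten (P y + Q y) (P y + Q y) (P y + Q y)) z) :
    ∃ a : ℂ, IsIntegral ℤ a ∧ 3 * (z - x - y) = 2 ^ N * a := by
  obtain ⟨b1, x1, a1, ha1, hxa1, hx1⟩ := HasVal.mixed hτ hT hP hQ h h'
  obtain ⟨b2, x2, a2, ha2, hxa2, hx2⟩ := HasVal.mixed hτ hT hQ hP h' h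
  have o1 := HasVal.add hP.ten hQ.ten (fun y => by rw [ten_mul, h, ten_zero_left])
    (fun y => by rw [ten_mul, h', ten_zero_left]) hx hy
  have o2 := HasVal.add b1 b2
    (fun y => by simp [Matrix.add_mul, Matrix.mul_add, ten_mul, h, h', ten_zero_left, ten_zero_mid,
      ten_zero_right])
    (fun y => by simp [Matrix.add_mul, Matrix.mul_add, ten_mul, h, h', ten_zero_left, ten_zero_mid,
      ten_zero_right]) hx1 hx2
  have b3 := IsBun.add hP.ten hQ.ten (fun y => by rw [ten_mul, h, ten_zero_left])
    (fun y => by rw [ten_mul, h', ten_zero_left])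
  have b4 := IsBun.add b1 b2
    (fun y => by simp [Matrix.add_mul, Matrix.mul_add, ten_mul, h, h', ten_zero_left, ten_zero_mid,
      ten_zero_right])
    (fun y => by simp [Matrix.add_mul, Matrix.mul_add, ten_mul, h, h', ten_zero_left, ten_zero_mid,
      ten_zero_right])
  have o3 := HasVal.add b3 b4
    (fun y => by simp [Matrix.add_mul, Matrix.mul_add, ten_mul, h, h', ten_zero_left, ten_zero_mid,
      ten_zero_right])
    (fun y => by simp [Matrix.add_mul, Matrix.mul_add, ten_mul, h, h', ten_zero_left, ten_zero_mid,
      ten_zero_right]) o1 o2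
  have hf : (fun y => _root_.ten (P y + Q y) (P y + Q y) (P y + Q y)) = fun y =>
      _root_.ten (P y) (P y) (P y) + _root_.ten (Q y) (Q y) (Q y) +
      (_root_.ten (P y) (P y) (Q y) + _root_.ten (Q y) (P y) (P y) + _root_.ten (P y) (Q y) (P y) +
      (_root_.ten (Q y) (Q y) (P y) + _root_.ten (P y) (Q y) (Q y) +
        _root_.ten (Q y) (P y) (Q y))) := by
    funext y
    simp only [ten_add_left, ten_add_mid, ten_add_right]
    abel
  obtain ⟨a, ha, hza⟩ := HasVal.unique hT (hP.add hQ h h').ten hz (hf ▸ o3)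
  refine ⟨3 * a + a1 + a2, ?_, by linear_combination 3 * hza + hxa1 + hxa2⟩
  exact (((isIntegral_algebraMap (x := (3 : ℤ))).mul ha).add ha1).add ha2

/-- The value of a cube, up to multiplication by three. -/
theorem HasVal.cube {N : ℕ} (hτ : AllVal τ) (hT : TrDiv τ N) (hτ' : ∀ y, τ (τ y) = y)
    {P : Y → Matrix ι ι ℂ} (hP : IsBun τ 1 P) (hx : HasVal τ 1 P x)
    (hy : HasVal τ (cycMat ι) (fun y => _root_.ten (P y) (P y) (P y)) y) :
    ∃ a : ℂ, IsIntegral ℤ a ∧ 3 * (x - y) = 2 ^ N * a := by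
  obtain ⟨α, _, _, β, _, _, δ, d, ς, q, hd, hq, hi, rfl⟩ := id hx
  have h1 : HasVal τ 1 P ((ς ^ 3 * q).trace - (δ ^ 3 * d).trace) := by
    refine ⟨α, _, _, β, _, _, δ ^ 3, d, ς ^ 3, q, ⟨(Commute.pow_left (hd.comm.symm : Commute δ d) 3).symm,
      hd.idem, by rw [← pow_mul, show 3 * 6 = 6 * 3 from rfl, pow_mul, hd.ord, one_pow]⟩,
      ⟨(Commute.pow_left (hq.comm.symm : Commute ς q) 3).symm, hq.idem,
        by rw [← pow_mul, show 3 * 6 = 6 * 3 from rfl, pow_mul, hq.ord, one_pow]⟩, ?_, rfl⟩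
    obtain ⟨A, B, hA, hB, hBA, hAB⟩ := hi
    have key : ∀ {μ ν : Type} [Fintype μ] [Fintype ν] [DecidableEq μ] [DecidableEq ν]
        {a : Matrix μ μ ℂ} {b : Matrix ν ν ℂ} {F : Y → Matrix μ ν ℂ}, EMap τ a b F →
        EMap τ (a ^ 3) (b ^ 3) F := fun {μ ν _ _ _ _ a b F} hF => ⟨hF.cont, fun y => by
      have := hF.eqv (τ (τ y))
      rw [hτ'] at this
      simp only [pow_succ, pow_zero, one_mul, Matrix.mul_assoc]
      rw [← hF.eqv, ← Matrix.mul_assoc a (F (τ y)), ← hF.eqv, hτ', ← Matrix.mul_assoc,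
        ← Matrix.mul_assoc a (F y * b), ← Matrix.mul_assoc a (F y), ← hF.eqv]
      simp only [Matrix.mul_assoc]⟩
    have h3 := key hA
    have h4 := key hB
    rw [dsum_pow, one_pow] at h3 h4
    exact ⟨A, B, h3, h4, hBA, hAB⟩
  obtain ⟨a, ha, hxa⟩ := HasVal.unique hT hP hx h1
  set R : Matrix (ι ⊕ α) (ι ⊕ α) ℂ := _root_.dsum 1 δ
  have hR : R ^ 6 = 1 := by rw [dsum_pow, hd.ord, one_pow, dsum_one]
  have B0 : IsBun τ R fun y => _root_.dsum (P y) (0 : Matrix α α ℂ) :=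
    ⟨hP.emap.dsum EMap.zero, fun y => by rw [dsum_mul, hP.idem, Matrix.mul_zero], hR⟩
  have C1 : IsCon R (_root_.dsum (0 : Matrix ι ι ℂ) d) :=
    ⟨by rw [dsum_mul, dsum_mul, hd.comm, Matrix.mul_zero, Matrix.zero_mul],
      by rw [dsum_mul, hd.idem, Matrix.mul_zero], hR⟩
  have hi0 : BIso τ 1 R P fun y => _root_.dsum (P y) (0 : Matrix α α ℂ) := by
    refine ⟨fun y => fromRows (P y) 0, fun y => fromCols (P y) 0,
      hP.emap.fromRows EMap.zero, hP.emap.fromCols EMap.zero, fun y => ?_, fun y => ?_⟩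
    · rw [fromCols_mul_fromRows, hP.idem, Matrix.mul_zero, add_zero]
    · rw [fromRows_mul_fromCols, hP.idem, Matrix.mul_zero, Matrix.mul_zero, Matrix.zero_mul]
      rfl
  have hy0 : HasVal τ (_root_.ten R R R * cycMat _) (fun y => _root_.ten
      (_root_.dsum (P y) (0 : Matrix α α ℂ)) (_root_.dsum (P y) 0) (_root_.dsum (P y) 0)) y :=
    HasVal.biso B0.ten (by rwa [ten_one, Matrix.one_mul]) hi0.ten
  have hy1 := HasVal.con (τ := τ) C1.ten
  rw [C1.trace_ten] at hy1
  have hy2 : HasVal τ (_root_.ten R R R * cycMat _) (fun y => _root_.ten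
      (_root_.dsum (P y) d) (_root_.dsum (P y) d) (_root_.dsum (P y) d)) (ς ^ 3 * q).trace := by
    have := HasVal.con (τ := τ) hq.ten
    rw [hq.trace_ten] at this
    exact HasVal.biso ((⟨hP.emap.dsum hd.isBun.emap, fun y => by rw [dsum_mul, hP.idem, hd.idem],
      hR⟩ : IsBun τ R fun y => _root_.dsum (P y) d).ten) this hi.symm.ten
  have hs : ∀ y, _root_.dsum (P y) d = _root_.dsum (P y) 0 + _root_.dsum (0 : Matrix ι ι ℂ) d :=
    fun y => by ext (i | i) (j | j) <;> simp [_root_.dsum]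
  simp only [hs] at hy2
  obtain ⟨b, hb, hyb⟩ := HasVal.ten_add hτ hT B0 C1.isBun
    (fun y => by rw [dsum_mul, Matrix.mul_zero, Matrix.zero_mul]; simp [_root_.dsum])
    (fun y => by rw [dsum_mul, Matrix.mul_zero, Matrix.zero_mul]; simp [_root_.dsum]) hy0 hy1 hy2
  have ht : (R ^ 3 * _root_.dsum (0 : Matrix ι ι ℂ) d).trace = (δ ^ 3 * d).trace := by
    rw [dsum_pow, dsum_mul, trace_dsum, Matrix.mul_zero, Matrix.trace_zero, zero_add]
  rw [ht] at hyb
  exact ⟨3 * a + b, ((isIntegral_algebraMap (x := (3 : ℤ))).mul ha).add hb,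
    by linear_combination 3 * hxa + hyb⟩

/-- The value of the bundle attached to the cube of an involution, up to multiplication by
three. -/
theorem HasVal.cube_involution {N : ℕ} (hτ : AllVal τ) (hT : TrDiv τ N) (hτ' : ∀ y, τ (τ y) = y)
    {g : Y → Matrix ι ι ℂ} (hg : EMap τ 1 1 g) (hgg : ∀ y, g y * g y = 1)
    (hx : HasVal τ 1 (fun y => (1 / 2 : ℂ) • (1 + g y)) x) :
    ∃ z a : ℂ, IsIntegral ℤ a ∧ 3 * (x - z) = 2 ^ N * a ∧
    HasVal τ (cycMat ι) (fun y => (1 / 2 : ℂ) • (1 + _root_.ten (g y) (g y) (g y))) z := by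
  have hP : IsBun τ 1 fun y => (1 / 2 : ℂ) • (1 + g y) :=
    ⟨(EMap.one.add hg).smul continuous_const fun _ => rfl, fun y => by
      simp only [Matrix.smul_mul, Matrix.mul_smul, Matrix.add_mul, Matrix.mul_add, hgg,
        Matrix.one_mul, Matrix.mul_one]
      module, one_pow _⟩
  have hQ : IsBun τ 1 fun y => (1 / 2 : ℂ) • (1 - g y) :=
    ⟨(EMap.one.sub hg).smul continuous_const fun _ => rfl, fun y => by
      simp only [Matrix.smul_mul, Matrix.mul_smul, Matrix.sub_mul, Matrix.mul_sub, hgg,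
        Matrix.one_mul, Matrix.mul_one]
      module, one_pow _⟩
  have h : ∀ y, ((1 / 2 : ℂ) • (1 + g y)) * ((1 / 2 : ℂ) • (1 - g y)) = 0 := fun y => by
    simp only [Matrix.smul_mul, Matrix.mul_smul, Matrix.add_mul, Matrix.mul_sub, hgg,
      Matrix.one_mul, Matrix.mul_one]
    module
  have h' : ∀ y, ((1 / 2 : ℂ) • (1 - g y)) * ((1 / 2 : ℂ) • (1 + g y)) = 0 := fun y => by
    simp only [Matrix.smul_mul, Matrix.mul_smul, Matrix.sub_mul, Matrix.mul_add, hgg,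
      Matrix.one_mul, Matrix.mul_one]
    module
  have hP3 := hP.ten
  rw [ten_one, Matrix.one_mul] at hP3
  obtain ⟨y, hy⟩ := hτ _ _ _ hP3
  obtain ⟨a, ha, hxa⟩ := HasVal.cube hτ hT hτ' hP hx hy
  obtain ⟨b1, x1, a1, ha1, hxa1, hx1⟩ := HasVal.mixed hτ hT hQ hP h' h
  rw [ten_one, Matrix.one_mul] at b1 hx1
  have o := HasVal.add hP3 b1
    (fun y => by simp only [Matrix.mul_add, ten_mul, h,
      ten_zero_mid, ten_zero_right, add_zero])
    (fun y => by simp only [Matrix.add_mul, ten_mul, h',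
      ten_zero_mid, ten_zero_right, add_zero]) hy hx1
  refine ⟨y + x1, a - a1, ha.sub ha1, by linear_combination hxa - hxa1, ?_⟩
  convert o using 2 with y
  simp only [sub_eq_add_neg, ← neg_one_smul ℂ (g y), smul_add, ten_add_left, ten_add_mid,
    ten_add_right, ten_smul_left, ten_smul_mid, ten_smul_right, ten_one]
  module

end Cube

/-! ### Clifford matrices -/

section Anti
variable {R : Type*} [Ring R] [Algebra ℂ R]

theorem mul_list_prod_of_anti {α : Type*} {e : α → R} {x : R} {l : List α}
    (h : ∀ a ∈ l, x * e a = -(e a * x)) :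
    x * (l.map e).prod = (-1 : ℤ) ^ l.length • ((l.map e).prod * x) := by
  induction l with
  | nil => simp
  | cons a l ih =>
    simp only [List.map_cons, List.prod_cons, List.length_cons]
    rw [← mul_assoc, h a (by simp), neg_mul, mul_assoc, ih fun b hb => h b (by simp [hb]),
      pow_succ, mul_smul_comm, mul_assoc]
    simp

theorem exists_conj_of_anti {n : ℕ} {e f : ℕ → R} {Γ : R} {w : ℂ} (hw : 1 + w ≠ 0)
    (he : ∀ i < n, e i * e i = 1) (hf : ∀ i < n, f i * f i = 1)
    (hfe : ∀ i < n, f i * e i + e i * f i = (2 * w) • (1 : R))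
    (hee : ∀ i < n, ∀ j < n, i ≠ j → e i * e j = -(e j * e i))
    (hff : ∀ i < n, ∀ j < n, i ≠ j → f i * f j = -(f j * f i))
    (hef : ∀ i < n, ∀ j < n, i ≠ j → e i * f j = -(f j * e i))
    (hΓe : ∀ i < n, Γ * e i = -(e i * Γ)) (hΓf : ∀ i < n, Γ * f i = -(f i * Γ)) :
    ∃ G G' : R, G * G' = 1 ∧ G' * G = 1 ∧ Γ * G = G * Γ ∧ ∀ i < n, f i * G = G * e i := by
  have key : ∀ l ≤ n, ∃ G G' : R, G * G' = 1 ∧ G' * G = 1 ∧ Γ * G = G * Γ ∧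
      (∀ i < l, f i * G = G * e i) ∧
      ∀ i < n, l ≤ i → f i * G = G * f i ∧ e i * G = G * e i := by
    intro l
    induction l with
    | zero => exact fun _ => ⟨1, 1, by simp, by simp, by simp, by simp, by simp⟩
    | succ l ih =>
      intro hl
      obtain ⟨G, G', h1, h2, h3, h4, h5⟩ := ih (by omega)
      have hl : l < n := hl
      have pass : ∀ x a b : R, x * a = -(a * x) → x * b = -(b * x) →
          x * (1 + a * b) = (1 + a * b) * x := fun x a b ha hb => by
        rw [mul_add, ← mul_assoc, ha, neg_mul, mul_assoc, hb, add_mul, mul_neg, neg_neg, mul_one,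
          one_mul, mul_assoc]
      have a1 : f l * (1 + f l * e l) = (1 + f l * e l) * e l := by
        rw [mul_add, add_mul, ← mul_assoc, hf l hl, mul_assoc, he l hl]
        simp [add_comm]
      have i1 : (1 + f l * e l) * (1 + e l * f l) = (2 + 2 * w) • (1 : R) := by
        rw [mul_add, mul_one, add_mul, one_mul,
          show f l * e l * (e l * f l) = f l * (e l * e l) * f l by noncomm_ring, he l hl, mul_one,
          hf l hl, add_smul, ← hfe l hl, two_smul]
        abel
      have i2 : (1 + e l * f l) * (1 + f l * e l) = (2 + 2 * w) • (1 : R) := by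
        rw [mul_add, mul_one, add_mul, one_mul,
          show e l * f l * (f l * e l) = e l * (f l * f l) * e l by noncomm_ring, hf l hl, mul_one,
          he l hl, add_smul, ← hfe l hl, two_smul]
        abel
      have hw2 : (2 + 2 * w) ≠ 0 := by
        rw [show 2 + 2 * w = 2 * (1 + w) by ring]; exact mul_ne_zero two_ne_zero hw
      refine ⟨G * (1 + f l * e l), (2 + 2 * w)⁻¹ • ((1 + e l * f l) * G'), ?_, ?_, ?_, ?_, ?_⟩
      · rw [mul_smul_comm, show G * (1 + f l * e l) * ((1 + e l * f l) * G') =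
          G * ((1 + f l * e l) * (1 + e l * f l)) * G' by simp only [mul_assoc], i1]
        simp [h1, smul_smul, hw2]
      · rw [smul_mul_assoc, show (1 + e l * f l) * G' * (G * (1 + f l * e l)) =
          (1 + e l * f l) * (G' * G) * (1 + f l * e l) by simp only [mul_assoc], h2, mul_one, i2]
        simp [smul_smul, hw2]
      · rw [← mul_assoc, h3, mul_assoc, mul_assoc, pass _ _ _ (hΓf l hl) (hΓe l hl)]
      · intro i hi
        rcases Nat.lt_succ_iff_lt_or_eq.1 hi with hi | rfl
        · rw [← mul_assoc, h4 i hi, mul_assoc, mul_assoc,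
            pass _ _ _ (hef i (by omega) l hl hi.ne) (hee i (by omega) l hl hi.ne)]
        · rw [← mul_assoc, (h5 i hl le_rfl).1, mul_assoc, mul_assoc, a1]
      · intro i hi hli
        have hne : i ≠ l := by omega
        have hfe' : f i * e l = -(e l * f i) := by rw [hef l hl i hi hne.symm, neg_neg]
        obtain ⟨h51, h52⟩ := h5 i hi (by omega)
        constructor
        · rw [← mul_assoc, h51, mul_assoc, mul_assoc, pass _ _ _ (hff i hi l hl hne) hfe']
        · rw [← mul_assoc, h52, mul_assoc, mul_assoc,
            pass _ _ _ (hef i hi l hl hne) (hee i hi l hl hne)]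
  obtain ⟨G, G', h1, h2, h3, h4, -⟩ := key n le_rfl
  exact ⟨G, G', h1, h2, h3, h4⟩

end Anti

theorem trace_list_prod_of_cyclic {ν : Type*} [Fintype ν] [DecidableEq ν]
    {e1 e2 e3 : ℕ → Matrix ν ν ℂ} {Γ T : Matrix ν ν ℂ} {w : ℂ} {n : ℕ}
    (h11 : ∀ i < n, ∀ j < n, i ≠ j → e1 i * e1 j = -(e1 j * e1 i))
    (h22 : ∀ i < n, ∀ j < n, i ≠ j → e2 i * e2 j = -(e2 j * e2 i))
    (h33 : ∀ i < n, ∀ j < n, i ≠ j → e3 i * e3 j = -(e3 j * e3 i))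
    (h12 : ∀ i < n, ∀ j < n, e1 i * e2 j = -(e2 j * e1 i))
    (h13 : ∀ i < n, ∀ j < n, e1 i * e3 j = -(e3 j * e1 i))
    (h23 : ∀ i < n, ∀ j < n, e2 i * e3 j = -(e3 j * e2 i))
    (hΓ2 : ∀ i < n, e2 i * Γ = -(Γ * e2 i)) (hΓ3 : ∀ i < n, e3 i * Γ = -(Γ * e3 i))
    (hT2 : ∀ i < n, e2 i * T = T * e1 i) (hT3 : ∀ i < n, e3 i * T = T * e2 i) (B : List ℕ) :
    ∀ A : List ℕ, (A ++ B).Nodup → (∀ i ∈ A ++ B, i < n) → Even (A ++ B).length →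
    ((A.map e1).prod * (B.map fun i => w • (e1 i + e2 i + e3 i)).prod * (Γ * T)).trace =
      (3 * w) ^ B.length * (((A ++ B).map e1).prod * (Γ * T)).trace := by
  induction B with
  | nil => intro A _ _ _; simp
  | cons b B ih =>
    intro A hnd hlt hev
    set f : ℕ → Matrix ν ν ℂ := fun i => w • (e1 i + e2 i + e3 i)
    have ih' := ih (A ++ [b]) (by simpa using hnd) (by simpa using hlt) (by simpa using hev)
    rw [List.append_assoc, List.singleton_append] at ih'
    have hb : b < n := hlt b (by simp)
    have hnb : b ∉ A ∧ b ∉ B := by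
      have := (List.nodup_append.1 hnd)
      exact ⟨fun h => this.2.2 b h b (by simp) rfl, (List.nodup_cons.1 this.2.1).1⟩
    have move : ∀ x y : Matrix ν ν ℂ, (∀ i ∈ B, x * f i = -(f i * x)) → x * Γ = -(Γ * x) →
        x * T = T * y → (∀ i ∈ A, y * e1 i = -(e1 i * y)) →
        ((A.map e1).prod * x * (B.map f).prod * (Γ * T)).trace =
          ((A.map e1).prod * y * (B.map f).prod * (Γ * T)).trace := by
      intro x y hx1 hx2 hx3 hy
      have s1 : x * (B.map f).prod * (Γ * T) =
          (-1 : ℤ) ^ (B.length + 1) • ((B.map f).prod * (Γ * T) * y) := by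
        rw [mul_list_prod_of_anti hx1, smul_mul_assoc, Matrix.mul_assoc, ← Matrix.mul_assoc x, hx2,
          Matrix.neg_mul, Matrix.mul_assoc, hx3, pow_succ]
        simp [Matrix.mul_assoc]
      have s2 := mul_list_prod_of_anti hy
      have hsgn : (-1 : ℤ) ^ (B.length + 1) * (-1) ^ A.length = 1 := by
        rw [← pow_add]
        refine Even.neg_one_pow ?_
        rw [List.length_append, List.length_cons] at hev
        rwa [add_comm]
      calc ((A.map e1).prod * x * (B.map f).prod * (Γ * T)).trace
          = ((A.map e1).prod * (x * (B.map f).prod * (Γ * T))).trace := by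
            simp only [Matrix.mul_assoc]
        _ = (-1 : ℤ) ^ (B.length + 1) •
            (y * (A.map e1).prod * ((B.map f).prod * (Γ * T))).trace := by
            rw [s1, mul_smul_comm, Matrix.trace_smul, ← Matrix.mul_assoc, Matrix.trace_mul_comm,
              ← Matrix.mul_assoc y]
        _ = _ := by
            rw [s2, smul_mul_assoc, Matrix.trace_smul, smul_smul, hsgn, one_smul]
            simp only [Matrix.mul_assoc]
    have neg' : ∀ {x y : Matrix ν ν ℂ}, x * y = -(y * x) → y * x = -(x * y) := fun h => by
      rw [h, neg_neg]
    have anti : ∀ x : Matrix ν ν ℂ, ∀ i, x * e1 i = -(e1 i * x) → x * e2 i = -(e2 i * x) →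
        x * e3 i = -(e3 i * x) → x * f i = -(f i * x) := fun x i ha hb hc => by
      simp only [f, mul_smul_comm, smul_mul_assoc, mul_add, add_mul, ha, hb, hc]
      rw [← smul_neg]
      congr 1
      abel
    have hB : ∀ i ∈ B, i < n ∧ b ≠ i := fun i hi =>
      ⟨hlt i (by simp [hi]), fun h => hnb.2 (h ▸ hi)⟩
    have hA : ∀ i ∈ A, i < n ∧ b ≠ i := fun i hi =>
      ⟨hlt i (by simp [hi]), fun h => hnb.1 (h ▸ hi)⟩
    have m3 := move (e3 b) (e2 b)
      (fun i hi => anti _ _ (neg' (h13 i (hB i hi).1 b hb)) (neg' (h23 i (hB i hi).1 b hb))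
        (h33 b hb i (hB i hi).1 (hB i hi).2)) (hΓ3 b hb) (hT3 b hb)
      (fun i hi => neg' (h12 i (hA i hi).1 b hb))
    have m2 := move (e2 b) (e1 b)
      (fun i hi => anti _ _ (neg' (h12 i (hB i hi).1 b hb)) (h22 b hb i (hB i hi).1 (hB i hi).2)
        (h23 b hb i (hB i hi).1)) (hΓ2 b hb) (hT2 b hb)
      (fun i hi => h11 b hb i (hA i hi).1 (hA i hi).2)
    rw [show (3 * w) ^ (b :: B).length = 3 * w * (3 * w) ^ B.length by
      rw [List.length_cons, pow_succ, mul_comm], mul_assoc (3 * w), ← ih', List.map_append,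
      List.prod_append, List.map_singleton, List.prod_singleton, List.map_cons, List.prod_cons]
    have : (A.map e1).prod * (f b * (B.map f).prod) * (Γ * T) =
        w • ((A.map e1).prod * e1 b * (B.map f).prod * (Γ * T) +
          (A.map e1).prod * e2 b * (B.map f).prod * (Γ * T) +
          (A.map e1).prod * e3 b * (B.map f).prod * (Γ * T)) := by
      simp only [f, mul_smul_comm, smul_mul_assoc, mul_add, add_mul, mul_assoc]
    rw [this, Matrix.trace_smul, Matrix.trace_add, Matrix.trace_add, m3, m2, smul_eq_mul]
    ring

/-- Generators of a complex Clifford algebra in its irreducible representation. -/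
structure Cliff {Λ : Type} [Fintype Λ] [DecidableEq Λ] (s : ℕ) (E : ℕ → Matrix Λ Λ ℂ)
    (γ : Matrix Λ Λ ℂ) : Prop where
  sq : ∀ i < 2 * s, E i * E i = 1
  anti : ∀ i < 2 * s, ∀ j < 2 * s, i ≠ j → E i * E j = -(E j * E i)
  chir_sq : γ * γ = 1
  chir_anti : ∀ i < 2 * s, γ * E i = -(E i * γ)
  card : Fintype.card Λ = 2 ^ s
  prod : ∃ c : ℂ, c • ((List.range (2 * s)).map E).prod = γ
  scalar : ∀ M : Matrix Λ Λ ℂ, (∀ i < 2 * s, M * E i = E i * M) → ∃ c : ℂ, M = c • 1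

theorem exists_cliff (s : ℕ) : ∃ (Λ : Type) (_ : Fintype Λ) (_ : DecidableEq Λ)
    (E : ℕ → Matrix Λ Λ ℂ) (γ : Matrix Λ Λ ℂ), Cliff s E γ := by
  induction s with
  | zero =>
    refine ⟨Unit, inferInstance, inferInstance, fun _ => 1, 1, ⟨by simp, by simp, by simp, by simp,
      by simp, ⟨1, by simp⟩, fun M _ => ⟨M () (), by ext; simp⟩⟩⟩
  | succ s ih =>
    obtain ⟨Λ, _, _, E, γ, h⟩ := ih
    let E' : ℕ → Matrix (Λ ⊕ Λ) (Λ ⊕ Λ) ℂ := fun i => if i < 2 * s then fromBlocks (E i) 0 0 (E i)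
      else if i = 2 * s then fromBlocks 0 γ γ 0
      else fromBlocks 0 (-Complex.I • γ) (Complex.I • γ) 0
    have e1 : ∀ i < 2 * s, E' i = fromBlocks (E i) 0 0 (E i) := fun i hi => if_pos hi
    have e2 : E' (2 * s) = fromBlocks 0 γ γ 0 := by simp [E']
    have e3 : E' (2 * s + 1) = fromBlocks 0 (-Complex.I • γ) (Complex.I • γ) 0 := by simp [E']
    have cases' : ∀ i < 2 * (s + 1), i < 2 * s ∨ i = 2 * s ∨ i = 2 * s + 1 := by omega
    have hn : ∀ i < 2 * s, E i * γ = -(γ * E i) := fun i hi => by rw [h.chir_anti i hi, neg_neg]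
    refine ⟨Λ ⊕ Λ, inferInstance, inferInstance, E', fromBlocks γ 0 0 (-γ),
      ⟨fun i hi => ?_, fun i hi j hj hij => ?_, ?_, fun i hi => ?_, ?_, ?_, fun M hM => ?_⟩⟩
    · rcases cases' i hi with hi | rfl | rfl
      · simp [e1 i hi, fromBlocks_multiply, h.sq i hi]
      · simp [e2, fromBlocks_multiply, h.chir_sq]
      · simp [e3, fromBlocks_multiply, h.chir_sq, smul_smul]
    · rcases cases' i hi with hi | rfl | rfl <;> rcases cases' j hj with hj | rfl | rfl <;>
        first | exact absurd rfl hij | skip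
      · simp [e1 i hi, e1 j hj, fromBlocks_multiply, h.anti i hi j hj hij, fromBlocks_neg]
      · simp [e1 i hi, e2, fromBlocks_multiply, hn i hi, fromBlocks_neg]
      · simp [e1 i hi, e3, fromBlocks_multiply, hn i hi, fromBlocks_neg]
      · simp [e1 j hj, e2, fromBlocks_multiply, h.chir_anti j hj, fromBlocks_neg]
      · simp [e2, e3, fromBlocks_multiply, h.chir_sq, fromBlocks_neg]
      · simp [e1 j hj, e3, fromBlocks_multiply, h.chir_anti j hj, fromBlocks_neg]
      · simp [e2, e3, fromBlocks_multiply, h.chir_sq, fromBlocks_neg]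
    · simp [fromBlocks_multiply, h.chir_sq]
    · rcases cases' i hi with hi | rfl | rfl
      · simp [e1 i hi, fromBlocks_multiply, h.chir_anti i hi, fromBlocks_neg]
      · simp [e2, fromBlocks_multiply, fromBlocks_neg]
      · simp [e3, fromBlocks_multiply, fromBlocks_neg]
    · simp [h.card, pow_succ, mul_two]
    · obtain ⟨c, hc⟩ := h.prod
      have hp : ∀ l : List ℕ, (∀ i ∈ l, i < 2 * s) →
          (l.map E').prod = fromBlocks (l.map E).prod 0 0 (l.map E).prod := by
        intro l
        induction l with
        | nil => simp
        | cons a l ih =>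
          intro hl
          simp [ih fun i hi => hl i (by simp [hi]), e1 a (hl a (by simp)), fromBlocks_multiply]
      refine ⟨-Complex.I * c, ?_⟩
      rw [show 2 * (s + 1) = 2 * s + 1 + 1 by ring, List.range_succ, List.range_succ,
        List.map_append, List.map_append, List.prod_append, List.prod_append,
        hp _ fun i hi => List.mem_range.1 hi]
      have ho : fromBlocks 0 γ γ 0 * fromBlocks 0 (-Complex.I • γ) (Complex.I • γ) 0 =
          fromBlocks (Complex.I • (1 : Matrix Λ Λ ℂ)) 0 0 (-Complex.I • (1 : Matrix Λ Λ ℂ)) := by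
        simp [fromBlocks_multiply, h.chir_sq]
      rw [List.map_singleton, List.map_singleton, List.prod_singleton, List.prod_singleton, e2, e3,
        Matrix.mul_assoc, ho, fromBlocks_multiply, fromBlocks_smul]
      have hI : -Complex.I * c * Complex.I = c := by linear_combination -c * Complex.I_sq
      simp only [Matrix.mul_smul, Matrix.mul_one, Matrix.mul_zero, add_zero, zero_add, smul_zero,
        smul_smul, hI, mul_neg, neg_smul, smul_neg, hc, neg_zero]
    · obtain ⟨A, B, C, D, rfl⟩ : ∃ A B C D, M = fromBlocks A B C D :=
        ⟨_, _, _, _, (fromBlocks_toBlocks M).symm⟩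
      have hc : ∀ i < 2 * s, A * E i = E i * A ∧ B * E i = E i * B ∧ C * E i = E i * C ∧
          D * E i = E i * D := fun i hi => by
        have := hM i (by omega)
        rw [e1 i hi, fromBlocks_multiply, fromBlocks_multiply] at this
        simpa [fromBlocks_inj] using this
      obtain ⟨a, rfl⟩ := h.scalar A fun i hi => (hc i hi).1
      obtain ⟨b, rfl⟩ := h.scalar B fun i hi => (hc i hi).2.1
      obtain ⟨c, rfl⟩ := h.scalar C fun i hi => (hc i hi).2.2.1
      obtain ⟨d, rfl⟩ := h.scalar D fun i hi => (hc i hi).2.2.2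
      have hΛ : Nonempty Λ := Fintype.card_pos_iff.1 (by rw [h.card]; positivity)
      have hγ : γ ≠ 0 := fun h0 => by
        have := h.chir_sq
        rw [h0, Matrix.mul_zero] at this
        exact zero_ne_one this
      have h2 := hM (2 * s) (by omega)
      have h3 := hM (2 * s + 1) (by omega)
      rw [e2, fromBlocks_multiply, fromBlocks_multiply] at h2
      rw [e3, fromBlocks_multiply, fromBlocks_multiply] at h3
      simp only [fromBlocks_inj, Matrix.smul_mul, Matrix.one_mul, Matrix.mul_smul, Matrix.mul_one,
        Matrix.mul_zero, smul_zero, zero_add, add_zero, smul_smul] at h2 h3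
      have hbc : b = c := smul_left_injective ℂ hγ h2.1
      have had : a = d := smul_left_injective ℂ hγ h2.2.1
      have hbc' : Complex.I * b = c * -Complex.I := smul_left_injective ℂ hγ h3.1
      have hb : b = 0 := by
        have : 2 * Complex.I * b = 0 := by rw [hbc] at hbc' ⊢; linear_combination hbc'
        simpa using this
      refine ⟨a, ?_⟩
      rw [← hbc, ← had, hb, ← fromBlocks_one, fromBlocks_smul]
      simp

section Splitting
variable {Λ : Type} [Fintype Λ] [DecidableEq Λ] {s : ℕ} {E : ℕ → Matrix Λ Λ ℂ} {γ : Matrix Λ Λ ℂ}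

theorem ten_neg_left {κ ι : Type*} [Fintype κ] [Fintype ι] [DecidableEq κ]
    [DecidableEq ι] (A B C : Matrix κ ι ℂ) : ten (-A) B C = -ten A B C := by
  rw [← neg_one_smul ℂ A, ten_smul_left, neg_one_smul]

theorem ten_neg_mid {κ ι : Type*} [Fintype κ] [Fintype ι] [DecidableEq κ]
    [DecidableEq ι] (A B C : Matrix κ ι ℂ) : ten A (-B) C = -ten A B C := by
  rw [← neg_one_smul ℂ B, ten_smul_mid, neg_one_smul]

theorem ten_neg_right {κ ι : Type*} [Fintype κ] [Fintype ι] [DecidableEq κ]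
    [DecidableEq ι] (A B C : Matrix κ ι ℂ) : ten A B (-C) = -ten A B C := by
  rw [← neg_one_smul ℂ C, ten_smul_right, neg_one_smul]

theorem one_kronecker_injective {K : Type} [Nonempty Λ] {M N : Matrix K K ℂ}
    (h : (1 : Matrix Λ Λ ℂ) ⊗ₖ M = 1 ⊗ₖ N) : M = N := by
  obtain ⟨a⟩ := ‹Nonempty Λ›
  ext i j
  simpa using congrFun (congrFun h (a, i)) (a, j)

theorem Cliff.nonempty (h : Cliff s E γ) : Nonempty Λ :=
  Fintype.card_pos_iff.1 (by rw [h.card]; positivity)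

theorem Cliff.exists_eq_one_kronecker (h : Cliff s E γ) {K : Type} [Fintype K] [DecidableEq K]
    {M : Matrix (Λ × K) (Λ × K) ℂ}
    (hM : ∀ i < 2 * s, M * (E i ⊗ₖ (1 : Matrix K K ℂ)) = (E i ⊗ₖ 1) * M) :
    ∃ Y : Matrix K K ℂ, M = 1 ⊗ₖ Y := by
  have key : ∀ k k', ∃ c : ℂ, (of fun a b => M (a, k) (b, k')) = c • (1 : Matrix Λ Λ ℂ) := by
    refine fun k k' => h.scalar _ fun i hi => ?_
    ext a b
    have := congrFun (congrFun (hM i hi) (a, k)) (b, k')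
    simpa [Matrix.mul_apply, Fintype.sum_prod_type, Matrix.one_apply] using this
  choose Y hY using key
  refine ⟨of Y, ?_⟩
  ext ⟨a, k⟩ ⟨b, k'⟩
  have := congrFun (congrFun (hY k k') a) b
  simp only [of_apply, Matrix.smul_apply, smul_eq_mul] at this
  rw [this, kroneckerMap_apply, of_apply, mul_comm]

/-- The sums of the three commuting copies of the Clifford generators. -/
def symGen (w : ℂ) (γ : Matrix Λ Λ ℂ) (F : Matrix Λ Λ ℂ) : Matrix (Λ × Λ × Λ) (Λ × Λ × Λ) ℂ :=
  w • (ten F 1 γ + ten γ F 1 + ten 1 γ F)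

theorem Cliff.exists_splitting (h : Cliff s E γ) {w : ℂ} (hw : 3 * w ^ 2 = 1) (hw1 : 1 + w ≠ 0) :
    ∃ (Z Z' : Matrix (Λ × Λ × Λ) (Λ × Λ × Λ) ℂ) (η S : Matrix (Λ × Λ) (Λ × Λ) ℂ),
      Z * Z' = 1 ∧ Z' * Z = 1 ∧ (∀ i < 2 * s, symGen w γ (E i) * Z = Z * ten (E i) 1 1) ∧
      cycMat Λ * Z = Z * (1 ⊗ₖ S) ∧ ten γ γ γ * Z = Z * (γ ⊗ₖ η) ∧ η * η = 1 ∧ η * S = S * η ∧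
      S ^ 6 = 1 ∧ S.trace = 1 ∧ (η * S).trace = 3 ^ s := by
  have hΛ := h.nonempty
  set e1 : ℕ → Matrix (Λ × Λ × Λ) (Λ × Λ × Λ) ℂ := fun i => ten (E i) 1 γ with he1
  set e2 : ℕ → Matrix (Λ × Λ × Λ) (Λ × Λ × Λ) ℂ := fun i => ten γ (E i) 1 with he2
  set e3 : ℕ → Matrix (Λ × Λ × Λ) (Λ × Λ × Λ) ℂ := fun i => ten 1 γ (E i) with he3
  set f : ℕ → Matrix (Λ × Λ × Λ) (Λ × Λ × Λ) ℂ := fun i => w • (e1 i + e2 i + e3 i) with hf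
  set Γ : Matrix (Λ × Λ × Λ) (Λ × Λ × Λ) ℂ := ten γ γ γ with hΓ
  set T := cycMat Λ with hT
  have q1 : ∀ i < 2 * s, e1 i * e1 i = 1 := fun i hi => by
    simp only [he1, ten_mul, h.sq i hi, Matrix.one_mul, h.chir_sq, ten_one]
  have q2 : ∀ i < 2 * s, e2 i * e2 i = 1 := fun i hi => by
    simp only [he2, ten_mul, h.sq i hi, Matrix.one_mul, h.chir_sq, ten_one]
  have q3 : ∀ i < 2 * s, e3 i * e3 i = 1 := fun i hi => by
    simp only [he3, ten_mul, h.sq i hi, Matrix.one_mul, h.chir_sq, ten_one]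
  have h11 : ∀ i < 2 * s, ∀ j < 2 * s, i ≠ j → e1 i * e1 j = -(e1 j * e1 i) := fun i hi j hj hij => by
    simp only [he1, ten_mul, h.anti i hi j hj hij, ten_neg_left]
  have h22 : ∀ i < 2 * s, ∀ j < 2 * s, i ≠ j → e2 i * e2 j = -(e2 j * e2 i) := fun i hi j hj hij => by
    simp only [he2, ten_mul, h.anti i hi j hj hij, ten_neg_mid]
  have h33 : ∀ i < 2 * s, ∀ j < 2 * s, i ≠ j → e3 i * e3 j = -(e3 j * e3 i) := fun i hi j hj hij => by
    simp only [he3, ten_mul, h.anti i hi j hj hij, ten_neg_right]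
  have h12 : ∀ i < 2 * s, ∀ j < 2 * s, e1 i * e2 j = -(e2 j * e1 i) := fun i hi j hj => by
    simp only [he1, he2, ten_mul, h.chir_anti i hi, ten_neg_left, Matrix.one_mul, Matrix.mul_one,
      neg_neg]
  have h13 : ∀ i < 2 * s, ∀ j < 2 * s, e1 i * e3 j = -(e3 j * e1 i) := fun i hi j hj => by
    simp only [he1, he3, ten_mul, h.chir_anti j hj, ten_neg_right, Matrix.one_mul, Matrix.mul_one]
  have h23 : ∀ i < 2 * s, ∀ j < 2 * s, e2 i * e3 j = -(e3 j * e2 i) := fun i hi j hj => by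
    simp only [he2, he3, ten_mul, h.chir_anti i hi, ten_neg_mid, Matrix.one_mul, Matrix.mul_one,
      neg_neg]
  have neg' : ∀ {x y : Matrix (Λ × Λ × Λ) (Λ × Λ × Λ) ℂ}, x * y = -(y * x) → y * x = -(x * y) :=
    fun h => by rw [h, neg_neg]
  have g1 : ∀ i < 2 * s, Γ * e1 i = -(e1 i * Γ) := fun i hi => by
    simp only [he1, hΓ, ten_mul, h.chir_anti i hi, ten_neg_left, Matrix.one_mul, Matrix.mul_one]
  have g2 : ∀ i < 2 * s, Γ * e2 i = -(e2 i * Γ) := fun i hi => by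
    simp only [he2, hΓ, ten_mul, h.chir_anti i hi, ten_neg_mid, Matrix.one_mul, Matrix.mul_one]
  have g3 : ∀ i < 2 * s, Γ * e3 i = -(e3 i * Γ) := fun i hi => by
    simp only [he3, hΓ, ten_mul, h.chir_anti i hi, ten_neg_right, Matrix.one_mul, Matrix.mul_one]
  have t1 : ∀ i, T * e1 i = e2 i * T := fun i => cycMat_mul_ten _ _ _
  have t2 : ∀ i, T * e2 i = e3 i * T := fun i => cycMat_mul_ten _ _ _
  have t3 : ∀ i, T * e3 i = e1 i * T := fun i => cycMat_mul_ten _ _ _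
  have tΓ : T * Γ = Γ * T := cycMat_mul_ten _ _ _
  have tf : ∀ i, T * f i = f i * T := fun i => by
    simp only [hf, mul_smul_comm, smul_mul_assoc, mul_add, add_mul, t1, t2, t3]
    congr 1
    abel
  obtain ⟨G, G', hG1, hG2, hGΓ, hGf⟩ := exists_conj_of_anti (n := 2 * s) (e := e1) (f := f) (Γ := Γ)
    hw1 q1 (fun i hi => by
      simp only [hf, mul_smul_comm, smul_mul_assoc, mul_add, add_mul, q1 i hi, q2 i hi, q3 i hi,
        h12 i hi i hi, h13 i hi i hi, h23 i hi i hi]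
      have : (1 : Matrix (Λ × Λ × Λ) (Λ × Λ × Λ) ℂ) = (3 * w ^ 2) • 1 := by rw [hw, one_smul]
      conv_rhs => rw [this]
      module)
    (fun i hi => by
      simp only [hf, mul_smul_comm, smul_mul_assoc, mul_add, add_mul, q1 i hi,
        h12 i hi i hi, h13 i hi i hi]
      module)
    h11 (fun i hi j hj hij => by
      simp only [hf, mul_smul_comm, smul_mul_assoc, mul_add, add_mul, h11 i hi j hj hij,
        h22 i hi j hj hij, h33 i hi j hj hij, h12 i hi j hj, h13 i hi j hj, h23 i hi j hj,
        h12 j hj i hi, h13 j hj i hi, h23 j hj i hi]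
      module)
    (fun i hi j hj hij => by
      simp only [hf, mul_smul_comm, smul_mul_assoc, mul_add, add_mul, h11 i hi j hj hij,
        h12 i hi j hj, h13 i hi j hj]
      module) g1 (fun i hi => by
      simp only [hf, mul_smul_comm, smul_mul_assoc, mul_add, add_mul, g1 i hi, g2 i hi, g3 i hi]
      module)
  set W : Matrix (Λ × Λ × Λ) (Λ × Λ × Λ) ℂ :=
    (1 / 2 : ℂ) • (1 + ten 1 1 γ + ten γ 1 1 - ten γ 1 γ) with hW
  have hWW : W * W = 1 := by
    simp only [hW, mul_smul_comm, smul_mul_assoc, mul_add, add_mul, mul_sub, sub_mul, ten_mul,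
      Matrix.one_mul, Matrix.mul_one, h.chir_sq, ten_one]
    module
  have hWe : ∀ i < 2 * s, e1 i * W = W * ten (E i) 1 1 := fun i hi => by
    simp only [hW, he1, mul_smul_comm, smul_mul_assoc, mul_add, add_mul, mul_sub, sub_mul, ten_mul,
      Matrix.one_mul, Matrix.mul_one, h.chir_sq, h.chir_anti i hi, ten_neg_left]
    module
  obtain ⟨Z, hZ⟩ : ∃ Z, Z = G * W := ⟨_, rfl⟩
  obtain ⟨Z', hZ'⟩ : ∃ Z, Z = W * G' := ⟨_, rfl⟩
  have z1 : Z * Z' = 1 := by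
    rw [hZ, hZ', Matrix.mul_assoc, ← Matrix.mul_assoc W, hWW, Matrix.one_mul, hG1]
  have z2 : Z' * Z = 1 := by
    rw [hZ, hZ', Matrix.mul_assoc, ← Matrix.mul_assoc G', hG2, Matrix.one_mul, hWW]
  have hfZ : ∀ i < 2 * s, f i * Z = Z * ten (E i) 1 1 := fun i hi => by
    rw [hZ, ← Matrix.mul_assoc, hGf i hi, Matrix.mul_assoc, hWe i hi, Matrix.mul_assoc]
  have hfZ' : ∀ i < 2 * s, Z' * f i = ten (E i) 1 1 * Z' := fun i hi => by
    rw [← Matrix.mul_one (f i), ← z1, ← Matrix.mul_assoc (f i), hfZ i hi, ← Matrix.mul_assoc,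
      ← Matrix.mul_assoc, z2, Matrix.one_mul]
  have hten : ∀ A : Matrix Λ Λ ℂ, ten A 1 1 = A ⊗ₖ (1 : Matrix (Λ × Λ) (Λ × Λ) ℂ) := fun A => by
    rw [ten, one_kronecker_one]
  obtain ⟨S, hS⟩ := h.exists_eq_one_kronecker (M := Z' * T * Z) fun i hi => by
    rw [← hten, Matrix.mul_assoc, ← hfZ i hi, ← Matrix.mul_assoc, Matrix.mul_assoc Z', tf,
      ← Matrix.mul_assoc, hfZ' i hi]
    simp only [Matrix.mul_assoc]
  obtain ⟨η, hη⟩ := h.exists_eq_one_kronecker (M := ten γ 1 1 * (Z' * Γ * Z)) fun i hi => by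
    have gf : Γ * f i = -(f i * Γ) := by
      simp only [hf, mul_smul_comm, smul_mul_assoc, mul_add, add_mul, g1 i hi, g2 i hi, g3 i hi]
      module
    rw [← hten, Matrix.mul_assoc, Matrix.mul_assoc _ Z, ← hfZ i hi, ← Matrix.mul_assoc _ (f i),
      Matrix.mul_assoc Z', gf, Matrix.mul_neg, ← Matrix.mul_assoc Z', hfZ' i hi, Matrix.neg_mul,
      Matrix.mul_neg, ← Matrix.mul_assoc (ten (E i) 1 1), Matrix.mul_assoc (ten (E i) 1 1),
      Matrix.mul_assoc (ten (E i) 1 1), ← Matrix.mul_assoc (ten γ 1 1), ten_mul, h.chir_anti i hi,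
      ten_neg_left, Matrix.neg_mul, neg_neg, ten_mul]
  have hγ1 : ten γ 1 1 * ten γ 1 1 = 1 := by
    rw [ten_mul, h.chir_sq, Matrix.one_mul, ten_one]
  have hη' : Z' * Γ * Z = γ ⊗ₖ η := by
    rw [← Matrix.one_mul (Z' * Γ * Z), ← hγ1, Matrix.mul_assoc, hη, hten, ← mul_kronecker_mul,
      Matrix.mul_one, Matrix.one_mul]
  have hTZ : T * Z = Z * (1 ⊗ₖ S) := by
    rw [← hS, ← Matrix.mul_assoc, ← Matrix.mul_assoc, z1, Matrix.one_mul]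
  have hΓZ : Γ * Z = Z * (γ ⊗ₖ η) := by
    rw [← hη', ← Matrix.mul_assoc, ← Matrix.mul_assoc, z1, Matrix.one_mul]
  have conjm : ∀ A B : Matrix (Λ × Λ × Λ) (Λ × Λ × Λ) ℂ,
      (Z' * A * Z) * (Z' * B * Z) = Z' * (A * B) * Z := fun A B => by
    rw [show Z' * A * Z * (Z' * B * Z) = Z' * A * (Z * Z') * B * Z by simp only [Matrix.mul_assoc],
      z1, Matrix.mul_one, Matrix.mul_assoc Z']
  have hΓΓ : Γ * Γ = 1 := by rw [hΓ, ten_mul, h.chir_sq, ten_one]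
  have hcard : (1 : Matrix Λ Λ ℂ).trace = 2 ^ s := by
    rw [Matrix.trace_one, h.card]; push_cast; rfl
  have htr : ∀ A : Matrix (Λ × Λ × Λ) (Λ × Λ × Λ) ℂ, (Z' * A * Z).trace = A.trace := fun A => by
    rw [Matrix.trace_mul_comm, ← Matrix.mul_assoc, z1, Matrix.one_mul]
  refine ⟨Z, Z', η, S, z1, z2, hfZ, hTZ, hΓZ, ?_, ?_, ?_, ?_, ?_⟩
  · refine one_kronecker_injective (Λ := Λ) ?_
    rw [← h.chir_sq, mul_kronecker_mul, ← hη', conjm, hΓΓ, Matrix.mul_one, z2, h.chir_sq,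
      one_kronecker_one]
  · refine one_kronecker_injective (Λ := Λ) ?_
    have h1 : (Z' * Γ * Z) * (Z' * T * Z) = (Z' * T * Z) * (Z' * Γ * Z) := by
      rw [conjm, conjm, tΓ]
    rw [hη', hS, ← mul_kronecker_mul, ← mul_kronecker_mul, Matrix.mul_one, Matrix.one_mul] at h1
    have h2 := congrArg (fun M => (γ ⊗ₖ (1 : Matrix (Λ × Λ) (Λ × Λ) ℂ)) * M) h1
    simpa only [← mul_kronecker_mul, h.chir_sq, Matrix.one_mul] using h2
  · refine one_kronecker_injective (Λ := Λ) ?_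
    have h6 : T ^ 6 = 1 := by rw [show 6 = 3 * 2 from rfl, pow_mul, cycMat_pow_three, one_pow]
    have := Matrix.conj_pow (g := Z) (A := 1 ⊗ₖ S) (B := T) hTZ.symm 6
    rw [h6, kronecker_pow', one_pow, Matrix.one_mul] at this
    have h2 := congrArg (fun M => Z' * M) this
    simp only [← Matrix.mul_assoc, z2, Matrix.one_mul] at h2
    rw [h2, one_kronecker_one]
  · have h1 := htr T
    rw [hS, trace_kronecker, hcard, ← Matrix.one_mul T, ← ten_one, trace_ten_mul_cycMat] at h1
    simp only [Matrix.one_mul, hcard] at h1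
    exact mul_left_cancel₀ (pow_ne_zero s two_ne_zero) (by rw [h1, mul_one])
  · obtain ⟨c, hc⟩ := h.prod
    have hprod : ∀ l : List ℕ, (∀ i ∈ l, i < 2 * s) →
        Z * (ten (l.map E).prod 1 1) * Z' = (l.map f).prod := by
      intro l
      induction l with
      | nil => intro _; simp [ten_one, z1]
      | cons a l ih =>
        intro hl
        rw [List.map_cons, List.map_cons, List.prod_cons, List.prod_cons,
          ← ih fun i hi => hl i (by simp [hi]), ← Matrix.mul_assoc, ← Matrix.mul_assoc,
          hfZ a (hl a (by simp)), Matrix.mul_assoc Z (ten (E a) 1 1), ten_mul, Matrix.one_mul]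
    have hprod1 : ∀ l : List ℕ, ((l.map e1).prod) = ten (l.map E).prod 1 (γ ^ l.length) := by
      intro l
      induction l with
      | nil => simp [ten_one]
      | cons a l ih =>
        rw [List.map_cons, List.map_cons, List.prod_cons, List.prod_cons, ih, he1, ten_mul,
          Matrix.one_mul, List.length_cons, pow_succ']
    have key := trace_list_prod_of_cyclic (w := w) h11 h22 h33 h12 h13 h23
      (fun i hi => neg' (g2 i hi)) (fun i hi => neg' (g3 i hi)) (fun i _ => (t1 i).symm)
      (fun i _ => (t2 i).symm) (List.range (2 * s)) [] (by simpa using List.nodup_range)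
      (by simp) (by simp)
    have h1 : (Z * ten γ 1 1 * Z' * (Γ * T)).trace = 2 ^ s * (η * S).trace := by
      rw [← hcard, ← trace_kronecker]
      rw [show (1 : Matrix Λ Λ ℂ) ⊗ₖ (η * S) = ten γ 1 1 * (Z' * (Γ * T) * Z) by
        rw [← conjm, ← Matrix.mul_assoc, hη, hS, ← mul_kronecker_mul, Matrix.one_mul],
        Matrix.mul_assoc Z, Matrix.mul_assoc Z, Matrix.trace_mul_comm Z]
      simp only [Matrix.mul_assoc]
    have h2 : Z * ten γ 1 1 * Z' = c • ((List.range (2 * s)).map f).prod := by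
      rw [← hprod _ fun i hi => List.mem_range.1 hi, ← hc, ten_smul_left, mul_smul_comm,
        smul_mul_assoc]
    have h3 : c • ((List.range (2 * s)).map e1).prod = ten γ 1 1 := by
      rw [hprod1, ← ten_smul_left, hc, List.length_range, pow_mul, pow_two, h.chir_sq, one_pow]
    simp only [List.map_nil, List.prod_nil, Matrix.one_mul, List.nil_append, List.length_range]
      at key
    rw [h2, smul_mul_assoc, Matrix.trace_smul, key, smul_eq_mul, mul_left_comm, ← smul_eq_mul c,
      ← Matrix.trace_smul, ← smul_mul_assoc, h3, ← Matrix.mul_assoc, ten_mul, trace_ten_mul_cycMat,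
      h.chir_sq, Matrix.one_mul, Matrix.one_mul, h.chir_sq, hcard, pow_mul] at h1
    have hw3 : (3 * w) ^ 2 = 3 := by linear_combination 3 * hw
    rw [hw3, mul_comm] at h1
    exact (mul_left_cancel₀ (pow_ne_zero s two_ne_zero) h1).symm

end Splitting

/-- Bounded matrix functions that are continuous away from the zeros of `r`. -/
structure Tame {Y : Type*} [TopologicalSpace Y] (r : Y → ℝ) {κ ι : Type*}
    (f : Y → Matrix κ ι ℂ) : Prop where
  cont : ∀ i j, ContinuousOn (fun y => f y i j) {y | r y ≠ 0}
  bdd : ∃ C : ℝ, ∀ y i j, ‖f y i j‖ ≤ C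

section Tame
variable {Y : Type*} [TopologicalSpace Y] {r : Y → ℝ} {κ ι μ : Type*} [Fintype κ] [Fintype ι]
  [Fintype μ] {f g h : Y → Matrix κ ι ℂ}

theorem Tame.const (M : Matrix κ ι ℂ) : Tame r fun _ => M :=
  ⟨fun _ _ => continuousOn_const, ⟨∑ i, ∑ j, ‖M i j‖, fun _ i j =>
    (Finset.single_le_sum (f := fun j => ‖M i j‖) (fun _ _ => norm_nonneg _)
      (Finset.mem_univ j)).trans (Finset.single_le_sum (f := fun i => ∑ j, ‖M i j‖)
      (fun _ _ => Finset.sum_nonneg fun _ _ => norm_nonneg _) (Finset.mem_univ i))⟩⟩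

theorem Tame.add (hf : Tame r f) (hg : Tame r g) : Tame r fun y => f y + g y := by
  obtain ⟨C, hC⟩ := hf.bdd
  obtain ⟨D, hD⟩ := hg.bdd
  exact ⟨fun i j => (hf.cont i j).add (hg.cont i j), C + D, fun y i j =>
    (norm_add_le _ _).trans (add_le_add (hC y i j) (hD y i j))⟩

theorem Tame.smul (hf : Tame r f) {c : Y → ℂ} (hc : ContinuousOn c {y | r y ≠ 0})
    (hb : ∃ C : ℝ, ∀ y, ‖c y‖ ≤ C) : Tame r fun y => c y • f y := by
  obtain ⟨C, hC⟩ := hf.bdd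
  obtain ⟨D, hD⟩ := hb
  refine ⟨fun i j => hc.mul (hf.cont i j), D * C, fun y i j => ?_⟩
  rw [Matrix.smul_apply, smul_eq_mul, norm_mul]
  exact mul_le_mul (hD y) (hC y i j) (norm_nonneg _) ((norm_nonneg _).trans (hD y))

theorem Tame.const_smul (hf : Tame r f) (c : ℂ) : Tame r fun y => c • f y :=
  hf.smul (c := fun _ => c) continuousOn_const ⟨_, fun _ => le_rfl⟩

theorem Tame.sum {α : Type*} (s : Finset α) {f : α → Y → Matrix κ ι ℂ}
    (hf : ∀ a ∈ s, Tame r (f a)) : Tame r fun y => ∑ a ∈ s, f a y := by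
  classical
  induction s using Finset.induction_on with
  | empty => simpa using Tame.const (r := r) (0 : Matrix κ ι ℂ)
  | insert a s ha ih =>
    simp only [Finset.sum_insert ha]
    exact (hf a (by simp)).add (ih fun b hb => hf b (by simp [hb]))

theorem Tame.const_mul (M : Matrix μ κ ℂ) (hf : Tame r f) : Tame r fun y => M * f y := by
  obtain ⟨C, hC⟩ := hf.bdd
  refine ⟨fun i j => ?_, ∑ i, ∑ k, ‖M i k‖ * C, fun y i j => ?_⟩
  · simp only [Matrix.mul_apply]
    exact continuousOn_finsetSum _ fun k _ => continuousOn_const.mul (hf.cont k j)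
  · rw [Matrix.mul_apply]
    refine (norm_sum_le _ _).trans ?_
    refine le_trans (b := ∑ k, ‖M i k‖ * C) ?_ ?_
    · refine Finset.sum_le_sum fun k _ => ?_
      rw [norm_mul]
      exact mul_le_mul_of_nonneg_left (hC y k j) (norm_nonneg _)
    · refine Finset.single_le_sum (f := fun i => ∑ k, ‖M i k‖ * C)
        (fun _ _ => Finset.sum_nonneg fun k _ => ?_) (Finset.mem_univ i)
      exact mul_nonneg (norm_nonneg _) ((norm_nonneg _).trans (hC y k j))

theorem Tame.ten (hf : Tame r f) (hg : Tame r g) (hh : Tame r h) :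
    Tame r fun y => ten (f y) (g y) (h y) := by
  obtain ⟨C, hC⟩ := hf.bdd
  obtain ⟨D, hD⟩ := hg.bdd
  obtain ⟨B, hB⟩ := hh.bdd
  refine ⟨fun i j => (hf.cont _ _).mul ((hg.cont _ _).mul (hh.cont _ _)), C * (D * B),
    fun y i j => ?_⟩
  have h1 := hC y i.1 j.1
  have h2 := hD y i.2.1 j.2.1
  have h3 := hB y i.2.2 j.2.2
  rw [_root_.ten, kroneckerMap_apply, kroneckerMap_apply, norm_mul, norm_mul]
  have h2' := (norm_nonneg (g y i.2.1 j.2.1)).trans h2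
  have h1' := (norm_nonneg (f y i.1 j.1)).trans h1
  gcongr

theorem Tame.continuous_smul (hr : Continuous r) (hf : Tame r f) :
    Continuous fun y => (r y : ℂ) • f y := by
  obtain ⟨C, hC⟩ := hf.bdd
  refine continuous_matrix fun i j => continuous_iff_continuousAt.2 fun y => ?_
  by_cases hy : r y = 0
  · rw [ContinuousAt, hy]
    simp only [Complex.ofReal_zero, zero_mul, Matrix.smul_apply, smul_eq_mul]
    refine squeeze_zero_norm (f := fun z => (r z : ℂ) * f z i j)
      (a := fun y => |r y| * C) (fun z => ?_) ?_
    · rw [norm_mul, Complex.norm_real, Real.norm_eq_abs]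
      exact mul_le_mul_of_nonneg_left (hC z i j) (abs_nonneg _)
    · simpa [hy] using ((hr.abs.mul continuous_const).tendsto (f := fun y => |r y| * C) y)
  · have ho : IsOpen {y | r y ≠ 0} := isOpen_ne_fun hr continuous_const
    exact (Complex.continuous_ofReal.comp hr).continuousAt.mul
      ((hf.cont i j).continuousAt (ho.mem_nhds hy))

end Tame

section Half
variable {Y : Type*} [TopologicalSpace Y] {τ : Y → Y} {ι : Type} [Fintype ι] [DecidableEq ι]
  {ρ : Matrix ι ι ℂ} {g g' V : Y → Matrix ι ι ℂ} {x : ℂ}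

theorem EMap.of_comm (hc : Continuous g) (hg : ∀ y, g (τ y) = g y) (h : ∀ y, g y * ρ = ρ * g y) :
    EMap τ ρ ρ g :=
  ⟨hc, fun y => by rw [hg, h]⟩

theorem IsBun.half (hg : EMap τ ρ ρ g) (hgg : ∀ y, g y * g y = 1) (hρ : ρ ^ 6 = 1) :
    IsBun τ ρ fun y => (1 / 2 : ℂ) • (1 + g y) :=
  ⟨(EMap.one.add hg).smul continuous_const fun _ => rfl, fun y => by
    simp only [mul_smul_comm, smul_mul_assoc, mul_add, add_mul, hgg, Matrix.one_mul, Matrix.mul_one]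
    module, hρ⟩

theorem HasVal.half_conj (hx : HasVal τ ρ (fun y => (1 / 2 : ℂ) • (1 + g y)) x) (hρ : ρ ^ 6 = 1)
    (hg : EMap τ ρ ρ g) (hgg : ∀ y, g y * g y = 1) (hg' : EMap τ ρ ρ g')
    (hgg' : ∀ y, g' y * g' y = 1) (hV : EMap τ ρ ρ V) (hu : ∀ y, IsUnit (V y))
    (h : ∀ y, V y * g y = g' y * V y) :
    HasVal τ ρ (fun y => (1 / 2 : ℂ) • (1 + g' y)) x :=
  hx.biso (IsBun.half hg' hgg' hρ) (BIso.of_conj (IsBun.half hg hgg hρ) hV hu fun y => by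
    simp only [mul_smul_comm, smul_mul_assoc, mul_add, add_mul, h, Matrix.one_mul, Matrix.mul_one])

end Half

section Cube
variable {Y : Type*} [TopologicalSpace Y] {τ : Y → Y} {Λ : Type} [Fintype Λ] [DecidableEq Λ]
  {t r : Y → ℝ} {γ : Matrix Λ Λ ℂ} {F : Y → Matrix Λ Λ ℂ} {x : ℂ}

/-- The combination `t Γ + r F` used to clutch two involutions along a join. -/
def clutch {Y : Type*} {κ : Type*} (t r : Y → ℝ) (Γ : Matrix κ κ ℂ) (F : Y → Matrix κ κ ℂ) (y : Y) :
    Matrix κ κ ℂ := (t y : ℂ) • Γ + (r y : ℂ) • F y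

theorem continuous_clutch {κ : Type*} [Fintype κ] (ht : Continuous t) (hr : Continuous r)
    (Γ : Matrix κ κ ℂ) {F : Y → Matrix κ κ ℂ} (hF : Tame r F) : Continuous (clutch t r Γ F) :=
  ((Complex.continuous_ofReal.comp ht).smul continuous_const).add (hF.continuous_smul hr)

theorem clutch_mul_self {κ : Type*} [Fintype κ] [DecidableEq κ] {Γ : Matrix κ κ ℂ}
    {F : Y → Matrix κ κ ℂ} (htr : ∀ y, t y ^ 2 + r y ^ 2 = 1) (hΓ : Γ * Γ = 1)
    (hF : ∀ y, F y * F y = 1) (hΓF : ∀ y, Γ * F y = -(F y * Γ)) (y : Y) :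
    clutch t r Γ F y * clutch t r Γ F y = 1 := by
  have h : (t y : ℂ) ^ 2 + (r y : ℂ) ^ 2 = 1 := by exact_mod_cast htr y
  rw [show (1 : Matrix κ κ ℂ) = ((t y : ℂ) ^ 2 + (r y : ℂ) ^ 2) • 1 by rw [h, one_smul]]
  simp only [clutch, mul_smul_comm, smul_mul_assoc, mul_add, add_mul, hΓ, hF, hΓF]
  module

theorem emap_clutch {κ : Type} [Fintype κ] [DecidableEq κ] {ρ Γ : Matrix κ κ ℂ}
    {F : Y → Matrix κ κ ℂ} (ht : Continuous t) (hr : Continuous r) (htτ : ∀ y, t (τ y) = t y)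
    (hrτ : ∀ y, r (τ y) = r y) (hFt : Tame r F) (hFτ : ∀ y, F (τ y) = F y)
    (hΓρ : Γ * ρ = ρ * Γ) (hFρ : ∀ y, F y * ρ = ρ * F y) : EMap τ ρ ρ (clutch t r Γ F) :=
  EMap.of_comm (continuous_clutch ht hr Γ hFt) (fun y => by simp only [clutch, htτ, hrτ, hFτ])
    fun y => by simp only [clutch, mul_smul_comm, smul_mul_assoc, mul_add, add_mul, hΓρ, hFρ]

/-- The symmetric function of the three copies of `K` in a triple tensor product. -/
def symOne (K : Matrix Λ Λ ℂ) : Matrix (Λ × Λ × Λ) (Λ × Λ × Λ) ℂ :=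
  ten K 1 1 + ten 1 K 1 + ten 1 1 K - ten K K K

/-- The symmetric function of the three copies of `K` in a triple tensor product. -/
def symTwo (K : Matrix Λ Λ ℂ) : Matrix (Λ × Λ × Λ) (Λ × Λ × Λ) ℂ :=
  1 - ten K K 1 - ten 1 K K - ten K 1 K

theorem symOne_mul_cycMat (K : Matrix Λ Λ ℂ) : symOne K * cycMat Λ = cycMat Λ * symOne K := by
  simp only [symOne, mul_add, add_mul, mul_sub, sub_mul, cycMat_mul_ten]
  abel

theorem symTwo_mul_cycMat (K : Matrix Λ Λ ℂ) : symTwo K * cycMat Λ = cycMat Λ * symTwo K := by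
  simp only [symTwo, mul_sub, sub_mul, cycMat_mul_ten, Matrix.one_mul,
    Matrix.mul_one]
  abel

theorem cube_conj_inv {K : Matrix Λ Λ ℂ} (hK : K * K = -1) {a b : ℂ} (hab : a ^ 2 + b ^ 2 = 1) :
    (1 + (a * b / 2) • symOne K - (b ^ 2 / 2) • symTwo K) *
      (1 - (a * b / 2) • symOne K - (b ^ 2 / 2) • symTwo K) = 1 := by
  have h1 : symOne K * symOne K = -4 • symTwo K := by
    simp only [symOne, symTwo, mul_add, add_mul, mul_sub, sub_mul, ten_mul, hK, ten_neg_left,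
      ten_neg_mid, ten_neg_right, Matrix.one_mul, Matrix.mul_one, ten_one]
    module
  have h2 : symOne K * symTwo K = 4 • symOne K := by
    simp only [symOne, symTwo, add_mul, mul_sub, sub_mul, ten_mul, hK, ten_neg_left,
      ten_neg_mid, ten_neg_right, Matrix.one_mul, Matrix.mul_one]
    module
  have h3 : symTwo K * symOne K = 4 • symOne K := by
    simp only [symOne, symTwo, mul_add, mul_sub, sub_mul, ten_mul, hK, ten_neg_left,
      ten_neg_mid, ten_neg_right, Matrix.one_mul, Matrix.mul_one]
    module
  have h4 : symTwo K * symTwo K = 4 • symTwo K := by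
    simp only [symTwo, mul_sub, sub_mul, ten_mul, hK, ten_neg_left,
      ten_neg_mid, ten_neg_right, Matrix.one_mul, Matrix.mul_one, ten_one]
    module
  have ha : a ^ 2 = 1 - b ^ 2 := by linear_combination hab
  simp only [add_mul, mul_sub, sub_mul, smul_mul_assoc, mul_smul_comm, h1, h2, h3, h4,
    Matrix.one_mul, Matrix.mul_one]
  have e : (a * b / 2) * (a * b / 2) * 4 = b ^ 2 - b ^ 2 * b ^ 2 := by linear_combination b ^ 2 * ha
  have e' : (b ^ 2 - b ^ 2 * b ^ 2) • symTwo K = ((a * b / 2) * (a * b / 2) * 4) • symTwo K := by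
    rw [e]
  linear_combination (norm := module) -e'

theorem cube_conj {K F : Matrix Λ Λ ℂ} (hKF : K * F = γ) (hFK : F * K = -γ) (hγK : γ * K = F)
    (hKγ : K * γ = -F) {a b : ℂ} (hab : a ^ 2 + b ^ 2 = 1) :
    (1 + (a * b / 2) • symOne K - (b ^ 2 / 2) • symTwo K) *
      ten (a • γ + b • F) (a • γ + b • F) (a • γ + b • F) =
    (a • ten γ γ γ + b • ten F F F) * (1 + (a * b / 2) • symOne K - (b ^ 2 / 2) • symTwo K) := by
  have h : ((a ^ 2 + b ^ 2) • 1 + (a * b / 2) • symOne K - (b ^ 2 / 2) • symTwo K) *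
      ten (a • γ + b • F) (a • γ + b • F) (a • γ + b • F) =
    (a ^ 2 + b ^ 2) • ((a • ten γ γ γ + b • ten F F F) *
      ((a ^ 2 + b ^ 2) • 1 + (a * b / 2) • symOne K - (b ^ 2 / 2) • symTwo K)) := by
    simp only [symOne, symTwo, mul_add, add_mul, mul_sub, sub_mul, ten_add_left, ten_add_mid,
      ten_add_right, ten_smul_left, ten_smul_mid, ten_smul_right, ten_mul, smul_mul_assoc,
      mul_smul_comm, hKF, hFK, hγK, hKγ,
      ten_neg_left, ten_neg_mid, ten_neg_right, Matrix.one_mul, Matrix.mul_one]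
    module
  rwa [hab, one_smul, one_smul] at h

end Cube

section CliffSum
variable {Y : Type*} [TopologicalSpace Y] {τ : Y → Y} {Λ : Type} [Fintype Λ] [DecidableEq Λ]
  {s : ℕ} {E : ℕ → Matrix Λ Λ ℂ} {γ : Matrix Λ Λ ℂ} {t r : Y → ℝ} {φ : ℕ → Y → ℝ} {x : ℂ}

/-- The Clifford multiplication by a vector. -/
def cliffSum (s : ℕ) (E : ℕ → Matrix Λ Λ ℂ) {Y : Type*} (φ : ℕ → Y → ℝ) (y : Y) : Matrix Λ Λ ℂ :=
  ∑ i ∈ Finset.range (2 * s), (φ i y : ℂ) • E i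

theorem Cliff.cliffSum_mul_self (h : Cliff s E γ) {y : Y} {c : ℝ}
    (hφ : ∑ i ∈ Finset.range (2 * s), φ i y ^ 2 = c) :
    cliffSum s E φ y * cliffSum s E φ y = (c : ℂ) • 1 := by
  have h1 : cliffSum s E φ y * cliffSum s E φ y = ∑ i ∈ Finset.range (2 * s),
      ∑ j ∈ Finset.range (2 * s), ((φ i y : ℂ) * φ j y) • (E i * E j) := by
    simp only [cliffSum, Finset.sum_mul, Finset.mul_sum, smul_mul_assoc, mul_smul_comm, smul_smul,
      Finset.smul_sum]
    rw [Finset.sum_comm]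
    exact Finset.sum_congr rfl fun i _ => Finset.sum_congr rfl fun j _ => by
      rw [mul_comm (φ j y : ℂ)]
  have h2 : cliffSum s E φ y * cliffSum s E φ y = ∑ i ∈ Finset.range (2 * s),
      ∑ j ∈ Finset.range (2 * s), ((φ i y : ℂ) * φ j y) • (E j * E i) := by
    rw [h1, Finset.sum_comm]
    simp only [mul_comm]
  have h3 : cliffSum s E φ y * cliffSum s E φ y + cliffSum s E φ y * cliffSum s E φ y =
      (2 : ℂ) • (c : ℂ) • 1 := by
    nth_rewrite 1 [h1]
    rw [h2, ← Finset.sum_add_distrib]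
    have h4 : ∀ i ∈ Finset.range (2 * s), (∑ j ∈ Finset.range (2 * s),
        ((φ i y : ℂ) * φ j y) • (E i * E j) + ∑ j ∈ Finset.range (2 * s),
        ((φ i y : ℂ) * φ j y) • (E j * E i)) = (2 * (φ i y : ℂ) ^ 2) • 1 := fun i hi => by
      rw [← Finset.sum_add_distrib, Finset.sum_eq_single i]
      · rw [h.sq i (Finset.mem_range.1 hi)]
        module
      · intro j hj hji
        rw [h.anti i (Finset.mem_range.1 hi) j (Finset.mem_range.1 hj) hji.symm]
        module
      · exact fun h => (h hi).elim
    rw [Finset.sum_congr rfl h4, ← Finset.sum_smul, ← Finset.mul_sum]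
    have : (∑ i ∈ Finset.range (2 * s), (φ i y : ℂ) ^ 2) = c := by exact_mod_cast hφ
    rw [this, mul_smul]
  rw [← two_smul ℂ] at h3
  exact smul_right_injective _ (two_ne_zero (α := ℂ)) h3

theorem Cliff.chir_mul_cliffSum (h : Cliff s E γ) (y : Y) :
    γ * cliffSum s E φ y = -(cliffSum s E φ y * γ) := by
  simp only [cliffSum, Finset.mul_sum, Finset.sum_mul, ← Finset.sum_neg_distrib, mul_smul_comm,
    smul_mul_assoc, ← smul_neg]
  exact Finset.sum_congr rfl fun i hi => by rw [h.chir_anti i (Finset.mem_range.1 hi)]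

theorem tame_cliffSum (hφ : ∀ i < 2 * s, ContinuousOn (φ i) {y | r y ≠ 0})
    (hφ1 : ∀ y, ∑ i ∈ Finset.range (2 * s), φ i y ^ 2 = 1) : Tame r (cliffSum s E φ) := by
  refine Tame.sum _ fun i hi => (Tame.const (E i)).smul
    (Complex.continuous_ofReal.comp_continuousOn (hφ i (Finset.mem_range.1 hi))) ⟨1, fun y => ?_⟩
  rw [Complex.norm_real, Real.norm_eq_abs, ← sq_le_one_iff_abs_le_one, ← hφ1 y]
  exact Finset.single_le_sum (f := fun i => φ i y ^ 2) (fun _ _ => sq_nonneg _) hi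

theorem Cliff.symGen_cliffSum_mul {Z : Matrix (Λ × Λ × Λ) (Λ × Λ × Λ) ℂ} {w : ℂ}
    (hZ : ∀ i < 2 * s, symGen w γ (E i) * Z = Z * ten (E i) 1 1) (y : Y) :
    symGen w γ (cliffSum s E φ y) * Z = Z * ten (cliffSum s E φ y) 1 1 := by
  have h1 : ∀ (u : Finset ℕ), (∀ i ∈ u, i < 2 * s) →
      symGen w γ (∑ i ∈ u, (φ i y : ℂ) • E i) * Z = Z * ten (∑ i ∈ u, (φ i y : ℂ) • E i) 1 1 := by
    intro u
    induction u using Finset.induction_on with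
    | empty => intro _; simp [symGen, ten_zero_left, ten_zero_mid, ten_zero_right]
    | insert a u ha ih =>
      intro hu
      have e : ∀ A : Matrix Λ Λ ℂ, symGen w γ ((φ a y : ℂ) • E a + A) =
          (φ a y : ℂ) • symGen w γ (E a) + symGen w γ A := fun A => by
        simp only [symGen, ten_add_left, ten_add_mid, ten_add_right, ten_smul_left, ten_smul_mid,
          ten_smul_right]
        module
      rw [Finset.sum_insert ha, e, add_mul, ih fun i hi => hu i (by simp [hi]), smul_mul_assoc,
        hZ a (hu a (by simp)), ten_add_left, mul_add, ten_smul_left, mul_smul_comm]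
  exact h1 _ fun i hi => Finset.mem_range.1 hi

/-- Two anticommuting-up-to-scalars clutchings over the same axis have the same value. -/
theorem HasVal.clutch_of_anti {κ : Type} [Fintype κ] [DecidableEq κ] {ρ Γ : Matrix κ κ ℂ}
    {A B : Y → Matrix κ κ ℂ} (htr : ∀ y, t y ^ 2 + r y ^ 2 = 1) (hρ : ρ ^ 6 = 1)
    (hΓ : Γ * Γ = 1) (hA : ∀ y, A y * A y = 1) (hB : ∀ y, B y * B y = 1)
    (hΓA : ∀ y, Γ * A y = -(A y * Γ)) (hΓB : ∀ y, Γ * B y = -(B y * Γ))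
    (hAB : ∀ y, A y * B y = -(B y * A y))
    (eA : EMap τ ρ ρ (clutch t r Γ A)) (eB : EMap τ ρ ρ (clutch t r Γ B))
    (hx : HasVal τ ρ (fun y => (1 / 2 : ℂ) • (1 + clutch t r Γ B y)) x) :
    HasVal τ ρ (fun y => (1 / 2 : ℂ) • (1 + clutch t r Γ A y)) x := by
  have sA := clutch_mul_self htr hΓ hA hΓA
  have sB := clutch_mul_self htr hΓ hB hΓB
  refine hx.half_conj (V := fun y => 1 + clutch t r Γ A y * clutch t r Γ B y) hρ eB sB eA sA
    (EMap.one.add (eA.mul eB)) (fun y => ?_) fun y => ?_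
  · have h1 : clutch t r Γ A y * clutch t r Γ B y + clutch t r Γ B y * clutch t r Γ A y =
        (2 * (t y : ℂ) ^ 2) • 1 := by
      simp only [clutch, mul_smul_comm, smul_mul_assoc, mul_add, add_mul, hΓ, hΓA, hΓB, hAB]
      module
    have h2 : (1 + clutch t r Γ A y * clutch t r Γ B y) *
        (1 + clutch t r Γ B y * clutch t r Γ A y) = (2 + 2 * (t y : ℂ) ^ 2) • 1 := by
      have e : clutch t r Γ A y * clutch t r Γ B y * (clutch t r Γ B y * clutch t r Γ A y) = 1 := by
        rw [Matrix.mul_assoc, ← Matrix.mul_assoc (clutch t r Γ B y), sB, Matrix.one_mul, sA]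
      rw [mul_add, add_mul, add_mul, e, Matrix.one_mul, Matrix.one_mul, Matrix.mul_one]
      linear_combination (norm := module) h1
    have h3 : (2 + 2 * (t y : ℂ) ^ 2) ≠ 0 := by
      have : (2 + 2 * t y ^ 2 : ℝ) ≠ 0 := by positivity
      exact_mod_cast this
    refine IsUnit.of_mul_eq_one (b := (2 + 2 * (t y : ℂ) ^ 2)⁻¹ •
      (1 + clutch t r Γ B y * clutch t r Γ A y)) ?_
    rw [mul_smul_comm, h2, smul_smul, inv_mul_cancel₀ h3, one_smul]
  · rw [add_mul, mul_add, Matrix.mul_assoc, sB, ← Matrix.mul_assoc, sA, Matrix.one_mul,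
      Matrix.mul_one, add_comm]

/-- The value of the clutching of a tensor product of involutions. -/
theorem HasVal.clutch_kron {κ : Type} [Fintype κ] [DecidableEq κ] {S η : Matrix κ κ ℂ} {N : ℕ}
    {F : Y → Matrix Λ Λ ℂ} (hτ : AllVal τ) (hT : TrDiv τ N)
    (htr : ∀ y, t y ^ 2 + r y ^ 2 = 1) (hγ : γ * γ = 1) (hF : ∀ y, F y * F y = 1)
    (hγF : ∀ y, γ * F y = -(F y * γ)) (hg : EMap τ 1 1 (clutch t r γ F)) (hη : η * η = 1)
    (hηS : η * S = S * η) (hS : S ^ 6 = 1)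
    (hx : HasVal τ 1 (fun y => (1 / 2 : ℂ) • (1 + clutch t r γ F y)) x) :
    ∃ x' a : ℂ, IsIntegral ℤ a ∧ x + x' - Fintype.card Λ = 2 ^ N * a ∧
      HasVal τ (1 ⊗ₖ S) (fun y => (1 / 2 : ℂ) • (1 + clutch t r (γ ⊗ₖ η) (fun y => F y ⊗ₖ 1) y))
        (x * ((S.trace + (η * S).trace) / 2) + x' * ((S.trace - (η * S).trace) / 2)) := by
  have hgg := clutch_mul_self htr hγ hF hγF
  have h1 : (1 : Matrix Λ Λ ℂ) ^ 6 = 1 := one_pow 6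
  have hP := IsBun.half hg hgg h1
  obtain ⟨x', hx'⟩ := hτ _ _ _ hP.compl
  have hsum := hx.add hP hP.compl (fun y => by rw [mul_sub, hP.idem, Matrix.mul_one, sub_self])
    (fun y => by rw [sub_mul, hP.idem, Matrix.one_mul, sub_self]) hx'
  simp only [add_sub_cancel] at hsum
  have hone : IsCon (1 : Matrix Λ Λ ℂ) 1 := ⟨rfl, Matrix.mul_one _, h1⟩
  obtain ⟨a, ha, e⟩ := HasVal.unique hT hone.isBun hsum (HasVal.con hone)
  rw [Matrix.one_mul, Matrix.trace_one] at e
  refine ⟨x', a, ha, e, ?_⟩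
  have hneg : ∀ y, -clutch t r γ F y * -clutch t r γ F y = 1 := fun y => by
    rw [neg_mul_neg, hgg]
  have hgn : EMap τ 1 1 fun y => -clutch t r γ F y :=
    EMap.of_comm hg.cont.neg (fun y => by have := hg.eqv y; simpa using this) fun y => by simp
  have hgm : EMap τ 1 1 fun y => γ * -clutch t r γ F y * γ :=
    ((EMap.const (by simp)).mul hgn).mul (EMap.const (by simp))
  have hgmm : ∀ y, γ * -clutch t r γ F y * γ * (γ * -clutch t r γ F y * γ) = 1 := fun y => by
    rw [show γ * -clutch t r γ F y * γ * (γ * -clutch t r γ F y * γ) =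
      γ * (-clutch t r γ F y * (γ * γ) * -clutch t r γ F y) * γ by simp only [Matrix.mul_assoc], hγ,
      Matrix.mul_one, hneg, Matrix.mul_one, hγ]
  have hx'' : HasVal τ 1 (fun y => (1 / 2 : ℂ) • (1 + γ * -clutch t r γ F y * γ)) x' := by
    refine HasVal.half_conj (g := fun y => -clutch t r γ F y) (V := fun _ => γ) ?_ h1 hgn hneg hgm
      hgmm (EMap.const (by simp)) (fun _ => IsUnit.of_mul_eq_one (b := γ) hγ) fun y => ?_
    · convert hx' using 2
      module
    · rw [Matrix.mul_assoc _ γ γ, hγ, Matrix.mul_one]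
  have hcp : IsCon S ((1 / 2 : ℂ) • (1 + η)) := ⟨by
    simp only [mul_smul_comm, smul_mul_assoc, mul_add, add_mul, hηS, Matrix.one_mul, Matrix.mul_one],
    by
      simp only [mul_smul_comm, smul_mul_assoc, mul_add, add_mul, hη, Matrix.one_mul, Matrix.mul_one]
      module, hS⟩
  have hcm : IsCon S ((1 / 2 : ℂ) • (1 - η)) := ⟨by
    simp only [mul_smul_comm, smul_mul_assoc, mul_sub, sub_mul, hηS, Matrix.one_mul, Matrix.mul_one],
    by
      simp only [mul_smul_comm, smul_mul_assoc, mul_sub, sub_mul, hη, Matrix.one_mul, Matrix.mul_one]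
      module, hS⟩
  have hpm : ((1 / 2 : ℂ) • (1 + η)) * ((1 / 2 : ℂ) • (1 - η)) = 0 := by
    simp only [mul_smul_comm, smul_mul_assoc, mul_sub, add_mul, hη, Matrix.one_mul, Matrix.mul_one]
    module
  have hmp : ((1 / 2 : ℂ) • (1 - η)) * ((1 / 2 : ℂ) • (1 + η)) = 0 := by
    simp only [mul_smul_comm, smul_mul_assoc, mul_add, sub_mul, hη, Matrix.one_mul, Matrix.mul_one]
    module
  have hB2 := IsBun.half hgm hgmm h1
  have := (hx.kron hP hcp).add (hP.kron hcp) (hB2.kron hcm)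
    (fun y => by rw [← mul_kronecker_mul, hpm, kronecker_zero])
    (fun y => by rw [← mul_kronecker_mul, hmp, kronecker_zero]) (hx''.kron hB2 hcm)
  have et : ∀ A B : Matrix κ κ ℂ, (A * ((1 / 2 : ℂ) • B)).trace = (A * B).trace / 2 := fun A B => by
    rw [mul_smul_comm, Matrix.trace_smul, smul_eq_mul]; ring
  rw [et, et, mul_add, mul_sub, Matrix.mul_one, Matrix.trace_add, Matrix.trace_sub, ← hηS] at this
  convert this using 1
  funext y
  have hc : γ * -clutch t r γ F y * γ = -((t y : ℂ) • γ) + (r y : ℂ) • F y := by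
    simp only [clutch, mul_neg, neg_mul, mul_smul_comm, smul_mul_assoc, mul_add, add_mul, hγ, hγF,
      Matrix.mul_assoc, Matrix.one_mul, Matrix.mul_one]
    module
  rw [hc]
  ext ⟨i, k⟩ ⟨j, l⟩
  simp only [clutch, Matrix.smul_apply, Matrix.add_apply, kroneckerMap_apply, Matrix.sub_apply,
    Matrix.neg_apply, smul_eq_mul, Matrix.one_apply, Prod.mk.injEq]
  by_cases hij : i = j <;> by_cases hkl : k = l <;> simp [hij, hkl] <;> ring

/-- The Adams operation relation for a Clifford clutching. -/
theorem Cliff.value_relation (h : Cliff s E γ) {N : ℕ} (hτ : AllVal τ) (hT : TrDiv τ N)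
    (hτ' : ∀ y, τ (τ y) = y) (ht : Continuous t) (hr : Continuous r) (htτ : ∀ y, t (τ y) = t y)
    (hrτ : ∀ y, r (τ y) = r y) (htr : ∀ y, t y ^ 2 + r y ^ 2 = 1)
    (hφ : ∀ i < 2 * s, ContinuousOn (φ i) {y | r y ≠ 0})
    (hφ1 : ∀ y, ∑ i ∈ Finset.range (2 * s), φ i y ^ 2 = 1)
    (hφτ : ∀ i < 2 * s, ∀ y, φ i (τ y) = φ i y)
    (hx : HasVal τ 1 (fun y => (1 / 2 : ℂ) • (1 + clutch t r γ (cliffSum s E φ) y)) x) :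
    ∃ a : ℂ, IsIntegral ℤ a ∧ 3 * ((1 - 3 ^ s) * (x - 2 ^ s / 2)) = 2 ^ N * a := by
  set F := cliffSum s E φ with hFdef
  have hF : Tame r F := tame_cliffSum hφ hφ1
  have hFF : ∀ y, F y * F y = 1 := fun y => by
    simpa using h.cliffSum_mul_self (hφ1 y)
  have hγF : ∀ y, γ * F y = -(F y * γ) := fun y => h.chir_mul_cliffSum y
  have hFτ : ∀ y, F (τ y) = F y := fun y =>
    Finset.sum_congr rfl fun i hi => by rw [hφτ i (Finset.mem_range.1 hi)]
  have hγ := h.chir_sq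
  have hT6 : cycMat Λ ^ 6 = 1 := by
    rw [show 6 = 3 * 2 from rfl, pow_mul, cycMat_pow_three, one_pow]
  have eg : EMap τ 1 1 (clutch t r γ F) :=
    emap_clutch ht hr htτ hrτ hF hFτ (by simp) (by simp)
  have hgg := clutch_mul_self htr hγ hFF hγF
  obtain ⟨z, a, ha, hxz, hz⟩ := HasVal.cube_involution hτ hT hτ' eg hgg hx
  have hab : ∀ y, (t y : ℂ) ^ 2 + (r y : ℂ) ^ 2 = 1 := fun y => by exact_mod_cast htr y
  set Γ : Matrix (Λ × Λ × Λ) (Λ × Λ × Λ) ℂ := ten γ γ γ with hΓ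
  have hΓΓ : Γ * Γ = 1 := by rw [hΓ, ten_mul, hγ, ten_one]
  have hΓT : Γ * cycMat Λ = cycMat Λ * Γ := (cycMat_mul_ten _ _ _).symm
  set F3 : Y → Matrix (Λ × Λ × Λ) (Λ × Λ × Λ) ℂ := fun y => ten (F y) (F y) (F y) with hF3
  have hF3F3 : ∀ y, F3 y * F3 y = 1 := fun y => by simp only [hF3, ten_mul, hFF, ten_one]
  have hΓF3 : ∀ y, Γ * F3 y = -(F3 y * Γ) := fun y => by
    simp only [hΓ, hF3, ten_mul, hγF, ten_neg_left, ten_neg_mid, ten_neg_right, neg_neg]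
  have eF3 : EMap τ (cycMat Λ) (cycMat Λ) (clutch t r Γ F3) :=
    emap_clutch ht hr htτ hrτ (hF.ten hF hF) (fun y => by simp only [hF3, hFτ]) hΓT
      fun y => (cycMat_mul_ten _ _ _).symm
  have hz1 : HasVal τ (cycMat Λ) (fun y => (1 / 2 : ℂ) • (1 + clutch t r Γ F3 y)) z := by
    set K : Y → Matrix Λ Λ ℂ := fun y => γ * F y with hK
    have hKK : ∀ y, K y * K y = -1 := fun y => by
      simp only [hK]
      nth_rewrite 1 [hγF]
      rw [Matrix.neg_mul, Matrix.mul_assoc, ← Matrix.mul_assoc γ, hγ, Matrix.one_mul, hFF]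
    have hKt : Tame r K := hF.const_mul γ
    have ht1 : Tame r (fun _ => (1 : Matrix Λ Λ ℂ)) := Tame.const 1
    have hs1 : Tame r fun y => symOne (K y) := by
      have := (((hKt.ten ht1 ht1).add (ht1.ten hKt ht1)).add (ht1.ten ht1 hKt)).add
        ((hKt.ten hKt hKt).const_smul (-1))
      simpa only [symOne, sub_eq_add_neg, neg_one_smul] using this
    have hs2 : Tame r fun y => symTwo (K y) := by
      have := (((Tame.const (1 : Matrix (Λ × Λ × Λ) (Λ × Λ × Λ) ℂ)).add
        ((hKt.ten hKt ht1).const_smul (-1))).add ((ht1.ten hKt hKt).const_smul (-1))).add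
        ((hKt.ten ht1 hKt).const_smul (-1))
      simpa only [symTwo, sub_eq_add_neg, neg_one_smul] using this
    have htc : Continuous fun y => (t y : ℂ) := Complex.continuous_ofReal.comp ht
    have hrc : Continuous fun y => (r y : ℂ) := Complex.continuous_ofReal.comp hr
    have hcub : EMap τ (cycMat Λ) (cycMat Λ) fun y =>
        ten (clutch t r γ F y) (clutch t r γ F y) (clutch t r γ F y) := by
      have := eg.ten
      rwa [ten_one, Matrix.one_mul] at this
    refine hz.half_conj (V := fun y => 1 + ((t y : ℂ) * r y / 2) • symOne (K y) -
      ((r y : ℂ) ^ 2 / 2) • symTwo (K y)) hT6 hcub (fun y => by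
      simp only [ten_mul, hgg, ten_one]) eF3 (clutch_mul_self htr hΓΓ hF3F3 hΓF3) ?_
      (fun y => IsUnit.of_mul_eq_one _ (cube_conj_inv (hKK y) (hab y)))
      fun y => ?_
    · refine EMap.of_comm ?_ (fun y => by simp only [htτ, hrτ, hK, hFτ]) fun y => by
        simp only [mul_sub, sub_mul, mul_add, add_mul, Matrix.one_mul, Matrix.mul_one,
          smul_mul_assoc, mul_smul_comm, symOne_mul_cycMat, symTwo_mul_cycMat]
      have c1 : Continuous fun y => ((t y : ℂ) * r y / 2) • symOne (K y) := by
        convert (htc.div_const 2).smul (hs1.continuous_smul hr) using 2 with y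
        rw [Pi.smul_apply', smul_smul, mul_div_right_comm]
      have c2 : Continuous fun y => ((r y : ℂ) ^ 2 / 2) • symTwo (K y) := by
        convert (hrc.div_const 2).smul (hs2.continuous_smul hr) using 2 with y
        rw [Pi.smul_apply', smul_smul, pow_two, mul_div_right_comm]
      exact (continuous_const.add c1).sub c2
    · refine cube_conj ?_ ?_ ?_ ?_ (hab y)
      · simp only [hK]
        rw [Matrix.mul_assoc, hFF, Matrix.mul_one]
      · simp only [hK]
        rw [hγF, Matrix.mul_neg, ← Matrix.mul_assoc, hFF, Matrix.one_mul]
      · simp only [hK]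
        rw [← Matrix.mul_assoc, hγ, Matrix.one_mul]
      · simp only [hK]
        rw [hγF, Matrix.neg_mul, Matrix.mul_assoc, hγ, Matrix.mul_one]
  obtain ⟨w, hw, hw1⟩ : ∃ w : ℂ, 3 * w ^ 2 = 1 ∧ 1 + w ≠ 0 := by
    refine ⟨((√3)⁻¹ : ℝ), ?_, ?_⟩
    · have : 3 * ((√3)⁻¹ : ℝ) ^ 2 = 1 := by
        rw [inv_pow, Real.sq_sqrt (by norm_num), mul_inv_cancel₀ (by norm_num)]
      exact_mod_cast this
    · have : 1 + ((√3)⁻¹ : ℝ) ≠ 0 := by positivity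
      exact_mod_cast this
  obtain ⟨Z, Z', η, S, hZ1, hZ2, hZE, hZT, hZΓ, hηη, hηS, hS6, hStr, hηStr⟩ :=
    h.exists_splitting hw hw1
  rw [← hΓ] at hZΓ
  set A : Y → Matrix (Λ × Λ × Λ) (Λ × Λ × Λ) ℂ := fun y => symGen w γ (F y) with hAdef
  have hAZ : ∀ y, A y * Z = Z * (F y ⊗ₖ 1) := fun y => by
    rw [← one_kronecker_one]
    exact Cliff.symGen_cliffSum_mul hZE y
  have hAA : ∀ y, A y * A y = 1 := fun y => by
    have e : (1 : Matrix (Λ × Λ × Λ) (Λ × Λ × Λ) ℂ) = (3 * w ^ 2) • 1 := by rw [hw, one_smul]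
    rw [e]
    simp only [hAdef, symGen, smul_mul_assoc, mul_smul_comm, mul_add, add_mul, ten_mul, hFF, hγ, hγF,
      Matrix.one_mul, Matrix.mul_one, ten_neg_left, ten_neg_mid, ten_neg_right, ten_one]
    module
  have hΓA : ∀ y, Γ * A y = -(A y * Γ) := fun y => by
    simp only [hΓ, hAdef, symGen, smul_mul_assoc, mul_smul_comm, mul_add, add_mul, ten_mul, hγ, hγF,
      Matrix.one_mul, Matrix.mul_one, ten_neg_left, ten_neg_mid, ten_neg_right]
    module
  have hAF3 : ∀ y, A y * F3 y = -(F3 y * A y) := fun y => by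
    simp only [hF3, hAdef, symGen, smul_mul_assoc, mul_smul_comm, mul_add, add_mul, ten_mul, hFF,
      hγF, Matrix.one_mul, Matrix.mul_one, ten_neg_left, ten_neg_mid, ten_neg_right]
    module
  have hAT : ∀ y, A y * cycMat Λ = cycMat Λ * A y := fun y => by
    simp only [hAdef, symGen, smul_mul_assoc, mul_smul_comm, mul_add, add_mul, cycMat_mul_ten]
    module
  have hAt : Tame r A := by
    have c1 : Tame r (fun _ => (1 : Matrix Λ Λ ℂ)) := Tame.const 1
    have c2 : Tame r (fun _ => γ) := Tame.const γ
    exact (((hF.ten c1 c2).add (c2.ten hF c1)).add (c1.ten c2 hF)).const_smul w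
  have eA : EMap τ (cycMat Λ) (cycMat Λ) (clutch t r Γ A) :=
    emap_clutch ht hr htτ hrτ hAt (fun y => by simp only [hAdef, hFτ]) hΓT hAT
  have hz2 := hz1.clutch_of_anti htr hT6 hΓΓ hAA hF3F3 hΓA hΓF3 hAF3 eA eF3
  obtain ⟨x', a', ha', hxx', hval⟩ :=
    HasVal.clutch_kron hτ hT htr hγ hFF hγF eg hηη hηS hS6 hx
  have hZ'T : Z' * cycMat Λ = (1 ⊗ₖ S) * Z' := by
    rw [← Matrix.mul_one (Z' * cycMat Λ), ← hZ1, Matrix.mul_assoc, ← Matrix.mul_assoc (cycMat Λ),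
      hZT, Matrix.mul_assoc Z, ← Matrix.mul_assoc, hZ2, Matrix.one_mul]
  have hZc : ∀ M M', M * Z = Z * M' → Z' * M = M' * Z' := fun M M' e => by
    rw [← Matrix.mul_one (Z' * M), ← hZ1, Matrix.mul_assoc, ← Matrix.mul_assoc M,
      e, Matrix.mul_assoc Z, ← Matrix.mul_assoc, hZ2, Matrix.one_mul]
  have hkron : ∀ y, (F y ⊗ₖ (1 : Matrix (Λ × Λ) (Λ × Λ) ℂ)) * (F y ⊗ₖ 1) = 1 := fun y => by
    rw [← mul_kronecker_mul, hFF, Matrix.one_mul, one_kronecker_one]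
  have eK : EMap τ (1 ⊗ₖ S) (1 ⊗ₖ S) (clutch t r (γ ⊗ₖ η) fun y => F y ⊗ₖ 1) := by
    have := ((EMap.const (τ := τ) (F := Z') hZ'T).mul eA).mul
      (EMap.const (τ := τ) (F := Z) hZT.symm)
    convert this using 1
    funext y
    rw [Matrix.mul_assoc]
    simp only [clutch, mul_add, add_mul, smul_mul_assoc, mul_smul_comm, hAZ, hZΓ,
      ← Matrix.mul_assoc Z', hZ2, Matrix.one_mul]
  have hz3 := hz2.biso (IsBun.half eK (clutch_mul_self htr
      (by rw [← mul_kronecker_mul, hγ, hηη, one_kronecker_one]) hkron fun y => by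
        rw [← mul_kronecker_mul, ← mul_kronecker_mul, hγF, Matrix.one_mul, Matrix.mul_one,
          ← neg_one_smul ℂ, smul_kronecker, neg_one_smul]) (by
        rw [kronecker_pow', hS6, one_pow, one_kronecker_one]))
    (BIso.of_conj (IsBun.half eA (clutch_mul_self htr hΓΓ hAA hΓA) hT6)
      (EMap.const (F := Z') hZ'T) (fun _ => IsUnit.of_mul_eq_one (b := Z) hZ2) fun y => by
        simp only [clutch, mul_smul_comm, smul_mul_assoc, mul_add, add_mul, Matrix.mul_one,
          Matrix.one_mul, hZc _ _ (hAZ y), hZc _ _ hZΓ])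
  obtain ⟨b, hb, e⟩ := HasVal.unique hT (IsBun.half eK (clutch_mul_self htr
      (by rw [← mul_kronecker_mul, hγ, hηη, one_kronecker_one]) hkron fun y => by
        rw [← mul_kronecker_mul, ← mul_kronecker_mul, hγF, Matrix.one_mul, Matrix.mul_one,
          ← neg_one_smul ℂ, smul_kronecker, neg_one_smul]) (by
        rw [kronecker_pow', hS6, one_pow, one_kronecker_one])) hz3 hval
  rw [hStr, hηStr] at e
  rw [h.card] at hxx'
  push_cast at hxx'
  obtain ⟨q, hq⟩ : ∃ q : ℤ, (1 - 3 ^ s : ℤ) = 2 * q := by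
    have : Odd (3 ^ s : ℤ) := Odd.pow (by decide)
    obtain ⟨k, hk⟩ := this
    exact ⟨-k, by rw [hk]; ring⟩
  have hq' : (1 - 3 ^ s : ℂ) = 2 * q := by exact_mod_cast hq
  have hint : ∀ k : ℤ, IsIntegral ℤ (k : ℂ) := fun k => by
    simpa using isIntegral_algebraMap (R := ℤ) (A := ℂ) (x := k)
  refine ⟨a + (3 : ℤ) * b + (3 : ℤ) * (q * a'), (ha.add ((hint 3).mul hb)).add
    ((hint 3).mul ((hint q).mul ha')), ?_⟩
  push_cast
  have h3 : (3 : ℂ) ^ s = 1 - 2 * q := by rw [← hq']; ring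
  rw [h3] at e ⊢
  linear_combination hxz + 3 * e + 3 * q * hxx'

end CliffSum

theorem two_pow_dvd_of_mul_eq {M : ℕ} {c : ℤ} {a b : ℂ} (ha : IsIntegral ℤ a) (hb : IsIntegral ℤ b)
    (h : (c : ℂ) * (2 * b - 1) = 2 ^ M * a) : (2 : ℤ) ^ M ∣ c := by
  have h1 : ∀ j : ℕ, ∃ e : ℂ, IsIntegral ℤ e ∧ (c : ℂ) * (2 * b) ^ j - c = 2 ^ M * e := by
    intro j
    induction j with
    | zero => exact ⟨0, isIntegral_zero, by simp⟩
    | succ j ih =>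
      obtain ⟨e, he, h2⟩ := ih
      have h2b : IsIntegral ℤ (2 * b) := by
        rw [two_mul]; exact hb.add hb
      exact ⟨e + (2 * b) ^ j * a, he.add ((h2b.pow j).mul ha), by
        linear_combination h2 + (2 * b) ^ j * h⟩
  obtain ⟨e, he, h2⟩ := h1 M
  have h3 : IsIntegral ℤ ((c : ℂ) * b ^ M - e) := by
    refine (IsIntegral.mul ?_ (hb.pow M)).sub he
    simpa using isIntegral_algebraMap (R := ℤ) (A := ℂ) (x := c)
  have h4 : (c : ℂ) = 2 ^ M * (c * b ^ M - e) := by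
    rw [mul_pow] at h2
    linear_combination -h2
  have h5 : (c : ℂ) * b ^ M - e = algebraMap ℚ ℂ ((c : ℚ) / 2 ^ M) := by
    have : (2 : ℂ) ^ M ≠ 0 := pow_ne_zero _ two_ne_zero
    simp only [map_div₀, map_intCast, map_pow, map_ofNat]
    field_simp
    linear_combination -h4
  rw [h5, isIntegral_algebraMap_iff (algebraMap ℚ ℂ).injective] at h3
  obtain ⟨z, hz⟩ := IsIntegrallyClosed.isIntegral_iff.1 h3
  refine ⟨z, ?_⟩
  have : (2 : ℚ) ^ M ≠ 0 := pow_ne_zero _ two_ne_zero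
  rw [eq_div_iff this] at hz
  have h6 : (z : ℚ) * 2 ^ M = c := by simpa using hz
  exact_mod_cast (by rw [← h6, mul_comm] : (c : ℚ) = 2 ^ M * z)

section Core
variable {Λ : Type} [Fintype Λ] [DecidableEq Λ] {s : ℕ} {E : ℕ → Matrix Λ Λ ℂ} {γ : Matrix Λ Λ ℂ}

theorem Cliff.trace_chir (h : Cliff s E γ) (hs : 1 ≤ s) : γ.trace = 0 := by
  have h0 : 0 < 2 * s := by omega
  have h1 : γ.trace = -γ.trace := calc
    γ.trace = (γ * E 0 * E 0).trace := by rw [Matrix.mul_assoc, h.sq 0 h0, Matrix.mul_one]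
    _ = (E 0 * (γ * E 0)).trace := Matrix.trace_mul_comm _ _
    _ = -(γ.trace) := by
      rw [h.chir_anti 0 h0, Matrix.mul_neg, ← Matrix.mul_assoc, h.sq 0 h0, Matrix.one_mul,
        Matrix.trace_neg]
  linear_combination h1 / 2

/-- The value of the bundle with clutching function a linear Clifford multiplication. -/
theorem Cliff.hasVal_linear {Y : Type*} [TopologicalSpace Y] {τ : Y → Y} (h : Cliff s E γ)
    (hs : 1 ≤ s) {t r a η : Y → ℝ}
    {F B : Y → Matrix Λ Λ ℂ} (hg : EMap τ 1 1 (clutch t r γ F))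
    (hgg : ∀ y, clutch t r γ F y * clutch t r γ F y = 1)
    (hB : Continuous B) (hη : Continuous η) (hBτ : ∀ y, B (τ y) = -B y) (hητ : ∀ y, η (τ y) = -η y)
    (hBB : ∀ y, B y * B y = ((a y ^ 2 : ℝ) : ℂ) • 1) (hγB : ∀ y, γ * B y = -(B y * γ))
    (hD : ∀ y, a y ^ 2 + η y ^ 2 ≠ 0)
    (ht : ∀ y, (a y ^ 2 + η y ^ 2) * t y = a y ^ 2 - η y ^ 2)
    (hF : ∀ y, ((a y ^ 2 + η y ^ 2 : ℝ) : ℂ) • ((r y : ℂ) • F y) = (2 * η y : ℂ) • B y) :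
    HasVal τ 1 (fun y => (1 / 2 : ℂ) • (1 + clutch t r γ F y)) (-(2 ^ s / 2)) := by
  have hbun := IsBun.half hg hgg (by simp)
  have hD' : ∀ y, ((a y ^ 2 + η y ^ 2 : ℝ) : ℂ) ≠ 0 := fun y => by exact_mod_cast hD y
  have hcon : IsCon (-1) ((1 / 2 : ℂ) • (1 - γ)) := ⟨by
    rw [Matrix.mul_neg, Matrix.neg_mul, Matrix.mul_one, Matrix.one_mul], by
    simp only [mul_smul_comm, smul_mul_assoc, mul_sub, sub_mul, h.chir_sq, Matrix.one_mul,
      Matrix.mul_one]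
    module, by rw [Even.neg_one_pow (by decide : Even 6)]⟩
  have hK : ∀ y, γ * B y * (γ * B y) = -(((a y ^ 2 : ℝ) : ℂ) • 1) := fun y => by
    nth_rewrite 1 [hγB]
    rw [Matrix.neg_mul, Matrix.mul_assoc, ← Matrix.mul_assoc γ, h.chir_sq, Matrix.one_mul, hBB]
  have hw : EMap τ (-1) 1 fun y => (η y : ℂ) • (1 : Matrix Λ Λ ℂ) - γ * B y := by
    refine ⟨((Complex.continuous_ofReal.comp hη).smul continuous_const).sub
      (continuous_const.mul hB), fun y => ?_⟩
    simp only [hητ, hBτ, Matrix.mul_neg, Matrix.mul_one, Matrix.neg_mul, Matrix.one_mul]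
    push_cast
    module
  have hi := BIso.of_conj (Q := fun _ => (1 / 2 : ℂ) • (1 - γ)) hbun hw (fun y => ?_) fun y => ?_
  · have h1 := (HasVal.con (τ := τ) hcon).biso hbun hi.symm
    convert h1 using 1
    rw [Matrix.neg_mul, Matrix.one_mul, Matrix.trace_neg, Matrix.trace_smul, Matrix.trace_sub,
      h.trace_chir hs, Matrix.trace_one, h.card]
    simp only [smul_eq_mul]
    push_cast
    ring
  · refine IsUnit.of_mul_eq_one (((a y ^ 2 + η y ^ 2 : ℝ) : ℂ)⁻¹ • ((η y : ℂ) • 1 + γ * B y)) ?_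
    have h2 : ((η y : ℂ) • (1 : Matrix Λ Λ ℂ) - γ * B y) * ((η y : ℂ) • 1 + γ * B y) =
        ((a y ^ 2 + η y ^ 2 : ℝ) : ℂ) • 1 := by
      simp only [mul_add, sub_mul, hK, smul_mul_assoc, mul_smul_comm, Matrix.one_mul,
        Matrix.mul_one]
      push_cast
      module
    rw [mul_smul_comm, h2, smul_smul, inv_mul_cancel₀ (hD' y), one_smul]
  · have h3 : ((η y : ℂ) • (1 : Matrix Λ Λ ℂ) - γ * B y) * clutch t r γ F y =
        -γ * ((η y : ℂ) • (1 : Matrix Λ Λ ℂ) - γ * B y) := by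
      apply smul_right_injective _ (hD' y)
      have h4 : ((a y ^ 2 + η y ^ 2 : ℝ) : ℂ) • clutch t r γ F y =
          ((a y ^ 2 - η y ^ 2 : ℝ) : ℂ) • γ + (2 * η y : ℂ) • B y := by
        rw [clutch, smul_add, hF, smul_smul, ← ht y]
        push_cast
        rfl
      have h5 : γ * B y * γ = -B y := by
        rw [hγB, Matrix.neg_mul, Matrix.mul_assoc, h.chir_sq, Matrix.mul_one]
      have h6 : γ * B y * B y = ((a y ^ 2 : ℝ) : ℂ) • γ := by
        rw [Matrix.mul_assoc, hBB, mul_smul_comm, Matrix.mul_one]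
      have h7 : γ * (γ * B y) = B y := by rw [← Matrix.mul_assoc, h.chir_sq, Matrix.one_mul]
      simp only
      rw [← mul_smul_comm, h4]
      simp only [mul_add, sub_mul, mul_sub, smul_mul_assoc, mul_smul_comm, Matrix.one_mul,
        Matrix.mul_one, Matrix.neg_mul, h5, h6, h7]
      push_cast
      module
    rw [mul_smul_comm, mul_add, h3, Matrix.mul_one, Matrix.neg_mul, ← sub_eq_add_neg,
      smul_mul_assoc, sub_mul (1 : Matrix Λ Λ ℂ), Matrix.one_mul]

theorem two_pow_dvd_of_odd_multiplication {V W : Type} [NormedAddCommGroup V] [NormedSpace ℝ V]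
    [NormedAddCommGroup W] [NormedSpace ℝ W] {k : ℕ} (hs : 1 ≤ s)
    (hV : Module.finrank ℝ V = 2 * s) (hW : Module.finrank ℝ W = 2 * k + 1) {φ : ℕ → V × W → ℝ}
    (hc : ∀ i < 2 * s, Continuous (φ i))
    (hφ : ∀ p, ∑ i ∈ Finset.range (2 * s), φ i p ^ 2 = (‖p.1‖ * ‖p.2‖) ^ 2)
    (hV' : ∀ i < 2 * s, ∀ x y, φ i (-x, y) = -φ i (x, y))
    (hW' : ∀ i < 2 * s, ∀ (c : ℝ) x y, φ i (x, c • y) = c * φ i (x, y)) :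
    (2 : ℤ) ^ (k + 1) ∣ 3 ^ s - 1 := by
  obtain ⟨Λ, _, _, E, γ, h⟩ := exists_cliff s
  have : FiniteDimensional ℝ V := Module.finite_of_finrank_pos (by omega)
  have : FiniteDimensional ℝ W := Module.finite_of_finrank_eq_succ hW
  have : Nontrivial W := Module.nontrivial_of_finrank_pos (R := ℝ) (by omega)
  obtain ⟨y₀, hy₀⟩ := exists_norm_eq W zero_le_one
  have hdim : Module.finrank ℝ (V × W) = 2 * (s + k) + 1 := by
    rw [Module.finrank_prod, hV, hW]; ring
  have hdim' : Module.finrank ℝ (V × ℝ) = 2 * s + 1 := by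
    rw [Module.finrank_prod, hV, Module.finrank_self]
  have hpos : ∀ p : US (V × W), 0 < ‖p.1.1‖ ^ 2 + ‖p.1.2‖ ^ 2 := fun p => by
    by_contra hp
    refine p.ne_zero (Prod.ext (norm_eq_zero.1 ?_) (norm_eq_zero.1 ?_)) <;> nlinarith
      [sq_nonneg ‖p.1.1‖, sq_nonneg ‖p.1.2‖]
  let D : US (V × W) → ℝ := fun p => ‖p.1.1‖ ^ 2 + ‖p.1.2‖ ^ 2
  let t : US (V × W) → ℝ := fun p => (‖p.1.1‖ ^ 2 - ‖p.1.2‖ ^ 2) / D p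
  let r : US (V × W) → ℝ := fun p => 2 * (‖p.1.1‖ * ‖p.1.2‖) / D p
  let ψ : ℕ → US (V × W) → ℝ := fun i p =>
    if ‖p.1.1‖ * ‖p.1.2‖ = 0 then (if i = 0 then 1 else 0) else φ i p.1 / (‖p.1.1‖ * ‖p.1.2‖)
  have hD : ∀ p, D p ≠ 0 := fun p => (hpos p).ne'
  have hDc : Continuous D := by fun_prop
  have ht : Continuous t := Continuous.div (by fun_prop) hDc hD
  have hr : Continuous r := Continuous.div (by fun_prop) hDc hD
  have hr0 : ∀ p, r p ≠ 0 → ‖p.1.1‖ * ‖p.1.2‖ ≠ 0 := fun p hp h0 => hp (by simp only [r, h0]; simp)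
  have htτ : ∀ p, t (-p) = t p := fun p => by simp [t, D]
  have hrτ : ∀ p, r (-p) = r p := fun p => by simp [r, D]
  have htr : ∀ p, t p ^ 2 + r p ^ 2 = 1 := fun p => by
    have := hD p
    simp only [t, r]
    field_simp
    simp only [D]
    ring
  have hψ : ∀ i < 2 * s, ContinuousOn (ψ i) {p | r p ≠ 0} := fun i hi => by
    refine ContinuousOn.congr (f := fun p => φ i p.1 / (‖p.1.1‖ * ‖p.1.2‖)) ?_ fun p hp =>
      if_neg (hr0 p hp)
    exact ((hc i hi).comp continuous_subtype_val).continuousOn.div (by fun_prop) hr0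
  have hψ1 : ∀ p, ∑ i ∈ Finset.range (2 * s), ψ i p ^ 2 = 1 := fun p => by
    by_cases h0 : ‖p.1.1‖ * ‖p.1.2‖ = 0
    · simp only [ψ, h0, if_true]
      rw [Finset.sum_eq_single 0 (fun i _ hi => by simp [hi]) (fun h0 => by simp at h0; omega)]
      simp
    · simp only [ψ, h0, if_false, div_pow]
      rw [← Finset.sum_div, hφ, div_self (pow_ne_zero 2 h0)]
  have hψτ : ∀ i < 2 * s, ∀ p, ψ i (-p) = ψ i p := fun i hi p => by
    have h1 : φ i (-p.1) = φ i p.1 := by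
      have := hW' i hi (-1) (-p.1.1) p.1.2
      rw [neg_one_smul, hV' i hi p.1.1 p.1.2, neg_mul_neg, one_mul] at this
      exact this
    have h2 : ‖(-p).1.1‖ = ‖p.1.1‖ := norm_neg _
    have h3 : ‖(-p).1.2‖ = ‖p.1.2‖ := norm_neg _
    simp only [ψ, h2, h3]
    rw [← h1]
    rfl
  have hFt := tame_cliffSum (E := E) hψ hψ1
  have hFτ : ∀ p, cliffSum s E ψ (-p) = cliffSum s E ψ p := fun y =>
    Finset.sum_congr rfl fun i hi => by rw [hψτ i (Finset.mem_range.1 hi)]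
  have hg : EMap (Neg.neg : US (V × W) → US (V × W)) 1 1 (clutch t r γ (cliffSum s E ψ)) :=
    emap_clutch ht hr htτ hrτ hFt hFτ (by simp) (by simp)
  have hgg := clutch_mul_self htr h.chir_sq (fun y => by
    simpa using h.cliffSum_mul_self (hψ1 y)) fun y => h.chir_mul_cliffSum y
  have hbun := IsBun.half hg hgg (by simp)
  obtain ⟨x, hx⟩ := allVal_US (s + k) hdim _ _ _ hbun
  obtain ⟨a, ha, hxa⟩ := h.value_relation (allVal_US (s + k) hdim) (trDiv_US (s + k) hdim)
    neg_neg ht hr htτ hrτ htr hψ hψ1 hψτ hx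
  let f : US (V × ℝ) → US (V × W) := fun p => ⟨(p.1.1, p.1.2 • y₀), by
    have := p.norm_eq
    rw [Prod.norm_def] at this
    simpa [Prod.norm_def, norm_smul, hy₀] using this⟩
  have hf : Continuous f := Continuous.subtype_mk (by fun_prop) _
  have hfn : ∀ p, f (-p) = -f p := fun p => Subtype.ext (by simp [f])
  have hx1 := hx.comp hf hfn
  have hx2 : HasVal (Neg.neg : US (V × ℝ) → US (V × ℝ)) 1 (fun p => (1 / 2 : ℂ) •
      (1 + clutch (fun p => t (f p)) (fun p => r (f p)) γ (fun p => cliffSum s E ψ (f p)) p))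
      (-(2 ^ s / 2)) := by
    refine h.hasVal_linear hs (a := fun p => ‖p.1.1‖) (η := fun p => p.1.2)
      (B := cliffSum s E fun i p => φ i (p.1.1, y₀)) (hg.comp hf hfn) (fun p => hgg (f p)) ?_ ?_ ?_
      ?_ ?_ ?_ ?_ ?_ ?_
    · refine continuous_finsetSum _ fun i hi => ?_
      have := (hc i (Finset.mem_range.1 hi)).comp (f := fun p : US (V × ℝ) => (p.1.1, y₀))
        (by fun_prop)
      exact (Complex.continuous_ofReal.comp this).smul continuous_const
    · fun_prop
    · intro p
      simp only [cliffSum, ← Finset.sum_neg_distrib]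
      refine Finset.sum_congr rfl fun i hi => ?_
      rw [← neg_smul, ← Complex.ofReal_neg, ← hV' i (Finset.mem_range.1 hi)]
      rfl
    · exact fun p => rfl
    · exact fun p => h.cliffSum_mul_self (by rw [hφ]; simp [hy₀])
    · exact fun y => h.chir_mul_cliffSum y
    · intro p
      simpa [f, norm_smul, hy₀] using (hpos (f p)).ne'
    · intro p
      have := hD (f p)
      simp only [t]
      rw [mul_div_assoc', div_eq_iff this]
      simp [D, f, norm_smul, hy₀]
      ring
    · intro p
      have h1 : D (f p) = ‖p.1.1‖ ^ 2 + p.1.2 ^ 2 := by simp [D, f, norm_smul, hy₀]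
      rw [← h1]
      simp only [cliffSum, Finset.smul_sum, smul_smul]
      refine Finset.sum_congr rfl fun i hi => ?_
      congr 1
      have h2 : r (f p) * ψ i (f p) * D (f p) = 2 * φ i (f p).1 := by
        have h3 := hD (f p)
        by_cases h0 : ‖(f p).1.1‖ * ‖(f p).1.2‖ = 0
        · have h4 := hφ (f p).1
          rw [h0, zero_pow two_ne_zero, Finset.sum_eq_zero_iff_of_nonneg
            (fun _ _ => sq_nonneg _)] at h4
          have h5 := pow_eq_zero_iff two_ne_zero |>.1 (h4 i hi)
          simp only [r, h0, h5]
          simp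
        · simp only [r, ψ, h0, if_false]
          rw [div_mul_div_comm, div_mul_eq_mul_div, div_eq_iff (mul_ne_zero h3 h0)]
          ring
      have h6 : φ i (f p).1 = p.1.2 * φ i (p.1.1, y₀) := hW' i (Finset.mem_range.1 hi) _ _ _
      rw [h6] at h2
      have h7 : ((r (f p) * ψ i (f p) * D (f p) : ℝ) : ℂ) =
        ((2 * (p.1.2 * φ i (p.1.1, y₀)) : ℝ) : ℂ) := by rw [h2]
      push_cast at h7
      linear_combination h7
  obtain ⟨b, hb, hxb⟩ := HasVal.unique (trDiv_US s hdim') (hbun.comp hf hfn) hx1 hx2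
  have h8 : (2 : ℤ) ^ (k + 1) ∣ 3 * (1 - 3 ^ s) := by
    refine two_pow_dvd_of_mul_eq ha hb ?_
    have h2s : (2 : ℂ) ^ s ≠ 0 := pow_ne_zero _ two_ne_zero
    apply mul_left_cancel₀ h2s
    push_cast
    rw [pow_succ] at hxb
    have : (2 : ℂ) ^ (s + k + 1) = 2 ^ s * 2 ^ (k + 1) := by ring
    rw [this] at hxa
    linear_combination hxa - 3 * (1 - 3 ^ s) * hxb
  rw [← dvd_neg, neg_sub]
  exact (IsCoprime.pow_left (by norm_num)).dvd_of_dvd_mul_left h8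

end Core

theorem not_two_pow_dvd_three_pow_sub_one {m : ℕ} (hm : 7 < m) :
    ¬ (2 : ℤ) ^ (m / 2 + 1) ∣ 3 ^ (m + 1) - 1 := by
  intro h
  have h' : 2 ^ (m / 2 + 1) ∣ 3 ^ (m + 1) - 1 := by
    have h1 : ((3 ^ (m + 1) - 1 : ℕ) : ℤ) = 3 ^ (m + 1) - 1 := by
      rw [Nat.cast_sub (Nat.one_le_pow _ _ (by norm_num))]; norm_num
    rw [← h1] at h
    exact_mod_cast h
  have h0 : 3 ^ (m + 1) - 1 ≠ 0 := by
    have : 3 ^ 1 ≤ 3 ^ (m + 1) := Nat.pow_le_pow_right (by norm_num) (by omega)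
    omega
  rw [padicValNat_dvd_iff_le h0] at h'
  rcases Nat.even_or_odd' m with ⟨j, rfl | rfl⟩
  · have h2 : ¬ 2 ^ 2 ∣ 3 ^ (2 * j + 1) - 1 := by
      have h9 : 3 ^ (2 * j) % 4 = 1 := by
        rw [pow_mul, Nat.pow_mod]; norm_num
      rw [pow_succ 3]
      omega
    rw [padicValNat_dvd_iff_le h0] at h2
    omega
  · have h3 := padicValNat.pow_two_sub_pow (x := 3) (y := 1) (n := 2 * j + 1 + 1) (by norm_num)
      (by norm_num) (by norm_num) (by omega) ⟨j + 1, by ring⟩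
    rw [one_pow, show 2 * j + 1 + 1 = 2 * (j + 1) by ring, padicValNat.mul (by norm_num)
      (by omega), padicValNat_self] at h3
    rw [show 2 * j + 1 + 1 = 2 * (j + 1) by ring] at h'
    have h4 : padicValNat 2 (3 + 1) = 2 := padicValNat.prime_pow (p := 2) 2
    rw [h4] at h3
    have h7 : j - 2 ≤ padicValNat 2 (j + 1) := by omega
    have h8 : 2 ^ (j - 2) ∣ j + 1 := (padicValNat_dvd_iff_le (by omega)).2 h7
    have h9 := Nat.le_of_dvd (by omega) h8
    obtain ⟨i, rfl⟩ : ∃ i, j = i + 4 := ⟨j - 4, by omega⟩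
    have h10 : i + 1 ≤ 2 ^ i := i.lt_two_pow_self
    rw [show i + 4 - 2 = i + 2 by omega, pow_add] at h9
    obtain rfl : i = 0 := by omega
    norm_num at h8

section Bihomogeneous
variable {V W : Type} [NormedAddCommGroup V] [NormedSpace ℝ V] [NormedAddCommGroup W]
  [NormedSpace ℝ W] {U : Type} [NormedAddCommGroup U] [NormedSpace ℝ U]

open Classical in
/-- The positively bihomogeneous extension of a map defined on a product of unit spheres. -/
noncomputable def US.bihom (f : US V × US W → US U) (p : V × W) : U :=
  if h : p.1 ≠ 0 ∧ p.2 ≠ 0 then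
    (‖p.1‖ * ‖p.2‖) • (f (US.normalize p.1 h.1, US.normalize p.2 h.2) : U) else 0

variable {f : US V × US W → US U}

theorem US.norm_bihom (p : V × W) : ‖US.bihom f p‖ = ‖p.1‖ * ‖p.2‖ := by
  unfold US.bihom
  split_ifs with h
  · simp [norm_smul]
  · rw [not_and_or, not_not, not_not] at h
    rcases h with h | h <;> simp [h]

theorem US.continuous_bihom (hf : Continuous f) : Continuous (US.bihom f) := by
  rw [continuous_iff_continuousAt]
  intro p
  by_cases h : p.1 ≠ 0 ∧ p.2 ≠ 0
  · have ho : IsOpen {q : V × W | q.1 ≠ 0 ∧ q.2 ≠ 0} :=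
      (isOpen_ne_fun continuous_fst continuous_const).inter
        (isOpen_ne_fun continuous_snd continuous_const)
    refine ContinuousOn.continuousAt (s := {q : V × W | q.1 ≠ 0 ∧ q.2 ≠ 0}) ?_ (ho.mem_nhds h)
    rw [continuousOn_iff_continuous_domRestrict]
    have h1 : ({q : V × W | q.1 ≠ 0 ∧ q.2 ≠ 0}).domRestrict (US.bihom f) = fun q =>
        (‖q.1.1‖ * ‖q.1.2‖) • (f (US.normalize q.1.1 q.2.1, US.normalize q.1.2 q.2.2) : U) := by
      ext q
      exact dif_pos q.2
    rw [h1]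
    refine Continuous.smul (by fun_prop) (continuous_subtype_val.comp (hf.comp
      (Continuous.prodMk ?_ ?_))) <;>
    refine Continuous.subtype_mk (Continuous.smul (Continuous.inv₀ (by fun_prop) fun q => ?_)
      (by fun_prop)) _
    · simpa using q.2.1
    · simpa using q.2.2
  · have h0 : ‖p.1‖ * ‖p.2‖ = 0 := by
      rw [not_and_or, not_not, not_not] at h
      rcases h with h | h <;> simp [h]
    have h1 : US.bihom f p = 0 := dif_neg h
    rw [ContinuousAt, h1, tendsto_zero_iff_norm_tendsto_zero]
    simp only [US.norm_bihom]
    rw [← h0]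
    exact Continuous.continuousAt (f := fun q : V × W => ‖q.1‖ * ‖q.2‖) (by fun_prop)

theorem US.bihom_neg_left (hf : ∀ x y, f (-x, y) = -f (x, y)) (x : V) (y : W) :
    US.bihom f (-x, y) = -US.bihom f (x, y) := by
  by_cases h : x ≠ 0 ∧ y ≠ 0
  · have h' : -x ≠ 0 ∧ y ≠ 0 := ⟨neg_ne_zero.2 h.1, h.2⟩
    have h1 : US.normalize (-x) h'.1 = -US.normalize x h.1 := Subtype.ext (by simp [US.normalize])
    rw [US.bihom, US.bihom, dif_pos h, dif_pos h']
    simp only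
    rw [h1, hf, norm_neg]
    exact smul_neg _ _
  · have h' : ¬(-x ≠ 0 ∧ y ≠ 0) := by rwa [neg_ne_zero]
    rw [US.bihom, US.bihom, dif_neg h, dif_neg h', neg_zero]

theorem US.bihom_smul_right (hf : ∀ x y, f (x, -y) = -f (x, y)) (c : ℝ) (x : V) (y : W) :
    US.bihom f (x, c • y) = c • US.bihom f (x, y) := by
  by_cases h : x ≠ 0 ∧ y ≠ 0
  · rcases lt_trichotomy c 0 with hc | rfl | hc
    · have h' : x ≠ 0 ∧ c • y ≠ 0 := ⟨h.1, smul_ne_zero hc.ne h.2⟩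
      have h1 : US.normalize (c • y) h'.2 = -US.normalize y h.2 := Subtype.ext (by
        simp only [US.normalize, norm_smul, smul_smul, Real.norm_of_nonpos hc.le]
        rw [mul_inv, mul_right_comm, inv_neg, neg_mul, inv_mul_cancel₀ hc.ne, neg_one_mul, neg_smul]
        rfl)
      rw [US.bihom, US.bihom, dif_pos h, dif_pos h']
      simp only
      rw [h1, hf, norm_smul, Real.norm_of_nonpos hc.le, smul_smul]
      refine (smul_neg _ _).trans ?_
      rw [← neg_smul]
      congr 1
      ring
    · rw [zero_smul, zero_smul]
      exact dif_neg (by simp)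
    · have h' : x ≠ 0 ∧ c • y ≠ 0 := ⟨h.1, smul_ne_zero hc.ne' h.2⟩
      have h1 : US.normalize (c • y) h'.2 = US.normalize y h.2 := Subtype.ext (by
        simp only [US.normalize, norm_smul, smul_smul, Real.norm_of_nonneg hc.le]
        rw [mul_inv, mul_right_comm, inv_mul_cancel₀ hc.ne', one_mul])
      rw [US.bihom, US.bihom, dif_pos h, dif_pos h']
      simp only
      rw [h1, norm_smul, Real.norm_of_nonneg hc.le, smul_smul]
      congr 1
      ring
  · have h' : ¬(x ≠ 0 ∧ c • y ≠ 0) := fun h' => h ⟨h'.1, fun h0 => h'.2 (by rw [h0, smul_zero])⟩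
    rw [US.bihom, US.bihom, dif_neg h, dif_neg h', smul_zero]

end Bihomogeneous

/-- There is no map `S ^ m × S ^ m → S ^ m` that is odd in each variable when `m > 7`. -/
theorem not_exists_biodd {m : ℕ} (hm : 7 < m)
    (f : US (EuclideanSpace ℝ (Fin (m + 1))) × US (EuclideanSpace ℝ (Fin (m + 1))) →
      US (EuclideanSpace ℝ (Fin (m + 1)))) (hf : Continuous f)
    (h1 : ∀ x y, f (-x, y) = -f (x, y)) (h2 : ∀ x y, f (x, -y) = -f (x, y)) : False := by
  obtain ⟨w, hw⟩ := exists_linearIndependent_of_le_finrank (R := ℝ) (M := EuclideanSpace ℝ (Fin (m + 1)))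
    (n := 2 * (m / 2) + 1)
    (by simp; omega)
  let W := Submodule.span ℝ (Set.range w)
  have hWr : Module.finrank ℝ W = 2 * (m / 2) + 1 := by
    rw [finrank_span_eq_card hw, Fintype.card_fin]
  have hV : Module.finrank ℝ (WithLp 2
      (EuclideanSpace ℝ (Fin (m + 1)) × EuclideanSpace ℝ (Fin (m + 1)))) = 2 * (m + 1) := by
    rw [(WithLp.linearEquiv 2 ℝ (_ × _)).finrank_eq, Module.finrank_prod]
    simp; ring
  let B : EuclideanSpace ℝ (Fin (m + 1)) × EuclideanSpace ℝ (Fin (m + 1)) →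
      EuclideanSpace ℝ (Fin (m + 1)) := US.bihom f
  have hB : Continuous B := US.continuous_bihom hf
  let φ : ℕ → WithLp 2 (EuclideanSpace ℝ (Fin (m + 1)) × EuclideanSpace ℝ (Fin (m + 1))) × W → ℝ := fun i p =>
    if h : i < m + 1 then B (p.1.fst, p.2) ⟨i, h⟩ else
      if h : i - (m + 1) < m + 1 then B (p.1.snd, p.2) ⟨i - (m + 1), h⟩ else 0
  refine not_two_pow_dvd_three_pow_sub_one hm
    (two_pow_dvd_of_odd_multiplication (φ := φ) (by omega) hV hWr
      ?_ ?_ ?_ ?_)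
  · intro i _
    simp only [φ]
    split_ifs <;> fun_prop
  · intro p
    have h3 : ∀ a : EuclideanSpace ℝ (Fin (m + 1)), ∑ i : Fin (m + 1), B (a, p.2) i ^ 2 = ‖a‖ ^ 2 * ‖p.2‖ ^ 2 := fun a => by
      rw [← EuclideanSpace.real_norm_sq_eq, US.norm_bihom, mul_pow]
      rfl
    rw [two_mul, Finset.sum_range_add, mul_pow, WithLp.prod_norm_sq_eq_of_L2, add_mul, ← h3, ← h3,
      Finset.sum_range, Finset.sum_range]
    congr 1
    · exact Finset.sum_congr rfl fun i _ => by simp [φ, -Order.lt_add_one_iff]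
    · exact Finset.sum_congr rfl fun i _ => by simp [φ, -Order.lt_add_one_iff]
  · intro i _ x y
    have h4 : ∀ a : EuclideanSpace ℝ (Fin (m + 1)), B (-a, y) = -B (a, y) := fun a => US.bihom_neg_left h1 _ _
    simp only [φ]
    split_ifs <;> simp [h4]
  · intro i _ c x y
    have h4 : ∀ a : EuclideanSpace ℝ (Fin (m + 1)), B (a, ((c • y : W) : EuclideanSpace ℝ (Fin (m + 1)))) = c • B (a, y) := fun a =>
      US.bihom_smul_right h2 _ _ _
    simp only [φ]
    split_ifs <;> simp only [h4, PiLp.smul_apply, smul_eq_mul, mul_zero]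

/-- Every continuous map from `A` to the base of a surjective covering lifts to the total space. -/
def LiftsToCoverings (A : Type) [TopologicalSpace A] : Prop :=
  ∀ (E B : Type) [TopologicalSpace E] [TopologicalSpace B] (p : E → B),
    IsCoveringMap p → Function.Surjective p → ∀ f : C(A, B), ∃ F : C(A, E), p ∘ F = f

namespace LiftsToCoverings

theorem of_unique (A : Type) [TopologicalSpace A] [Unique A] : LiftsToCoverings A := by
  intro E B _ _ p _ hs f
  obtain ⟨e, he⟩ := hs (f default)
  exact ⟨.const A e, funext fun a => by simp [he, Unique.eq_default a]⟩

theorem congr {A A' : Type} [TopologicalSpace A] [TopologicalSpace A'] (e : A ≃ₜ A')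
    (h : LiftsToCoverings A) : LiftsToCoverings A' := by
  intro E B _ _ p hp hs f
  obtain ⟨F, hF⟩ := h E B p hp hs (f.comp ⟨e, e.continuous⟩)
  refine ⟨F.comp ⟨e.symm, e.symm.continuous⟩, funext fun a => ?_⟩
  simpa using congrFun hF (e.symm a)

/-- Lifting over a product with a space `S` swept out by arcs issuing from a point. -/
theorem prod {Y S S' : Type} [TopologicalSpace Y] [TopologicalSpace S] [TopologicalSpace S']
    [CompactSpace Y] [CompactSpace S'] [T2Space S] [T2Space Y] [PreconnectedSpace S']
    (hY : LiftsToCoverings Y) (Q : C(I × S', S)) (hQ : Function.Surjective Q) (N : S)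
    (h0 : ∀ u, Q (0, u) = N)
    (hinj : ∀ t t' u u', Q (t, u) = Q (t', u') → t = t' ∧ (u = u' ∨ t = 0 ∨ t = 1))
    (h1 : ∀ u u', Q (1, u) = Q (1, u')) :
    LiftsToCoverings (Y × S) := by
  intro E B _ _ p hp hs f
  obtain ⟨F₀, hF₀⟩ := hY E B p hp hs (f.comp ⟨fun y => (y, N), by fun_prop⟩)
  let H : C(I × (Y × S'), B) := f.comp ⟨fun a => (a.2.1, Q (a.1, a.2.2)), by fun_prop⟩
  have hH0 : ∀ a, H (0, a) = p (F₀.comp ⟨Prod.fst, continuous_fst⟩ a) := fun a => by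
    simpa [H, h0] using (congrFun hF₀ a.1).symm
  let K := hp.liftHomotopy H (F₀.comp ⟨Prod.fst, continuous_fst⟩) hH0
  have hK : ∀ a, p (K a) = H a := congrFun (hp.liftHomotopy_lifts H _ hH0)
  have hK0 : ∀ a, K (0, a) = F₀ a.1 := hp.liftHomotopy_zero H _ hH0
  have hK1 : ∀ y u u', K (1, (y, u)) = K (1, (y, u')) := fun y u u' => by
    have hc : Continuous fun u => K (1, (y, u)) := by fun_prop
    exact hp.const_of_comp hc (fun u u' => by simp [hK, H, h1 u u']) u u'
  let R : I × (Y × S') → Y × S := fun a => (a.2.1, Q (a.1, a.2.2))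
  have hR : Topology.IsQuotientMap (⟨R, by fun_prop⟩ : C(I × (Y × S'), Y × S)) := by
    have hc : Continuous R := by fun_prop
    refine hc.isClosedMap.isQuotientMap hc ?_
    rintro ⟨y, s⟩
    obtain ⟨⟨t, u⟩, rfl⟩ := hQ s
    exact ⟨(t, (y, u)), rfl⟩
  have hKR : Function.FactorsThrough K R := by
    rintro ⟨t, y, u⟩ ⟨t', y', u'⟩ h
    simp only [R, Prod.mk.injEq] at h
    obtain ⟨rfl, h⟩ := h
    obtain ⟨rfl, rfl | rfl | rfl⟩ := hinj _ _ _ _ h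
    · rfl
    · simp [hK0]
    · exact hK1 _ _ _
  refine ⟨hR.lift K hKR, funext fun a => ?_⟩
  obtain ⟨a, rfl⟩ := hR.surjective a
  have h3 : (hR.lift K hKR) (R a) = K a := ContinuousMap.congr_fun (hR.lift_comp K hKR) a
  simp [h3, hK, H, R]

end LiftsToCoverings

section
variable {V : Type} [NormedAddCommGroup V] [InnerProductSpace ℝ V]

/-- The arc from `e` to `-e` through `u`, reparametrised to `[0, 1]`. -/
noncomputable def meridian (e : US V) : C(I × US ((ℝ ∙ (e : V))ᗮ), US V) where
  toFun a := ⟨Real.cos (Real.pi * a.1) • (e : V) + Real.sin (Real.pi * a.1) • ((a.2 : (ℝ ∙ (e : V))ᗮ) : V), by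
    have h1 : ‖(e : V)‖ = 1 := norm_eq_of_mem_sphere e
    have h2 : ‖((a.2 : (ℝ ∙ (e : V))ᗮ) : V)‖ = 1 := norm_eq_of_mem_sphere a.2
    have h3 : inner ℝ (e : V) ((a.2 : (ℝ ∙ (e : V))ᗮ) : V) = 0 :=
      Submodule.mem_orthogonal_singleton_iff_inner_right.1 (a.2 : (ℝ ∙ (e : V))ᗮ).2
    rw [mem_sphere_zero_iff_norm, ← sq_eq_sq₀ (norm_nonneg _) zero_le_one, norm_add_sq_real,
      norm_smul, norm_smul, h1, h2, inner_smul_left, inner_smul_right, h3]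
    simp⟩
  continuous_toFun := by fun_prop

theorem inner_meridian (e : US V) (a) : inner ℝ (e : V) (meridian e a : V) = Real.cos (Real.pi * a.1) := by
  have h1 : ‖(e : V)‖ = 1 := norm_eq_of_mem_sphere e
  have h3 : inner ℝ (e : V) ((a.2 : (ℝ ∙ (e : V))ᗮ) : V) = 0 :=
    Submodule.mem_orthogonal_singleton_iff_inner_right.1 (a.2 : (ℝ ∙ (e : V))ᗮ).2
  simp [meridian, inner_add_right, inner_smul_right, h3, h1]

theorem meridian_injective (e : US V) (t t' u u') (h : meridian e (t, u) = meridian e (t', u')) :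
    t = t' ∧ (u = u' ∨ t = 0 ∨ t = 1) := by
  have hmem : ∀ t : I, Real.pi * t ∈ Set.Icc 0 Real.pi := fun t =>
    ⟨by have := t.2.1; positivity, by nlinarith [t.2.2, Real.pi_pos]⟩
  have h1 := congrArg (fun x : US V => inner ℝ (e : V) (x : V)) h
  simp only [inner_meridian] at h1
  have ht : t = t' := Subtype.ext
    (mul_left_cancel₀ Real.pi_ne_zero (Real.injOn_cos (hmem t) (hmem t') h1))
  subst ht
  refine ⟨rfl, ?_⟩
  by_cases hs : Real.sin (Real.pi * t) = 0
  · right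
    rcases (hmem t).1.eq_or_lt with h2 | h2
    · left; exact Subtype.ext (by simpa [Real.pi_ne_zero] using h2.symm)
    · rcases (hmem t).2.eq_or_lt with h3 | h3
      · right; exact Subtype.ext (mul_left_cancel₀ Real.pi_ne_zero (by simpa using h3))
      · exact absurd hs (Real.sin_pos_of_pos_of_lt_pi h2 h3).ne'
  · left
    have h4 := congrArg Subtype.val h
    simp only [meridian, ContinuousMap.coe_mk, add_right_inj] at h4
    exact Subtype.ext (Subtype.ext (smul_right_injective V hs h4))

theorem meridian_surjective (e : US V) (u₀ : US ((ℝ ∙ (e : V))ᗮ)) :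
    Function.Surjective (meridian e) := by
  intro x
  have he : ‖(e : V)‖ = 1 := norm_eq_of_mem_sphere e
  have hx : ‖(x : V)‖ = 1 := norm_eq_of_mem_sphere x
  set c := inner ℝ (e : V) (x : V) with hc
  have hc1 := abs_le.1 ((abs_real_inner_le_norm (e : V) (x : V)).trans (by rw [he, hx, one_mul]))
  set w : V := x - c • (e : V) with hw
  have hwm : w ∈ (ℝ ∙ (e : V))ᗮ := Submodule.mem_orthogonal_singleton_iff_inner_right.2 (by
    simp [hw, inner_sub_right, inner_smul_right, he, hc])
  have hxw : (x : V) = c • (e : V) + w := by simp [hw]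
  have hnw : ‖w‖ ^ 2 = 1 - c ^ 2 := by
    rw [hw, norm_sub_sq_real, inner_smul_right, real_inner_comm, ← hc, norm_smul, he, hx]
    simp; ring
  let t : I := ⟨Real.arccos c / Real.pi, div_nonneg (Real.arccos_nonneg c) Real.pi_pos.le,
    (div_le_one Real.pi_pos).2 (Real.arccos_le_pi c)⟩
  have ht : Real.pi * t = Real.arccos c := by simp only [t]; field_simp
  have hcos : Real.cos (Real.pi * t) = c := by rw [ht, Real.cos_arccos hc1.1 hc1.2]
  have hsin : Real.sin (Real.pi * t) = ‖w‖ := by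
    rw [ht, Real.sin_arccos, ← hnw, Real.sqrt_sq (norm_nonneg _)]
  by_cases h0 : w = 0
  · refine ⟨(t, u₀), Subtype.ext ?_⟩
    simp only [meridian, ContinuousMap.coe_mk, hcos, hsin]
    rw [hxw, h0]; simp
  · refine ⟨(t, ⟨⟨‖w‖⁻¹ • w, Submodule.smul_mem _ _ hwm⟩, ?_⟩), Subtype.ext ?_⟩
    · simp [norm_smul, h0]
    · simp only [meridian, ContinuousMap.coe_mk, hcos, hsin]
      rw [smul_inv_smul₀ (by simpa using h0), ← hxw]

end

theorem liftsToCoverings_sphere_pow {m : ℕ} (hm : 1 < m) (n : ℕ) :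
    LiftsToCoverings (Fin n → US (EuclideanSpace ℝ (Fin (m + 1)))) := by
  induction n with
  | zero => exact .of_unique _
  | succ n ih =>
    let e : US (EuclideanSpace ℝ (Fin (m + 1))) := ⟨EuclideanSpace.single 0 1, by simp⟩
    have hfr : Module.finrank ℝ (ℝ ∙ (e : EuclideanSpace ℝ (Fin (m + 1))))ᗮ = m := by
      have : Fact (Module.finrank ℝ (EuclideanSpace ℝ (Fin (m + 1))) = m + 1) := ⟨by simp⟩
      exact Submodule.finrank_orthogonal_span_singleton (ne_zero_of_mem_unit_sphere e)
    have hrk : 1 < Module.rank ℝ (ℝ ∙ (e : EuclideanSpace ℝ (Fin (m + 1))))ᗮ := by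
      rw [← Module.finrank_eq_rank, hfr]; exact_mod_cast hm
    have hconn : IsConnected (Metric.sphere (0 : (ℝ ∙ (e : EuclideanSpace ℝ (Fin (m + 1))))ᗮ) 1) :=
      isConnected_sphere hrk 0 zero_le_one
    have : PreconnectedSpace (US (ℝ ∙ (e : EuclideanSpace ℝ (Fin (m + 1))))ᗮ) :=
      isPreconnected_iff_preconnectedSpace.1 hconn.isPreconnected
    obtain ⟨u₀, hu₀⟩ := hconn.nonempty
    have h := ih.prod (meridian e) (meridian_surjective e ⟨u₀, hu₀⟩) e
      (fun u => Subtype.ext (by simp [meridian])) (meridian_injective e)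
      (fun u u' => Subtype.ext (by simp [meridian]))
    exact h.congr ((Homeomorph.prodComm _ _).trans
      { Fin.consEquiv fun _ : Fin (n + 1) => US (EuclideanSpace ℝ (Fin (m + 1))) with
        continuous_toFun := Continuous.finCons
          (A := fun _ : Fin (n + 1) => US (EuclideanSpace ℝ (Fin (m + 1)))) continuous_fst
          continuous_snd
        continuous_invFun := (continuous_apply 0).prodMk
          (continuous_pi fun i => continuous_apply i.succ) })

namespace IsQuotientCoveringMap
variable {X B₁ B₂ V T : Type} [TopologicalSpace X] [TopologicalSpace B₁] [TopologicalSpace B₂]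
  [Group V] [Group T] [MulAction V X] [MulAction T X] {p : X → B₁} {q : X → B₂}

/-- Two lifts of the same map along a quotient covering differ by a deck transformation. -/
theorem exists_smul_eq (hq : IsQuotientCoveringMap q T) {A : Type} [TopologicalSpace A]
    [ConnectedSpace A] {f g : A → X} (hf : Continuous f) (hg : Continuous g)
    (h : q ∘ f = q ∘ g) : ∃ t : T, ∀ a, f a = t • g a := by
  obtain ⟨a⟩ : Nonempty A := inferInstance
  obtain ⟨t, ht⟩ := hq.apply_eq_iff_mem_orbit.1 (congrFun h a)
  have := hq.toContinuousConstSMul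
  refine ⟨t, congrFun (hq.isCoveringMap.eq_of_comp_eq hf (hg.const_smul t) ?_ a ht.symm)⟩
  rw [h]
  exact funext fun a => (hq.map_smul t).symm

theorem smul_left_inj (hq : IsQuotientCoveringMap q T) {t t' : T} {x : X} (h : t • x = t' • x) :
    t = t' :=
  have := hq.isCancelSMul
  IsCancelSMul.right_cancel _ _ _ h

/-- A map between total spaces covering a map of base spaces is equivariant along a homomorphism
of deck groups. -/
theorem exists_equivariant [ConnectedSpace X] (hp : IsQuotientCoveringMap p V)
    (hq : IsQuotientCoveringMap q T) {Φ : C(X, X)} {φ : B₁ → B₂} (h : q ∘ Φ = φ ∘ p) :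
    ∃ ι : V →* T, ∀ v x, Φ (v • x) = ι v • Φ x := by
  have := hp.toContinuousConstSMul
  have key : ∀ v : V, ∃ t : T, ∀ x, Φ (v • x) = t • Φ x := fun v =>
    hq.exists_smul_eq (Φ.continuous.comp (continuous_const_smul v)) Φ.continuous (by
      funext x
      have h1 := congrFun h (v • x)
      have h2 := congrFun h x
      simp only [Function.comp_apply, hp.map_smul] at h1 h2 ⊢
      rw [h1, h2])
  choose ι hι using key
  obtain ⟨x⟩ : Nonempty X := inferInstance
  refine ⟨MonoidHom.mk' ι fun a b => hq.smul_left_inj (x := Φ x) ?_, hι⟩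
  rw [← hι, mul_smul, hι, hι, mul_smul]

/-- If the base of one quotient covering is a homotopy retract of the base of another, and maps
lift, then there are equivariant self-maps of the total space with inverse homomorphisms. -/
theorem exists_equivariant_of_homotopic [ConnectedSpace X] (hL : LiftsToCoverings X)
    (hp : IsQuotientCoveringMap p V) (hq : IsQuotientCoveringMap q T)
    (hV : ∀ a b : V, a * b = b * a) (φ : C(B₁, B₂)) (ψ : C(B₂, B₁))
    (h : (ψ.comp φ).Homotopic (.id B₁)) :
    ∃ (Φ Ψ : C(X, X)) (ι : V →* T) (κ : T →* V), (∀ v x, Φ (v • x) = ι v • Φ x) ∧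
      (∀ t x, Ψ (t • x) = κ t • Ψ x) ∧ ∀ v, κ (ι v) = v := by
  have := hp.toContinuousConstSMul
  obtain ⟨Φ, hΦ⟩ := hL _ _ q hq.isCoveringMap hq.surjective (φ.comp ⟨p, hp.continuous⟩)
  obtain ⟨Ψ, hΨ⟩ := hL _ _ p hp.isCoveringMap hp.surjective (ψ.comp ⟨q, hq.continuous⟩)
  obtain ⟨ι, hι⟩ := hp.exists_equivariant hq (φ := φ) hΦ
  obtain ⟨κ, hκ⟩ := hq.exists_equivariant hp (φ := ψ) hΨ
  refine ⟨Φ, Ψ, ι, κ, hι, hκ, fun v => ?_⟩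
  obtain ⟨H⟩ := h
  let H' : C(I × X, B₁) := H.toContinuousMap.comp ⟨fun a => (a.1, p a.2), by
    have := hp.continuous
    fun_prop⟩
  have hH0 : ∀ x, H' (0, x) = p ((Ψ.comp Φ) x) := fun x => by
    have h1 := congrFun hΨ (Φ x)
    have h2 := congrFun hΦ x
    simp only [Function.comp_apply, ContinuousMap.comp_apply, ContinuousMap.coe_mk] at h1 h2
    simp [H', h1, h2]
  let K := hp.isCoveringMap.liftHomotopy H' (Ψ.comp Φ) hH0
  have hK : ∀ a, p (K a) = H' a := congrFun (hp.isCoveringMap.liftHomotopy_lifts H' _ hH0)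
  have hK0 : ∀ x, K (0, x) = Ψ (Φ x) := hp.isCoveringMap.liftHomotopy_zero H' _ hH0
  obtain ⟨v₀, hv₀⟩ := hp.exists_smul_eq (f := fun x => K (1, x)) (g := id) (by fun_prop)
    continuous_id (funext fun x => by simp [hK, H'])
  obtain ⟨w, hw⟩ := hp.exists_smul_eq (f := fun a : I × X => K (a.1, v • a.2)) (g := K)
    (by fun_prop) K.continuous (funext fun a => by simp [hK, H', hp.map_smul])
  obtain ⟨x⟩ : Nonempty X := inferInstance
  have h0 := hw (0, x)
  simp only [hK0, hι, hκ] at h0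
  have h1 := hw (1, x)
  simp only [hv₀, id, ← mul_smul] at h1
  rw [hp.smul_left_inj h0]
  have h2 := hp.smul_left_inj h1
  rw [hV w] at h2
  exact (mul_left_cancel h2).symm

end IsQuotientCoveringMap

section
variable {V : Type} [NormedAddCommGroup V] [InnerProductSpace ℝ V]

/-- Signs act on the unit sphere. -/
instance US.signAction : MulAction ℤˣ (US V) where
  smul s x := if s = 1 then x else -x
  one_smul x := if_pos rfl
  mul_smul s t x := by
    rcases Int.units_eq_one_or s with rfl | rfl <;> rcases Int.units_eq_one_or t with rfl | rfl <;>
      simp [HSMul.hSMul]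

theorem US.neg_one_smul (x : US V) : (-1 : ℤˣ) • x = -x := rfl

theorem US.neg_ne_self (x : US V) : -x ≠ x := fun h => by
  have h1 := ne_zero_of_mem_unit_sphere x
  have h2 := congrArg Subtype.val h
  refine h1 ((smul_eq_zero_iff_right (two_ne_zero (α := ℝ))).1 ?_)
  rw [two_smul]
  nth_rw 1 [← h2]
  exact neg_add_cancel (x : V)

instance US.continuousConstSMul_sign : ContinuousConstSMul ℤˣ (US V) where
  continuous_const_smul s := by
    rcases Int.units_eq_one_or s with rfl | rfl
    · exact continuous_id.congr fun x => (one_smul _ x).symm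
    · exact continuous_neg

/-- Sign vectors act coordinatewise on powers of the unit sphere. -/
instance US.signPowAction (n : ℕ) : MulAction (Fin n → ℤˣ) (Fin n → US V) := Pi.mulAction'

theorem US.isCancelSMul_sign_pow (n : ℕ) : IsCancelSMul (Fin n → ℤˣ) (Fin n → US V) where
  right_cancel' s t x h := by
    funext i
    have h1 : s i • x i = t i • x i := congrFun h i
    have h2 := US.neg_ne_self (x i)
    rcases Int.units_eq_one_or (s i) with h3 | h3 <;>
      rcases Int.units_eq_one_or (t i) with h4 | h4 <;>
      rw [h3, h4] at h1 ⊢ <;> simp only [one_smul, US.neg_one_smul] at h1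
    · exact (h2 h1.symm).elim
    · exact (h2 h1).elim

/-- A continuous self-map of `(S^m)^n`, equivariant along a surjective endomorphism of the sign
group, forces this endomorphism to permute coordinates. -/
theorem exists_coordinate_of_equivariant {n : ℕ} (x₀ : US V)
    (hbi : ∀ f : US V × US V → US V, Continuous f → (∀ x y, f (-x, y) = -f (x, y)) →
      (∀ x y, f (x, -y) = -f (x, y)) → False)
    (θ : C(Fin n → US V, Fin n → US V))
    (A : (Fin n → ℤˣ) →* (Fin n → ℤˣ)) (hA : Function.Surjective A)
    (hθ : ∀ t x, θ (t • x) = A t • θ x) (i : Fin n) : ∃ j, ∀ t, A t i = t j := by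
  let χ : (Fin n → ℤˣ) →* ℤˣ := (Pi.evalMonoidHom _ i).comp A
  have hχ : ∀ t, χ t = A t i := fun t => rfl
  obtain ⟨j, hj⟩ : ∃ j, χ (Pi.mulSingle j (-1)) = -1 := by
    by_contra! h
    have h1 : χ = 1 := by
      refine MonoidHom.functions_ext _ _ _ fun j s => ?_
      rcases Int.units_eq_one_or s with rfl | rfl
      · simp
      · exact (Int.units_eq_one_or _).resolve_right (h j)
    obtain ⟨t, ht⟩ := hA fun _ => -1
    have h2 := hχ t
    rw [h1, ht, MonoidHom.one_apply] at h2
    exact absurd h2.symm (by simp)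
  have hk : ∀ k ≠ j, χ (Pi.mulSingle k (-1)) = 1 := by
    intro k hkj
    refine (Int.units_eq_one_or _).resolve_right fun hk => ?_
    let z : US V × US V →
      Fin n → US V :=
      fun a l => if l = j then a.1 else if l = k then a.2 else x₀
    have hz : Continuous z := continuous_pi fun l => by
      simp only [z]; split_ifs <;> fun_prop
    refine hbi (fun a => θ (z a) i) (by fun_prop) (fun x y => ?_) (fun x y => ?_)
    · have h1 : z (-x, y) = (Pi.mulSingle j (-1) : Fin n → ℤˣ) • z (x, y) := by
        funext l
        by_cases hl : l = j
        · subst hl; simp [z, US.neg_one_smul]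
        · simp [z, hl]
      simp only [h1, hθ]
      exact (congrArg (· • θ (z (x, y)) i) hj).trans (US.neg_one_smul _)
    · have h1 : z (x, -y) = (Pi.mulSingle k (-1) : Fin n → ℤˣ) • z (x, y) := by
        funext l
        by_cases hl : l = k
        · subst hl; simp [z, US.neg_one_smul, hkj]
        · simp [z, hl]
      simp only [h1, hθ]
      exact (congrArg (· • θ (z (x, y)) i) hk).trans (US.neg_one_smul _)
  refine ⟨j, fun t => ?_⟩
  have h1 : χ = Pi.evalMonoidHom _ j := by
    refine MonoidHom.functions_ext _ _ _ fun k s => ?_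
    rcases Int.units_eq_one_or s with rfl | rfl
    · simp
    · by_cases hkj : k = j
      · subst hkj; simp [hj]
      · simp [hk k hkj, Ne.symm hkj]
  exact DFunLike.congr_fun h1 t

end

/-- Quadratic forms over `𝔽₂` on a space of large dimension have a common nontrivial zero. -/
theorem QuadraticForm.exists_common_zero {M ι : Type} [AddCommGroup M] [Module (ZMod 2) M]
    [Finite M] [Fintype ι] (Q : ι → QuadraticForm (ZMod 2) M)
    (h : 2 * Fintype.card ι < Module.finrank (ZMod 2) M) : ∃ x ≠ 0, ∀ i, Q i x = 0 := by
  classical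
  have : Module.Finite (ZMod 2) M := Module.Finite.of_finite
  let b := Module.finBasis (ZMod 2) M
  let σ' := Fin (Module.finrank (ZMod 2) M)
  let P : ι → MvPolynomial σ' (ZMod 2) := fun i =>
    ∑ j, ∑ k, MvPolynomial.C ((Q i).toBilin b (b j) (b k)) * MvPolynomial.X j * MvPolynomial.X k
  have hP : ∀ i c, MvPolynomial.eval c (P i) = Q i (∑ j, c j • b j) := fun i c => by
    conv_rhs => rw [← QuadraticMap.toQuadraticMap_toBilin (Q i) b]
    simp only [P, map_sum, map_mul, MvPolynomial.eval_C, MvPolynomial.eval_X,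
      LinearMap.BilinMap.toQuadraticMap_apply, map_smul,
      smul_eq_mul]
    rw [Finset.sum_comm]
    refine Finset.sum_congr rfl fun j _ => ?_
    rw [LinearMap.sum_apply, Finset.mul_sum]
    refine Finset.sum_congr rfl fun k _ => ?_
    rw [LinearMap.smul_apply, smul_eq_mul]
    ring
  have hdeg : ∀ i, (P i).totalDegree ≤ 2 := fun i =>
    MvPolynomial.totalDegree_finsetSum_le fun j _ => MvPolynomial.totalDegree_finsetSum_le
      fun k _ => (MvPolynomial.totalDegree_mul _ _).trans (by
        have h1 := MvPolynomial.totalDegree_mul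
          (MvPolynomial.C ((Q i).toBilin b (b j) (b k))) (MvPolynomial.X j)
        rw [MvPolynomial.totalDegree_C, MvPolynomial.totalDegree_X] at h1
        rw [MvPolynomial.totalDegree_X]
        omega)
  have hd := char_dvd_card_solutions_of_fintype_sum_lt 2 (f := P) (by
    refine (Finset.sum_le_sum fun i _ => hdeg i).trans_lt ?_
    simpa [σ', mul_comm] using h)
  have hz : ∀ i, MvPolynomial.eval (0 : σ' → ZMod 2) (P i) = 0 := fun i => by
    rw [hP]; simp
  have hc : 1 < Fintype.card {x : σ' → ZMod 2 // ∀ i, MvPolynomial.eval x (P i) = 0} :=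
    lt_of_lt_of_le one_lt_two (Nat.le_of_dvd (Fintype.card_pos_iff.2 ⟨⟨0, hz⟩⟩) hd)
  obtain ⟨⟨c, hc⟩, hne⟩ := Fintype.exists_ne_of_one_lt_card hc ⟨0, hz⟩
  refine ⟨∑ j, c j • b j, fun h0 => hne (Subtype.ext (funext fun j => ?_)), fun i => by
    rw [← hP, hc]⟩
  exact Fintype.linearIndependent_iff.1 b.linearIndependent c h0 j

theorem mul_comm_of_forall_mul_self_eq_one {M : Type} [Group M] (h : ∀ x : M, x * x = 1) (x y : M) :
    x * y = y * x := by
  have hi : ∀ x : M, x⁻¹ = x := fun x => inv_eq_of_mul_eq_one_left (h x)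
  rw [← hi (x * y), _root_.mul_inv_rev, hi, hi]

/-- Quadratic functions on a large elementary abelian 2-group have a common nontrivial zero. -/
theorem exists_common_zero_of_quadratic {M ι : Type} [Group M] [Finite M] [Fintype ι]
    (h2 : ∀ x : M, x * x = 1) (f : ι → M → ZMod 2) (h0 : ∀ i, f i 1 = 0)
    (hf : ∀ i x x' y, f i (x * x' * y) =
      f i (x * x') + f i (x * y) + f i (x' * y) - f i x - f i x' - f i y)
    (hc : 2 ^ (2 * Fintype.card ι + 1) ≤ Nat.card M) : ∃ x ≠ 1, ∀ i, f i x = 0 := by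
  let _ : CommGroup M :=
    { (inferInstance : Group M) with mul_comm := mul_comm_of_forall_mul_self_eq_one h2 }
  let _ : Module (ZMod 2) (Additive M) := AddCommGroup.zmodModule (n := 2) fun x => by
    rw [two_smul]; exact h2 x.toMul
  have hs : ∀ a : ZMod 2, a = 0 ∨ a = 1 := by decide
  let Q : ι → QuadraticForm (ZMod 2) (Additive M) := fun i =>
    QuadraticMap.ofPolar (fun x => f i x.toMul)
      (fun a x => by rcases hs a with rfl | rfl <;> simp [h0])
      (fun x x' y => by
        have := hf i x.toMul x'.toMul y.toMul
        simp only [QuadraticMap.polar, toMul_add, this]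
        ring)
      (fun a x y => by rcases hs a with rfl | rfl <;> simp [h0, QuadraticMap.polar])
  have hfin : Finite (Additive M) := inferInstanceAs (Finite M)
  obtain ⟨x, hx, hxQ⟩ := QuadraticForm.exists_common_zero Q (by
    have := Fintype.ofFinite (Additive M)
    have h3 : Fintype.card (Additive M) = 2 ^ Module.finrank (ZMod 2) (Additive M) := by
      simpa using Module.card_eq_pow_finrank (K := ZMod 2) (V := Additive M)
    have h4 : Nat.card M = Fintype.card (Additive M) := Nat.card_eq_fintype_card (α := Additive M)
    rw [h4, h3] at hc
    exact Nat.lt_of_succ_le ((Nat.pow_le_pow_iff_right one_lt_two).1 hc))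
  exact ⟨x.toMul, hx, hxQ⟩

/-- In a central extension of a large elementary abelian 2-group by `V`, some element outside `V`
has a square killed by given characters of `V`. -/
theorem exists_sq_mem_ker {K ι : Type} [Group K] [Finite K] [Fintype ι] (V : Subgroup K) [V.Normal]
    (hc : ∀ v ∈ V, ∀ k, v * k = k * v) (h2 : ∀ v ∈ V, v * v = 1) (hK : ∀ k, k * k ∈ V)
    (χ : ι → V →* ℤˣ) (hcard : 2 ^ (2 * Fintype.card ι + 1) ≤ V.index) :
    ∃ k ∉ V, ∀ i, χ i ⟨k * k, hK k⟩ = 1 := by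
  let b : ℤˣ → ZMod 2 := fun u => if u = 1 then 0 else 1
  have hb : ∀ u w, b (u * w) = b u + b w := by decide
  have hb0 : ∀ u, b u = 0 → u = 1 := by decide
  have hq : ∀ x : K ⧸ V, x * x = 1 := by
    rintro ⟨k⟩
    exact (QuotientGroup.eq_one_iff (k * k)).2 (hK k)
  have hcomm := mul_comm_of_forall_mul_self_eq_one hq
  let c : K → K → V := fun k l => ⟨l * k * l⁻¹ * k⁻¹, by
    rw [← QuotientGroup.eq_one_iff]
    simp only [QuotientGroup.mk_mul, QuotientGroup.mk_inv]
    rw [hcomm (l : K ⧸ V) k]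
    simp⟩
  let F : K → V := fun k => ⟨k * k, hK k⟩
  have hF : ∀ k l, F (k * l) = c k l * F k * F l := fun k l => Subtype.ext (by
    have h1 := hc (c k l) (c k l).2 k
    change (k * l) * (k * l) = (c k l : K) * (k * k) * (l * l)
    rw [← mul_assoc (c k l : K), h1]
    simp only [c]
    group)
  have hcl : ∀ k l m, c (k * l) m = c k m * c l m := fun k l m => Subtype.ext (by
    have h1 := hc (c l m) (c l m).2 k⁻¹
    change m * (k * l) * m⁻¹ * (k * l)⁻¹ = m * k * m⁻¹ * k⁻¹ * (c l m : K)
    rw [mul_assoc _ k⁻¹, ← h1]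
    simp only [c]
    group)
  let f : ι → K ⧸ V → ZMod 2 := fun i x => b (χ i (F x.out))
  have hf : ∀ i (k : K), f i k = b (χ i (F k)) := fun i k => by
    obtain ⟨⟨v, hv⟩, h1⟩ := QuotientGroup.mk_out_eq_mul V k
    have h3 : F (k * v) = F k := Subtype.ext (by
      change (k * v) * (k * v) = k * k
      rw [mul_assoc, ← mul_assoc v, hc v hv k, mul_assoc k, h2 v hv, mul_one])
    simp only [f]
    rw [h1, h3]
  obtain ⟨x, hx, hxQ⟩ := exists_common_zero_of_quadratic hq f (fun i => by
      have h1 := hf i 1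
      have h3 : F 1 = 1 := Subtype.ext (mul_one 1)
      rw [h3, map_one] at h1
      exact h1) (by
      rintro i ⟨k⟩ ⟨l⟩ ⟨m⟩
      change f i ((k * l * m : K) : K ⧸ V) = f i ((k * l : K) : K ⧸ V) + f i ((k * m : K) : K ⧸ V) +
        f i ((l * m : K) : K ⧸ V) - f i (k : K ⧸ V) - f i (l : K ⧸ V) - f i (m : K ⧸ V)
      simp only [hf, hF, hcl, map_mul, hb]
      ring) hcard
  obtain ⟨k, rfl⟩ := QuotientGroup.mk_surjective x
  exact ⟨k, fun h => hx ((QuotientGroup.eq_one_iff k).2 h), fun i => hb0 _ (by rw [← hxQ i, hf])⟩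

/-- Adjoining a commuting involution to an elementary abelian 2-group. -/
theorem IsMaximalRank2.mem_of_commute {G : Type} [Group G] [Finite G] {V : Subgroup G}
    (hV : IsElemAbelian2 V) (hmax : IsMaximalRank2 V) {k : G} (hk : k * k = 1)
    (hkV : ∀ v ∈ V, v * k = k * v) : k ∈ V := by
  let A : Subgroup G :=
    { carrier := {x | ∃ v ∈ V, x = v ∨ x = v * k}
      one_mem' := ⟨1, V.one_mem, Or.inl rfl⟩
      mul_mem' := by
        rintro x y ⟨v, hv, h | h⟩ ⟨w, hw, h' | h'⟩ <;> rw [h, h']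
        · exact ⟨v * w, V.mul_mem hv hw, Or.inl rfl⟩
        · exact ⟨v * w, V.mul_mem hv hw, Or.inr (mul_assoc _ _ _).symm⟩
        · exact ⟨v * w, V.mul_mem hv hw, Or.inr (by rw [mul_assoc, ← hkV w hw, mul_assoc])⟩
        · exact ⟨v * w, V.mul_mem hv hw, Or.inl (by
            rw [hkV w hw, mul_assoc, ← mul_assoc k, hk, one_mul])⟩
      inv_mem' := by
        rintro x ⟨v, hv, h | h⟩ <;> rw [h]
        · exact ⟨v⁻¹, V.inv_mem hv, Or.inl rfl⟩
        · refine ⟨v⁻¹, V.inv_mem hv, Or.inr ?_⟩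
          rw [_root_.mul_inv_rev, inv_eq_of_mul_eq_one_left hk, hkV _ (V.inv_mem hv)] }
  have hA : ∀ a ∈ A, a * a = 1 := by
    rintro x ⟨v, hv, h | h⟩ <;> rw [h]
    · exact hV.1 v hv
    · rw [mul_assoc, ← mul_assoc k, ← hkV v hv, mul_assoc v, hk, mul_one, hV.1 v hv]
  have hA2 : IsElemAbelian2 A := ⟨hA, fun a ha b hb => congrArg Subtype.val
    (mul_comm_of_forall_mul_self_eq_one (M := A) (fun x => Subtype.ext (hA x x.2)) ⟨a, ha⟩ ⟨b, hb⟩)⟩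
  have hVA : V ≤ A := fun v hv => ⟨v, hv, Or.inl rfl⟩
  rw [Subgroup.eq_of_le_of_card_ge hVA (hmax A hA2)]
  exact ⟨1, V.one_mem, Or.inr (one_mul k).symm⟩

/-- The kernel of a permutation action with commuting elements has small index. -/
theorem four_pow_card_orbits_mul_index_le {G : Type} [Group G] [Finite G] (n : ℕ)
    [MulAction G (Fin n)] [Fintype (MulAction.orbitRel.Quotient G (Fin n))]
    (hcomm : ∀ (g h : G) (i : Fin n), g • h • i = h • g • i) :
    4 ^ Fintype.card (MulAction.orbitRel.Quotient G (Fin n)) *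
      (MulAction.toPermHom G (Fin n)).ker.index ≤ 4 ^ n := by
  classical
  let O := MulAction.orbitRel.Quotient G (Fin n)
  let φ : (G ⧸ (MulAction.toPermHom G (Fin n)).ker) → (o : O) → o.orbit := fun x o =>
    ⟨x.out • o.out, by
      rw [MulAction.orbitRel.Quotient.mem_orbit]
      conv_rhs => rw [← Quotient.out_eq' o]
      exact Quotient.sound' ⟨x.out, rfl⟩⟩
  have hφ : Function.Injective φ := by
    intro x y h
    rw [← Quotient.out_eq' x, ← Quotient.out_eq' y]
    refine (QuotientGroup.eq).2 (MonoidHom.mem_ker.2 (Equiv.ext fun i => ?_))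
    have h1 : (Quotient.mk'' i : O).out ∈ MulAction.orbit G i :=
      MulAction.orbitRel_apply.1 (Quotient.mk_out i)
    obtain ⟨g, hg⟩ := MulAction.mem_orbit_symm.1 h1
    have h2 : x.out • (Quotient.mk'' i : O).out = y.out • (Quotient.mk'' i : O).out :=
      congrArg Subtype.val (congrFun h (Quotient.mk'' i))
    change (x.out⁻¹ * y.out) • i = i
    rw [← hg]
    simp only
    rw [hcomm, mul_smul]
    exact congrArg (g • ·) (inv_smul_eq_iff.2 h2.symm)
  have h1 : (MulAction.toPermHom G (Fin n)).ker.index ≤ ∏ o : O, Fintype.card o.orbit := by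
    rw [← Fintype.card_pi, ← Nat.card_eq_fintype_card]
    exact Nat.card_le_card_of_injective φ hφ
  have h2 : ∑ o : O, Fintype.card o.orbit = n := by
    rw [← Fintype.card_sigma, ← Fintype.card_congr (MulAction.selfEquivSigmaOrbits' G (Fin n)),
      Fintype.card_fin]
  have h3 : ∀ k : ℕ, 4 * k ≤ 4 ^ k := fun k => by
    induction k with
    | zero => simp
    | succ k ih => rcases k with _ | k <;> simp_all [pow_succ]; omega
  calc _ ≤ 4 ^ Fintype.card O * ∏ o : O, Fintype.card o.orbit := Nat.mul_le_mul_left _ h1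
    _ = ∏ o : O, 4 * Fintype.card o.orbit := by
      rw [Finset.prod_mul_distrib, Finset.prod_const, Finset.card_univ]
    _ ≤ ∏ o : O, 4 ^ Fintype.card o.orbit := Finset.prod_le_prod' fun o _ => h3 _
    _ = 4 ^ n := by rw [Finset.prod_pow_eq_pow_sum, h2]

/-- A normal elementary abelian 2-subgroup of maximal rank `n`, whose conjugation action permutes
the coordinates of some basis, cannot have an elementary abelian quotient of rank `> 2 * n`. -/
theorem not_conj_permutes_coordinates {G : Type} [Group G] [Finite G] {n rW : ℕ} (V : Subgroup G)
    [V.Normal] (hV : IsElemAbelian2 V) (hmax : IsMaximalRank2 V) (hW : ∀ w : G ⧸ V, w * w = 1)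
    (hrW : Nat.card (G ⧸ V) = 2 ^ rW) (hrW' : 2 * n + 1 ≤ rW) (e : V →* (Fin n → ℤˣ))
    (he : Function.Bijective e)
    (hp : ∀ (g : G) (i : Fin n), ∃ j, ∀ v : V, e (MulAut.conjNormal g v) i = e v j) : False := by
  classical
  choose s hs using hp
  have huniq : ∀ {j k}, (∀ v, e v j = e v k) → j = k := fun {j k} h => by
    by_contra hjk
    obtain ⟨v, hv⟩ := he.2 (Pi.mulSingle j (-1))
    have := h v
    rw [hv] at this
    simp [Ne.symm hjk] at this
  let act : MulAction G (Fin n) :=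
    { smul g i := s g⁻¹ i
      one_smul i := huniq fun v => by
        change e v (s 1⁻¹ i) = _
        rw [← hs]; simp
      mul_smul g h i := huniq fun v => by
        change e v (s (g * h)⁻¹ i) = e v (s g⁻¹ (s h⁻¹ i))
        rw [← hs, ← hs, ← hs, _root_.mul_inv_rev, map_mul, MulAut.mul_apply] }
  have hact : ∀ (g : G) (v : V) i, e v (g • i) = e (MulAut.conjNormal g⁻¹ v) i := fun g v i =>
    (hs g⁻¹ i v).symm
  have hVtriv : ∀ u ∈ V, ∀ i : Fin n, u • i = i := fun u hu i => huniq fun v => by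
    rw [hact]
    refine congrFun (congrArg e (Subtype.ext ?_)) i
    rw [MulAut.conjNormal_apply, hV.2 _ (V.inv_mem hu) _ v.2]
    group
  have hWc := mul_comm_of_forall_mul_self_eq_one hW
  have hmulV : ∀ g h : G, ∃ u ∈ V, g * h = h * g * u := fun g h =>
    ⟨(h * g)⁻¹ * (g * h), QuotientGroup.eq.1 (hWc h g), by group⟩
  have hcomm : ∀ (g h : G) (i : Fin n), g • h • i = h • g • i := fun g h i => by
    obtain ⟨u, hu, hgh⟩ := hmulV g h
    rw [← mul_smul, ← mul_smul, hgh, mul_smul _ u, hVtriv u hu]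
  let K := (MulAction.toPermHom G (Fin n)).ker
  have hKfix : ∀ k ∈ K, ∀ i : Fin n, k • i = i := fun k hk i => Equiv.ext_iff.1 hk i
  have hVK : V ≤ K := fun v hv => Equiv.ext fun i => hVtriv v hv i
  have hKV : ∀ v ∈ V, ∀ k ∈ K, v * k = k * v := fun v hv k hk => by
    have h1 : MulAut.conjNormal k⁻¹ (⟨v, hv⟩ : V) = ⟨v, hv⟩ := he.1 (funext fun i => by
      rw [← hact, hKfix k hk])
    have h2 := congrArg Subtype.val h1
    rw [MulAut.conjNormal_apply, inv_inv] at h2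
    rw [mul_assoc] at h2
    exact inv_mul_eq_iff_eq_mul.1 h2
  have hsqV : ∀ k : G, k * k ∈ V := fun k => (QuotientGroup.eq_one_iff (k * k)).1 (hW k)
  have hsq : ∀ k ∈ K, ∀ (h : G) (i : Fin n),
      e ⟨k * k, hsqV k⟩ (h • i) = e ⟨k * k, hsqV k⟩ i := fun k hk h i => by
    rw [hact]
    refine congrFun (congrArg e (Subtype.ext ?_)) i
    rw [MulAut.conjNormal_apply, inv_inv]
    obtain ⟨u, hu, hkh⟩ := hmulV k h
    have h1 := hKV u hu k hk
    change h⁻¹ * (k * k) * h = k * k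
    have h2 : h⁻¹ * k * h = k * u := by rw [mul_assoc, hkh]; group
    calc h⁻¹ * (k * k) * h = (h⁻¹ * k * h) * (h⁻¹ * k * h) := by group
      _ = k * (u * k) * u := by rw [h2]; group
      _ = k * k * (u * u) := by rw [h1]; group
      _ = k * k := by rw [hV.1 u hu, mul_one]
  let O := MulAction.orbitRel.Quotient G (Fin n)
  have hindex : 2 ^ (2 * Fintype.card O + 1) ≤ (V.subgroupOf K).index := by
    have h1 := four_pow_card_orbits_mul_index_le n hcomm
    have h2 : (V.subgroupOf K).index * K.index = 2 ^ rW := by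
      rw [← hrW]; exact Subgroup.relIndex_mul_index hVK
    have h3 : 2 ^ (2 * n + 1) ≤ 2 ^ rW := Nat.pow_le_pow_right two_pos hrW'
    rw [pow_succ, pow_mul] at h3 ⊢
    norm_num at h3 ⊢
    have h4 : 0 < (4 : ℕ) ^ n := by positivity
    refine Nat.le_of_mul_le_mul_right ?_ h4
    calc 4 ^ Fintype.card O * 2 * 4 ^ n = 4 ^ Fintype.card O * (4 ^ n * 2) := by ring
      _ ≤ 4 ^ Fintype.card O * ((V.subgroupOf K).index * K.index) :=
        Nat.mul_le_mul_left _ (h3.trans h2.ge)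
      _ = (V.subgroupOf K).index * (4 ^ Fintype.card O * K.index) := by ring
      _ ≤ _ := Nat.mul_le_mul_left _ h1
  let χ : O → V.subgroupOf K →* ℤˣ := fun o =>
    (Pi.evalMonoidHom _ o.out).comp (e.comp (Subgroup.subgroupOfEquivOfLe hVK).toMonoidHom)
  obtain ⟨⟨k, hk⟩, hkV, hkχ⟩ := exists_sq_mem_ker (V.subgroupOf K)
    (fun v hv k => Subtype.ext (hKV v hv k k.2)) (fun v hv => Subtype.ext (hV.1 v hv))
    (fun k => hsqV k) χ hindex
  refine hkV (hmax.mem_of_commute hV ?_ fun v hv => hKV v hv k hk)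
  have h1 : (⟨k * k, hsqV k⟩ : V) = 1 := he.1 (funext fun i => by
    have h2 : (Quotient.mk'' i : O).out ∈ MulAction.orbit G i :=
      MulAction.orbitRel_apply.1 (Quotient.mk_out i)
    obtain ⟨g, hg⟩ := h2
    rw [← hsq k hk g i, map_one]
    exact (congrArg (e ⟨k * k, hsqV k⟩) hg).trans (hkχ (Quotient.mk'' i)))
  exact congrArg Subtype.val h1

theorem antipodal_iff {m : ℕ} {x y : Sph m} : antipodal m x y ↔ ∃ s : ℤˣ, s • x = y := by
  constructor
  · rintro (h | h)
    · exact ⟨1, by rw [one_smul]; exact Subtype.ext h.symm⟩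
    · exact ⟨-1, (US.neg_one_smul x).trans (Subtype.ext h.symm)⟩
  · rintro ⟨s, rfl⟩
    rcases Int.units_eq_one_or s with rfl | rfl
    · exact Or.inl (by rw [one_smul])
    · exact Or.inr rfl

theorem mk_antipodal_eq_iff {m : ℕ} {x y : Sph m} :
    Quot.mk (antipodal m) x = Quot.mk (antipodal m) y ↔ ∃ s : ℤˣ, s • y = x := by
  have he : Equivalence (antipodal m) :=
    { refl x := Or.inl rfl
      symm {x y} h := by
        obtain ⟨s, rfl⟩ := antipodal_iff.1 h
        exact antipodal_iff.2 ⟨s⁻¹, inv_smul_smul _ _⟩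
      trans {x y z} h h' := by
        obtain ⟨s, rfl⟩ := antipodal_iff.1 h
        obtain ⟨t, rfl⟩ := antipodal_iff.1 h'
        exact antipodal_iff.2 ⟨t * s, mul_smul _ _ _⟩ }
  rw [he.quot_mk_eq_iff, ← antipodal_iff]
  exact ⟨he.symm, he.symm⟩

theorem isOpenQuotientMap_mk_antipodal (m : ℕ) :
    IsOpenQuotientMap (Quot.mk (antipodal m) : Sph m → RP m) where
  surjective := Quot.mk_surjective
  continuous := continuous_quot_mk
  isOpenMap U hU := by
    rw [← isQuotientMap_quot_mk.isOpen_preimage]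
    have h : Quot.mk (antipodal m) ⁻¹' (Quot.mk (antipodal m) '' U) =
        ⋃ s : ℤˣ, (fun x : Sph m => s • x) ⁻¹' U := by
      ext x
      simp only [Set.mem_preimage, Set.mem_image, Set.mem_iUnion, mk_antipodal_eq_iff]
      constructor
      · rintro ⟨_, hy, s, rfl⟩; exact ⟨s, hy⟩
      · rintro ⟨s, hs⟩; exact ⟨_, hs, s, rfl⟩
    rw [h]
    exact isOpen_iUnion fun s => hU.preimage (continuous_const_smul s)

/-- The map `(S^m)^n → (ℝP^m)^n` is the quotient covering of the sign group. -/
theorem isQuotientCoveringMap_projective (m n : ℕ) :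
    IsQuotientCoveringMap (fun (x : Fin n → Sph m) i => (Quot.mk (antipodal m) (x i) : RP m))
      (Fin n → ℤˣ) := by
  have : ContinuousConstSMul (Fin n → ℤˣ) (Fin n → Sph m) :=
    ⟨fun t => continuous_pi fun i => (continuous_apply i).const_smul (t i)⟩
  have : IsCancelSMul (Fin n → ℤˣ) (Fin n → Sph m) := US.isCancelSMul_sign_pow n
  refine (IsOpenQuotientMap.piMap fun _ => isOpenQuotientMap_mk_antipodal m).isQuotientMap
    |>.isQuotientCoveringMap_of_properlyDiscontinuousSMul fun {x y} => ?_
  constructor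
  · intro h
    choose t ht using fun i => mk_antipodal_eq_iff.1 (congrFun h i)
    exact ⟨t, funext ht⟩
  · rintro ⟨t, rfl⟩
    exact funext fun i => mk_antipodal_eq_iff.2 ⟨t i, rfl⟩

/-- The orbit map of a free continuous action of a finite group is a quotient covering. -/
theorem isQuotientCoveringMap_orbit {X G : Type} [TopologicalSpace X] [T2Space X]
    [LocallyCompactSpace X] [Group G] [Finite G] [MulAction G X] [ContinuousConstSMul G X]
    (hfree : ∀ (g : G) (x : X), g • x = x → g = 1) (V : Subgroup G) :
    IsQuotientCoveringMap (Quot.mk fun x y : X => ∃ v ∈ V, v • x = y) V := by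
  have : ContinuousConstSMul V X := ⟨fun v => continuous_const_smul (v : G)⟩
  have : IsCancelSMul V X := isCancelSMul_iff_eq_one_of_smul_eq.2 fun v x h =>
    Subtype.ext (hfree v x h)
  have he : Equivalence fun x y : X => ∃ v ∈ V, v • x = y :=
    { refl x := ⟨1, V.one_mem, one_smul _ _⟩
      symm := by
        rintro x _ ⟨v, hv, rfl⟩
        exact ⟨v⁻¹, V.inv_mem hv, inv_smul_smul _ _⟩
      trans := by
        rintro x _ _ ⟨v, hv, rfl⟩ ⟨w, hw, rfl⟩
        exact ⟨w * v, V.mul_mem hw hv, mul_smul _ _ _⟩ }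
  refine isQuotientMap_quot_mk.isQuotientCoveringMap_of_properlyDiscontinuousSMul fun {x y} => ?_
  rw [he.quot_mk_eq_iff]
  constructor
  · intro h
    obtain ⟨v, hv, h⟩ := he.symm h
    exact ⟨⟨v, hv⟩, h⟩
  · rintro ⟨v, h⟩
    exact he.symm ⟨v, v.2, h⟩

end

theorem stmt12 (m n : ℕ) (hm7 : 7 < m)
    (G : Type) [Group G] [Finite G] (V : Subgroup G) [V.Normal]
    (hV : IsElemAbelian2 V) (hmax : IsMaximalRank2 V)
    (hnV : Nat.card V = 2 ^ n)
    (hW : ∀ w : G ⧸ V, w * w = 1)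
    (rW : ℕ)
    (hrW : Nat.card (G ⧸ V) = 2 ^ rW)
    (hrW' : 2 * n + 1 ≤ rW)
    -- a free continuous action of G on X = (S^m)^n
    (ρ : G → (Fin n → Sph m) → (Fin n → Sph m))
    (hρ1 : ∀ x, ρ 1 x = x)
    (hρmul : ∀ g h x, ρ (g * h) x = ρ g (ρ h x))
    (hcont : ∀ g, Continuous (ρ g))
    (hfree : ∀ g x, ρ g x = x → g = 1) :
    ¬ Nonempty (ContinuousMap.HomotopyEquiv
      (Quot fun x y : Fin n → Sph m => ∃ v ∈ V, ρ v x = y)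
      (Fin n → RP m)) := by
  rintro ⟨E⟩
  let _ : MulAction G (Fin n → Sph m) :=
    { smul := ρ
      one_smul := hρ1
      mul_smul := hρmul }
  have hρ : ContinuousConstSMul G (Fin n → Sph m) := ⟨hcont⟩
  have hconn : ConnectedSpace (Sph m) := isConnected_iff_connectedSpace.1
    (isConnected_sphere (by
      rw [← Module.finrank_eq_rank, finrank_euclideanSpace_fin]
      exact_mod_cast (by omega : 1 < m + 1)) 0 zero_le_one)
  have hp := isQuotientCoveringMap_orbit (X := Fin n → Sph m) hfree V
  have hq := isQuotientCoveringMap_projective m n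
  have hVc : ∀ a b : V, a * b = b * a := fun a b => Subtype.ext (hV.2 a a.2 b b.2)
  obtain ⟨Φ, Ψ, ι, κ, hΦ, hΨ, hκι⟩ := hp.exists_equivariant_of_homotopic
    (liftsToCoverings_sphere_pow (by omega) n) hq hVc E.toFun E.invFun E.left_inv
  have hι : Function.Bijective ι := by
    have := Fintype.ofFinite V
    refine (Fintype.bijective_iff_injective_and_card ι).2 ⟨Function.LeftInverse.injective hκι, ?_⟩
    rw [← Nat.card_eq_fintype_card, hnV]
    simp
  have hικ : ∀ t, ι (κ t) = t := fun t => by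
    obtain ⟨v, rfl⟩ := hι.2 t
    rw [hκι]
  refine not_conj_permutes_coordinates V hV hmax hW hrW hrW' ι hι fun g i => ?_
  let A : (Fin n → ℤˣ) →* (Fin n → ℤˣ) :=
    ι.comp ((MulAut.conjNormal g : V ≃* V).toMonoidHom.comp κ)
  have hA : Function.Surjective A := hι.2.comp ((MulAut.conjNormal g : V ≃* V).surjective.comp
    fun v => ⟨ι v, hκι v⟩)
  obtain ⟨j, hj⟩ := exists_coordinate_of_equivariant
    (V := EuclideanSpace ℝ (Fin (m + 1))) ⟨EuclideanSpace.single 0 1, by simp⟩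
    (fun f hf h1 h2 => not_exists_biodd hm7 f hf h1 h2)
    (Φ.comp ((⟨_, hcont g⟩ : C(Fin n → Sph m, Fin n → Sph m)).comp Ψ)) A hA (fun t x => by
      have h1 : ∀ v : V, ∀ y : Fin n → Sph m,
          g • v • y = (MulAut.conjNormal g v : V) • g • y := fun v y => by
        change g • (v : G) • y = ((MulAut.conjNormal g v : V) : G) • g • y
        rw [← mul_smul, ← mul_smul, MulAut.conjNormal_apply, inv_mul_cancel_right]
      change Φ (g • Ψ (t • x)) = A t • Φ (g • Ψ x)
      rw [hΨ, h1, hΦ]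
      rfl) i
  refine ⟨j, fun v => ?_⟩
  rw [← hj (ι v)]
  simp [A, hκι]
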